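/- Let m₁, …, m_r ≥ 3 be pairwise distinct integers, let n₁, …, n_r ≥ 1 be integers, and set f = ∏ Φ_{m_i}^{n_i} and g = ∏ Φ_{m_i} in ℚ[X], where Φ_m denotes the m-th cyclotomic polynomial. Let B be a nondegenerate symmetric bilinear form on a ℚ-vector space V of dimension deg f. Suppose that for every prime number p the base change of B to ℚ_p ⊗_ℚ V admits an isometry whose characteristic polynomial is the image of f and whose minimal polynomial is the image of g, and that the base change of B to ℝ ⊗_ℚ V admits such an isometry. Then B admits an isometry with characteristic polynomial f and minimal polynomial g. -/

import Mathlib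

open TensorProduct Polynomial

/-- `B` admits an isometry with characteristic polynomial `F` and minimal polynomial `G`. -/
def HasIsometryWith (L : Type*) [Field L] (W : Type*) [AddCommGroup W] [Module L W]
    [Module.Finite L W] (B : LinearMap.BilinForm L W) (F G : Polynomial L) : Prop :=
  ∃ t : W ≃ₗ[L] W, (∀ x y, B (t x) (t y) = B x y) ∧
    LinearMap.charpoly (t : W →ₗ[L] W) = F ∧ minpoly L (t : W →ₗ[L] W) = G

namespace CycIso

set_option linter.unusedSectionVars false

/-! ### The Grothendieck–Witt group of a field, by generators and relations -/

/-- The relations between the generators `⟨a⟩` of the Grothendieck–Witt group. -/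
def gwRel (F : Type*) [Field F] : AddSubgroup (FreeAbelianGroup F) :=
  AddSubgroup.closure
    ({FreeAbelianGroup.of 0} ∪
      {x | ∃ a b : F, b ≠ 0 ∧ x = FreeAbelianGroup.of (a * b ^ 2) - FreeAbelianGroup.of a} ∪
      {x | ∃ a b : F, a + b ≠ 0 ∧ x = FreeAbelianGroup.of a + FreeAbelianGroup.of b
        - (FreeAbelianGroup.of (a + b) + FreeAbelianGroup.of (a * b * (a + b)))})

/-- The Grothendieck–Witt group of a field; the generator of a zero entry is zero. -/
def GW (F : Type*) [Field F] : Type _ := FreeAbelianGroup F ⧸ gwRel F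

noncomputable instance (F : Type*) [Field F] : AddCommGroup (GW F) :=
  inferInstanceAs (AddCommGroup (FreeAbelianGroup F ⧸ gwRel F))

namespace GW

variable {F : Type*} [Field F]

/-- The class of the one-dimensional form `a x²`. -/
noncomputable def of (a : F) : GW F := QuotientAddGroup.mk (FreeAbelianGroup.of a)

@[simp] lemma of_zero : of (0 : F) = 0 :=
  (QuotientAddGroup.eq_zero_iff _).2 (AddSubgroup.subset_closure (Or.inl (Or.inl rfl)))

lemma of_mul_sq (a : F) {b : F} (hb : b ≠ 0) : of (a * b ^ 2) = of a := by
  have : (QuotientAddGroup.mk (FreeAbelianGroup.of (a * b ^ 2) - FreeAbelianGroup.of a) :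
      FreeAbelianGroup F ⧸ gwRel F) = 0 :=
    (QuotientAddGroup.eq_zero_iff _).2
      (AddSubgroup.subset_closure (Or.inl (Or.inr ⟨a, b, hb, rfl⟩)))
  exact sub_eq_zero.1 this

lemma of_add_of {a b : F} (h : a + b ≠ 0) :
    of a + of b = of (a + b) + of (a * b * (a + b)) := by
  have : (QuotientAddGroup.mk (FreeAbelianGroup.of a + FreeAbelianGroup.of b
      - (FreeAbelianGroup.of (a + b) + FreeAbelianGroup.of (a * b * (a + b)))) :
        FreeAbelianGroup F ⧸ gwRel F) = 0 :=
    (QuotientAddGroup.eq_zero_iff _).2 (AddSubgroup.subset_closure (Or.inr ⟨a, b, h, rfl⟩))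
  exact sub_eq_zero.1 this

/-- Two entries that differ by a nonzero square have the same class. -/
lemma of_eq_of {a b c : F} (hc : c ≠ 0) (h : a = b * c ^ 2) : of a = of b := by
  rw [h, of_mul_sq _ hc]

@[elab_as_elim]
lemma induction {P : GW F → Prop} (zero : P 0) (of' : ∀ a : F, a ≠ 0 → P (of a))
    (neg : ∀ x, P x → P (-x)) (add : ∀ x y, P x → P y → P (x + y)) (x : GW F) : P x := by
  have hof : ∀ a : F, P (of a) := fun a ↦ by
    rcases eq_or_ne a 0 with rfl | h
    · simpa using zero
    · exact of' a h
  induction x using QuotientAddGroup.induction_on with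
  | H z =>
    induction z using FreeAbelianGroup.induction_on with
    | zero => exact zero
    | of a => exact hof a
    | neg a _ => exact neg _ (hof a)
    | add x y hx hy => exact add _ _ hx hy

/-- Homomorphisms out of the Grothendieck–Witt group. -/
noncomputable def lift {A : Type*} [AddCommGroup A] (f : F → A) (h0 : f 0 = 0)
    (h1 : ∀ a b : F, a ≠ 0 → b ≠ 0 → f (a * b ^ 2) = f a)
    (h2 : ∀ a b : F, a ≠ 0 → b ≠ 0 → a + b ≠ 0 →
      f a + f b = f (a + b) + f (a * b * (a + b))) : GW F →+ A :=
  QuotientAddGroup.lift (gwRel F) (FreeAbelianGroup.lift f) (by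
    rw [gwRel, AddSubgroup.closure_le]
    rintro x ((rfl | ⟨a, b, hb, rfl⟩) | ⟨a, b, hab, rfl⟩)
    · simp [h0]
    · rcases eq_or_ne a 0 with rfl | ha
      · simp
      · simp [h1 a b ha hb]
    · rcases eq_or_ne a 0 with rfl | ha
      · simp [h0]
      rcases eq_or_ne b 0 with rfl | hb
      · simp
      simp [h2 a b ha hb hab])

@[simp] lemma lift_of {A : Type*} [AddCommGroup A] (f : F → A) (h0) (h1) (h2) (a : F) :
    lift f h0 h1 h2 (of a) = f a :=
  FreeAbelianGroup.lift_apply_of f a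

lemma hom_ext {A : Type*} [AddCommGroup A] {f g : GW F →+ A} (h : ∀ a : F, f (of a) = g (of a)) :
    f = g := by
  refine AddMonoidHom.ext fun x ↦ ?_
  induction x using GW.induction with
  | zero => simp
  | of' a _ => exact h a
  | neg x hx => simp [hx]
  | add x y hx hy => simp [hx, hy]

/-- Functoriality in the field. -/
noncomputable def map {E : Type*} [Field E] (φ : F →+* E) : GW F →+ GW E :=
  lift (fun a ↦ of (φ a)) (by simp)
    (fun a b _ hb ↦ by
      rw [map_mul, map_pow, of_mul_sq]
      exact (map_ne_zero φ).2 hb)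
    (fun a b _ _ h ↦ by
      rw [map_add, map_mul, map_mul, map_add, of_add_of]
      rw [← map_add]; exact (map_ne_zero φ).2 h)

@[simp] lemma map_of {E : Type*} [Field E] (φ : F →+* E) (a : F) : map φ (of a) = of (φ a) := by
  simp [map]

/-- The dimension. -/
noncomputable def dim : GW F →+ ℤ :=
  open Classical in
  lift (fun a ↦ if a = 0 then 0 else 1) (by simp)
    (fun a b ha hb ↦ by simp [ha, hb])
    (fun a b ha hb h ↦ by simp [ha, hb, h])

@[simp] lemma dim_of {a : F} (ha : a ≠ 0) : dim (of a) = 1 := by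
  simp [dim, ha]

/-- The class of a hyperbolic plane does not depend on its diagonalisation. -/
lemma of_add_of_neg [NeZero (2 : F)] {a b : F} (ha : a ≠ 0) (hb : b ≠ 0) :
    of a + of (-a) = of b + of (-b) := by
  suffices h : ∀ c : F, c ≠ 0 → of c + of (-c) = of 1 + of (-1 : F) by rw [h a ha, h b hb]
  intro c hc
  have h2 : (2 : F) ≠ 0 := NeZero.ne 2
  rcases eq_or_ne c 1 with rfl | h1
  · rfl
  rcases eq_or_ne c (-1) with rfl | h1'
  · rw [neg_neg, add_comm]
  have hs : ((c + 1) / 2) ≠ 0 := div_ne_zero (fun h ↦ h1' (eq_neg_of_add_eq_zero_left h)) h2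
  have ht : ((c - 1) / 2) ≠ 0 := div_ne_zero (sub_ne_zero.2 h1) h2
  have hsum : ((c + 1) / 2) ^ 2 + -((c - 1) / 2) ^ 2 = c := by field_simp; ring
  have := of_add_of (a := ((c + 1) / 2) ^ 2) (b := -((c - 1) / 2) ^ 2) (by rwa [hsum])
  rw [hsum] at this
  rw [← of_mul_sq 1 hs, ← of_mul_sq (-1) ht, one_mul, neg_one_mul, this]
  congr 1
  exact (of_eq_of (mul_ne_zero hs ht) (by ring)).symm

end GW

section Chain

variable {F V : Type*} [Field F] [AddCommGroup V] [Module F V]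
  (B : LinearMap.BilinForm F V)

/-- A finite family of pairwise orthogonal, anisotropic vectors. -/
def OrthFam {ι : Type*} (e : ι → V) : Prop :=
  (∀ i j, i ≠ j → B (e i) (e j) = 0) ∧ ∀ i, B (e i) (e i) ≠ 0

variable {B}

lemma OrthFam.linearIndependent {ι : Type*} {e : ι → V} (he : OrthFam B e) :
    LinearIndependent F e :=
  LinearMap.linearIndependent_of_isOrthoᵢ (B := B)
    (fun i j hij ↦ he.1 i j hij) (fun i h ↦ he.2 i h)

lemma OrthFam.comp {ι κ : Type*} {e : ι → V} (he : OrthFam B e) {f : κ → ι}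
    (hf : Function.Injective f) : OrthFam B (e ∘ f) :=
  ⟨fun _ _ h ↦ he.1 _ _ (hf.ne h), fun _ ↦ he.2 _⟩

lemma OrthFam.apply_sum {ι : Type*} [Fintype ι] {e : ι → V} (he : OrthFam B e) (c : ι → F)
    (i : ι) : B (e i) (∑ j, c j • e j) = c i * B (e i) (e i) := by
  rw [map_sum, Finset.sum_eq_single i]
  · simp
  · intro j _ hj; simp [he.1 i j hj.symm]
  · simp

lemma OrthFam.sum_sum {ι : Type*} [Fintype ι] {e : ι → V} (he : OrthFam B e) (c : ι → F) :
    B (∑ j, c j • e j) (∑ j, c j • e j) = ∑ i, c i ^ 2 * B (e i) (e i) := by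
  rw [LinearMap.BilinForm.sum_left]
  refine Finset.sum_congr rfl fun i _ ↦ ?_
  rw [LinearMap.BilinForm.smul_left, he.apply_sum]; ring

lemma OrthFam.cons (hB : B.IsSymm) {n : ℕ} {v : V} {e : Fin n → V} (he : OrthFam B e)
    (hv : B v v ≠ 0) (hve : ∀ j, B v (e j) = 0) : OrthFam B (Fin.cons v e : Fin (n + 1) → V) := by
  have hve' : ∀ j, B (e j) v = 0 := fun j ↦ by rw [hB.eq]; exact hve j
  constructor
  · intro i j hij
    induction i using Fin.cases with
    | zero =>
      induction j using Fin.cases with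
      | zero => exact absurd rfl hij
      | succ j => simpa using hve j
    | succ i =>
      induction j using Fin.cases with
      | zero => simpa using hve' i
      | succ j => simpa using he.1 i j (fun h ↦ hij (by rw [h]))
  · intro i
    induction i using Fin.cases with
    | zero => simpa using hv
    | succ i => simpa using he.2 i

lemma OrthFam.exists_complement [CharZero F] (hB : B.IsSymm) {n : ℕ} (e : Fin (n + 1) → V)
    (c : Fin (n + 1) → F) (he : OrthFam B e)
    (hw : B (∑ i, c i • e i) (∑ i, c i • e i) ≠ 0) :
    ∃ e' : Fin n → V, OrthFam B e' ∧ (∀ j, B (∑ i, c i • e i) (e' j) = 0) ∧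
      (∀ j, e' j ∈ Submodule.span F (Set.range e)) ∧
      ∑ i, GW.of (B (e i) (e i)) =
        GW.of (B (∑ i, c i • e i) (∑ i, c i • e i)) + ∑ j, GW.of (B (e' j) (e' j)) := by
  induction n with
  | zero =>
    refine ⟨Fin.elim0, ⟨fun i ↦ i.elim0, fun i ↦ i.elim0⟩, fun j ↦ j.elim0, fun j ↦ j.elim0, ?_⟩
    rw [he.sum_sum] at hw ⊢
    simp only [Fin.sum_univ_succ, Fin.sum_univ_zero, add_zero] at hw ⊢
    refine (GW.of_eq_of (c := c 0) ?_ (by ring)).symm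
    rintro h; simp [h] at hw
  | succ n ih =>
    set w := ∑ i, c i • e i with hwdef
    obtain ⟨i, hi⟩ : ∃ i, c i ^ 2 * B (e i) (e i) ≠ B w w := by
      by_contra! h
      have h1 := he.sum_sum c
      rw [← hwdef, Finset.sum_congr rfl (fun i _ ↦ h i), Finset.sum_const, Finset.card_univ,
        Fintype.card_fin, nsmul_eq_mul] at h1
      have : ((n : F) + 1) * B w w = 0 := by push_cast at h1; linear_combination -h1
      rcases mul_eq_zero.1 this with h2 | h2
      · exact Nat.cast_add_one_ne_zero n h2
      · exact hw h2
    set g := e ∘ i.succAbove with hg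
    have hgo : OrthFam B g := he.comp Fin.succAbove_right_injective
    set w' := ∑ j, c (i.succAbove j) • g j with hw'
    have hww : w = c i • e i + w' := by
      rw [hwdef, Fin.sum_univ_succAbove _ i]; rfl
    have hew' : B (e i) w' = 0 := by
      rw [hw', map_sum]
      refine Finset.sum_eq_zero fun j _ ↦ ?_
      rw [map_smul, hg, Function.comp, he.1 _ _ (Fin.succAbove_ne i j).symm, smul_zero]
    have hw'e : B w' (e i) = 0 := by rw [hB.eq]; exact hew'
    have hBw : B w w = c i ^ 2 * B (e i) (e i) + B w' w' := by
      rw [hww]; simp [hew', hw'e]; ring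
    have hw'0 : B w' w' ≠ 0 := fun h ↦ hi (by rw [hBw, h, add_zero])
    obtain ⟨e'', h1, h2, h3, h4⟩ := ih g (fun j ↦ c (i.succAbove j)) hgo hw'0
    rw [← hw'] at h2 h4
    have hsub : Submodule.span F (Set.range g) ≤ Submodule.span F (Set.range e) :=
      Submodule.span_mono (Set.range_comp_subset_range _ _)
    have hgi : ∀ x ∈ Submodule.span F (Set.range g), B (e i) x = 0 := by
      intro x hx
      induction hx using Submodule.span_induction with
      | mem x hx =>
        obtain ⟨j, rfl⟩ := hx
        exact he.1 _ _ (Fin.succAbove_ne i j).symm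
      | zero => simp
      | add x y _ _ hx hy => simp [hx, hy]
      | smul a x _ hx => simp [hx]
    have hie'' : ∀ j, B (e i) (e'' j) = 0 := fun j ↦ hgi _ (h3 j)
    have hei : e i ∈ Submodule.span F (Set.range e) := Submodule.subset_span ⟨i, rfl⟩
    have hw'mem : w' ∈ Submodule.span F (Set.range e) :=
      Submodule.sum_mem _ fun j _ ↦ Submodule.smul_mem _ _ (Submodule.subset_span ⟨_, rfl⟩)
    have hsum : ∑ j, GW.of (B (e j) (e j)) =
        GW.of (B (e i) (e i)) + ∑ j, GW.of (B (g j) (g j)) := by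
      rw [Fin.sum_univ_succAbove _ i]; rfl
    rw [hsum, h4]
    rcases eq_or_ne (c i) 0 with hc | hc
    · have hww' : w = w' := by rw [hww, hc, zero_smul, zero_add]
      refine ⟨Fin.cons (e i) e'', h1.cons hB (he.2 i) hie'', fun j ↦ ?_, fun j ↦ ?_, ?_⟩
      · induction j using Fin.cases with
        | zero => simpa [hww'] using hw'e
        | succ j => simpa [hww'] using h2 j
      · induction j using Fin.cases with
        | zero => simpa using hei
        | succ j => simpa using hsub (h3 j)
      · rw [Fin.sum_univ_succ, hww']; simp only [Fin.cons_zero, Fin.cons_succ]; abel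
    · set t := c i ^ 2 * B (e i) (e i) with ht
      have ht0 : t ≠ 0 := mul_ne_zero (pow_ne_zero _ hc) (he.2 i)
      set v := (B w' w' * c i) • e i - t • w' with hv
      have hvv : B v v = t * B w' w' * (t + B w' w') := by
        rw [hv]; simp [hew', hw'e, ht]; ring
      have hvw : B w v = 0 := by
        rw [hv, hww]; simp [hew', hw'e, ht]; ring
      have htw : t + B w' w' ≠ 0 := by rwa [← hBw]
      refine ⟨Fin.cons v e'', h1.cons hB ?_ ?_, fun j ↦ ?_, fun j ↦ ?_, ?_⟩
      · rw [hvv]; exact mul_ne_zero (mul_ne_zero ht0 hw'0) htw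
      · intro j; rw [hv]; simp [hie'', h2]
      · induction j using Fin.cases with
        | zero => simpa using hvw
        | succ j => rw [hww]; simp [hie'', h2]
      · induction j using Fin.cases with
        | zero =>
          simp only [Fin.cons_zero, hv]
          exact Submodule.sub_mem _ (Submodule.smul_mem _ _ hei) (Submodule.smul_mem _ _ hw'mem)
        | succ j => simpa using hsub (h3 j)
      · rw [Fin.sum_univ_succ]; simp only [Fin.cons_zero, Fin.cons_succ]
        rw [hvv, hBw, ← add_assoc, ← add_assoc, ← GW.of_add_of htw]
        congr 2
        exact (GW.of_eq_of hc (by rw [ht]; ring)).symm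

/-- Two orthogonal families with the same span have the same class. -/
lemma OrthFam.sum_eq [CharZero F] (hB : B.IsSymm) {n : ℕ} {e f : Fin n → V}
    (he : OrthFam B e) (hf : OrthFam B f) (h : ∀ j, f j ∈ Submodule.span F (Set.range e)) :
    ∑ i, GW.of (B (e i) (e i)) = ∑ i, GW.of (B (f i) (f i)) := by
  induction n with
  | zero => simp
  | succ n ih =>
    have hspan : Submodule.span F (Set.range f) = Submodule.span F (Set.range e) := by
      have : FiniteDimensional F (Submodule.span F (Set.range e)) :=
        FiniteDimensional.span_of_finite F (Set.finite_range e)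
      apply Submodule.eq_of_le_of_finrank_eq
      · rw [Submodule.span_le]; rintro _ ⟨j, rfl⟩; exact h j
      · rw [finrank_span_eq_card hf.linearIndependent, finrank_span_eq_card he.linearIndependent]
    obtain ⟨c, hc⟩ := (Submodule.mem_span_range_iff_exists_fun F).1 (h 0)
    obtain ⟨e', h1, h2, h3, h4⟩ := exists_complement hB e c he (by rw [hc]; exact hf.2 0)
    rw [hc] at h2 h4
    rw [h4, Fin.sum_univ_succ]
    congr 1
    refine (ih (e := f ∘ Fin.succ) (hf.comp (Fin.succ_injective n)) h1 fun j ↦ ?_).symm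
    have hj : e' j ∈ Submodule.span F (Set.range f) := hspan ▸ h3 j
    obtain ⟨d, hd⟩ := (Submodule.mem_span_range_iff_exists_fun F).1 hj
    have hd0 : d 0 = 0 := by
      have := hf.apply_sum d 0
      rw [hd, h2 j] at this
      exact (mul_eq_zero.1 this.symm).resolve_right (hf.2 0)
    rw [← hd, Fin.sum_univ_succ, hd0, zero_smul, zero_add]
    exact Submodule.sum_mem _ fun k _ ↦ Submodule.smul_mem _ _ (Submodule.subset_span ⟨k, rfl⟩)

end Chain

section

open Matrix

/-! ### Congruence of matrices and the class of a symmetric matrix -/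

section Cong

variable {F : Type*} [CommRing F] {ι κ μ ν : Type*} [Fintype ι] [Fintype κ] [Fintype μ] [Fintype ν]
  [DecidableEq ι] [DecidableEq κ] [DecidableEq μ] [DecidableEq ν]

/-- Congruence of square matrices, possibly with different index types. -/
def Cong (M : Matrix ι ι F) (N : Matrix κ κ F) : Prop :=
  ∃ (P : Matrix ι κ F) (Q : Matrix κ ι F), P * Q = 1 ∧ Q * P = 1 ∧ Pᵀ * M * P = N

lemma Cong.refl (M : Matrix ι ι F) : Cong M M := ⟨1, 1, by simp, by simp, by simp⟩

lemma Cong.symm {M : Matrix ι ι F} {N : Matrix κ κ F} : Cong M N → Cong N M := by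
  rintro ⟨P, Q, h1, h2, rfl⟩
  refine ⟨Q, P, h2, h1, ?_⟩
  calc Qᵀ * (Pᵀ * M * P) * Q = (P * Q)ᵀ * M * (P * Q) := by
        simp only [Matrix.transpose_mul, Matrix.mul_assoc]
    _ = M := by simp [h1]

lemma Cong.trans {M : Matrix ι ι F} {N : Matrix κ κ F} {O : Matrix μ μ F} :
    Cong M N → Cong N O → Cong M O := by
  rintro ⟨P, Q, h1, h2, rfl⟩ ⟨P', Q', h1', h2', rfl⟩
  refine ⟨P * P', Q' * Q, ?_, ?_, ?_⟩
  · rw [Matrix.mul_assoc, ← Matrix.mul_assoc P', h1', Matrix.one_mul, h1]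
  · rw [Matrix.mul_assoc, ← Matrix.mul_assoc Q, h2, Matrix.one_mul, h2']
  · simp only [Matrix.transpose_mul, Matrix.mul_assoc]

lemma Cong.of_isUnit_det {M N P : Matrix ι ι F} (hP : IsUnit P.det) (h : Pᵀ * M * P = N) :
    Cong M N :=
  ⟨P, P⁻¹, Matrix.mul_nonsing_inv _ hP, Matrix.nonsing_inv_mul _ hP, h⟩

lemma Cong.reindex (e : κ ≃ ι) (M : Matrix ι ι F) : Cong M (M.submatrix e e) := by
  refine ⟨(1 : Matrix ι ι F).submatrix id e, (1 : Matrix ι ι F).submatrix e id, ?_, ?_, ?_⟩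
  · rw [Matrix.submatrix_mul_equiv, Matrix.one_mul]; simp
  · rw [← Matrix.submatrix_mul _ _ e id e Function.bijective_id]; simp
  · ext i j; simp [Matrix.mul_apply, Matrix.one_apply]

lemma Cong.fromBlocks {M : Matrix ι ι F} {N : Matrix κ κ F} {M' : Matrix μ μ F}
    {N' : Matrix ν ν F} : Cong M N → Cong M' N' →
    Cong (Matrix.fromBlocks M 0 0 M') (Matrix.fromBlocks N 0 0 N') := by
  rintro ⟨P, Q, h1, h2, rfl⟩ ⟨P', Q', h1', h2', rfl⟩
  refine ⟨Matrix.fromBlocks P 0 0 P', Matrix.fromBlocks Q 0 0 Q', ?_, ?_, ?_⟩ <;>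
    simp [Matrix.fromBlocks_multiply, Matrix.fromBlocks_transpose, *]

lemma Cong.map {E : Type*} [CommRing E] (φ : F →+* E) {M : Matrix ι ι F} {N : Matrix κ κ F} :
    Cong M N → Cong (M.map φ) (N.map φ) := by
  rintro ⟨P, Q, h1, h2, rfl⟩
  refine ⟨P.map φ, Q.map φ, ?_, ?_, ?_⟩
  · rw [← Matrix.map_mul, h1, Matrix.map_one _ (map_zero φ) (map_one φ)]
  · rw [← Matrix.map_mul, h2, Matrix.map_one _ (map_zero φ) (map_one φ)]
  · rw [Matrix.map_mul, Matrix.map_mul, Matrix.transpose_map]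

lemma Cong.isSymm {M : Matrix ι ι F} {N : Matrix κ κ F} (h : Cong M N) (hM : M.IsSymm) :
    N.IsSymm := by
  obtain ⟨P, Q, -, -, rfl⟩ := h
  rw [Matrix.IsSymm, Matrix.transpose_mul, Matrix.transpose_mul, Matrix.transpose_transpose, hM.eq,
    Matrix.mul_assoc]

lemma Cong.isUnit_det {M : Matrix ι ι F} {N : Matrix κ κ F} (h : Cong M N) (hM : IsUnit M.det) :
    IsUnit N.det := by
  obtain ⟨P, Q, h1, h2, rfl⟩ := h
  apply Matrix.isUnit_det_of_right_inverse (B := Q * M⁻¹ * Qᵀ)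
  calc Pᵀ * M * P * (Q * M⁻¹ * Qᵀ) = Pᵀ * (M * (P * Q) * M⁻¹) * Qᵀ := by
        simp only [Matrix.mul_assoc]
    _ = (Q * P)ᵀ := by
        rw [h1, Matrix.mul_one, Matrix.mul_nonsing_inv _ hM, Matrix.mul_one, Matrix.transpose_mul]
    _ = 1 := by rw [h2, Matrix.transpose_one]

end Cong

section Class

variable {F : Type*} [Field F] {ι κ μ : Type*} [Fintype ι] [Fintype κ] [Fintype μ]
  [DecidableEq ι] [DecidableEq κ] [DecidableEq μ]

lemma Cong.det_ne_zero {M : Matrix ι ι F} {N : Matrix κ κ F} (h : Cong M N) (hM : M.det ≠ 0) :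
    N.det ≠ 0 := (h.isUnit_det (isUnit_iff_ne_zero.2 hM)).ne_zero

lemma OrthFam.sum_eq' [CharZero F] {V : Type*} [AddCommGroup V] [Module F V]
    {B : LinearMap.BilinForm F V} (hB : B.IsSymm) {e : ι → V} {f : κ → V}
    (he : OrthFam B e) (hf : OrthFam B f) (hcard : Fintype.card ι = Fintype.card κ)
    (h : ∀ j, f j ∈ Submodule.span F (Set.range e)) :
    ∑ i, GW.of (B (e i) (e i)) = ∑ i, GW.of (B (f i) (f i)) := by
  let α := (Fintype.equivFin ι).symm
  let β := (Fintype.equivFinOfCardEq hcard.symm).symm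
  rw [← α.sum_comp, ← β.sum_comp]
  refine OrthFam.sum_eq hB (he.comp α.injective) (hf.comp β.injective) fun j ↦ ?_
  have := h (β j)
  rwa [← α.surjective.range_comp] at this

lemma Cong.diagonal_sum_eq [CharZero F] {d : ι → F} {d' : κ → F} (hd : ∀ i, d i ≠ 0)
    (hd' : ∀ i, d' i ≠ 0) (h : Cong (diagonal d) (diagonal d')) :
    ∑ i, GW.of (d i) = ∑ i, GW.of (d' i) := by
  obtain ⟨P, Q, h1, h2, h3⟩ := h
  set B := Matrix.toBilin' (diagonal d)
  have hB : B.IsSymm := ⟨fun x y ↦ by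
    simp only [B, Matrix.toBilin'_apply', Matrix.mulVec_diagonal, dotProduct]
    exact Finset.sum_congr rfl fun i _ ↦ by ring⟩
  have hcol : ∀ i j, B (P.col i) (P.col j) = (diagonal d') i j := by
    intro i j
    rw [← h3, Matrix.mul_assoc, Matrix.mul_apply]
    simp only [B, Matrix.toBilin'_apply', dotProduct, Matrix.mulVec, Matrix.mul_apply,
      Matrix.col_apply, Matrix.transpose_apply]
  have hsing : ∀ i j, B (Pi.single i 1) (Pi.single j 1) = (diagonal d) i j := fun i j ↦ by
    simp [B]
  have he : OrthFam B (fun i : ι ↦ (Pi.single i 1 : ι → F)) :=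
    ⟨fun i j hij ↦ by rw [hsing]; simp [hij], fun i ↦ by rw [hsing]; simpa using hd i⟩
  have hf : OrthFam B (fun i : κ ↦ P.col i) :=
    ⟨fun i j hij ↦ by rw [hcol]; simp [hij], fun i ↦ by rw [hcol]; simpa using hd' i⟩
  have hcard : Fintype.card ι = Fintype.card κ := Matrix.square_of_invertible P Q h1 h2
  have := OrthFam.sum_eq' hB he hf hcard fun j ↦ by
    rw [Submodule.mem_span_range_iff_exists_fun]
    exact ⟨P.col j, by ext k; simp [Finset.sum_apply, Pi.single_apply]⟩
  simpa [hsing, hcol] using this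

/-- A nondegenerate symmetric matrix is congruent to a diagonal one. -/
lemma exists_cong_diagonal [CharZero F] {M : Matrix ι ι F} (hM : M.IsSymm) (hdet : M.det ≠ 0) :
    ∃ d : ι → F, (∀ i, d i ≠ 0) ∧ Cong M (diagonal d) := by
  have : Invertible (2 : F) := invertibleOfNonzero two_ne_zero
  set B := Matrix.toBilin' M
  have hB : B.IsSymm := ⟨fun x y ↦ by
    simp only [B, Matrix.toBilin'_apply']
    rw [dotProduct_mulVec, ← Matrix.mulVec_transpose, hM.eq, dotProduct_comm]⟩
  obtain ⟨v, hv⟩ := LinearMap.BilinForm.exists_orthogonal_basis (B := B) ⟨hB.eq⟩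
  let w : Module.Basis ι F (ι → F) := v.reindex (Fintype.equivOfCardEq (by simp))
  have hw : ∀ i j, i ≠ j → B (w i) (w j) = 0 := fun i j hij ↦ by
    simp only [w, Module.Basis.reindex_apply]
    exact hv ((Equiv.injective _).ne hij)
  let P : Matrix ι ι F := (Pi.basisFun F ι).toMatrix w
  have hP : IsUnit P.det := by
    rw [isUnit_iff_ne_zero]
    intro h
    have := congrArg Matrix.det ((Pi.basisFun F ι).toMatrix_mul_toMatrix_flip w)
    rw [Matrix.det_mul, Matrix.det_one] at this
    simp only [P] at h
    rw [h, zero_mul] at this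
    exact zero_ne_one this
  have hPMP : ∀ i j, (Pᵀ * M * P) i j = B (w i) (w j) := fun i j ↦ by
    rw [Matrix.mul_assoc, Matrix.mul_apply]
    simp only [B, Matrix.toBilin'_apply', dotProduct, Matrix.mulVec, Matrix.mul_apply, P,
      Matrix.transpose_apply, Module.Basis.toMatrix_apply, Pi.basisFun_repr]
  have hc : Cong M (diagonal fun i ↦ B (w i) (w i)) :=
    Cong.of_isUnit_det hP (by
      ext i j
      rw [hPMP]
      rcases eq_or_ne i j with rfl | h
      · simp
      · simp [h, hw i j h])
  refine ⟨_, fun i ↦ ?_, hc⟩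
  have := hc.det_ne_zero hdet
  rw [Matrix.det_diagonal] at this
  exact (Finset.prod_ne_zero_iff.1 this) i (Finset.mem_univ _)

open Classical in
/-- The class of a nondegenerate symmetric matrix in the Grothendieck–Witt group. -/
noncomputable def gw (M : Matrix ι ι F) : GW F :=
  if h : ∃ d : ι → F, (∀ i, d i ≠ 0) ∧ Cong M (diagonal d) then ∑ i, GW.of (h.choose i) else 0

lemma gw_eq_sum [CharZero F] {M : Matrix ι ι F} {d : κ → F} (hd : ∀ i, d i ≠ 0)
    (h : Cong M (diagonal d)) : gw M = ∑ i, GW.of (d i) := by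
  have hex : ∃ d : ι → F, (∀ i, d i ≠ 0) ∧ Cong M (diagonal d) := by
    obtain ⟨P, Q, h1, h2, -⟩ := id h
    let e : ι ≃ κ := Fintype.equivOfCardEq (Matrix.square_of_invertible P Q h1 h2)
    refine ⟨d ∘ e, fun i ↦ hd _, h.trans ?_⟩
    have := Cong.reindex e (diagonal d)
    rwa [Matrix.submatrix_diagonal_equiv] at this
  rw [gw, dif_pos hex]
  exact (hex.choose_spec.2.symm.trans h).diagonal_sum_eq hex.choose_spec.1 hd

lemma gw_diagonal [CharZero F] {d : ι → F} (hd : ∀ i, d i ≠ 0) :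
    gw (diagonal d) = ∑ i, GW.of (d i) := gw_eq_sum hd (Cong.refl _)

lemma Cong.gw_eq [CharZero F] {M : Matrix ι ι F} {N : Matrix κ κ F} (hM : M.IsSymm)
    (hdet : M.det ≠ 0) (h : Cong M N) : gw M = gw N := by
  obtain ⟨d, hd, h'⟩ := exists_cong_diagonal hM hdet
  rw [gw_eq_sum hd h', gw_eq_sum hd (h.symm.trans h')]

lemma gw_fromBlocks [CharZero F] {M : Matrix ι ι F} {N : Matrix κ κ F} (hM : M.IsSymm)
    (hdet : M.det ≠ 0) (hN : N.IsSymm) (hdetN : N.det ≠ 0) :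
    gw (fromBlocks M 0 0 N) = gw M + gw N := by
  obtain ⟨d, hd, h⟩ := exists_cong_diagonal hM hdet
  obtain ⟨d', hd', h'⟩ := exists_cong_diagonal hN hdetN
  rw [gw_eq_sum hd h, gw_eq_sum hd' h', gw_eq_sum (d := Sum.elim d d')
    (by rintro (i | i) <;> simp [hd, hd']) (by
      rw [← Matrix.fromBlocks_diagonal]; exact h.fromBlocks h')]
  simp

lemma Cong.blockDiagonal' {α : Type*} [Fintype α] [DecidableEq α] {ι κ : α → Type*}
    [∀ a, Fintype (ι a)] [∀ a, DecidableEq (ι a)] [∀ a, Fintype (κ a)] [∀ a, DecidableEq (κ a)]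
    {M : ∀ a, Matrix (ι a) (ι a) F} {N : ∀ a, Matrix (κ a) (κ a) F} (h : ∀ a, Cong (M a) (N a)) :
    Cong (Matrix.blockDiagonal' M) (Matrix.blockDiagonal' N) := by
  choose P Q h1 h2 h3 using h
  refine ⟨Matrix.blockDiagonal' P, Matrix.blockDiagonal' Q, ?_, ?_, ?_⟩
  · rw [← Matrix.blockDiagonal'_mul]; simp only [h1]; exact Matrix.blockDiagonal'_one
  · rw [← Matrix.blockDiagonal'_mul]; simp only [h2]; exact Matrix.blockDiagonal'_one
  · rw [Matrix.blockDiagonal'_transpose, ← Matrix.blockDiagonal'_mul, ← Matrix.blockDiagonal'_mul]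
    simp [h3]

lemma gw_blockDiagonal' [CharZero F] {α : Type*} [Fintype α] [DecidableEq α] {ι : α → Type*}
    [∀ a, Fintype (ι a)] [∀ a, DecidableEq (ι a)] {M : ∀ a, Matrix (ι a) (ι a) F}
    (hM : ∀ a, (M a).IsSymm) (hdet : ∀ a, (M a).det ≠ 0) :
    gw (Matrix.blockDiagonal' M) = ∑ a, gw (M a) := by
  choose d hd h using fun a ↦ exists_cong_diagonal (hM a) (hdet a)
  rw [gw_eq_sum (d := fun x : (Σ a, ι a) ↦ d x.1 x.2) (fun _ ↦ hd _ _) (by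
      rw [← Matrix.blockDiagonal'_diagonal]; exact Cong.blockDiagonal' h)]
  rw [Fintype.sum_sigma]
  exact Finset.sum_congr rfl fun a _ ↦ (gw_eq_sum (hd a) (h a)).symm

lemma gw_map [CharZero F] {E : Type*} [Field E] [CharZero E] (φ : F →+* E) {M : Matrix ι ι F}
    (hM : M.IsSymm) (hdet : M.det ≠ 0) : gw (M.map φ) = GW.map φ (gw M) := by
  obtain ⟨d, hd, h⟩ := exists_cong_diagonal hM hdet
  rw [gw_eq_sum hd h, gw_eq_sum (d := fun i ↦ φ (d i)) (fun i ↦ (map_ne_zero φ).2 (hd i)) (by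
    have := h.map φ
    rwa [Matrix.diagonal_map (map_zero φ)] at this)]
  simp

end Class

/-! ### Witt cancellation -/

section Cancellation

variable {F : Type*} [Field F] {ι κ μ : Type*} [Fintype ι] [Fintype κ] [Fintype μ]
  [DecidableEq ι] [DecidableEq κ] [DecidableEq μ]

/-- The reflection in an anisotropic vector. -/
lemma reflection_cong {M : Matrix ι ι F} (hM : M.IsSymm) {u : ι → F} (hu : u ⬝ᵥ M *ᵥ u ≠ 0)
    (R : Matrix ι ι F) (hR : R = 1 - (2 / (u ⬝ᵥ M *ᵥ u)) • (vecMulVec u (u ᵥ* M))) :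
    Rᵀ * M * R = M := by
  have hsym : u ᵥ* M = M *ᵥ u := by rw [← Matrix.mulVec_transpose, hM.eq]
  set q := u ⬝ᵥ M *ᵥ u
  have h1 : M * vecMulVec u (u ᵥ* M) = vecMulVec (M *ᵥ u) (M *ᵥ u) := by
    rw [Matrix.mul_vecMulVec, hsym]
  have h2 : (vecMulVec u (u ᵥ* M))ᵀ * M = vecMulVec (M *ᵥ u) (M *ᵥ u) := by
    rw [Matrix.transpose_vecMulVec, Matrix.vecMulVec_mul, hsym]
  have h3 : vecMulVec (M *ᵥ u) (M *ᵥ u) * vecMulVec u (u ᵥ* M) =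
      q • vecMulVec (M *ᵥ u) (M *ᵥ u) := by
    rw [Matrix.vecMulVec_mul_vecMulVec, hsym, dotProduct_comm]
    ext i j; simp [vecMulVec_apply, q]; ring
  rw [hR, Matrix.transpose_sub, Matrix.transpose_one, Matrix.transpose_smul, Matrix.sub_mul,
    Matrix.one_mul, Matrix.smul_mul, h2, Matrix.mul_sub, Matrix.mul_one, Matrix.sub_mul,
    Matrix.mul_smul, h1, Matrix.smul_mul, Matrix.mul_smul, h3, smul_smul, smul_smul]
  rw [show 2 / q * (2 / q) * q = 2 / q + 2 / q by field_simp; ring, add_smul]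
  abel

/-- Two vectors of the same nonzero length are exchanged by an isometry. -/
lemma exists_isometry_mulVec_eq [CharZero F] {M : Matrix ι ι F} (hM : M.IsSymm) {w e : ι → F}
    (he : e ⬝ᵥ M *ᵥ e ≠ 0) (hw : w ⬝ᵥ M *ᵥ w = e ⬝ᵥ M *ᵥ e) :
    ∃ R : Matrix ι ι F, Rᵀ * M * R = M ∧ (R *ᵥ w = e ∨ R *ᵥ w = -e) := by
  have hsym : ∀ x y : ι → F, x ⬝ᵥ M *ᵥ y = y ⬝ᵥ M *ᵥ x := fun x y ↦ by
    rw [dotProduct_mulVec, ← Matrix.mulVec_transpose, hM.eq, dotProduct_comm]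
  have key : ∀ f : ι → F, f ⬝ᵥ M *ᵥ f = w ⬝ᵥ M *ᵥ w → (w - f) ⬝ᵥ M *ᵥ (w - f) ≠ 0 →
      ∃ R : Matrix ι ι F, Rᵀ * M * R = M ∧ R *ᵥ w = f := by
    intro f hf hq
    refine ⟨_, reflection_cong hM hq _ rfl, ?_⟩
    have h1 : (w - f) ᵥ* M ⬝ᵥ w = ((w - f) ⬝ᵥ M *ᵥ (w - f)) / 2 := by
      rw [← dotProduct_mulVec]
      simp only [Matrix.mulVec_sub, dotProduct_sub, sub_dotProduct, hf, hsym f w]; ring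
    rw [Matrix.sub_mulVec, Matrix.one_mulVec, Matrix.smul_mulVec, Matrix.vecMulVec_mulVec, h1]
    ext i
    simp only [Pi.sub_apply, Pi.smul_apply, MulOpposite.smul_eq_mul_unop, MulOpposite.unop_op,
      smul_eq_mul]
    field_simp
    ring
  by_cases h : (w - e) ⬝ᵥ M *ᵥ (w - e) = 0
  · have h' : (w - -e) ⬝ᵥ M *ᵥ (w - -e) ≠ 0 := by
      intro h'
      apply he
      simp only [Matrix.mulVec_sub, dotProduct_sub, sub_dotProduct, Matrix.mulVec_neg,
        dotProduct_neg, neg_dotProduct, hw, hsym e w] at h h'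
      linear_combination (h + h') / 4
    obtain ⟨R, h1, h2⟩ := key (-e) (by simp [Matrix.mulVec_neg, hw]) h'
    exact ⟨R, h1, Or.inr h2⟩
  · obtain ⟨R, h1, h2⟩ := key e hw.symm h
    exact ⟨R, h1, Or.inl h2⟩

lemma cong_cancel_one [CharZero F] {a : F} (ha : a ≠ 0) {M : Matrix ι ι F} {N : Matrix κ κ F}
    (hN : N.IsSymm) (hdet : M.det ≠ 0)
    (h : Cong (fromBlocks (diagonal fun _ : Unit ↦ a) 0 0 M)
      (fromBlocks (diagonal fun _ : Unit ↦ a) 0 0 N)) : Cong M N := by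
  have hcard : Fintype.card κ = Fintype.card ι := by
    obtain ⟨P, Q, h1, h2, -⟩ := h
    simpa using (Matrix.square_of_invertible P Q h1 h2).symm
  let ε : κ ≃ ι := Fintype.equivOfCardEq hcard
  suffices H : ∀ N : Matrix ι ι F, N.IsSymm → Cong (fromBlocks (diagonal fun _ : Unit ↦ a) 0 0 M)
      (fromBlocks (diagonal fun _ : Unit ↦ a) 0 0 N) → Cong M N by
    refine (H _ ?_ (h.trans ((Cong.refl _).fromBlocks (Cong.reindex ε.symm N)))).trans
      (Cong.reindex ε.symm N).symm
    exact (Cong.reindex ε.symm N).isSymm hN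
  clear h hN N
  intro N hN h
  have hdetN : N.det ≠ 0 := by
    have := h.det_ne_zero (by simp [Matrix.det_fromBlocks_zero₂₁, ha, hdet])
    simpa [Matrix.det_fromBlocks_zero₂₁, ha] using this
  obtain ⟨P, Q, h1, h2, h3⟩ := h.symm
  set A := fromBlocks (diagonal fun _ : Unit ↦ a) 0 0 N with hA
  have hAs : A.IsSymm := by
    rw [Matrix.IsSymm, hA, fromBlocks_transpose, hN.eq]; simp
  let e : Unit ⊕ ι → F := Pi.single (Sum.inl ()) 1
  have he : e ⬝ᵥ A *ᵥ e = a := by simp [e, A]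
  have hw : (P *ᵥ e) ⬝ᵥ A *ᵥ (P *ᵥ e) = a := by
    have : (P *ᵥ e) ⬝ᵥ A *ᵥ (P *ᵥ e) = e ⬝ᵥ (Pᵀ * A * P) *ᵥ e := by
      rw [← Matrix.mulVec_mulVec, ← Matrix.mulVec_mulVec, Matrix.dotProduct_mulVec e,
        Matrix.vecMul_transpose]
    rw [this, h3]; simp [e]
  obtain ⟨R, hR, hRw⟩ := exists_isometry_mulVec_eq hAs (w := P *ᵥ e) (e := e) (by rwa [he])
    (by rw [hw, he])
  set T := R * P with hT
  have hTA : Tᵀ * A * T = fromBlocks (diagonal fun _ : Unit ↦ a) 0 0 M := by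
    rw [hT, Matrix.transpose_mul, ← h3]
    nth_rw 2 [← hR]
    simp only [Matrix.mul_assoc]
  have hT21 : T.toBlocks₂₁ = 0 := by
    ext i j
    have : (T *ᵥ e) (Sum.inr i) = 0 := by
      rw [hT, ← Matrix.mulVec_mulVec]
      rcases hRw with h | h <;> rw [h] <;> simp [e]
    simpa [e, toBlocks₂₁] using this
  have hT11 : T.toBlocks₁₁ = 1 ∨ T.toBlocks₁₁ = -1 := by
    have : (T *ᵥ e) (Sum.inl ()) = 1 ∨ (T *ᵥ e) (Sum.inl ()) = -1 := by
      rw [hT, ← Matrix.mulVec_mulVec]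
      rcases hRw with h | h <;> rw [h] <;> simp [e]
    rcases this with h | h
    · left; ext i j; simpa [e, toBlocks₁₁] using h
    · right; ext i j; simpa [e, toBlocks₁₁] using h
  rw [← fromBlocks_toBlocks T, hT21, hA, fromBlocks_transpose, fromBlocks_multiply,
    fromBlocks_multiply] at hTA
  simp only [transpose_zero, Matrix.zero_mul, Matrix.mul_zero, add_zero, zero_add] at hTA
  obtain ⟨-, h12, -, h22⟩ := fromBlocks_inj.1 hTA
  have h12' : T.toBlocks₁₂ = 0 := by
    have hd : (diagonal fun _ : Unit ↦ a) = a • (1 : Matrix Unit Unit F) := by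
      rw [Matrix.smul_one_eq_diagonal]
    rw [hd] at h12
    rcases hT11 with h | h <;> rw [h] at h12 <;> simpa [ha] using h12
  rw [h12'] at h22
  simp only [transpose_zero, Matrix.zero_mul, zero_add] at h22
  refine (Cong.of_isUnit_det (isUnit_iff_ne_zero.2 fun h ↦ hdet ?_) h22).symm
  rw [← h22, Matrix.det_mul, h, mul_zero]

instance instDecidableEqToType {α : Type*} [DecidableEq α] (c : Multiset α) :
    DecidableEq c.ToType :=
  inferInstanceAs (DecidableEq (Σ x : α, Fin (c.count x)))

/-- The diagonal matrix with prescribed entries. -/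
noncomputable def diagM [DecidableEq F] (c : Multiset Fˣ) :
    Matrix c.ToType c.ToType F := diagonal fun x ↦ ((x : Fˣ) : F)

variable [DecidableEq F]

lemma diagM_cong (d : ι → Fˣ) :
    Cong (diagonal fun i ↦ (d i : F)) (diagM (Finset.univ.val.map d)) := by
  let e : (Finset.univ.val.map d).ToType ≃ ι :=
    (Equiv.sigmaCongrRight fun x ↦ (Fintype.equivFinOfCardEq (α := {i // d i = x}) (by
      rw [Multiset.count_map, Fintype.card_subtype]
      simp only [eq_comm]; rfl)).symm).trans (Equiv.sigmaFiberEquiv d)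
  have he : ∀ y, d (e y) = (y : Fˣ) := fun y ↦ by
    simp only [e, Equiv.sigmaFiberEquiv]
    exact (_ : {i // d i = y.1}).2
  have := Cong.reindex e (diagonal fun i ↦ (d i : F))
  rw [Matrix.submatrix_diagonal_equiv] at this
  convert this using 2
  rw [diagM]
  congr 1
  ext y
  simp [he]

lemma diagM_add (c d : Multiset Fˣ) : Cong (fromBlocks (diagM c) 0 0 (diagM d)) (diagM (c + d)) := by
  have := diagM_cong (Sum.elim (fun x : c ↦ (x : Fˣ)) (fun x : d ↦ (x : Fˣ)))
  have h : Finset.univ.val.map (Sum.elim (fun x : c ↦ (x : Fˣ)) (fun x : d ↦ (x : Fˣ))) = c + d := by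
    rw [← Finset.univ_disjSum_univ, Finset.val_disjSum, Multiset.disjSum, Multiset.map_add,
      Multiset.map_map, Multiset.map_map]
    simp [Function.comp_def]
  rw [h] at this
  refine Cong.trans ?_ this
  have h' : (fun i ↦ ((Sum.elim (fun x : c ↦ (x : Fˣ)) (fun x : d ↦ (x : Fˣ)) i : Fˣ) : F)) =
      Sum.elim (fun x : c ↦ ((x : Fˣ) : F)) (fun x : d ↦ ((x : Fˣ) : F)) := by
    ext (i | i) <;> simp
  rw [diagM, diagM, Matrix.fromBlocks_diagonal, h']
  exact Cong.refl _

lemma diagM_isSymm (c : Multiset Fˣ) : (diagM c).IsSymm := Matrix.diagonal_transpose _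

lemma diagM_det (c : Multiset Fˣ) : (diagM c).det ≠ 0 := by
  rw [diagM, Matrix.det_diagonal]
  exact Finset.prod_ne_zero_iff.2 fun i _ ↦ Units.ne_zero _

/-- Isometry of diagonal forms, as a congruence on the monoid of multisets of entries. -/
def isoCon (F : Type*) [Field F] [DecidableEq F] : AddCon (Multiset Fˣ) where
  r c d := Cong (diagM c) (diagM d)
  iseqv := ⟨fun _ ↦ Cong.refl _, Cong.symm, Cong.trans⟩
  add' h h' := (diagM_add _ _).symm.trans ((h.fromBlocks h').trans (diagM_add _ _))

lemma diagM_singleton (a : Fˣ) : Cong (diagonal fun _ : Unit ↦ (a : F)) (diagM {a}) :=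
  diagM_cong fun _ : Unit ↦ a

lemma isoCon_cancel_left [CharZero F] (c d d' : Multiset Fˣ) (h : isoCon F (c + d) (c + d')) :
    isoCon F d d' := by
  induction c using Multiset.induction_on with
  | empty => simpa using h
  | cons a c ih =>
    refine ih ?_
    rw [Multiset.cons_add, Multiset.cons_add, ← Multiset.singleton_add,
      ← Multiset.singleton_add a] at h
    have h' : Cong (diagM ({a} + (c + d))) (diagM ({a} + (c + d'))) := h
    refine cong_cancel_one (a := (a : F)) a.ne_zero (diagM_isSymm _)
      (diagM_det _) ?_
    exact (((diagM_singleton a).fromBlocks (Cong.refl _)).trans (diagM_add _ _)).trans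
      (h'.trans (((diagM_singleton a).fromBlocks (Cong.refl _)).trans (diagM_add _ _)).symm)

instance [CharZero F] : IsCancelAdd (isoCon F).Quotient := by
  have : IsLeftCancelAdd (isoCon F).Quotient := ⟨fun a b c h ↦ by
    induction a, b using AddCon.induction_on₂ with | _ a b
    induction c using AddCon.induction_on with | _ c
    exact (AddCon.eq _).2 (isoCon_cancel_left a b c ((AddCon.eq _).1 h))⟩
  exact AddCommMagma.IsLeftCancelAdd.toIsCancelAdd _

/-- The class of a diagonal form in the Grothendieck group of isometry classes. -/
noncomputable def isoClass : Multiset Fˣ →+ Algebra.GrothendieckAddGroup (isoCon F).Quotient :=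
  Algebra.GrothendieckAddGroup.of.comp (isoCon F).mk'

lemma isoClass_eq_iff [CharZero F] {c d : Multiset Fˣ} :
    isoClass c = isoClass d ↔ Cong (diagM c) (diagM d) := by
  rw [isoClass, AddMonoidHom.comp_apply, AddMonoidHom.comp_apply,
    Algebra.GrothendieckAddGroup.of_injective.eq_iff]
  exact (isoCon F).eq

lemma sum_singleton_eq {α : Type*} (d : ι → α) :
    ∑ i, ({d i} : Multiset α) = Finset.univ.val.map d := by
  rw [← Multiset.sum_map_singleton (Finset.univ.val.map d), Multiset.map_map]; rfl

lemma isoClass_univ_eq [CharZero F] {d d' : ι → Fˣ} (h : Cong (diagonal fun i ↦ (d i : F))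
    (diagonal fun i ↦ (d' i : F))) : ∑ i, isoClass {d i} = ∑ i, isoClass {d' i} := by
  have : ∀ d : ι → Fˣ, ∑ i, isoClass {d i} = isoClass (Finset.univ.val.map d) := fun d ↦ by
    rw [← map_sum, sum_singleton_eq]
  rw [this, this, isoClass_eq_iff]
  exact ((diagM_cong d).symm.trans h).trans (diagM_cong _)

/-- The comparison map from the Grothendieck–Witt group to isometry classes. -/
noncomputable def toIso [CharZero F] : GW F →+ Algebra.GrothendieckAddGroup (isoCon F).Quotient :=
  GW.lift (fun a ↦ if h : a = 0 then 0 else isoClass {Units.mk0 a h}) (by simp)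
    (fun a b ha hb ↦ by
      have hab : a * b ^ 2 ≠ 0 := mul_ne_zero ha (pow_ne_zero 2 hb)
      rw [dif_neg ha, dif_neg hab, isoClass_eq_iff]
      refine (diagM_singleton _).symm.trans (Cong.trans ?_ (diagM_singleton _))
      refine Cong.symm (Cong.of_isUnit_det (P := diagonal fun _ ↦ b) (by simpa using hb) ?_)
      simp only [diagonal_transpose, diagonal_mul_diagonal, Units.val_mk0]
      congr 1; ext; ring)
    (fun a b ha hb h ↦ by
      have h3 : a * b * (a + b) ≠ 0 := mul_ne_zero (mul_ne_zero ha hb) h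
      rw [dif_neg ha, dif_neg hb, dif_neg h, dif_neg h3]
      have := isoClass_univ_eq (d := ![Units.mk0 a ha, Units.mk0 b hb])
        (d' := ![Units.mk0 _ h, Units.mk0 _ h3])
        (Cong.of_isUnit_det (P := !![1, b; 1, -a]) ?_ ?_)
      · simpa using this
      · rw [det_fin_two_of, isUnit_iff_ne_zero]
        intro h'; exact h (by linear_combination -h')
      · ext i j; fin_cases i <;> fin_cases j <;> simp [Matrix.mul_apply, Fin.sum_univ_two] <;> ring)

lemma toIso_sum [CharZero F] (d : ι → F) (hd : ∀ i, d i ≠ 0) : toIso (∑ i, GW.of (d i)) =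
    isoClass (Finset.univ.val.map fun i ↦ Units.mk0 (d i) (hd i)) := by
  have : ∀ i, toIso (GW.of (d i)) = isoClass {Units.mk0 (d i) (hd i)} := fun i ↦ by
    simp [toIso, hd i]
  rw [map_sum, Finset.sum_congr rfl fun i _ ↦ this i, ← map_sum, sum_singleton_eq]

end Cancellation

lemma cong_of_gw_eq {F : Type*} [Field F] [CharZero F] {ι κ : Type*} [Fintype ι] [Fintype κ]
    [DecidableEq ι] [DecidableEq κ] {M : Matrix ι ι F} {N : Matrix κ κ F} (hM : M.IsSymm)
    (hdet : M.det ≠ 0) (hN : N.IsSymm) (hdetN : N.det ≠ 0) (h : gw M = gw N) : Cong M N := by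
  classical
  obtain ⟨d, hd, h1⟩ := exists_cong_diagonal hM hdet
  obtain ⟨d', hd', h1'⟩ := exists_cong_diagonal hN hdetN
  rw [gw_eq_sum hd h1, gw_eq_sum hd' h1'] at h
  have h2 := congrArg toIso h
  rw [toIso_sum d hd, toIso_sum d' hd', isoClass_eq_iff] at h2
  have e1 := diagM_cong fun i ↦ Units.mk0 (d i) (hd i)
  have e2 := diagM_cong fun i ↦ Units.mk0 (d' i) (hd' i)
  simp only [Units.val_mk0] at e1 e2
  exact h1.trans (e1.trans (h2.trans (e2.symm.trans h1'.symm)))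

end

/-! ### The Witt group of a finite prime field and residue maps -/

/-- The Witt group of a field. -/
def Witt (F : Type*) [Field F] : Type _ :=
  GW F ⧸ AddSubgroup.zmultiples (GW.of (1 : F) + GW.of (-1))

noncomputable instance (F : Type*) [Field F] : AddCommGroup (Witt F) :=
  inferInstanceAs (AddCommGroup (GW F ⧸ AddSubgroup.zmultiples (GW.of (1 : F) + GW.of (-1))))

namespace Witt

variable {F : Type*} [Field F]

/-- The class of a form in the Witt group. -/
noncomputable def mk : GW F →+ Witt F := QuotientAddGroup.mk' _

lemma mk_eq_zero {x : GW F} : mk x = 0 ↔ x ∈ AddSubgroup.zmultiples (GW.of (1 : F) + GW.of (-1)) :=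
  QuotientAddGroup.eq_zero_iff x

/-- The class of a one-dimensional form. -/
noncomputable def of (a : F) : Witt F := mk (GW.of a)

@[simp] lemma of_zero : of (0 : F) = 0 := by simp [of]

lemma of_mul_sq (a : F) {b : F} (hb : b ≠ 0) : of (a * b ^ 2) = of a := by
  rw [of, GW.of_mul_sq _ hb]; rfl

lemma of_eq_of {a b c : F} (hc : c ≠ 0) (h : a = b * c ^ 2) : of a = of b := by
  rw [h, of_mul_sq _ hc]

lemma of_add_of {a b : F} (h : a + b ≠ 0) :
    of a + of b = of (a + b) + of (a * b * (a + b)) := by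
  simp only [of, ← map_add, GW.of_add_of h]

lemma of_add_of_neg [NeZero (2 : F)] (a : F) : of a + of (-a) = 0 := by
  rcases eq_or_ne a 0 with rfl | ha
  · simp
  rw [of, of, ← map_add, GW.of_add_of_neg ha (one_ne_zero (α := F)), mk_eq_zero]
  exact AddSubgroup.mem_zmultiples _

end Witt

section Residue

variable {p : ℕ} [hp : Fact p.Prime]

lemma padic_unit_norm {u : ℤ_[p]} : PadicInt.toZMod u ≠ 0 ↔ ‖u‖ = 1 := by
  rw [ne_eq, ← RingHom.mem_ker, PadicInt.ker_toZMod, IsLocalRing.mem_maximalIdeal,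
    mem_nonunits_iff, not_not, PadicInt.isUnit_iff]

lemma exists_padic_rep {a : ℚ_[p]} (ha : a ≠ 0) :
    ∃ (k : ℤ) (u : ℤ_[p]), PadicInt.toZMod u ≠ 0 ∧ a = (p : ℚ_[p]) ^ k * (u : ℚ_[p]) := by
  have hp0 : (p : ℚ_[p]) ≠ 0 := by exact_mod_cast hp.out.ne_zero
  have hn : ‖a * (p : ℚ_[p]) ^ (-a.valuation)‖ = 1 := by
    rw [norm_mul, Padic.norm_eq_zpow_neg_valuation ha, Padic.norm_p_zpow,
      ← zpow_add₀ (by exact_mod_cast hp.out.ne_zero)]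
    simp
  refine ⟨a.valuation, ⟨a * (p : ℚ_[p]) ^ (-a.valuation), hn.le⟩, padic_unit_norm.2 hn, ?_⟩
  change a = (p : ℚ_[p]) ^ a.valuation * (a * (p : ℚ_[p]) ^ (-a.valuation))
  rw [mul_comm, mul_assoc, ← zpow_add₀ hp0]; simp

lemma padic_rep_unique {k l : ℤ} {u v : ℤ_[p]} (hu : PadicInt.toZMod u ≠ 0)
    (hv : PadicInt.toZMod v ≠ 0) (h : (p : ℚ_[p]) ^ k * (u : ℚ_[p]) = (p : ℚ_[p]) ^ l * (v : ℚ_[p])) :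
    k = l ∧ u = v := by
  have hp0 : (p : ℚ_[p]) ≠ 0 := by exact_mod_cast hp.out.ne_zero
  have h1 := congrArg norm h
  rw [norm_mul, norm_mul, ← PadicInt.norm_def, ← PadicInt.norm_def, padic_unit_norm.1 hu,
    padic_unit_norm.1 hv, mul_one, mul_one, Padic.norm_p_zpow, Padic.norm_p_zpow] at h1
  have hkl : k = l := by
    have := zpow_right_injective₀ (a := (p : ℝ)) (by exact_mod_cast hp.out.pos)
      (by exact_mod_cast hp.out.one_lt.ne') h1
    simpa using this
  subst hkl
  exact ⟨rfl, Subtype.ext (mul_left_cancel₀ (zpow_ne_zero _ hp0) h)⟩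

open Classical in
/-- The second residue of a one-dimensional form. -/
noncomputable def resFun (a : ℚ_[p]) : Witt (ZMod p) :=
  if h : ∃ x : ℤ × ℤ_[p], PadicInt.toZMod x.2 ≠ 0 ∧ a = (p : ℚ_[p]) ^ x.1 * (x.2 : ℚ_[p]) then
    if Odd h.choose.1 then Witt.of (PadicInt.toZMod h.choose.2) else 0
  else 0

lemma resFun_rep {k : ℤ} {u : ℤ_[p]} (hu : PadicInt.toZMod u ≠ 0) :
    resFun ((p : ℚ_[p]) ^ k * (u : ℚ_[p])) = if Odd k then Witt.of (PadicInt.toZMod u) else 0 := by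
  have h : ∃ x : ℤ × ℤ_[p], PadicInt.toZMod x.2 ≠ 0 ∧
      (p : ℚ_[p]) ^ k * (u : ℚ_[p]) = (p : ℚ_[p]) ^ x.1 * (x.2 : ℚ_[p]) := ⟨(k, u), hu, rfl⟩
  obtain ⟨h1, h2⟩ := padic_rep_unique hu h.choose_spec.1 h.choose_spec.2
  rw [resFun, dif_pos h, ← h1, ← h2]

lemma resFun_zero : resFun (0 : ℚ_[p]) = 0 := by
  rw [resFun, dif_neg]
  rintro ⟨x, hx, h⟩
  have hp0 : (p : ℚ_[p]) ≠ 0 := by exact_mod_cast hp.out.ne_zero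
  refine hx ?_
  rw [show x.2 = 0 from Subtype.ext ((mul_eq_zero.1 h.symm).resolve_left (zpow_ne_zero _ hp0)),
    map_zero]

lemma resFun_add {k : ℤ} {u v : ℤ_[p]} [NeZero (2 : ZMod p)] {j : ℕ} (hu : PadicInt.toZMod u ≠ 0)
    (hv : PadicInt.toZMod v ≠ 0)
    (h : (p : ℚ_[p]) ^ k * (u : ℚ_[p]) + (p : ℚ_[p]) ^ (k + j) * (v : ℚ_[p]) ≠ 0) :
    resFun ((p : ℚ_[p]) ^ k * (u : ℚ_[p])) + resFun ((p : ℚ_[p]) ^ (k + j) * (v : ℚ_[p])) =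
      resFun ((p : ℚ_[p]) ^ k * (u : ℚ_[p]) + (p : ℚ_[p]) ^ (k + j) * (v : ℚ_[p])) +
      resFun ((p : ℚ_[p]) ^ k * (u : ℚ_[p]) * ((p : ℚ_[p]) ^ (k + j) * (v : ℚ_[p])) *
        ((p : ℚ_[p]) ^ k * (u : ℚ_[p]) + (p : ℚ_[p]) ^ (k + j) * (v : ℚ_[p]))) := by
  have hp0 : (p : ℚ_[p]) ≠ 0 := by exact_mod_cast hp.out.ne_zero
  have hsum : (p : ℚ_[p]) ^ k * (u : ℚ_[p]) + (p : ℚ_[p]) ^ (k + j) * (v : ℚ_[p]) =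
      (p : ℚ_[p]) ^ k * ((u + p ^ j * v : ℤ_[p]) : ℚ_[p]) := by
    push_cast; rw [zpow_add₀ hp0, zpow_natCast]; ring
  by_cases hw : PadicInt.toZMod (u + (p : ℤ_[p]) ^ j * v) = 0
  · have hj : j = 0 := by
      by_contra hj
      rw [map_add, map_mul, map_pow, map_natCast] at hw
      simp [hj, hu] at hw
    subst hj
    simp only [pow_zero, one_mul, map_add, Nat.cast_zero, add_zero] at hw h hsum ⊢
    obtain ⟨l, w, hw', hl⟩ := exists_padic_rep h
    rw [hl, show (p : ℚ_[p]) ^ k * (u : ℚ_[p]) * ((p : ℚ_[p]) ^ k * (v : ℚ_[p])) * ((p : ℚ_[p]) ^ l * (w : ℚ_[p])) =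
      (p : ℚ_[p]) ^ (k + k + l) * ((u * v * w : ℤ_[p]) : ℚ_[p]) by
        push_cast; rw [zpow_add₀ hp0, zpow_add₀ hp0]; ring]
    have hvu : PadicInt.toZMod v = -PadicInt.toZMod u := eq_neg_of_add_eq_zero_right hw
    rw [resFun_rep hu, resFun_rep hv, resFun_rep hw', resFun_rep (by simp [hu, hv, hw'])]
    have e1 : (if Odd k then Witt.of (PadicInt.toZMod u) else 0) +
        (if Odd k then Witt.of (PadicInt.toZMod v) else 0) = 0 := by
      split_ifs
      · rw [hvu, Witt.of_add_of_neg]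
      · simp
    have e2 : Witt.of (PadicInt.toZMod (u * v * w)) = Witt.of (-PadicInt.toZMod w) :=
      Witt.of_eq_of hu (by simp only [map_mul, hvu]; ring)
    have e3 : Odd (k + k + l) ↔ Odd l := by grind
    rw [e1, e2]
    simp only [e3]
    split_ifs
    · rw [Witt.of_add_of_neg]
    · simp
  · rw [hsum, show (p : ℚ_[p]) ^ k * (u : ℚ_[p]) * ((p : ℚ_[p]) ^ (k + j) * (v : ℚ_[p])) *
      ((p : ℚ_[p]) ^ k * ((u + p ^ j * v : ℤ_[p]) : ℚ_[p])) =
      (p : ℚ_[p]) ^ (k + k + (k + j)) * ((u * v * (u + p ^ j * v) : ℤ_[p]) : ℚ_[p]) by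
        push_cast; simp only [zpow_add₀ hp0]; ring]
    rw [resFun_rep hu, resFun_rep hv, resFun_rep hw, resFun_rep (by rw [map_mul, map_mul]; exact mul_ne_zero (mul_ne_zero hu hv) hw)]
    have e3 : Odd (k + k + (k + j)) ↔ Odd (k + j) := by grind
    simp only [e3]
    rcases eq_or_ne j 0 with rfl | hj
    · simp only [pow_zero, one_mul, map_add, Nat.cast_zero, add_zero, map_mul] at hw ⊢
      split_ifs
      · exact Witt.of_add_of hw
      · simp
    · have e4 : PadicInt.toZMod (u + (p : ℤ_[p]) ^ j * v) = PadicInt.toZMod u := by simp [hj]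
      rw [map_mul, map_mul, e4]
      congr 2
      exact (Witt.of_eq_of hu (by ring)).symm

/-- The second residue map at an odd prime. -/
noncomputable def res (p : ℕ) [hp : Fact p.Prime] [NeZero (2 : ZMod p)] :
    GW ℚ_[p] →+ Witt (ZMod p) :=
  GW.lift resFun resFun_zero
    (fun a b ha hb ↦ by
      have hp0 : (p : ℚ_[p]) ≠ 0 := by exact_mod_cast hp.out.ne_zero
      obtain ⟨k, u, hu, rfl⟩ := exists_padic_rep ha
      obtain ⟨l, v, hv, rfl⟩ := exists_padic_rep hb
      rw [show (p : ℚ_[p]) ^ k * (u : ℚ_[p]) * ((p : ℚ_[p]) ^ l * (v : ℚ_[p])) ^ 2 =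
        (p : ℚ_[p]) ^ (k + l + l) * ((u * v ^ 2 : ℤ_[p]) : ℚ_[p]) by
          push_cast; simp only [zpow_add₀ hp0]; ring]
      rw [resFun_rep hu, resFun_rep (by simp [hu, hv]), map_mul, map_pow, Witt.of_mul_sq _ hv]
      have e3 : Odd (k + l + l) ↔ Odd k := by grind
      simp only [e3])
    (fun a b ha hb h ↦ by
      obtain ⟨k, u, hu, rfl⟩ := exists_padic_rep ha
      obtain ⟨l, v, hv, rfl⟩ := exists_padic_rep hb
      rcases le_total k l with hkl | hkl
      · obtain ⟨j, rfl⟩ := Int.le.dest hkl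
        exact resFun_add hu hv h
      · obtain ⟨j, rfl⟩ := Int.le.dest hkl
        rw [add_comm] at h
        rw [add_comm, resFun_add hv hu h]
        congr 2 <;> ring)

lemma res_of_rep [NeZero (2 : ZMod p)] {k : ℤ} {u : ℤ_[p]} (hu : PadicInt.toZMod u ≠ 0) :
    res p (GW.of ((p : ℚ_[p]) ^ k * (u : ℚ_[p]))) =
      if Odd k then Witt.of (PadicInt.toZMod u) else 0 := by
  rw [res, GW.lift_of, resFun_rep hu]

/-- The residue map on forms over the rationals. -/
noncomputable def resQ (p : ℕ) [Fact p.Prime] [NeZero (2 : ZMod p)] : GW ℚ →+ Witt (ZMod p) :=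
  (res p).comp (GW.map (algebraMap ℚ ℚ_[p]))

lemma resQ_of [NeZero (2 : ZMod p)] {n : ℤ} (hn : (n : ZMod p) ≠ 0) :
    resQ p (GW.of (n : ℚ)) = 0 := by
  have := res_of_rep (p := p) (k := 0) (u := n) (by simpa using hn)
  simpa [resQ] using this

lemma resQ_of_mul [NeZero (2 : ZMod p)] {n : ℤ} (hn : (n : ZMod p) ≠ 0) :
    resQ p (GW.of (p * n : ℚ)) = Witt.of (n : ZMod p) := by
  have := res_of_rep (p := p) (k := 1) (u := n) (by simpa using hn)
  simpa [resQ] using this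

end Residue

/-! ### Signature and parity of the valuation -/

/-- The signature of a real form. -/
noncomputable def sgn : GW ℝ →+ ℤ :=
  GW.lift (fun a ↦ (SignType.sign a : ℤ)) (by simp)
    (fun a b ha hb ↦ by
      have : SignType.sign (b ^ 2) = 1 := sign_pos (by positivity)
      rw [sign_mul, this, mul_one])
    (fun a b ha hb h ↦ by
      simp only [sign_mul]
      rcases ha.lt_or_gt with h1 | h1 <;> rcases hb.lt_or_gt with h2 | h2 <;>
        rcases h.lt_or_gt with h3 | h3 <;> simp [sign_pos, sign_neg, h1, h2, h3] <;> linarith)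

/-- The signature of a rational form. -/
noncomputable def sgnQ : GW ℚ →+ ℤ := sgn.comp (GW.map (algebraMap ℚ ℝ))

lemma sgnQ_of_pos {a : ℚ} (ha : 0 < a) : sgnQ (GW.of a) = 1 := by
  simp [sgnQ, sgn, sign_pos, ha]

lemma sgnQ_of_neg {a : ℚ} (ha : a < 0) : sgnQ (GW.of a) = -1 := by
  simp [sgnQ, sgn, sign_neg, ha]

/-- The parity of the valuation of the determinant of a form over `ℚ_2`. -/
noncomputable def parity : GW ℚ_[2] →+ ZMod 2 :=
  GW.lift (fun a ↦ (a.valuation : ZMod 2)) (by simp)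
    (fun a b ha hb ↦ by
      rw [Padic.valuation_mul ha (pow_ne_zero _ hb), Padic.valuation_pow]
      push_cast
      rw [show (2 : ZMod 2) = 0 from rfl]; ring)
    (fun a b ha hb h ↦ by
      rw [Padic.valuation_mul (mul_ne_zero ha hb) h, Padic.valuation_mul ha hb]
      push_cast
      have h2 : (2 : ZMod 2) = 0 := rfl
      linear_combination (-((a + b).valuation : ZMod 2)) * h2)

/-- The parity of the 2-adic valuation of the determinant of a rational form. -/
noncomputable def parityQ : GW ℚ →+ ZMod 2 := parity.comp (GW.map (algebraMap ℚ ℚ_[2]))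

lemma parityQ_of (a : ℚ) : parityQ (GW.of a) = (padicValRat 2 a : ZMod 2) := by
  simp [parityQ, parity, Padic.valuation_ratCast]

/-! ### Injectivity of the residue maps over the rationals -/

lemma Witt.exists_lift {F A : Type*} [Field F] [AddCommGroup A] (f : GW F →+ A)
    (h : f (GW.of 1 + GW.of (-1)) = 0) : ∃ g : Witt F →+ A, ∀ x, g (Witt.mk x) = f x := by
  refine ⟨QuotientAddGroup.lift _ f ?_, fun x ↦ rfl⟩
  rw [AddSubgroup.zmultiples_le]
  exact h

/-- `n` is a nonzero integer all of whose prime factors are smaller than `k`. -/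
def IsSmooth (k : ℕ) (n : ℤ) : Prop := n ≠ 0 ∧ ∀ q : ℕ, q.Prime → (q : ℤ) ∣ n → q < k

namespace IsSmooth

lemma mul {k : ℕ} {a b : ℤ} (ha : IsSmooth k a) (hb : IsSmooth k b) : IsSmooth k (a * b) :=
  ⟨mul_ne_zero ha.1 hb.1, fun q hq h ↦
    ((Nat.prime_iff_prime_int.1 hq).dvd_or_dvd h).elim (ha.2 q hq) (hb.2 q hq)⟩

lemma neg {k : ℕ} {a : ℤ} (ha : IsSmooth k a) : IsSmooth k (-a) :=
  ⟨neg_ne_zero.2 ha.1, fun q hq h ↦ ha.2 q hq (by simpa using h)⟩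

lemma of_abs_lt {k : ℕ} {a : ℤ} (h0 : a ≠ 0) (ha : |a| < k) : IsSmooth k a :=
  ⟨h0, fun q _ h ↦ by
    have := Int.le_of_dvd (abs_pos.2 h0) ((dvd_abs _ _).2 h)
    omega⟩

lemma one (k : ℕ) : IsSmooth k 1 :=
  ⟨one_ne_zero, fun q hq h ↦ (hq.one_lt.ne' (by exact_mod_cast Int.eq_one_of_dvd_one (by simp) h)).elim⟩

lemma cast_ne_zero {p : ℕ} [Fact p.Prime] {a : ℤ} (ha : IsSmooth p a) : (a : ZMod p) ≠ 0 := by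
  rw [ne_eq, ZMod.intCast_zmod_eq_zero_iff_dvd]
  exact fun h ↦ (ha.2 p Fact.out h).false

end IsSmooth

/-- The subgroup generated by the classes of integers with small prime factors. -/
noncomputable def smoothSubgroup (k : ℕ) : AddSubgroup (GW ℚ) :=
  AddSubgroup.closure {x | ∃ n : ℤ, IsSmooth k n ∧ x = GW.of (n : ℚ)}

lemma IsSmooth.of_mem {k : ℕ} {n : ℤ} (h : IsSmooth k n) : GW.of (n : ℚ) ∈ smoothSubgroup k :=
  AddSubgroup.subset_closure ⟨n, h, rfl⟩

/-- The quotient by the smooth subgroup. -/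
def SmoothQuotient (k : ℕ) : Type := GW ℚ ⧸ smoothSubgroup k

noncomputable instance (k : ℕ) : AddCommGroup (SmoothQuotient k) :=
  inferInstanceAs (AddCommGroup (GW ℚ ⧸ smoothSubgroup k))

section Step

variable {p : ℕ} [hp : Fact p.Prime]

/-- The class of a form in the quotient by the smooth subgroup. -/
noncomputable def smoothMk (p : ℕ) : GW ℚ →+ SmoothQuotient p := QuotientAddGroup.mk' _

lemma IsSmooth.smoothMk_eq_zero {n : ℤ} (h : IsSmooth p n) : smoothMk p (GW.of (n : ℚ)) = 0 :=
  (QuotientAddGroup.eq_zero_iff _).2 h.of_mem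

lemma smoothMk_mul_eq {n₁ n₂ r l c : ℤ} (h₁ : n₁ ≠ 0) (h₁' : |n₁| < p) (h₂ : n₂ ≠ 0)
    (h₂' : |n₂| < p) (hr : r ≠ 0) (hr' : |r| < p) (hc : IsSmooth p c)
    (h : n₁ * n₂ = r + p * l) :
    smoothMk p (GW.of ((p * (n₁ * n₂) * c : ℤ) : ℚ)) = smoothMk p (GW.of ((p * r * c : ℤ) : ℚ)) := by
  rcases eq_or_ne l 0 with rfl | hl
  · rw [h]; simp
  have hp0 : (0 : ℤ) < p := by exact_mod_cast hp.out.pos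
  have hl' : |l| < p := by
    have e1 : |n₁ * n₂| ≤ (p - 1) * (p - 1) := by
      rw [abs_mul]; exact mul_le_mul (by omega) (by omega) (abs_nonneg _) (by omega)
    have e2 : |(p : ℤ) * l| ≤ (p - 1) * (p - 1) + (p - 1) := by
      rw [show (p : ℤ) * l = n₁ * n₂ - r by linarith]
      exact (abs_sub _ _).trans (by omega)
    rw [abs_mul, abs_of_pos hp0] at e2
    nlinarith
  have hpq : (p : ℚ) ≠ 0 := by exact_mod_cast hp0.ne'
  have hcq : (c : ℚ) ≠ 0 := by exact_mod_cast hc.1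
  have hQ : (n₁ * n₂ : ℚ) = r + p * l := by exact_mod_cast h
  have key := GW.of_add_of (a := (p * r * c : ℚ)) (b := l * c * p ^ 2) (by
    rw [show (p * r * c : ℚ) + l * c * p ^ 2 = p * (n₁ * n₂) * c by rw [hQ]; ring]
    simp [hpq, hcq, h₁, h₂])
  rw [GW.of_mul_sq _ hpq] at key
  have e1 : (p * r * c : ℚ) + l * c * p ^ 2 = p * (n₁ * n₂) * c := by rw [hQ]; ring
  have e2 : GW.of ((p * r * c : ℚ) * (l * c * p ^ 2) * (p * r * c + l * c * p ^ 2)) =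
      GW.of ((r * l * n₁ * n₂ * c : ℤ) : ℚ) := by
    refine GW.of_eq_of (c := p ^ 2 * c) (by positivity) ?_
    rw [e1]; push_cast; ring
  rw [e2, e1] at key
  have s1 : IsSmooth p (l * c) := (IsSmooth.of_abs_lt hl hl').mul hc
  have s2 : IsSmooth p (r * l * n₁ * n₂ * c) :=
    ((((IsSmooth.of_abs_lt hr hr').mul (IsSmooth.of_abs_lt hl hl')).mul
      (IsSmooth.of_abs_lt h₁ h₁')).mul (IsSmooth.of_abs_lt h₂ h₂')).mul hc
  have := congrArg (smoothMk p) key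
  rw [map_add, map_add, s2.smoothMk_eq_zero, show (l * c : ℚ) = ((l * c : ℤ) : ℚ) by push_cast; rfl,
    s1.smoothMk_eq_zero, add_zero, add_zero] at this
  push_cast
  exact this.symm

lemma smoothMk_natCast_eq (n : ℕ) : ∀ {r c : ℤ}, IsSmooth p n → r ≠ 0 → |r| < p → IsSmooth p c →
    (p : ℤ) ∣ n - r →
    smoothMk p (GW.of ((p * n * c : ℤ) : ℚ)) = smoothMk p (GW.of ((p * r * c : ℤ) : ℚ)) := by
  have hp1 : (1 : ℤ) < p := by exact_mod_cast hp.out.one_lt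
  induction n using induction_on_primes with
  | zero => intro r c h; exact (h.1 rfl).elim
  | one =>
    rintro r c - hr hr' hc ⟨l, hl⟩
    have := smoothMk_mul_eq (p := p) (n₁ := 1) (n₂ := 1) (l := l) one_ne_zero (by simpa using hp1)
      one_ne_zero (by simpa using hp1) hr hr' hc (by push_cast at hl; linarith)
    simpa using this
  | prime_mul q n hq ih =>
    rintro r c hqn hr hr' hc hd
    have hqs : IsSmooth p q := by
      refine IsSmooth.of_abs_lt (by exact_mod_cast hq.ne_zero) ?_
      have := hqn.2 q hq (by push_cast; exact dvd_mul_right _ _)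
      simpa using this
    have hns : IsSmooth p n := ⟨fun h ↦ hqn.1 (by push_cast; rw [h, mul_zero]),
      fun q' hq' h ↦ hqn.2 q' hq' (by push_cast; exact dvd_mul_of_dvd_right h _)⟩
    set r' : ℤ := n % p with hr'def
    have hr0 : r' ≠ 0 := by
      intro h
      have : (p : ℤ) ∣ n := Int.dvd_of_emod_eq_zero h
      exact (hns.2 p hp.out this).false
    have hrnn : 0 ≤ r' := Int.emod_nonneg _ (by omega)
    have hrlt : r' < p := Int.emod_lt_of_pos _ (by omega)
    have hrd : (p : ℤ) ∣ n - r' := by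
      rw [hr'def]; exact Int.dvd_self_sub_emod
    have h1 := ih (r := r') (c := q * c) hns hr0 (by rw [abs_of_nonneg hrnn]; exact hrlt)
      (hqs.mul hc) hrd
    obtain ⟨l, hl⟩ : (p : ℤ) ∣ r' * q - r := by
      push_cast at hd
      have := dvd_sub hd (hrd.mul_left q)
      rwa [show (q : ℤ) * n - r - q * (n - r') = r' * q - r by ring] at this
    have h2 := smoothMk_mul_eq (p := p) (n₁ := r') (n₂ := q) (l := l) hr0
      (by rw [abs_of_nonneg hrnn]; exact hrlt) hqs.1
      (by have := hqs.2 q hq dvd_rfl; simpa using this) hr hr' hc (by linarith)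
    rw [← h2]
    convert h1 using 3 <;> push_cast <;> ring

lemma smoothMk_eq {n r c : ℤ} (hn : IsSmooth p n) (hr : r ≠ 0) (hr' : |r| < p) (hc : IsSmooth p c)
    (h : (n : ZMod p) = r) :
    smoothMk p (GW.of ((p * n * c : ℤ) : ℚ)) = smoothMk p (GW.of ((p * r * c : ℤ) : ℚ)) := by
  have hd : (p : ℤ) ∣ n - r := by
    rw [← ZMod.intCast_zmod_eq_zero_iff_dvd]; push_cast; rw [h, sub_self]
  obtain ⟨k, rfl | rfl⟩ := n.eq_nat_or_neg
  · exact smoothMk_natCast_eq k hn hr hr' hc hd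
  · have := smoothMk_natCast_eq k (r := -r) (c := -c) (by simpa using hn.neg) (neg_ne_zero.2 hr)
      (by simpa using hr') hc.neg (by
        rw [← dvd_neg]
        rwa [show -((k : ℤ) - -r) = -(k : ℤ) - r by ring])
    convert this using 3
    · ring_nf
    · ring_nf

/-- The section of the residue map on one-dimensional forms. -/
noncomputable def residueSection (a : ZMod p) : SmoothQuotient p :=
  smoothMk p (GW.of ((p * a.val : ℤ) : ℚ))

lemma residueSection_intCast {n : ℤ} (hn : IsSmooth p n) :
    residueSection (n : ZMod p) = smoothMk p (GW.of ((p * n : ℤ) : ℚ)) := by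
  have h := smoothMk_eq (p := p) (n := n) (r := (n : ZMod p).val) (c := 1) hn
    (by exact_mod_cast (ZMod.val_ne_zero _).2 hn.cast_ne_zero)
    (by rw [Nat.abs_cast]; exact_mod_cast ZMod.val_lt _) (IsSmooth.one p) (by simp)
  rw [mul_one, mul_one] at h
  exact h.symm

lemma val_isSmooth {a : ZMod p} (ha : a ≠ 0) : IsSmooth p a.val :=
  IsSmooth.of_abs_lt (by exact_mod_cast (ZMod.val_ne_zero _).2 ha) (by rw [Nat.abs_cast]; exact_mod_cast ZMod.val_lt _)

lemma exists_residueSection [NeZero (2 : ZMod p)] :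
    ∃ g : Witt (ZMod p) →+ SmoothQuotient p,
      ∀ n : ℤ, IsSmooth p n → g (Witt.of (n : ZMod p)) = smoothMk p (GW.of ((p * n : ℤ) : ℚ)) := by
  have hp0 : (p : ℚ) ≠ 0 := by exact_mod_cast hp.out.ne_zero
  obtain ⟨f, hf⟩ : ∃ f : GW (ZMod p) →+ SmoothQuotient p, ∀ a, f (GW.of a) = residueSection a :=
    ⟨GW.lift residueSection
    (by simp [residueSection])
    (fun a b ha hb ↦ by
      have h := residueSection_intCast (p := p) (n := a.val * b.val ^ 2)
        (by rw [pow_two]; exact (val_isSmooth ha).mul ((val_isSmooth hb).mul (val_isSmooth hb)))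
      push_cast [ZMod.natCast_zmod_val] at h
      rw [h, residueSection]
      congr 1
      refine GW.of_eq_of (c := (b.val : ℚ)) (by exact_mod_cast (ZMod.val_ne_zero _).2 hb) ?_
      push_cast; ring)
    (fun a b ha hb hab ↦ by
      have h2 := residueSection_intCast (p := p) (n := (b.val : ℤ) - p) (by
        have h1 := ZMod.val_lt b
        have h3 : 0 < b.val := ZMod.val_pos.2 hb
        refine IsSmooth.of_abs_lt (by omega) (by rw [abs_lt]; omega))
      have hbs : IsSmooth p ((b.val : ℤ) - p) := by
        have h1 := ZMod.val_lt b
        have h3 : 0 < b.val := ZMod.val_pos.2 hb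
        refine IsSmooth.of_abs_lt (by omega) (by rw [abs_lt]; omega)
      have hne : (a.val : ℤ) + (b.val - p) ≠ 0 := by
        intro h
        apply hab
        have := congrArg (Int.cast : ℤ → ZMod p) h
        simpa using this
      have hss : IsSmooth p ((a.val : ℤ) + (b.val - p)) := by
        have h1 := ZMod.val_lt b
        have h3 := ZMod.val_lt a
        have h4 : 0 < b.val := ZMod.val_pos.2 hb
        refine IsSmooth.of_abs_lt hne (by rw [abs_lt]; omega)
      have h3 := residueSection_intCast hss
      have h4 := residueSection_intCast (((val_isSmooth ha).mul hbs).mul hss)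
      push_cast [ZMod.natCast_zmod_val, CharP.cast_eq_zero, sub_zero] at h2 h3 h4
      rw [h2, h3, h4, residueSection, ← map_add, ← map_add]
      congr 1
      have hneq : (a.val : ℚ) + (b.val - p) ≠ 0 := by exact_mod_cast hne
      have := GW.of_add_of (a := (p * a.val : ℚ)) (b := p * (b.val - p)) (by
        rw [← mul_add]; exact mul_ne_zero hp0 hneq)
      push_cast
      rw [this, ← mul_add]
      congr 1
      refine GW.of_eq_of (c := (p : ℚ)) hp0 ?_
      ring), fun a ↦ GW.lift_of ..⟩
  obtain ⟨g, hg⟩ := Witt.exists_lift f (by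
    have h1 := residueSection_intCast (p := p) (IsSmooth.one p)
    have h2 := residueSection_intCast (p := p) (IsSmooth.one p).neg
    push_cast at h1 h2
    rw [map_add, hf, hf, h1, h2, ← map_add]
    simp only [mul_one, mul_neg]
    rw [GW.of_add_of_neg hp0 one_ne_zero, map_add]
    have h3 := (IsSmooth.one p).smoothMk_eq_zero
    have h4 := (IsSmooth.one p).neg.smoothMk_eq_zero
    push_cast at h3 h4
    rw [h3, h4, add_zero])
  refine ⟨g, fun n hn ↦ ?_⟩
  rw [Witt.of, hg, hf, residueSection_intCast hn]

lemma mem_smoothSubgroup_of_resQ [NeZero (2 : ZMod p)] {x : GW ℚ}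
    (hx : x ∈ smoothSubgroup (p + 1)) (h : resQ p x = 0) : x ∈ smoothSubgroup p := by
  obtain ⟨g, hg⟩ := exists_residueSection (p := p)
  have hp0 : (p : ℚ) ≠ 0 := by exact_mod_cast hp.out.ne_zero
  have key : g (resQ p x) = smoothMk p x := by
    clear h
    refine AddSubgroup.closure_induction (p := fun x _ ↦ g (resQ p x) = smoothMk p x) ?_ (by simp)
      (fun x y _ _ h1 h2 ↦ by rw [map_add, map_add, h1, h2, map_add])
      (fun x _ h1 ↦ by rw [map_neg, map_neg, h1, map_neg]) hx
    rintro - ⟨n, hn, rfl⟩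
    obtain ⟨n', hn', hnd⟩ := (Int.finiteMultiplicity_iff.2
      ⟨by simpa using hp.out.ne_one, hn.1⟩ : FiniteMultiplicity (p : ℤ) n).exists_eq_pow_mul_and_not_dvd
    generalize multiplicity (p : ℤ) n = k at hn'
    subst hn'
    have hs : IsSmooth p n' := by
      refine ⟨fun h ↦ hnd (h ▸ dvd_zero _), fun q hq hd ↦ ?_⟩
      have := hn.2 q hq (dvd_mul_of_dvd_right hd _)
      refine lt_of_le_of_ne (by omega) ?_
      rintro rfl
      exact hnd hd
    obtain ⟨j, rfl | rfl⟩ := k.even_or_odd'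
    · have e : GW.of (((p : ℤ) ^ (2 * j) * n' : ℤ) : ℚ) = GW.of (n' : ℚ) :=
        GW.of_eq_of (c := (p : ℚ) ^ j) (pow_ne_zero _ hp0) (by push_cast; ring)
      rw [e, resQ_of hs.cast_ne_zero, map_zero, hs.smoothMk_eq_zero]
    · have e : GW.of (((p : ℤ) ^ (2 * j + 1) * n' : ℤ) : ℚ) = GW.of ((p * n' : ℤ) : ℚ) :=
        GW.of_eq_of (c := (p : ℚ) ^ j) (pow_ne_zero _ hp0) (by push_cast; ring)
      rw [e, ← hg n' hs]
      push_cast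
      rw [resQ_of_mul hs.cast_ne_zero]
  rw [h, map_zero] at key
  exact (QuotientAddGroup.eq_zero_iff _).1 key.symm

end Step

lemma smoothSubgroup_mono {k l : ℕ} (h : k ≤ l) : smoothSubgroup k ≤ smoothSubgroup l := by
  refine AddSubgroup.closure_mono ?_
  rintro - ⟨n, hn, rfl⟩
  exact ⟨n, ⟨hn.1, fun q hq hd ↦ (hn.2 q hq hd).trans_le h⟩, rfl⟩

lemma exists_mem_smoothSubgroup (x : GW ℚ) : ∃ k, x ∈ smoothSubgroup k := by
  induction x using GW.induction with
  | zero => exact ⟨0, zero_mem _⟩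
  | of' a ha =>
    have h : IsSmooth ((a.num * a.den).natAbs + 1) (a.num * a.den) :=
      IsSmooth.of_abs_lt (mul_ne_zero (Rat.num_ne_zero.2 ha) (by simp)) (by
        rw [Int.abs_eq_natAbs]; omega)
    refine ⟨(a.num * a.den).natAbs + 1, ?_⟩
    convert h.of_mem using 1
    refine GW.of_eq_of (c := (a.den : ℚ)⁻¹) (by simp) ?_
    have : (a.den : ℚ) ≠ 0 := by simp
    nth_rewrite 1 [← Rat.num_div_den a]
    push_cast
    field_simp
  | add x y hx hy =>
    obtain ⟨k, hk⟩ := hx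
    obtain ⟨l, hl⟩ := hy
    exact ⟨max k l, add_mem (smoothSubgroup_mono (le_max_left _ _) hk)
      (smoothSubgroup_mono (le_max_right _ _) hl)⟩
  | neg x hx =>
    obtain ⟨k, hk⟩ := hx
    exact ⟨k, neg_mem hk⟩

lemma neZero_two_zmod {p : ℕ} [hp : Fact p.Prime] (h : p ≠ 2) : NeZero (2 : ZMod p) :=
  ⟨fun h2 ↦ h <| by
    have : ((2 : ℕ) : ZMod p) = 0 := by exact_mod_cast h2
    rw [ZMod.natCast_eq_zero_iff] at this
    exact (Nat.prime_dvd_prime_iff_eq hp.out Nat.prime_two).1 this⟩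

lemma mem_smoothSubgroup_three {x : GW ℚ}
    (h : ∀ (p : ℕ) (_ : Fact p.Prime) (_ : NeZero (2 : ZMod p)), resQ p x = 0) :
    x ∈ smoothSubgroup 3 := by
  obtain ⟨k, hk⟩ := exists_mem_smoothSubgroup x
  induction k with
  | zero => exact smoothSubgroup_mono (by omega) hk
  | succ k ih =>
    rcases lt_or_ge k 3 with hk3 | hk3
    · exact smoothSubgroup_mono (by omega) hk
    refine ih ?_
    by_cases hp : k.Prime
    · have : Fact k.Prime := ⟨hp⟩
      have := neZero_two_zmod (p := k) (by omega)
      exact mem_smoothSubgroup_of_resQ hk (h k _ _)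
    · refine AddSubgroup.closure_mono ?_ hk
      rintro - ⟨n, hn, rfl⟩
      refine ⟨n, ⟨hn.1, fun q hq hd ↦ ?_⟩, rfl⟩
      have := hn.2 q hq hd
      have : q ≠ k := fun h ↦ hp (h ▸ hq)
      omega

lemma GW.two_of_two : GW.of (2 : ℚ) + GW.of 2 = GW.of 1 + GW.of 1 := by
  have := GW.of_add_of (a := (1 : ℚ)) (b := 1) (by norm_num)
  norm_num at this
  exact this.symm

/-- A rational form of dimension zero is determined by its signature, the parity of the
2-adic valuation of its determinant, and its residues at odd primes. -/
theorem GW.eq_zero_of_resQ {x : GW ℚ} (hdim : x.dim = 0) (hsgn : sgnQ x = 0) (hpar : parityQ x = 0)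
    (h : ∀ (p : ℕ) (_ : Fact p.Prime) (_ : NeZero (2 : ZMod p)), resQ p x = 0) : x = 0 := by
  have hx := mem_smoothSubgroup_three h
  obtain ⟨a, b, c, rfl⟩ : ∃ a b c : ℤ, x = a • GW.of 1 + b • GW.of (-1) + c • GW.of 2 := by
    refine AddSubgroup.closure_induction (p := fun x _ ↦ ∃ a b c : ℤ,
      x = a • GW.of 1 + b • GW.of (-1) + c • GW.of 2) ?_ ⟨0, 0, 0, by simp⟩ ?_ ?_ hx
    · rintro - ⟨n, hn, rfl⟩
      have hpow : ∃ k : ℕ, n.natAbs = 2 ^ k := by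
        refine ⟨_, Nat.eq_prime_pow_of_unique_prime_dvd (p := 2) (by simpa using hn.1) ?_⟩
        intro q hq hd
        have h1 := hn.2 q hq (Int.natCast_dvd.2 hd)
        have h2 := hq.two_le
        omega
      obtain ⟨k, hk⟩ := hpow
      have h22 : GW.of (-2 : ℚ) = GW.of 1 + GW.of (-1) - GW.of 2 := by
        rw [GW.of_add_of_neg one_ne_zero (two_ne_zero (α := ℚ))]; abel
      obtain ⟨j, rfl | rfl⟩ := k.even_or_odd' <;>
        rcases Int.natAbs_eq n with hn' | hn' <;> rw [hn', hk]
      · refine ⟨1, 0, 0, ?_⟩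
        rw [GW.of_eq_of (b := (1 : ℚ)) (c := 2 ^ j) (by positivity) (by push_cast; ring)]; simp
      · refine ⟨0, 1, 0, ?_⟩
        rw [GW.of_eq_of (b := (-1 : ℚ)) (c := 2 ^ j) (by positivity) (by push_cast; ring)]; simp
      · refine ⟨0, 0, 1, ?_⟩
        rw [GW.of_eq_of (b := (2 : ℚ)) (c := 2 ^ j) (by positivity) (by push_cast; ring)]; simp
      · refine ⟨1, 1, -1, ?_⟩
        rw [GW.of_eq_of (b := (-2 : ℚ)) (c := 2 ^ j) (by positivity) (by push_cast; ring), h22]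
        simp; abel
    · rintro x y - - ⟨a, b, c, rfl⟩ ⟨a', b', c', rfl⟩
      exact ⟨a + a', b + b', c + c', by simp only [add_smul]; abel⟩
    · rintro x - ⟨a, b, c, rfl⟩
      exact ⟨-a, -b, -c, by simp only [neg_smul]; abel⟩
  simp only [map_add, map_zsmul, GW.dim_of (one_ne_zero (α := ℚ)),
    GW.dim_of (neg_ne_zero.2 (one_ne_zero (α := ℚ))), GW.dim_of (two_ne_zero (α := ℚ)),
    sgnQ_of_pos one_pos, sgnQ_of_pos two_pos, sgnQ_of_neg (neg_one_lt_zero (R := ℚ)),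
    smul_eq_mul] at hdim hsgn
  have hpar' : (c : ZMod 2) = 0 := by
    have h2 : padicValRat 2 2 = 1 := by
      have := padicValRat.self (p := 2) (by norm_num); exact_mod_cast this
    have h1 : padicValRat 2 (-1) = 0 := by rw [padicValRat.neg]; simp
    simpa [map_add, map_zsmul, parityQ_of, h2, h1] using hpar
  obtain ⟨d, rfl⟩ := (ZMod.intCast_zmod_eq_zero_iff_dvd c 2).1 hpar'
  obtain rfl : b = 0 := by omega
  obtain rfl : a = -(2 * d) := by push_cast at *; omega
  have h3 : (2 * d) • GW.of (2 : ℚ) = (2 * d) • GW.of 1 := by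
    rw [mul_comm, mul_smul, mul_smul, two_smul, two_smul, GW.two_of_two]
  push_cast
  rw [h3]; simp

/-! ### Square classes in `ℚ_2` -/

lemma isSquare_padic_two {n : ℤ} (h : n % 8 = 1) : ∃ y : ℚ_[2], y ≠ 0 ∧ (n : ℚ_[2]) = y ^ 2 := by
  have h1 : ‖(Polynomial.aeval (1 : ℤ_[2])) (X ^ 2 - C n : ℤ[X])‖ <
      ‖(Polynomial.aeval (1 : ℤ_[2])) (derivative (X ^ 2 - C n : ℤ[X]))‖ ^ 2 := by
    have e1 : (Polynomial.aeval (1 : ℤ_[2])) (X ^ 2 - C n : ℤ[X]) = ((1 - n : ℤ) : ℤ_[2]) := by simp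
    have e2 : (Polynomial.aeval (1 : ℤ_[2])) (derivative (X ^ 2 - C n : ℤ[X])) = ((2 : ℕ) : ℤ_[2]) := by
      simp [derivative_sub]
      norm_num [map_ofNat]
    rw [e1, e2, PadicInt.norm_p]
    have h3 : ‖((1 - n : ℤ) : ℤ_[2])‖ ≤ (2 : ℕ) ^ (-(3 : ℕ) : ℤ) :=
      PadicInt.norm_int_le_pow_iff_dvd.2 (by norm_num; omega)
    refine h3.trans_lt (by norm_num)
  obtain ⟨z, hz, -⟩ := hensels_lemma h1
  have hz' : (n : ℤ_[2]) = z ^ 2 := by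
    simp only [map_sub, map_pow, aeval_X, aeval_C] at hz
    rw [sub_eq_zero] at hz
    rw [hz]; simp
  have hn : (n : ℚ_[2]) = (z : ℚ_[2]) ^ 2 := by exact_mod_cast congrArg (fun t : ℤ_[2] ↦ (t : ℚ_[2])) hz'
  refine ⟨z, fun h0 ↦ ?_, hn⟩
  rw [h0] at hn
  have : n = 0 := by simpa using hn
  omega

lemma GW.of_eq_of_padic_two {a b : ℤ} (c : ℚ_[2]) (h : a * b % 8 = 1) :
    GW.of ((a : ℚ_[2]) * c) = GW.of ((b : ℚ_[2]) * c) := by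
  obtain ⟨y, hy, hy'⟩ := isSquare_padic_two h
  have hb : (b : ℚ_[2]) ≠ 0 := by
    rintro h0
    have : b = 0 := by exact_mod_cast h0
    simp [this] at h
  refine GW.of_eq_of (c := y / b) (div_ne_zero hy hb) ?_
  rw [div_pow, ← hy']
  push_cast
  field_simp

lemma GW.two_of_three : GW.of (3 : ℚ_[2]) + GW.of 3 = GW.of (-1) + GW.of (-1) := by
  have h := GW.of_add_of (a := (3 : ℚ_[2])) (b := 3 * 2 ^ 2) (by norm_num)
  rw [GW.of_mul_sq _ (by norm_num)] at h
  have h1 : GW.of ((3 : ℚ_[2]) + 3 * 2 ^ 2) = GW.of (-1) := by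
    have := GW.of_eq_of_padic_two (a := 15) (b := -1) 1 (by norm_num)
    norm_num at this ⊢; exact this
  have h2 : GW.of ((3 : ℚ_[2]) * (3 * 2 ^ 2) * (3 + 3 * 2 ^ 2)) = GW.of (-1) := by
    rw [← h1]
    exact GW.of_eq_of (c := 6) (by norm_num) (by norm_num)
  rw [h, h1, h2]

/-- The class of the norm form of the quaternions over `ℚ_2`. -/
noncomputable def quatClass : GW ℚ_[2] := (2 : ℤ) • GW.of (-1) - (2 : ℤ) • GW.of 1

lemma two_smul_quatClass : (2 : ℤ) • quatClass = 0 := by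
  have h1 := GW.of_add_of (a := (1 : ℚ_[2])) (b := 2) (by norm_num)
  have h2 := GW.of_add_of (a := (1 : ℚ_[2])) (b := 1) (by norm_num)
  have h3 := GW.of_add_of (a := (3 : ℚ_[2])) (b := 3) (by norm_num)
  have h4 : GW.of ((3 : ℚ_[2]) * 3 * (3 + 3)) = GW.of 6 :=
    GW.of_eq_of (c := 3) (by norm_num) (by norm_num)
  rw [h4] at h3
  norm_num at h1 h2 h3
  have h5 := GW.two_of_three
  have h6 : GW.of (1 : ℚ_[2]) + GW.of 2 + (GW.of 1 + GW.of 2) =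
    GW.of 3 + GW.of 6 + (GW.of 3 + GW.of 6) := by rw [h1]
  have h7 : (4 : ℤ) • GW.of (1 : ℚ_[2]) = (4 : ℤ) • GW.of (-1) := by
    linear_combination (norm := module) h6 + h2 - h3 + (2 : ℤ) • h5
  rw [quatClass, smul_sub, smul_smul, smul_smul]
  norm_num
  rw [h7, sub_self]

lemma sum_three_sq_padic_two {x y w : ℚ_[2]} (h : x ^ 2 + y ^ 2 + w ^ 2 = 0) : w = 0 := by
  have key : ∀ x y : ℚ_[2], ‖x‖ ≤ 1 → ‖y‖ ≤ 1 → x ^ 2 + y ^ 2 + 1 ≠ 0 := by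
    intro x y hx hy h
    obtain ⟨x, rfl⟩ : ∃ x' : ℤ_[2], (x' : ℚ_[2]) = x := ⟨⟨x, hx⟩, rfl⟩
    obtain ⟨y, rfl⟩ : ∃ y' : ℤ_[2], (y' : ℚ_[2]) = y := ⟨⟨y, hy⟩, rfl⟩
    have h' : x ^ 2 + y ^ 2 + 1 = 0 := PadicInt.ext (by push_cast; exact h)
    have h2 := congrArg (PadicInt.toZModPow (p := 2) 2) h'
    simp only [map_add, map_pow, map_one, map_zero] at h2
    generalize PadicInt.toZModPow (p := 2) 2 x = a at h2
    generalize PadicInt.toZModPow (p := 2) 2 y = b at h2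
    clear h' h hx hy x y
    revert a b
    decide
  have key' : ∀ x y w : ℚ_[2], x ^ 2 + y ^ 2 + w ^ 2 = 0 → ‖x‖ ≤ ‖w‖ → ‖y‖ ≤ ‖w‖ → w = 0 := by
    intro x y w h hx hy
    by_contra hw
    have hw' : 0 < ‖w‖ := norm_pos_iff.2 hw
    refine key (x / w) (y / w) ?_ ?_ ?_
    · rw [norm_div]; exact (div_le_one hw').2 hx
    · rw [norm_div]; exact (div_le_one hw').2 hy
    · field_simp; linear_combination h
  rcases le_total ‖x‖ ‖w‖ with h1 | h1 <;> rcases le_total ‖y‖ ‖w‖ with h2 | h2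
  · exact key' x y w h h1 h2
  · have := key' x w y (by linear_combination h) (h1.trans h2) h2
    simpa [this] using h2
  · have := key' y w x (by linear_combination h) (h2.trans h1) h1
    simpa [this] using h1
  · rcases le_total ‖x‖ ‖y‖ with h3 | h3
    · have := key' x w y (by linear_combination h) h3 h2
      simpa [this] using h2
    · have := key' y w x (by linear_combination h) h3 h1
      simpa [this] using h1

lemma quatClass_ne_zero : quatClass ≠ 0 := by
  intro h
  have hgw : gw (Matrix.diagonal (fun _ : Fin 2 ↦ (-1 : ℚ_[2]))) =
      gw (Matrix.diagonal (fun _ : Fin 2 ↦ (1 : ℚ_[2]))) := by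
    rw [gw_diagonal (by simp), gw_diagonal (by simp)]
    rw [quatClass, sub_eq_zero] at h
    simpa [two_smul] using h
  obtain ⟨P, Q, h1, h2, h3⟩ := cong_of_gw_eq (Matrix.isSymm_diagonal _) (by simp)
    (Matrix.isSymm_diagonal _) (by simp) hgw.symm
  have h4 := congrFun (congrFun h3 0) 0
  simp [Matrix.mul_apply, Fin.sum_univ_two] at h4
  have := sum_three_sq_padic_two (x := P 0 0) (y := P 1 0) (w := 1) (by linear_combination h4)
  exact one_ne_zero this

/-! ### The distinguished class in the Witt group of a prime field -/

section Eta

variable {p : ℕ} [hp : Fact p.Prime]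

open Classical in
/-- The class `⟨1⟩ - ⟨ε⟩` with `ε` a nonsquare. -/
noncomputable def eta (p : ℕ) [Fact p.Prime] : Witt (ZMod p) :=
  if h : ∃ e : ZMod p, ¬ IsSquare e then Witt.of 1 - Witt.of h.choose else 0

lemma eta_eq {e : ZMod p} (he : ¬ IsSquare e) : Witt.of 1 - Witt.of e = eta p := by
  have h : ∃ e : ZMod p, ¬ IsSquare e := ⟨e, he⟩
  rw [eta, dif_pos h]
  congr 1
  have h2 := h.choose_spec
  generalize h.choose = e' at h2
  have h0 : e ≠ 0 := fun h ↦ he (h ▸ IsSquare.zero)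
  have h0' : e' ≠ 0 := fun h ↦ h2 (h ▸ IsSquare.zero)
  obtain ⟨y, hy⟩ : IsSquare (e * e') := by
    by_contra hc
    have := quadraticChar_neg_one_iff_not_isSquare.2 he
    have h3 := quadraticChar_neg_one_iff_not_isSquare.2 h2
    have h4 := quadraticChar_neg_one_iff_not_isSquare.2 hc
    rw [map_mul, this, h3] at h4
    norm_num at h4
  have hy0 : y ≠ 0 := by rintro rfl; simp [h0, h0'] at hy
  refine Witt.of_eq_of (c := y / e') (div_ne_zero hy0 h0') ?_
  rw [div_pow, pow_two, ← hy]; field_simp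

lemma two_smul_eta : eta p + eta p = 0 := by
  by_cases h : ∃ e : ZMod p, ¬ IsSquare e
  · obtain ⟨e, he⟩ := h
    rw [← eta_eq he]
    obtain ⟨x, y, hxy⟩ := ZMod.sq_add_sq p e
    have h0 : e ≠ 0 := fun h ↦ he (h ▸ IsSquare.zero)
    have hx : x ≠ 0 := by rintro rfl; exact he ⟨y, by rw [← hxy]; ring⟩
    have hy : y ≠ 0 := by rintro rfl; exact he ⟨x, by rw [← hxy]; ring⟩
    have h1 := Witt.of_add_of (a := 1 * x ^ 2) (b := 1 * y ^ 2) (by simpa [hxy] using h0)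
    rw [Witt.of_mul_sq _ hx, Witt.of_mul_sq _ hy, one_mul, one_mul, hxy,
      Witt.of_eq_of (a := x ^ 2 * y ^ 2 * e) (b := e) (mul_ne_zero hx hy) (by ring)] at h1
    rw [show Witt.of 1 - Witt.of e + (Witt.of 1 - Witt.of e) =
      Witt.of 1 + Witt.of 1 - (Witt.of e + Witt.of e) by abel, h1, sub_self]
  · rw [eta, dif_neg h, add_zero]

lemma neg_eta : -eta p = eta p := neg_eq_of_add_eq_zero_left two_smul_eta

lemma eta_eq' {e : ZMod p} (he : ¬ IsSquare e) : Witt.of e - Witt.of 1 = eta p := by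
  rw [← neg_eta, ← eta_eq he, neg_sub]

end Eta

/-! ### Reciprocity -/

/-- Base change from `ℚ` to `ℚ_2`. -/
noncomputable abbrev toTwo : GW ℚ →+ GW ℚ_[2] := GW.map (algebraMap ℚ ℚ_[2])

/-- A test class: dimension, signature and parity vanish, and the residues are either trivial
or equal to `eta`, the latter exactly on `S`. -/
structure IsTest (x : GW ℚ) (S : Finset ℕ) : Prop where
  dim : x.dim = 0
  sgn : sgnQ x = 0
  par : parityQ x = 0
  res : ∀ (p : ℕ) (_ : Fact p.Prime) (_ : NeZero (2 : ZMod p)),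
    resQ p x = if p ∈ S then eta p else 0

lemma IsTest.sub {x y : GW ℚ} {S T : Finset ℕ} (hx : IsTest x S) (hy : IsTest y T) :
    IsTest (x - y) (symmDiff S T) where
  dim := by rw [map_sub, hx.dim, hy.dim, sub_zero]
  sgn := by rw [map_sub, hx.sgn, hy.sgn, sub_zero]
  par := by rw [map_sub, hx.par, hy.par, sub_zero]
  res p _ _ := by
    rw [map_sub, hx.res, hy.res]
    simp only [Finset.mem_symmDiff]
    by_cases h1 : p ∈ S <;> by_cases h2 : p ∈ T <;> simp [h1, h2, neg_eta]

lemma intCast_zmod_ne_zero {p : ℕ} [hp : Fact p.Prime] {q : ℕ} (hq : q.Prime) (h : p ≠ q) :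
    ((q : ℤ) : ZMod p) ≠ 0 := by
  rw [ne_eq, ZMod.intCast_zmod_eq_zero_iff_dvd]
  intro hd
  exact h ((Nat.prime_dvd_prime_iff_eq hp.out hq).1 (by exact_mod_cast hd))

lemma padicValRat_two_prime {p : ℕ} (hp : p.Prime) (h2 : p ≠ 2) : padicValRat 2 p = 0 := by
  have : Fact p.Prime := ⟨hp⟩
  rw [padicValRat.of_nat, padicValNat_primes (p := 2) (q := p) (Ne.symm h2)]
  rfl

section Tests

variable {p : ℕ} [hp : Fact p.Prime]

lemma isTest_three_mod_four (h : p % 4 = 3) :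
    IsTest ((2 : ℤ) • GW.of (p : ℚ) - (2 : ℤ) • GW.of 1) {p} where
  dim := by
    have : (p : ℚ) ≠ 0 := by exact_mod_cast hp.out.ne_zero
    simp [this]
  sgn := by
    rw [map_sub, map_zsmul, map_zsmul, sgnQ_of_pos (by exact_mod_cast hp.out.pos),
      sgnQ_of_pos one_pos, sub_self]
  par := by
    rw [map_sub, map_zsmul, map_zsmul, parityQ_of, parityQ_of,
      padicValRat_two_prime hp.out (by omega)]
    simp
  res q _ _ := by
    have h1 := resQ_of (p := q) (n := 1) (by simp)
    push_cast at h1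
    rw [map_sub, map_zsmul, map_zsmul, h1, smul_zero, sub_zero]
    simp only [Finset.mem_singleton]
    split_ifs with hq
    · subst hq
      have h2 := resQ_of_mul (p := q) (n := 1) (by simp)
      push_cast at h2
      rw [mul_one] at h2
      rw [h2, ← eta_eq (e := (-1 : ZMod q)) (by rw [ZMod.exists_sq_eq_neg_one_iff]; omega), two_smul,
        sub_eq_add_neg, neg_eq_of_add_eq_zero_left (Witt.of_add_of_neg 1)]
    · have h2 := resQ_of (p := q) (intCast_zmod_ne_zero hp.out hq)
      push_cast at h2
      rw [h2, smul_zero]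

lemma toTwo_three_mod_four (h : p % 4 = 3) :
    toTwo ((2 : ℤ) • GW.of (p : ℚ) - (2 : ℤ) • GW.of 1) = quatClass := by
  have key : (2 : ℤ) • GW.of (p : ℚ_[2]) = (2 : ℤ) • GW.of (-1) := by
    rcases (by omega : p % 8 = 7 ∨ p % 8 = 3) with h8 | h8
    · have := GW.of_eq_of_padic_two (a := p) (b := -1) 1 (by omega)
      push_cast at this
      rw [mul_one, mul_one] at this
      rw [this]
    · have := GW.of_eq_of_padic_two (a := p) (b := 3) 1 (by omega)
      push_cast at this
      rw [mul_one, mul_one] at this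
      rw [this, two_smul, two_smul, GW.two_of_three]
  simp [toTwo, quatClass, key]

/-- The test class attached to two distinct primes. -/
lemma isTest_pair {a : ℕ} [ha : Fact a.Prime] (h : p ≠ 2) (hap : a ≠ p)
    (hsq : ¬ IsSquare (a : ZMod p)) {S : Finset ℕ} (hS : p ∈ S) (hS2 : ∀ q ∈ S, q = p ∨ q = a)
    (hSa : a ≠ 2 → (a ∈ S ∧ ¬ IsSquare (p : ZMod a))) :
    IsTest (GW.of 1 + GW.of (p * a : ℚ) - GW.of (a : ℚ) - GW.of (p : ℚ)) S where
  dim := by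
    have : (p : ℚ) ≠ 0 := by exact_mod_cast hp.out.ne_zero
    have : (a : ℚ) ≠ 0 := by exact_mod_cast ha.out.ne_zero
    simp [*]
  sgn := by
    have h1 : (0 : ℚ) < p := by exact_mod_cast hp.out.pos
    have h2 : (0 : ℚ) < a := by exact_mod_cast ha.out.pos
    simp [sgnQ_of_pos, h1, h2]
  par := by
    have h1 : (p : ℚ) ≠ 0 := by exact_mod_cast hp.out.ne_zero
    have h2 : (a : ℚ) ≠ 0 := by exact_mod_cast ha.out.ne_zero
    simp [map_sub, map_add, parityQ_of, padicValRat.mul h1 h2]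
  res q _ _ := by
    have hq2 : q ≠ 2 := by
      rintro rfl
      exact (NeZero.ne (2 : ZMod 2)) rfl
    have h1 := resQ_of (p := q) (n := 1) (by simp)
    push_cast at h1
    rw [map_sub, map_sub, map_add, h1, zero_add]
    rcases eq_or_ne q p with rfl | hqp
    · rw [if_pos hS]
      have e1 := resQ_of_mul (p := q) (intCast_zmod_ne_zero ha.out hap.symm)
      have e2 := resQ_of_mul (p := q) (n := 1) (by simp)
      have e3 := resQ_of (p := q) (intCast_zmod_ne_zero ha.out hap.symm)
      push_cast at e1 e2 e3
      rw [mul_one] at e2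
      rw [e1, e2, e3, sub_zero, eta_eq' hsq]
    · rcases eq_or_ne q a with rfl | hqa
      · obtain ⟨hS1, hS3⟩ := hSa hq2
        rw [if_pos hS1]
        have e1 := resQ_of_mul (p := q) (intCast_zmod_ne_zero hp.out hqp)
        have e2 := resQ_of_mul (p := q) (n := 1) (by simp)
        have e3 := resQ_of (p := q) (intCast_zmod_ne_zero hp.out hqp)
        push_cast at e1 e2 e3
        rw [mul_one] at e2
        rw [mul_comm, e1, e2, e3, sub_zero, eta_eq' hS3]
      · rw [if_neg (fun hq ↦ (hS2 q hq).elim hqp hqa)]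
        have e1 := resQ_of (p := q) (n := p * a) (by
          push_cast
          exact_mod_cast mul_ne_zero (intCast_zmod_ne_zero hp.out hqp)
            (intCast_zmod_ne_zero ha.out hqa))
        have e2 := resQ_of (p := q) (intCast_zmod_ne_zero hp.out hqp)
        have e3 := resQ_of (p := q) (intCast_zmod_ne_zero ha.out hqa)
        push_cast at e1 e2 e3
        rw [e1, e2, e3, sub_zero, sub_zero]

lemma toTwo_pair_two (h : p % 8 = 5) :
    toTwo (GW.of 1 + GW.of (p * (2 : ℕ) : ℚ) - GW.of ((2 : ℕ) : ℚ) - GW.of (p : ℚ)) =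
      -quatClass := by
  have e1 := GW.of_eq_of_padic_two (a := p) (b := 5) 1 (by omega)
  have e2 := GW.of_eq_of_padic_two (a := p) (b := 5) 2 (by omega)
  have e3 := GW.of_add_of (a := (2 : ℚ_[2])) (b := 5) (by norm_num)
  have e4 := GW.of_add_of (a := (1 : ℚ_[2])) (b := 6) (by norm_num)
  have e5 := GW.of_eq_of_padic_two (a := 35) (b := 3) 2 (by norm_num)
  have e6 := GW.of_eq_of_padic_two (a := 21) (b := 5) 2 (by norm_num)
  have e7 := GW.of_eq_of_padic_two (a := 7) (b := -1) 1 (by norm_num)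
  norm_num at e1 e2 e3 e4 e5 e6 e7
  rw [e5] at e3
  rw [e6] at e4
  rw [e7] at e3 e4
  simp only [toTwo, map_add, map_sub, GW.map_of, map_one, map_mul, map_natCast, quatClass, neg_sub]
  push_cast
  rw [e1, e2]
  linear_combination (norm := module) -e3 - e4

lemma toTwo_pair {a : ℕ} (h : p % 8 = 1) :
    toTwo (GW.of 1 + GW.of (p * a : ℚ) - GW.of (a : ℚ) - GW.of (p : ℚ)) = 0 := by
  have e1 := GW.of_eq_of_padic_two (a := p) (b := 1) 1 (by omega)
  have e2 := GW.of_eq_of_padic_two (a := p) (b := 1) a (by omega)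
  push_cast at e1 e2
  rw [one_mul, mul_one] at e1
  rw [one_mul] at e2
  simp only [toTwo, map_add, map_sub, GW.map_of, map_one, map_mul, map_natCast]
  rw [e1, e2]; abel

lemma exists_prime_nonresidue (h : p % 8 = 1) :
    ∃ a : ℕ, a.Prime ∧ a < p ∧ a ≠ 2 ∧ ¬ IsSquare (a : ZMod p) := by
  by_contra! hc
  have hc' : ∀ n : ℕ, n < p → IsSquare (n : ZMod p) := by
    intro n
    induction n using induction_on_primes with
    | zero => intro _; simp
    | one => intro _; simp
    | prime_mul q n hq ih =>
      intro hlt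
      rcases Nat.eq_zero_or_pos n with rfl | hn
      · simp
      push_cast
      refine IsSquare.mul ?_ (ih (lt_of_le_of_lt (Nat.le_mul_of_pos_left n hq.pos) hlt))
      rcases eq_or_ne q 2 with rfl | hq2
      · exact_mod_cast (ZMod.exists_sq_eq_two_iff (by omega)).2 (Or.inl h)
      · exact hc q hq (lt_of_le_of_lt (Nat.le_mul_of_pos_right q hn) hlt) hq2
  obtain ⟨e, he⟩ := FiniteField.exists_nonsquare (F := ZMod p) (by
    rw [ZMod.ringChar_zmod_n]; omega)
  exact he (by simpa using hc' e.val (ZMod.val_lt e))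

end Tests

lemma card_smul_quatClass {m n : ℕ} (h : m % 2 = n % 2) :
    (m : ℤ) • quatClass = (n : ℤ) • quatClass := by
  have key : ∀ k : ℕ, (k : ℤ) • quatClass = ((k % 2 : ℕ) : ℤ) • quatClass := fun k ↦ by
    nth_rewrite 1 [← Nat.div_add_mod k 2]
    push_cast
    rw [add_smul, mul_comm, mul_smul, two_smul_quatClass, smul_zero, zero_add]
  rw [key m, key n, h]

lemma IsTest.toTwo_eq (N : ℕ) : ∀ {x : GW ℚ} {S : Finset ℕ}, IsTest x S →
    (∀ p ∈ S, p < N ∧ p.Prime ∧ p ≠ 2) → toTwo x = (S.card : ℤ) • quatClass := by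
  induction N with
  | zero =>
    intro x S hx hS
    obtain rfl : S = ∅ := Finset.eq_empty_of_forall_notMem fun p hp ↦ by simpa using (hS p hp).1
    rw [GW.eq_zero_of_resQ hx.dim hx.sgn hx.par (fun p _ _ ↦ by rw [hx.res]; simp)]
    simp
  | succ p ih =>
    intro x S hx hS
    by_cases hpS : p ∈ S
    swap
    · exact ih hx fun q hq ↦ ⟨lt_of_le_of_ne (Nat.lt_succ_iff.1 (hS q hq).1)
        (fun h ↦ hpS (h ▸ hq)), (hS q hq).2⟩
    obtain ⟨-, hp, hp2⟩ := hS p hpS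
    have : Fact p.Prime := ⟨hp⟩
    have hodd := hp.eq_two_or_odd
    have herase : symmDiff S {p} = S.erase p := by
      ext q; simp only [Finset.mem_symmDiff, Finset.mem_singleton, Finset.mem_erase]
      rcases eq_or_ne q p with rfl | h <;> simp_all
    have hbound : ∀ q ∈ S.erase p, q < p ∧ q.Prime ∧ q ≠ 2 := fun q hq ↦
      ⟨lt_of_le_of_ne (Nat.lt_succ_iff.1 (hS q (Finset.mem_of_mem_erase hq)).1)
        (Finset.ne_of_mem_erase hq), (hS q (Finset.mem_of_mem_erase hq)).2⟩
    have hcard := Finset.card_erase_add_one hpS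
    rcases (by omega : p % 4 = 3 ∨ p % 8 = 5 ∨ p % 8 = 1) with h | h | h
    · have h1 := hx.sub (isTest_three_mod_four h)
      rw [herase] at h1
      have h2 := ih h1 hbound
      rw [map_sub, toTwo_three_mod_four h, sub_eq_iff_eq_add] at h2
      rw [h2, ← hcard]; push_cast; rw [add_smul, one_smul]
    · have : Fact (Nat.Prime 2) := ⟨Nat.prime_two⟩
      have h1 := hx.sub (isTest_pair (p := p) (a := 2) (S := {p}) hp2 hp2.symm (by
        push_cast; rw [ZMod.exists_sq_eq_two_iff hp2]; omega) (by simp) (by simp) (by simp))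
      rw [herase] at h1
      have h2 := ih h1 hbound
      rw [map_sub, toTwo_pair_two h, sub_neg_eq_add, ← eq_sub_iff_add_eq] at h2
      have h3 : -quatClass = quatClass :=
        neg_eq_of_add_eq_zero_left (by rw [← two_smul ℤ, two_smul_quatClass])
      rw [h2, ← hcard]; push_cast; rw [add_smul, one_smul, sub_eq_add_neg, h3]
    · obtain ⟨a, ha, hap, ha2, hsq⟩ := exists_prime_nonresidue h
      have : Fact a.Prime := ⟨ha⟩
      have hsq' : ¬ IsSquare (p : ZMod a) := by
        rwa [← ZMod.exists_sq_eq_prime_iff_of_mod_four_eq_one (by omega) ha2]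
      have h1 := hx.sub (isTest_pair (p := p) (a := a) (S := {p, a}) hp2 hap.ne hsq (by simp)
        (by simp) (by simp [hsq']))
      have hsd : symmDiff S {p, a} = symmDiff (S.erase p) {a} := by
        ext q
        simp only [Finset.mem_symmDiff, Finset.mem_singleton, Finset.mem_erase, Finset.mem_insert]
        rcases eq_or_ne q p with rfl | h <;> rcases eq_or_ne q a with rfl | h' <;> simp_all
      rw [hsd] at h1
      have h2 := ih h1 (by
        intro q hq
        rw [Finset.mem_symmDiff, Finset.mem_singleton] at hq
        rcases hq with ⟨hq, -⟩ | ⟨rfl, -⟩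
        · exact hbound q hq
        · exact ⟨hap, ha, ha2⟩)
      rw [map_sub, toTwo_pair h, sub_zero] at h2
      rw [h2]
      apply card_smul_quatClass
      rw [← hcard]
      by_cases haS : a ∈ S.erase p
      · have : symmDiff (S.erase p) {a} = (S.erase p).erase a := by
          ext q; simp only [Finset.mem_symmDiff, Finset.mem_singleton, Finset.mem_erase]
          rcases eq_or_ne q a with rfl | h' <;> simp_all
        rw [this]
        have := Finset.card_erase_add_one haS
        omega
      · have : symmDiff (S.erase p) {a} = insert a (S.erase p) := by
          ext q; simp only [Finset.mem_symmDiff, Finset.mem_singleton, Finset.mem_insert]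
          rcases eq_or_ne q a with rfl | h' <;> simp_all
        rw [this, Finset.card_insert_of_notMem haS]

/-- Reciprocity: a test class that vanishes over `ℚ_2` has an even number of nontrivial residues. -/
theorem IsTest.even_card {x : GW ℚ} {S : Finset ℕ} (hdim : x.dim = 0) (hsgn : sgnQ x = 0)
    (h2 : toTwo x = 0) (hS : ∀ p ∈ S, p.Prime ∧ p ≠ 2)
    (hres : ∀ (p : ℕ) (_ : Fact p.Prime) (_ : NeZero (2 : ZMod p)),
      resQ p x = if p ∈ S then eta p else 0) : Even S.card := by
  have hx : IsTest x S := ⟨hdim, hsgn, by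
    change parity (toTwo x) = 0
    rw [h2, map_zero], hres⟩
  have h := hx.toTwo_eq (S.sup id + 1) fun p hp ↦
    ⟨Nat.lt_succ_iff.2 (Finset.le_sup (f := id) hp), hS p hp⟩
  by_contra hodd
  rw [Nat.not_even_iff] at hodd
  rw [h2, card_smul_quatClass (n := 1) (by omega)] at h
  exact quatClass_ne_zero (by simpa using h.symm)

/-! ### Local constancy of isometry classes -/

/-- Near the identity, the squaring map of a Banach algebra has a unique continuous inverse. -/
lemma exists_local_sqrt (F : Type*) [NontriviallyNormedField F] [CompleteSpace F] [NeZero (2 : F)]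
    (A : Type*) [NormedRing A] [NormedAlgebra F A] [FiniteDimensional F A] :
    ∃ (U : Set A) (g : A → A),
    U ∈ nhds 1 ∧ Set.InjOn (fun P ↦ P * P) U ∧
      Filter.Tendsto g (nhds 1) (nhds 1) ∧ ∀ᶠ X in nhds 1, g X * g X = X ∧ IsUnit X := by
  have : CompleteSpace A := FiniteDimensional.complete F A
  have h2 : IsUnit (2 : F) := (NeZero.ne (2 : F)).isUnit
  let e : A ≃L[F] A := ContinuousLinearEquiv.smulLeft h2.unit
  have hd : HasStrictFDerivAt (fun P : A ↦ P * P) (e : A →L[F] A) 1 := by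
    have := (hasStrictFDerivAt_id (𝕜 := F) (1 : A)).mul' (hasStrictFDerivAt_id (𝕜 := F) 1)
    refine this.congr_fderiv ?_
    ext1 X
    simp [e, two_smul, Units.smul_def]
  let φ := hd.toOpenPartialHomeomorph
  have hs : (1 : A) ∈ φ.source := hd.mem_toOpenPartialHomeomorph_source
  have ht : (1 : A) ∈ φ.target := by
    have := hd.image_mem_toOpenPartialHomeomorph_target
    simpa using this
  have h1 : φ 1 = 1 := by
    change (1 : A) * 1 = 1; simp
  refine ⟨φ.source, φ.symm, φ.open_source.mem_nhds hs, φ.injOn, ?_, ?_⟩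
  · have := φ.symm.continuousAt (x := 1) ht
    have h3 : φ.symm 1 = 1 := by
      have := φ.left_inv hs
      rwa [h1] at this
    rwa [ContinuousAt, h3] at this
  · filter_upwards [φ.open_target.mem_nhds ht, Units.nhds 1] with X hX hX'
    exact ⟨φ.right_inv hX, hX'⟩

section Near

attribute [local instance] Matrix.linftyOpNormedRing Matrix.linftyOpNormedAlgebra

variable {F : Type*} [NontriviallyNormedField F] [CompleteSpace F] [NeZero (2 : F)]
  {ι : Type*} [Fintype ι] [DecidableEq ι]

lemma eventually_cong {M₀ : Matrix ι ι F} (hsymm : M₀.IsSymm) (hdet : IsUnit M₀.det) :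
    ∀ᶠ M in nhds M₀, M.IsSymm → Cong M₀ M := by
  obtain ⟨U, g, hU, hinj, hg, hgX⟩ := exists_local_sqrt F (Matrix ι ι F)
  have hc1 : Filter.Tendsto (fun M : Matrix ι ι F ↦ M₀⁻¹ * M) (nhds M₀) (nhds 1) := by
    have : Continuous (fun M : Matrix ι ι F ↦ M₀⁻¹ * M) := continuous_const.mul continuous_id
    have h := this.tendsto M₀
    rwa [Matrix.nonsing_inv_mul _ hdet] at h
  have hc2 : Filter.Tendsto (fun P : Matrix ι ι F ↦ M₀⁻¹ * P.transpose * M₀) (nhds 1) (nhds 1) := by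
    have : Continuous (fun P : Matrix ι ι F ↦ M₀⁻¹ * P.transpose * M₀) :=
      (continuous_const.mul continuous_id.matrix_transpose).mul continuous_const
    have h := this.tendsto 1
    rwa [Matrix.transpose_one, mul_one, Matrix.nonsing_inv_mul _ hdet] at h
  filter_upwards [(hg.comp hc1) hU, ((hc2.comp hg).comp hc1) hU, hc1.eventually hgX]
    with M h1 h2 ⟨h3, h4⟩ hM
  simp only [Set.mem_preimage, Function.comp_apply] at h1 h2
  set P := g (M₀⁻¹ * M)
  have e1 : M₀ * (M₀⁻¹ * M) = M := by rw [← mul_assoc, Matrix.mul_nonsing_inv _ hdet, one_mul]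
  have e2 : M₀⁻¹ * P.transpose * M₀ = P := by
    refine hinj h2 h1 ?_
    change M₀⁻¹ * P.transpose * M₀ * (M₀⁻¹ * P.transpose * M₀) = P * P
    have : M₀⁻¹ * P.transpose * M₀ * (M₀⁻¹ * P.transpose * M₀) =
        M₀⁻¹ * (P * P).transpose * M₀ := by
      rw [Matrix.transpose_mul]
      simp only [mul_assoc]
      rw [← mul_assoc M₀ M₀⁻¹, Matrix.mul_nonsing_inv _ hdet, one_mul]
    rw [this, h3, Matrix.transpose_mul, hM.eq, Matrix.transpose_nonsing_inv, hsymm.eq]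
    simp only [mul_assoc]
    rw [Matrix.nonsing_inv_mul _ hdet, mul_one]
  have e3 : P.transpose * M₀ * P = M := by
    have : P.transpose * M₀ = M₀ * P := by
      conv_rhs => rw [← e2]
      rw [← mul_assoc, ← mul_assoc, Matrix.mul_nonsing_inv _ hdet, one_mul]
    rw [this, mul_assoc, h3, e1]
  have hP : IsUnit P.det := by
    have : IsUnit (P * P).det := by
      rw [h3]; exact (Matrix.isUnit_iff_isUnit_det _).1 h4
    rw [Matrix.det_mul] at this
    exact isUnit_of_mul_isUnit_left this
  exact Cong.of_isUnit_det hP e3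

end Near

/-! ### Unimodular matrices over local rings -/

section Unimodular

variable {R : Type*} [CommRing R] [IsLocalRing R]

lemma exists_cong_isUnit_apply {ι : Type*} [Fintype ι] [DecidableEq ι] [Nonempty ι]
    (h2 : IsUnit (2 : R)) {M : Matrix ι ι R} (hM : M.IsSymm) (hdet : IsUnit M.det) :
    ∃ (N : Matrix ι ι R) (i : ι), Cong M N ∧ IsUnit (N i i) := by
  by_cases h : ∃ i, IsUnit (M i i)
  · obtain ⟨i, hi⟩ := h
    exact ⟨M, i, Cong.refl M, hi⟩
  push Not at h
  have hex : ∃ i j, IsUnit (M i j) := by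
    by_contra! hcon
    have h0 : M.map (IsLocalRing.residue R) = 0 := by
      ext i j
      simpa using hcon i j
    have h1 := hdet.map (IsLocalRing.residue R)
    rw [RingHom.map_det, RingHom.mapMatrix_apply, h0, Matrix.det_zero] at h1
    exact not_isUnit_zero h1
  obtain ⟨i, j, hij⟩ := hex
  have hne : j ≠ i := by
    rintro rfl
    exact h _ hij
  set P := Matrix.transvection j i (1 : R) with hP
  refine ⟨P.transpose * M * P, i, Cong.of_isUnit_det ?_ rfl, ?_⟩
  · rw [hP, Matrix.det_transvection_of_ne _ _ hne]
    exact isUnit_one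
  · have he : (P.transpose * M * P) i i = M i i + M j j + 2 * M i j := by
      have hji : M j i = M i j := hM.apply i j
      simp only [hP, Matrix.transvection, Matrix.transpose_add, Matrix.transpose_one,
        Matrix.transpose_single, Matrix.add_mul, Matrix.mul_add, Matrix.one_mul, Matrix.mul_one,
        Matrix.add_apply, Matrix.mul_single_apply_same, Matrix.single_mul_apply_same, hji]
      ring
    rw [he]
    by_contra hcon
    have h3 : M i i + M j j ∈ nonunits R := IsLocalRing.nonunits_add (h i) (h j)
    have h4 : -(M i i + M j j) ∈ nonunits R := by
      rwa [mem_nonunits_iff, IsUnit.neg_iff]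
    have h5 := IsLocalRing.nonunits_add hcon h4
    rw [mem_nonunits_iff] at h5
    apply h5
    have : M i i + M j j + 2 * M i j + -(M i i + M j j) = 2 * M i j := by ring
    rw [this]
    exact h2.mul hij

lemma exists_cong_diagonal_isUnit (h2 : IsUnit (2 : R)) (n : ℕ) :
    ∀ {M : Matrix (Fin n) (Fin n) R}, M.IsSymm → IsUnit M.det →
      ∃ d : Fin n → R, (∀ i, IsUnit (d i)) ∧ Cong M (Matrix.diagonal d) := by
  induction n with
  | zero =>
    intro M _ _
    refine ⟨Fin.elim0, fun i ↦ i.elim0, ?_⟩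
    convert Cong.refl M
    ext i
    exact i.elim0
  | succ n ih =>
    intro M hM hdet
    obtain ⟨N, i, hMN, hi⟩ := exists_cong_isUnit_apply h2 hM hdet
    obtain ⟨e⟩ : Nonempty (Unit ⊕ Fin n ≃ Fin (n + 1)) :=
      Fintype.card_eq.1 (by simp [add_comm])
    let e' : Unit ⊕ Fin n ≃ Fin (n + 1) := e.trans (Equiv.swap (e (Sum.inl ())) i)
    have he' : e' (Sum.inl ()) = i := by simp [e']
    have hN := Cong.reindex e' N
    set N' := N.submatrix e' e' with hN'
    have hc := hMN.trans hN
    have hs := hc.isSymm hM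
    have hd := hc.isUnit_det hdet
    rw [← Matrix.fromBlocks_toBlocks N'] at hc hs hd
    set A := N'.toBlocks₁₁
    set B := N'.toBlocks₁₂
    set C := N'.toBlocks₂₁
    set D := N'.toBlocks₂₂
    obtain ⟨-, hBC, -, hD⟩ := Matrix.isSymm_fromBlocks_iff.1 hs
    have hA : IsUnit A := by
      rw [Matrix.isUnit_iff_isUnit_det, Matrix.det_unique]
      simpa [A, Matrix.toBlocks₁₁, hN', he'] using hi
    let _ := hA.invertible
    have hAs : A.transpose = A := by ext; rfl
    have hsch := Matrix.fromBlocks_eq_of_invertible₁₁ A B C D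
    have hc2 : Cong (Matrix.fromBlocks A B C D)
        (Matrix.fromBlocks A 0 0 (D - C * ⅟A * B)) := by
      apply Cong.symm
      refine Cong.of_isUnit_det (P := Matrix.fromBlocks 1 (⅟A * B) 0 1) (by simp) ?_
      rw [hsch, Matrix.fromBlocks_transpose]
      congr 2
      simp [Matrix.transpose_mul, hBC]
    have hs2 := hc2.isSymm hs
    have hd2 := hc2.isUnit_det hd
    rw [Matrix.det_fromBlocks_zero₂₁] at hd2
    obtain ⟨d, hd', hcd⟩ := ih (Matrix.isSymm_fromBlocks_iff.1 hs2).2.2.2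
      (isUnit_of_mul_isUnit_right hd2)
    have hAd : A = Matrix.diagonal (fun _ ↦ N i i) := by
      ext a b
      simp [A, Matrix.toBlocks₁₁, hN', he']
    have h6 : Cong M (Matrix.diagonal (Sum.elim (fun _ : Unit ↦ N i i) d)) := by
      refine hc.trans (hc2.trans ?_)
      rw [← Matrix.fromBlocks_diagonal, ← hAd]
      exact (Cong.refl A).fromBlocks hcd
    refine ⟨Sum.elim (fun _ : Unit ↦ N i i) d ∘ e'.symm, ?_, ?_⟩
    · intro j
      rcases h : e'.symm j with u | u
      · simpa [h] using hi
      · simpa [h] using hd' u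
    · have := h6.trans (Cong.reindex e'.symm _)
      rwa [Matrix.submatrix_diagonal_equiv] at this

end Unimodular

lemma res_gw_unimodular {p : ℕ} [Fact p.Prime] [NeZero (2 : ZMod p)] {ι : Type*} [Fintype ι]
    [DecidableEq ι] {M : Matrix ι ι ℤ_[p]} (hM : M.IsSymm) (hdet : IsUnit M.det) :
    res p (gw (M.map PadicInt.Coe.ringHom)) = 0 := by
  have h2 : IsUnit (2 : ℤ_[p]) := by
    by_contra h
    have h1 : (2 : ℤ_[p]) ∈ IsLocalRing.maximalIdeal ℤ_[p] := h
    rw [← PadicInt.ker_toZMod, RingHom.mem_ker, map_ofNat] at h1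
    exact NeZero.ne _ h1
  let e := (Fintype.equivFin ι).symm
  have hc := Cong.reindex e M
  obtain ⟨d, hd, hcd⟩ := exists_cong_diagonal_isUnit h2 _ (hc.isSymm hM) (hc.isUnit_det hdet)
  have h3 := (hc.trans hcd).map PadicInt.Coe.ringHom
  rw [Matrix.diagonal_map (map_zero _)] at h3
  rw [gw_eq_sum (fun i ↦ ?_) h3, map_sum]
  · refine Finset.sum_eq_zero fun i _ ↦ ?_
    have := res_of_rep (p := p) (k := 0) (u := d i) ?_
    · rw [zpow_zero, one_mul, if_neg (by decide)] at this
      exact this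
    · intro h0
      rw [← RingHom.mem_ker, PadicInt.ker_toZMod] at h0
      exact h0 (hd i)
  · have := (hd i).ne_zero
    exact fun h ↦ this (PadicInt.ext h)

/-! ### Scaled trace forms -/

section Trace

variable {K : Type*} [Field K] [NumberField K] {ι κ : Type*} [Fintype ι] [DecidableEq ι]
  [Fintype κ] [DecidableEq κ]

/-- The Gram matrix of `(x, y) ↦ Tr (a * x * y)` in the basis `e`. -/
noncomputable def traceMat (e : Module.Basis ι ℚ K) (a : K) : Matrix ι ι ℚ :=
  Matrix.of fun i j ↦ Algebra.trace ℚ K (a * (e i * e j))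

lemma traceMat_apply (e : Module.Basis ι ℚ K) (a : K) (i j : ι) :
    traceMat e a i j = Algebra.trace ℚ K (a * (e i * e j)) := rfl

lemma traceMat_isSymm (e : Module.Basis ι ℚ K) (a : K) : (traceMat e a).IsSymm := by
  ext i j
  simp [traceMat, mul_comm (e i)]

lemma traceMat_mul (e : Module.Basis ι ℚ K) (a y : K) (e' : Module.Basis κ ℚ K) :
    (Matrix.of fun i j ↦ e.repr (y * e' j) i).transpose * traceMat e a *
      (Matrix.of fun i j ↦ e.repr (y * e' j) i) = traceMat e' (a * y ^ 2) := by
  have h : ∀ j, y * e' j = ∑ i, e.repr (y * e' j) i • e i := fun j ↦ (e.sum_repr _).symm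
  ext i j
  rw [traceMat_apply]
  have h2 : a * y ^ 2 * (e' i * e' j) = a * ((y * e' i) * (y * e' j)) := by ring
  rw [h2]
  conv_rhs => rw [h i, h j]
  simp only [Matrix.mul_apply, Matrix.transpose_apply, Matrix.of_apply, traceMat,
    Finset.sum_mul, Finset.mul_sum, map_sum, smul_mul_assoc, mul_smul_comm, map_smul,
    smul_eq_mul]
  refine Finset.sum_congr rfl fun k _ ↦ Finset.sum_congr rfl fun l _ ↦ ?_
  ring

lemma traceMat_eq (e : Module.Basis ι ℚ K) (a : K) :
    traceMat e a = (Algebra.leftMulMatrix e a).transpose * Algebra.traceMatrix ℚ e := by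
  ext i j
  have h : a * e i = ∑ k, Algebra.leftMulMatrix e a k i • e k := by
    simp only [Algebra.leftMulMatrix_eq_repr_mul]
    exact (e.sum_repr _).symm
  rw [traceMat_apply, ← mul_assoc, h]
  simp [Matrix.mul_apply, Finset.sum_mul, map_sum, Algebra.traceMatrix_apply]

lemma det_traceMat (e : Module.Basis ι ℚ K) (a : K) :
    (traceMat e a).det = Algebra.norm ℚ a * Algebra.discr ℚ e := by
  rw [traceMat_eq, Matrix.det_mul, Matrix.det_transpose, Algebra.norm_eq_matrix_det e,
    Algebra.discr_def]

lemma det_traceMat_ne_zero (e : Module.Basis ι ℚ K) {a : K} (ha : a ≠ 0) :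
    (traceMat e a).det ≠ 0 := by
  rw [det_traceMat]
  exact mul_ne_zero (Algebra.norm_ne_zero_iff.2 ha) (Algebra.discr_not_zero_of_basis ℚ e)

lemma cong_traceMat (e : Module.Basis ι ℚ K) (e' : Module.Basis κ ℚ K) (a : K) {y : K}
    (hy : y ≠ 0) : Cong (traceMat e a) (traceMat e' (a * y ^ 2)) := by
  let lm : K ≃ₗ[ℚ] K := LinearEquiv.ofBijective (LinearMap.mulLeft ℚ y)
    ⟨mul_right_injective₀ hy, fun z ↦ ⟨y⁻¹ * z, by simp [hy]⟩⟩
  let e'' := e'.map lm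
  refine ⟨Matrix.of fun i j ↦ e.repr (y * e' j) i, e''.toMatrix e, ?_, ?_, traceMat_mul e a y e'⟩
  · have : (Matrix.of fun i j ↦ e.repr (y * e' j) i) = e.toMatrix e'' := by
      ext i j
      rw [Module.Basis.toMatrix_apply, Module.Basis.map_apply]
      rfl
    rw [this, Module.Basis.toMatrix_mul_toMatrix_flip]
  · have : (Matrix.of fun i j ↦ e.repr (y * e' j) i) = e.toMatrix e'' := by
      ext i j
      rw [Module.Basis.toMatrix_apply, Module.Basis.map_apply]
      rfl
    rw [this, Module.Basis.toMatrix_mul_toMatrix_flip]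

variable (K) in
/-- The class of the form `(x, y) ↦ Tr (a * x * y)` on `K`. -/
noncomputable def tr (a : K) : GW ℚ := gw (traceMat (NumberField.integralBasis K) a)

lemma gw_traceMat (e : Module.Basis ι ℚ K) {a : K} (ha : a ≠ 0) : gw (traceMat e a) = tr K a := by
  classical
  have h := cong_traceMat e (NumberField.integralBasis K) a one_ne_zero
  rw [one_pow, mul_one] at h
  exact h.gw_eq (traceMat_isSymm e a) (det_traceMat_ne_zero e ha)

lemma tr_mul_sq {a y : K} (ha : a ≠ 0) (hy : y ≠ 0) : tr K (a * y ^ 2) = tr K a :=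
  ((cong_traceMat _ _ a hy).gw_eq (traceMat_isSymm _ a) (det_traceMat_ne_zero _ ha)).symm

/-- A full set of embeddings into a field of characteristic zero computes the trace. -/
lemma trace_eq_sum_of_injective {F : Type*} [Field F] [CharZero F] {σ : κ → K →+* F}
    (hσ : Function.Injective σ) (hcard : Fintype.card κ = Module.finrank ℚ K) (x : K) :
    algebraMap ℚ F (Algebra.trace ℚ K x) = ∑ j, σ j x := by
  let E := AlgebraicClosure F
  apply (algebraMap F E).injective
  rw [← IsScalarTower.algebraMap_apply ℚ F E, trace_eq_sum_embeddings E (L := K), map_sum]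
  let g : κ → (K →ₐ[ℚ] E) := fun j ↦ ((algebraMap F E).comp (σ j)).toRatAlgHom
  have hg : Function.Bijective g := by
    rw [Fintype.bijective_iff_injective_and_card]
    refine ⟨fun i j hij ↦ hσ (RingHom.ext fun x ↦ (algebraMap F E).injective ?_), ?_⟩
    · exact DFunLike.congr_fun hij x
    · rw [hcard, AlgHom.card ℚ K E]
  exact (Fintype.sum_bijective g hg _ _ fun j ↦ rfl).symm

lemma cong_traceMat_diagonal {F : Type*} [Field F] [CharZero F] {σ : κ → K →+* F}
    (hσ : Function.Injective σ) (hcard : Fintype.card κ = Module.finrank ℚ K)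
    (e : Module.Basis ι ℚ K) (a : K) :
    Cong ((traceMat e a).map (algebraMap ℚ F)) (Matrix.diagonal fun j ↦ σ j a) := by
  have hce : Fintype.card κ = Fintype.card ι := by
    rw [hcard, Module.finrank_eq_card_basis e]
  let f : ι ≃ κ := Fintype.equivOfCardEq hce.symm
  let P : Matrix κ ι F := Matrix.of fun j i ↦ σ j (e i)
  have hP : ∀ a : K, P.transpose * Matrix.diagonal (fun j ↦ σ j a) * P =
      (traceMat e a).map (algebraMap ℚ F) := by
    intro a
    ext i j
    rw [Matrix.map_apply, traceMat_apply, trace_eq_sum_of_injective hσ hcard]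
    rw [Matrix.mul_apply]
    simp only [Matrix.mul_diagonal, Matrix.transpose_apply, P, Matrix.of_apply, map_mul]
    exact Finset.sum_congr rfl fun _ _ ↦ by ring
  let P' : Matrix ι ι F := P.submatrix f id
  have hdet : IsUnit P'.det := by
    have h1 := hP 1
    have h2 : P'.transpose * P' = (traceMat e 1).map (algebraMap ℚ F) := by
      rw [← h1]
      simp only [map_one, Matrix.diagonal_one, Matrix.mul_one]
      ext i j
      simp only [Matrix.mul_apply, P', Matrix.transpose_apply, Matrix.submatrix_apply, id]
      exact Fintype.sum_equiv f _ _ fun _ ↦ rfl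
    have h3 := congrArg Matrix.det h2
    rw [Matrix.det_mul, Matrix.det_transpose, ← RingHom.mapMatrix_apply, ← RingHom.map_det] at h3
    rw [isUnit_iff_ne_zero]
    intro h0
    rw [h0, mul_zero] at h3
    exact det_traceMat_ne_zero e one_ne_zero ((map_eq_zero _).1 h3.symm)
  have h4 : Cong (Matrix.diagonal fun i ↦ σ (f i) a) ((traceMat e a).map (algebraMap ℚ F)) := by
    refine Cong.of_isUnit_det hdet ?_
    rw [← hP a]
    ext i j
    rw [Matrix.mul_apply, Matrix.mul_apply]
    simp only [Matrix.mul_diagonal, P', Matrix.transpose_apply, Matrix.submatrix_apply, id]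
    exact Fintype.sum_equiv f _ _ fun _ ↦ rfl
  have h5 := Cong.reindex f (Matrix.diagonal fun j ↦ σ j a)
  rw [Matrix.submatrix_diagonal_equiv] at h5
  exact (h5.trans h4).symm

lemma map_tr_eq_sum {F : Type*} [Field F] [CharZero F] {σ : κ → K →+* F}
    (hσ : Function.Injective σ) (hcard : Fintype.card κ = Module.finrank ℚ K) {a : K} (ha : a ≠ 0) :
    GW.map (algebraMap ℚ F) (tr K a) = ∑ j, GW.of (σ j a) := by
  rw [tr, ← gw_map _ (traceMat_isSymm _ a) (det_traceMat_ne_zero _ ha)]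
  exact gw_eq_sum (fun j ↦ by simpa using ha) (cong_traceMat_diagonal hσ hcard _ a)

end Trace

section

open NumberField IsDedekindDomain

/-! ### Orders at primes and residues of trace forms -/

section Ord

variable {K : Type*} [Field K] [NumberField K]

/-- The normalized additive valuation at `v`. -/
noncomputable def ord (v : HeightOneSpectrum (𝓞 K)) (x : K) : ℤ := -WithZero.log (v.valuation K x)

variable {v : HeightOneSpectrum (𝓞 K)} {x y : K}

lemma valuation_eq_exp_ord (hx : x ≠ 0) : v.valuation K x = WithZero.exp (-ord v x) := by
  simp [ord, WithZero.exp_log, hx]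

lemma ord_one : ord v (1 : K) = 0 := by simp [ord]

lemma ord_mul (hx : x ≠ 0) (hy : y ≠ 0) : ord v (x * y) = ord v x + ord v y := by
  rw [ord, map_mul, WithZero.log_mul (by simpa) (by simpa), ord, ord]
  ring

lemma ord_inv : ord v x⁻¹ = -ord v x := by simp [ord, WithZero.log_inv]

lemma ord_div (hx : x ≠ 0) (hy : y ≠ 0) : ord v (x / y) = ord v x - ord v y := by
  rw [div_eq_mul_inv, ord_mul hx (inv_ne_zero hy), ord_inv, sub_eq_add_neg]

lemma ord_pow (n : ℕ) : ord v (x ^ n) = n * ord v x := by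
  simp [ord, WithZero.log_pow]

lemma ord_zpow (n : ℤ) : ord v (x ^ n) = n * ord v x := by
  simp [ord, WithZero.log_zpow]

lemma ord_prod {α : Type*} (s : Finset α) {f : α → K} (hf : ∀ i ∈ s, f i ≠ 0) :
    ord v (∏ i ∈ s, f i) = ∑ i ∈ s, ord v (f i) := by
  classical
  induction s using Finset.induction_on with
  | empty => simp [ord_one]
  | insert a s ha ih =>
    rw [Finset.prod_insert ha, Finset.sum_insert ha, ord_mul (hf a (by simp))
      (Finset.prod_ne_zero_iff.2 fun i hi ↦ hf i (by simp [hi])),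
      ih fun i hi ↦ hf i (by simp [hi])]

lemma ord_neg : ord v (-x) = ord v x := by simp [ord, Valuation.map_neg]

lemma ord_nonneg_iff (hx : x ≠ 0) : 0 ≤ ord v x ↔ v.valuation K x ≤ 1 := by
  rw [valuation_eq_exp_ord hx, ← WithZero.exp_zero, WithZero.exp_le_exp]
  omega

lemma ord_coe_nonneg (a : 𝓞 K) : 0 ≤ ord v (a : K) := by
  by_cases h : (a : K) = 0
  · simp [ord, h]
  · rw [ord_nonneg_iff h]
    exact v.valuation_le_one a

lemma le_ord_iff {a : 𝓞 K} (ha : a ≠ 0) (n : ℕ) : n ≤ ord v (a : K) ↔ a ∈ v.asIdeal ^ n := by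
  have h : (a : K) ≠ 0 := by simpa using ha
  rw [← v.intValuation_le_pow_iff_mem, ← v.valuation_of_algebraMap (K := K),
    valuation_eq_exp_ord h, WithZero.exp_le_exp]
  omega

lemma ord_pos_iff {a : 𝓞 K} (ha : a ≠ 0) : 0 < ord v (a : K) ↔ a ∈ v.asIdeal := by
  have := le_ord_iff (v := v) ha 1
  rw [pow_one] at this
  rw [← this]
  norm_num
  omega

lemma ord_eq_zero_of_notMem {a : 𝓞 K} (ha : a ∉ v.asIdeal) : ord v (a : K) = 0 := by
  have h0 : a ≠ 0 := by
    rintro rfl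
    exact ha (zero_mem _)
  have := (ord_pos_iff (v := v) h0).not.2 ha
  have := ord_coe_nonneg (v := v) a
  omega

lemma finite_ord_ne_zero (hx : x ≠ 0) : {v : HeightOneSpectrum (𝓞 K) | ord v x ≠ 0}.Finite := by
  obtain ⟨a, b, hb, rfl⟩ := IsFractionRing.div_surjective (A := 𝓞 K) x
  have hb0 : b ≠ 0 := nonZeroDivisors.ne_zero hb
  have ha0 : a ≠ 0 := by
    rintro rfl
    simp at hx
  have key : ∀ c : 𝓞 K, c ≠ 0 → {v : HeightOneSpectrum (𝓞 K) | c ∈ v.asIdeal}.Finite := by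
    intro c hc
    have := Ideal.finite_factors (I := Ideal.span {c}) (by simpa using hc)
    refine this.subset fun v hv ↦ ?_
    simpa [Ideal.dvd_span_singleton] using hv
  refine ((key a ha0).union (key b hb0)).subset fun v hv ↦ ?_
  by_contra hcon
  simp only [Set.mem_union, Set.mem_ofPred_eq, not_or] at hcon
  apply hv
  rw [ord_div (by simpa using ha0) (by simpa using hb0), ord_eq_zero_of_notMem hcon.1,
    ord_eq_zero_of_notMem hcon.2, sub_zero]

/-- Elements integral above `p` have a denominator prime to `p`. -/
lemma exists_natCast_mul_mem {p : ℕ} (hp : p.Prime) (hx : x ≠ 0)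
    (h : ∀ v : HeightOneSpectrum (𝓞 K), (p : 𝓞 K) ∈ v.asIdeal → 0 ≤ ord v x) :
    ∃ N : ℕ, p.Coprime N ∧ ∃ z : 𝓞 K, (N : K) * x = z := by
  let I : Ideal (𝓞 K) :=
    { carrier := {r | ∃ z : 𝓞 K, (r : K) * x = z}
      add_mem' := by
        rintro a b ⟨z, hz⟩ ⟨z', hz'⟩
        exact ⟨z + z', by simp [add_mul, hz, hz']⟩
      zero_mem' := ⟨0, by simp⟩
      smul_mem' := by
        rintro a b ⟨z, hz⟩
        exact ⟨a * z, by simp [mul_assoc, hz]⟩ }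
  have hI0 : I ≠ ⊥ := by
    obtain ⟨a, b, hb, rfl⟩ := IsFractionRing.div_surjective (A := 𝓞 K) x
    have hb0 : b ≠ 0 := nonZeroDivisors.ne_zero hb
    intro hbot
    have : b ∈ I := ⟨a, by
      have : (b : K) ≠ 0 := by simpa using hb0
      field_simp⟩
    rw [hbot, Ideal.mem_bot] at this
    exact hb0 this
  have hN : ∃ z : 𝓞 K, ((Ideal.absNorm I : ℕ) : K) * x = z := by
    obtain ⟨z, hz⟩ := Ideal.absNorm_mem I
    exact ⟨z, by simpa using hz⟩
  refine ⟨Ideal.absNorm I, ?_, hN⟩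
  rw [hp.coprime_iff_not_dvd]
  intro hdvd
  obtain ⟨P, hP, hPp, hPI⟩ := Ideal.exists_isMaximal_dvd_of_dvd_absNorm
    (Nat.prime_iff_prime_int.1 hp) I (by exact_mod_cast hdvd)
  have hpP : (p : 𝓞 K) ∈ P := by
    have : (p : ℤ) ∈ Ideal.under ℤ P := by rw [hPp]; exact Ideal.mem_span_singleton_self _
    simpa [Ideal.mem_comap] using this
  let w : HeightOneSpectrum (𝓞 K) := ⟨P, hP.isPrime, by
    rintro rfl
    simp [hp.ne_zero] at hpP⟩
  obtain ⟨n, d, hd⟩ := w.exists_primeCompl_mul_eq_of_integer x ((ord_nonneg_iff hx).1 (h w hpP))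
  have hdI : (d : 𝓞 K) ∈ I := ⟨n, by rw [mul_comm]; exact hd⟩
  exact d.2 (Ideal.dvd_iff_le.1 hPI hdI)

lemma norm_ratCast_padic_le_one {p : ℕ} [Fact p.Prime] {N : ℕ} (hN : p.Coprime N) {q : ℚ} {z : ℤ}
    (h : (N : ℚ) * q = z) : ‖(q : ℚ_[p])‖ ≤ 1 := by
  have h1 : ‖((N : ℤ) : ℚ_[p])‖ = 1 := by
    rw [Padic.norm_intCast_eq_one_iff, Int.isCoprime_iff_gcd_eq_one, Int.gcd_natCast_natCast]
    exact hN.symm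
  have h2 : ((N : ℤ) : ℚ_[p]) * (q : ℚ_[p]) = (z : ℚ_[p]) := by
    have := congrArg (fun q : ℚ ↦ (q : ℚ_[p])) h
    push_cast at this ⊢
    exact this
  calc ‖(q : ℚ_[p])‖ = ‖((N : ℤ) : ℚ_[p]) * (q : ℚ_[p])‖ := by rw [norm_mul, h1, one_mul]
    _ ≤ 1 := by rw [h2]; exact Padic.norm_int_le_one z

lemma norm_norm_padic_le_one {p : ℕ} [Fact p.Prime] (hx : x ≠ 0)
    (h : ∀ v : HeightOneSpectrum (𝓞 K), (p : 𝓞 K) ∈ v.asIdeal → 0 ≤ ord v x) :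
    ‖((Algebra.norm ℚ x : ℚ) : ℚ_[p])‖ ≤ 1 := by
  obtain ⟨N, hN, z, hz⟩ := exists_natCast_mul_mem (Fact.out : p.Prime) hx h
  have h1 := congrArg (Algebra.norm ℚ) hz
  rw [map_mul, ← map_natCast (algebraMap ℚ K), Algebra.norm_algebraMap,
    ← Algebra.coe_norm_int] at h1
  exact norm_ratCast_padic_le_one (hN.pow_right (Module.finrank ℚ K)) (by push_cast; exact h1)

/-- The scaled trace form of a unit above an unramified odd prime has trivial residue. -/
lemma resQ_tr_eq_zero_of_unit {p : ℕ} [Fact p.Prime] [NeZero (2 : ZMod p)]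
    (hd : ¬ (p : ℤ) ∣ discr K) (hx : x ≠ 0)
    (h : ∀ v : HeightOneSpectrum (𝓞 K), (p : 𝓞 K) ∈ v.asIdeal → ord v x = 0) :
    resQ p (tr K x) = 0 := by
  set e := integralBasis K
  have hInt : ∀ i j, ‖((traceMat e x i j : ℚ) : ℚ_[p])‖ ≤ 1 := by
    intro i j
    obtain ⟨N, hN, z, hz⟩ := exists_natCast_mul_mem (Fact.out : p.Prime) hx fun v hv ↦ (h v hv).ge
    have h1 : (N : ℚ) * traceMat e x i j =
        ((Algebra.trace ℤ (𝓞 K) (z * (RingOfIntegers.basis K i * RingOfIntegers.basis K j)) : ℤ) :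
          ℚ) := by
      rw [traceMat_apply, Algebra.coe_trace_int, ← nsmul_eq_mul, ← map_nsmul, nsmul_eq_mul,
        ← mul_assoc, hz]
      simp [e]
    exact norm_ratCast_padic_le_one hN h1
  let M : Matrix _ _ ℤ_[p] := Matrix.of fun i j ↦ ⟨((traceMat e x i j : ℚ) : ℚ_[p]), hInt i j⟩
  have hM : M.map PadicInt.Coe.ringHom = (traceMat e x).map (algebraMap ℚ ℚ_[p]) := by
    ext i j
    rfl
  have hMs : M.IsSymm := by
    ext i j
    have := (traceMat_isSymm e x).apply i j
    exact Subtype.ext (by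
      change ((traceMat e x j i : ℚ) : ℚ_[p]) = ((traceMat e x i j : ℚ) : ℚ_[p])
      rw [this])
  have hdet : IsUnit M.det := by
    rw [PadicInt.isUnit_iff]
    have h1 : ((M.det : ℤ_[p]) : ℚ_[p]) = (((traceMat e x).det : ℚ) : ℚ_[p]) := by
      change PadicInt.Coe.ringHom M.det = algebraMap ℚ ℚ_[p] _
      rw [RingHom.map_det, RingHom.mapMatrix_apply, hM, RingHom.map_det, RingHom.mapMatrix_apply]
    rw [PadicInt.norm_def, h1, det_traceMat, ← coe_discr]
    push_cast
    rw [norm_mul]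
    have h2 : ‖((discr K : ℤ) : ℚ_[p])‖ = 1 := by
      rw [Padic.norm_intCast_eq_one_iff]
      exact ((Nat.prime_iff_prime_int.1 Fact.out).coprime_iff_not_dvd.2 hd).symm
    rw [h2, mul_one]
    refine le_antisymm (norm_norm_padic_le_one hx fun v hv ↦ (h v hv).ge) ?_
    have h3 : ‖((Algebra.norm ℚ x⁻¹ : ℚ) : ℚ_[p])‖ ≤ 1 :=
      norm_norm_padic_le_one (inv_ne_zero hx) fun v hv ↦ by rw [ord_inv, h v hv, neg_zero]
    rw [Algebra.norm_inv] at h3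
    push_cast at h3
    rw [norm_inv] at h3
    refine (inv_le_one₀ ?_).1 h3
    have : Algebra.norm ℚ x ≠ 0 := Algebra.norm_ne_zero_iff.2 hx
    rw [norm_pos_iff]
    exact_mod_cast this
  have := res_gw_unimodular hMs hdet
  rwa [hM, gw_map _ (traceMat_isSymm e x) (det_traceMat_ne_zero e hx)] at this

end Ord

/-! ### Elements with prescribed orders -/

section Uniformizers

open scoped nonZeroDivisors

variable {K : Type*} [Field K] [NumberField K]

/-- `v` lies above one of the rational primes in `S`. -/
def Above (S : Finset ℕ) (v : HeightOneSpectrum (𝓞 K)) : Prop := ∃ p ∈ S, (p : 𝓞 K) ∈ v.asIdeal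

lemma Above.mono {S T : Finset ℕ} (h : S ⊆ T) {v : HeightOneSpectrum (𝓞 K)} (hv : Above S v) :
    Above T v := by
  obtain ⟨p, hp, hv⟩ := hv
  exact ⟨p, h hp, hv⟩

lemma exists_prime_mem (v : HeightOneSpectrum (𝓞 K)) {N : ℕ} (hN : N ≠ 0)
    (h : (N : 𝓞 K) ∈ v.asIdeal) : ∃ p ∈ N.primeFactors, (p : 𝓞 K) ∈ v.asIdeal := by
  have := v.isPrime
  induction N using Nat.recOnPrimePow with
  | zero => exact absurd rfl hN
  | one => exact absurd (by simpa using h) ((Ideal.ne_top_iff_one _).1 v.isPrime.ne_top)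
  | prime_pow_mul a p n hp hpa hn ih =>
    push_cast at h
    rcases v.isPrime.mem_or_mem h with h | h
    · exact ⟨p, by
        rw [Nat.mem_primeFactors]
        exact ⟨hp, (dvd_pow_self p hn.ne').mul_right a, hN⟩, v.isPrime.mem_of_pow_mem _ h⟩
    · have ha : a ≠ 0 := by rintro rfl; simp at hpa
      obtain ⟨q, hq, hqv⟩ := ih ha h
      refine ⟨q, ?_, hqv⟩
      rw [Nat.mem_primeFactors] at hq ⊢
      exact ⟨hq.1, hq.2.1.mul_left _, hN⟩

lemma exists_prime_mem' (v : HeightOneSpectrum (𝓞 K)) : ∃ p : ℕ, p.Prime ∧ (p : 𝓞 K) ∈ v.asIdeal := by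
  have h0 : Ideal.absNorm v.asIdeal ≠ 0 := by
    rw [Ne, Ideal.absNorm_eq_zero_iff]
    exact v.ne_bot
  obtain ⟨p, hp, hpv⟩ := exists_prime_mem v h0 (Ideal.absNorm_mem _)
  exact ⟨p, Nat.prime_of_mem_primeFactors hp, hpv⟩

lemma eq_of_prime_mem {v : HeightOneSpectrum (𝓞 K)} {p q : ℕ} (hp : p.Prime) (hq : q.Prime)
    (hpv : (p : 𝓞 K) ∈ v.asIdeal) (hqv : (q : 𝓞 K) ∈ v.asIdeal) : p = q := by
  by_contra hne
  have h1 : IsCoprime (p : ℤ) q := Nat.isCoprime_iff_coprime.2 ((Nat.coprime_primes hp hq).2 hne)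
  obtain ⟨a, b, hab⟩ := h1
  have h2 := congrArg (Int.cast : ℤ → 𝓞 K) hab
  push_cast at h2
  apply v.isPrime.ne_top
  rw [Ideal.eq_top_iff_one, ← h2]
  exact add_mem (Ideal.mul_mem_left _ _ hpv) (Ideal.mul_mem_left _ _ hqv)

lemma above_iff {S : Finset ℕ} (hS : ∀ p ∈ S, p.Prime) {v : HeightOneSpectrum (𝓞 K)} {p : ℕ}
    (hp : p.Prime) (hpv : (p : 𝓞 K) ∈ v.asIdeal) : Above S v ↔ p ∈ S := by
  refine ⟨?_, fun h ↦ ⟨p, h, hpv⟩⟩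
  rintro ⟨q, hq, hqv⟩
  rwa [eq_of_prime_mem hp (hS q hq) hpv hqv]

lemma count_spanSingleton (v : HeightOneSpectrum (𝓞 K)) {x : K} (hx : x ≠ 0) :
    FractionalIdeal.count K v (FractionalIdeal.spanSingleton (𝓞 K)⁰ x) = ord v x := by
  have key : ∀ a : 𝓞 K, a ≠ 0 →
      FractionalIdeal.count K v (FractionalIdeal.spanSingleton (𝓞 K)⁰ (a : K)) = ord v (a : K) := by
    intro a ha
    have h1 : FractionalIdeal.spanSingleton (𝓞 K)⁰ (a : K) =
        ((Ideal.span {a} : Ideal (𝓞 K)) : FractionalIdeal (𝓞 K)⁰ K) := by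
      rw [FractionalIdeal.coeIdeal_span_singleton]
    rw [h1, FractionalIdeal.count_coe K v (by simpa using ha), ord,
      HeightOneSpectrum.valuation_of_algebraMap, v.intValuation_if_neg ha]
    simp
  obtain ⟨a, b, hb, rfl⟩ := IsFractionRing.div_surjective (A := 𝓞 K) x
  have hb0 : (b : K) ≠ 0 := by
    intro h
    exact nonZeroDivisors.ne_zero hb (by exact_mod_cast h)
  have ha0 : (a : K) ≠ 0 := by
    rintro h
    apply hx
    change (a : K) / _ = 0
    rw [h, zero_div]
  change FractionalIdeal.count K v (FractionalIdeal.spanSingleton _ ((a : K) / b)) = ord v ((a : K) / b)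
  rw [ord_div ha0 hb0, ← key a (by rintro rfl; simp at ha0), ← key b (by rintro rfl; simp at hb0),
    div_eq_mul_inv, ← FractionalIdeal.spanSingleton_mul_spanSingleton,
    ← FractionalIdeal.spanSingleton_inv, FractionalIdeal.count_mul, FractionalIdeal.count_inv,
    sub_eq_add_neg]
  · exact FractionalIdeal.spanSingleton_ne_zero_iff.2 ha0
  · exact inv_ne_zero (FractionalIdeal.spanSingleton_ne_zero_iff.2 hb0)

lemma count_eq_zero_of_notMem {v : HeightOneSpectrum (𝓞 K)} {J : Ideal (𝓞 K)} (hJ : J ≠ 0)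
    (h : ¬ J ≤ v.asIdeal) : FractionalIdeal.count K v J = 0 := by
  rw [FractionalIdeal.count_coe K v hJ, Nat.cast_eq_zero, ← not_ne_iff]
  intro hc
  rw [← Ideal.dvd_iff_le] at h
  apply h
  rw [← Associates.mk_dvd_mk]
  by_contra hnd
  apply hc
  by_contra h0
  exact hnd (by
    have := (Associates.prime_pow_dvd_iff_le (Associates.mk_ne_zero.2 hJ)
      v.associates_irreducible (k := 1)).2 (Nat.one_le_iff_ne_zero.2 h0)
    rw [pow_one] at this
    exact this)

variable (K) in
lemma exists_uniformizer_off : ∃ S₀ : Finset ℕ, (∀ p ∈ S₀, p.Prime) ∧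
    ∀ v : HeightOneSpectrum (𝓞 K), ∃ ϖ : K, ϖ ≠ 0 ∧
      (¬ Above S₀ v → ord v ϖ = 1) ∧ ∀ w, w ≠ v → ¬ Above S₀ w → ord w ϖ = 0 := by
  classical
  choose J hJ using fun c : ClassGroup (𝓞 K) ↦ ClassGroup.mk0_surjective c
  refine ⟨Finset.univ.biUnion fun c ↦ (Ideal.absNorm (J c : Ideal (𝓞 K))).primeFactors, ?_, ?_⟩
  · intro p hp
    simp only [Finset.mem_biUnion, Finset.mem_univ, true_and] at hp
    obtain ⟨c, hc⟩ := hp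
    exact Nat.prime_of_mem_primeFactors hc
  · intro v
    set I : (Ideal (𝓞 K))⁰ := ⟨v.asIdeal, mem_nonZeroDivisors_iff_ne_zero.2 v.ne_bot⟩ with hI
    have h1 := hJ (ClassGroup.mk0 I)
    rw [ClassGroup.mk0_eq_mk0_iff_exists_fraction_ring K] at h1
    obtain ⟨x, hx, h⟩ := h1
    suffices ∀ w, ¬ Above _ w → ord w x = if v = w then 1 else 0 from
      ⟨x, hx, fun hv ↦ by simpa using this v hv, fun w hw h ↦ by simpa [Ne.symm hw] using this w h⟩
    intro w hw
    have h2 := congrArg (FractionalIdeal.count K w) h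
    have hJ0 : (J (ClassGroup.mk0 I) : Ideal (𝓞 K)) ≠ 0 := nonZeroDivisors.coe_ne_zero _
    rw [FractionalIdeal.count_mul K w (FractionalIdeal.spanSingleton_ne_zero_iff.2 hx) (by simpa using hJ0),
      count_spanSingleton w hx, count_eq_zero_of_notMem hJ0, add_zero] at h2
    · rw [h2, hI, FractionalIdeal.count_maximal]
    · intro hle
      apply hw
      have hN : Ideal.absNorm (J (ClassGroup.mk0 I) : Ideal (𝓞 K)) ≠ 0 := by
        rw [Ne, Ideal.absNorm_eq_zero_iff]
        exact hJ0
      obtain ⟨p, hp, hpw⟩ := exists_prime_mem w hN (hle (Ideal.absNorm_mem _))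
      exact ⟨p, by simp only [Finset.mem_biUnion, Finset.mem_univ, true_and]; exact ⟨_, hp⟩, hpw⟩

/-- Some power of each prime is principal. -/
lemma exists_generator_pow (v : HeightOneSpectrum (𝓞 K)) :
    ∃ (ϖ : K) (h : ℕ), ϖ ≠ 0 ∧ 0 < h ∧ ord v ϖ = h ∧ ∀ w, w ≠ v → ord w ϖ = 0 := by
  classical
  set I : (Ideal (𝓞 K))⁰ := ⟨v.asIdeal, mem_nonZeroDivisors_iff_ne_zero.2 v.ne_bot⟩ with hI
  have h1 : ClassGroup.mk0 (1 : (Ideal (𝓞 K))⁰) = ClassGroup.mk0 (I ^ Nat.card (ClassGroup (𝓞 K))) := by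
    rw [map_pow, pow_card_eq_one', map_one]
  rw [ClassGroup.mk0_eq_mk0_iff_exists_fraction_ring K] at h1
  obtain ⟨x, hx, h⟩ := h1
  have h2 : ∀ w, ord w x = Nat.card (ClassGroup (𝓞 K)) * if v = w then 1 else 0 := by
    intro w
    have h2 := congrArg (FractionalIdeal.count K w) h
    rw [FractionalIdeal.count_mul K w (FractionalIdeal.spanSingleton_ne_zero_iff.2 hx) (by simp), count_spanSingleton w hx] at h2
    simp only [OneMemClass.coe_one, Ideal.one_eq_top, SubmonoidClass.coe_pow, hI,
      FractionalIdeal.coeIdeal_pow, FractionalIdeal.count_pow, FractionalIdeal.coeIdeal_top,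
      FractionalIdeal.count_one, FractionalIdeal.count_maximal, add_zero] at h2
    exact h2
  refine ⟨x, Nat.card (ClassGroup (𝓞 K)), hx, Nat.card_pos, ?_, fun w hw ↦ ?_⟩
  · rw [h2 v, if_pos rfl, mul_one]
  · rw [h2 w, if_neg (Ne.symm hw), mul_zero]

/-- The primes above `S`. -/
lemma finite_above {S : Finset ℕ} (hS : ∀ p ∈ S, p.Prime) :
    {v : HeightOneSpectrum (𝓞 K) | Above S v}.Finite := by
  have h0 : (((∏ p ∈ S, p : ℕ) : 𝓞 K) : K) ≠ 0 := by
    rw [Ne, RingOfIntegers.coe_eq_zero_iff, ← Ne, Nat.cast_ne_zero, Finset.prod_ne_zero_iff]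
    exact fun p hp ↦ (hS p hp).ne_zero
  refine (finite_ord_ne_zero h0).subset ?_
  rintro v ⟨p, hp, hv⟩
  have h1 : ((∏ p ∈ S, p : ℕ) : 𝓞 K) ∈ v.asIdeal := by
    rw [← Finset.mul_prod_erase S _ hp]
    push_cast
    exact Ideal.mul_mem_right _ _ hv
  have h2 := (ord_pos_iff (v := v) (by intro h; rw [h] at h0; simp at h0)).2 h1
  exact ne_of_gt h2

/-- Approximation of orders at finitely many primes. -/
lemma exists_uniformizer_finset (F : Finset (HeightOneSpectrum (𝓞 K)))
    (v : HeightOneSpectrum (𝓞 K)) :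
    ∃ ϖ : 𝓞 K, ϖ ≠ 0 ∧ ord v (ϖ : K) = 1 ∧ ∀ w ∈ F, w ≠ v → ord w (ϖ : K) = 0 := by
  classical
  obtain ⟨π, hπ, hπ'⟩ : ∃ π ∈ v.asIdeal, π ∉ v.asIdeal ^ 2 := by
    obtain ⟨π, hπ⟩ := v.intValuation_exists_uniformizer
    have hπ0 : π ≠ 0 := by
      rintro rfl
      rw [map_zero] at hπ
      exact WithZero.exp_ne_zero hπ.symm
    have : ord v (π : K) = 1 := by
      rw [ord, HeightOneSpectrum.valuation_of_algebraMap, hπ]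
      simp
    refine ⟨π, ?_, ?_⟩
    · have := (le_ord_iff (v := v) hπ0 1).1 (by rw [this]; norm_num)
      simpa using this
    · intro h
      have := (le_ord_iff (v := v) hπ0 2).2 h
      omega
  obtain ⟨y, hy⟩ := IsDedekindDomain.exists_forall_sub_mem_ideal (s := insert v F)
    (fun w ↦ w.asIdeal) (fun w ↦ if w = v then 2 else 1) (fun w _ ↦ w.prime)
    (fun w _ w' _ hne h ↦ hne (HeightOneSpectrum.ext h)) (fun w ↦ if (w : HeightOneSpectrum (𝓞 K)) = v then π else 1)
  have hv := hy v (by simp)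
  simp only [if_true] at hv
  have hy1 : y ∈ v.asIdeal := by
    have := add_mem (Ideal.pow_le_self two_ne_zero hv) hπ
    simpa using this
  have hy2 : y ∉ v.asIdeal ^ 2 := by
    intro h
    apply hπ'
    have := sub_mem h hv
    simpa using this
  have hy0 : y ≠ 0 := by
    rintro rfl
    simp at hy2
  refine ⟨y, hy0, ?_, fun w hw hne ↦ ?_⟩
  · have h1 := (le_ord_iff (v := v) hy0 1).2 (by simpa using hy1)
    have h2 := mt (le_ord_iff (v := v) hy0 2).1 hy2
    omega
  · have h1 := hy w (by simp [hw])
    simp only [hne, if_false, pow_one] at h1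
    apply ord_eq_zero_of_notMem
    intro h
    apply w.isPrime.ne_top
    rw [Ideal.eq_top_iff_one]
    have := sub_mem h h1
    simpa using this

end Uniformizers

/-! ### Residues at embeddings into `ℚ_p` -/

section Local

variable {p : ℕ} [hp : Fact p.Prime]

lemma exists_padic_rep' {a : ℚ_[p]} (ha : a ≠ 0) :
    ∃ u : ℤ_[p], PadicInt.toZMod u ≠ 0 ∧ a = (p : ℚ_[p]) ^ a.valuation * (u : ℚ_[p]) := by
  obtain ⟨k, u, hu, rfl⟩ := exists_padic_rep ha
  refine ⟨u, hu, ?_⟩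
  have hp0 : (p : ℚ_[p]) ≠ 0 := by exact_mod_cast hp.out.ne_zero
  have hu0 : u ≠ 0 := by rintro rfl; simp at hu
  have hu1 : ‖(u : ℚ_[p])‖ = 1 := padic_unit_norm.1 hu
  have : ((p : ℚ_[p]) ^ k * (u : ℚ_[p])).valuation = k := by
    rw [Padic.valuation_mul (zpow_ne_zero _ hp0) (by simpa using hu0), Padic.valuation_zpow,
      Padic.valuation_p]
    have h2 : (u : ℚ_[p]).valuation = 0 := by
      rw [Padic.norm_eq_zpow_neg_valuation (by simpa using hu0)] at hu1
      have h3 := zpow_right_injective₀ (a := (p : ℝ)) (by exact_mod_cast hp.out.pos)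
        (by exact_mod_cast hp.out.ne_one) (hu1.trans (zpow_zero (p : ℝ)).symm)
      simpa using h3
    rw [h2]
    simp
  rw [this]

lemma isSquare_of_toZMod (h2 : p ≠ 2) {u : ℤ_[p]} (hu : PadicInt.toZMod u ≠ 0)
    (h : IsSquare (PadicInt.toZMod u)) : IsSquare u := by
  obtain ⟨c, hc⟩ := h
  obtain ⟨a, rfl⟩ := ZMod.ringHom_surjective (PadicInt.toZMod (p := p)) c
  have ha : PadicInt.toZMod a ≠ 0 := by rintro h; simp [h, hc] at hu
  have hd : ‖(2 * a : ℤ_[p])‖ = 1 := by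
    rw [← padic_unit_norm, map_mul]
    refine mul_ne_zero ?_ ha
    have h3 := (neZero_two_zmod h2).ne
    rwa [map_ofNat]
  have h1 : ‖(X ^ 2 - C u : ℤ_[p][X]).aeval a‖ <
      ‖(X ^ 2 - C u : ℤ_[p][X]).derivative.aeval a‖ ^ 2 := by
    have e1 : (X ^ 2 - C u : ℤ_[p][X]).derivative.aeval a = 2 * a := by
      simp [one_add_one_eq_two]
    rw [e1, hd, one_pow]
    refine lt_of_le_of_ne (PadicInt.norm_le_one _) ?_
    rw [Ne, ← padic_unit_norm, not_not]
    simp [hc, pow_two]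
  obtain ⟨z, hz, -⟩ := hensels_lemma h1
  refine ⟨z, ?_⟩
  simp only [map_sub, map_pow, aeval_X, aeval_C, Algebra.algebraMap_self, RingHom.id_apply] at hz
  rw [← pow_two]
  exact (sub_eq_zero.1 hz).symm

variable [NeZero (2 : ZMod p)]

lemma res_of_even {a : ℚ_[p]} (ha : a ≠ 0) (h : Even a.valuation) : res p (GW.of a) = 0 := by
  obtain ⟨u, hu, hau⟩ := exists_padic_rep' ha
  rw [hau, res_of_rep hu, if_neg (Int.not_odd_iff_even.2 h)]

lemma ne_two_of_neZero : p ≠ 2 := by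
  rintro rfl
  exact NeZero.ne (2 : ZMod 2) rfl

open Classical in
lemma res_sub_res_mul {a u : ℚ_[p]} (ha : a ≠ 0) (hu : u ≠ 0) (hodd : Odd a.valuation)
    (heven : Even u.valuation) :
    res p (GW.of a) - res p (GW.of (a * u)) = if IsSquare u then 0 else eta p := by
  split_ifs with hsq
  · obtain ⟨c, rfl⟩ := hsq
    have hc : c ≠ 0 := by rintro rfl; simp at hu
    rw [← pow_two, GW.of_mul_sq _ hc, sub_self]
  · obtain ⟨α, hα, haα⟩ := exists_padic_rep' ha
    obtain ⟨ε, hε, huε⟩ := exists_padic_rep' hu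
    have hp0 : (p : ℚ_[p]) ≠ 0 := by exact_mod_cast hp.out.ne_zero
    have h1 : a * u = (p : ℚ_[p]) ^ (a.valuation + u.valuation) * ((α * ε : ℤ_[p]) : ℚ_[p]) := by
      conv_lhs => rw [haα, huε]
      rw [zpow_add₀ hp0]
      push_cast
      ring
    rw [h1, res_of_rep (by rw [map_mul]; exact mul_ne_zero hα hε), if_pos (hodd.add_even heven)]
    conv_lhs => rw [haα]
    rw [res_of_rep hα, if_pos hodd, map_mul]
    have hns : ¬ IsSquare (PadicInt.toZMod ε) := by
      intro h
      apply hsq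
      obtain ⟨c, hc⟩ := isSquare_of_toZMod ne_two_of_neZero hε h
      obtain ⟨k, hk⟩ := heven
      refine ⟨(p : ℚ_[p]) ^ k * c, ?_⟩
      rw [huε, hk, hc, zpow_add₀ hp0]
      push_cast
      ring
    by_cases hαs : IsSquare (PadicInt.toZMod α)
    · obtain ⟨c, hc⟩ := hαs
      have hc0 : c ≠ 0 := by rintro rfl; simp [hc] at hα
      have e1 : Witt.of (c * c) = Witt.of (1 : ZMod p) := Witt.of_eq_of hc0 (by ring)
      have e2 : Witt.of (c * c * PadicInt.toZMod ε) = Witt.of (PadicInt.toZMod ε) :=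
        Witt.of_eq_of hc0 (by ring)
      rw [← eta_eq hns, hc, e1, e2]
    · rw [← eta_eq' hαs]
      congr 1
      obtain ⟨y, hy⟩ : IsSquare (PadicInt.toZMod α * PadicInt.toZMod ε) := by
        by_contra hc
        have := quadraticChar_neg_one_iff_not_isSquare.2 hαs
        have h3 := quadraticChar_neg_one_iff_not_isSquare.2 hns
        have h4 := quadraticChar_neg_one_iff_not_isSquare.2 hc
        rw [map_mul, this, h3] at h4
        norm_num at h4
      have hy0 : y ≠ 0 := by rintro rfl; simp [hα, hε] at hy
      exact Witt.of_eq_of hy0 (by rw [hy]; ring)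

end Local

section Embedding

variable {K : Type*} [Field K] [NumberField K] {p : ℕ} [hp : Fact p.Prime]

lemma norm_embedding_le_one (σ : K →+* ℚ_[p]) (a : 𝓞 K) : ‖σ a‖ ≤ 1 := by
  have h1 : IsIntegral ℤ_[p] (σ a) := by
    have h2 : IsIntegral ℤ (σ (a : K)) := (RingOfIntegers.isIntegral_coe a).map σ.toIntAlgHom
    exact h2.tower_top
  obtain ⟨y, hy⟩ := IsIntegrallyClosed.isIntegral_iff.1 h1
  rw [← hy]
  exact PadicInt.norm_le_one y

/-- The place of `K` induced by an embedding into `ℚ_p`. -/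
lemma exists_place (σ : K →+* ℚ_[p]) : ∃ v : HeightOneSpectrum (𝓞 K), (p : 𝓞 K) ∈ v.asIdeal ∧
    (∀ a : 𝓞 K, a ∈ v.asIdeal ↔ ‖σ a‖ < 1) ∧
    ∀ x : K, x ≠ 0 → (σ x).valuation = ord v x := by
  let φ : 𝓞 K →+* ℤ_[p] :=
    { toFun a := ⟨σ a, norm_embedding_le_one σ a⟩
      map_one' := Subtype.ext (by simp)
      map_mul' a b := Subtype.ext (by simp; rfl)
      map_zero' := Subtype.ext (by simp)
      map_add' a b := Subtype.ext (by simp; rfl) }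
  have hmem : ∀ a : 𝓞 K, a ∈ Ideal.comap φ (IsLocalRing.maximalIdeal ℤ_[p]) ↔ ‖σ a‖ < 1 := by
    intro a
    rw [Ideal.mem_comap, IsLocalRing.mem_maximalIdeal, PadicInt.mem_nonunits]
    rfl
  have hpm : (p : 𝓞 K) ∈ Ideal.comap φ (IsLocalRing.maximalIdeal ℤ_[p]) := by
    rw [hmem]
    have : σ ((p : 𝓞 K) : K) = (p : ℚ_[p]) := by simp
    rw [this]
    exact Padic.norm_p_lt_one
  let v : HeightOneSpectrum (𝓞 K) := ⟨Ideal.comap φ (IsLocalRing.maximalIdeal ℤ_[p]),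
    Ideal.IsPrime.comap φ, by
      intro h
      rw [h, Ideal.mem_bot] at hpm
      exact hp.out.ne_zero (by exact_mod_cast hpm)⟩
  have hnorm : ∀ a : 𝓞 K, a ∉ v.asIdeal → (σ a).valuation = 0 := by
    intro a ha
    have h1 : ‖σ a‖ = 1 := le_antisymm (norm_embedding_le_one σ a) (not_lt.1 (mt (hmem a).2 ha))
    have h0 : σ a ≠ 0 := by intro h; simp [h] at h1
    rw [Padic.norm_eq_zpow_neg_valuation h0] at h1
    have h3 := zpow_right_injective₀ (a := (p : ℝ)) (by exact_mod_cast hp.out.pos)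
        (by exact_mod_cast hp.out.ne_one) (h1.trans (zpow_zero (p : ℝ)).symm)
    simpa using h3
  have hunit : ∀ x : K, x ≠ 0 → ord v x = 0 → (σ x).valuation = 0 := by
    have hge : ∀ x : K, x ≠ 0 → 0 ≤ ord v x → 0 ≤ (σ x).valuation := by
      intro x hx h
      obtain ⟨n, d, hd⟩ := v.exists_primeCompl_mul_eq_of_integer x ((ord_nonneg_iff hx).1 h)
      have h1 := congrArg σ hd
      have hd0 : σ ((d : 𝓞 K) : K) ≠ 0 := by
        rw [Ne, map_eq_zero]
        intro h0
        exact d.2 (by rw [(by exact_mod_cast h0 : (d : 𝓞 K) = 0)]; exact zero_mem _)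
      have h2 := congrArg Padic.valuation h1
      rw [map_mul, Padic.valuation_mul (by simpa using hx) hd0] at h2
      have h3 := hnorm d d.2
      have h4 : 0 ≤ (σ (n : K)).valuation := by
        rw [← Padic.norm_le_one_iff_val_nonneg]
        exact norm_embedding_le_one σ n
      have h5 : (σ ((algebraMap (𝓞 K) K) (d : 𝓞 K))).valuation = 0 := h3
      have h6 : 0 ≤ (σ ((algebraMap (𝓞 K) K) n)).valuation := h4
      omega
    intro x hx h
    refine le_antisymm ?_ (hge x hx h.ge)
    have := hge x⁻¹ (inv_ne_zero hx) (by rw [ord_inv, h, neg_zero])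
    rw [map_inv₀, Padic.valuation_inv] at this
    omega
  obtain ⟨ϖ, hϖ0, hϖ, -⟩ := exists_uniformizer_finset ∅ v
  have hϖ0' : (ϖ : K) ≠ 0 := by simpa using hϖ0
  have key : ∀ x : K, x ≠ 0 → (σ x).valuation = ord v x * (σ (ϖ : K)).valuation := by
    intro x hx
    have h1 := hunit (x / (ϖ : K) ^ ord v x) (div_ne_zero hx (zpow_ne_zero _ hϖ0')) (by
      rw [ord_div hx (zpow_ne_zero _ hϖ0'), ord_zpow, hϖ]; ring)
    rw [map_div₀, map_zpow₀, div_eq_mul_inv, Padic.valuation_mul (by simpa using hx)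
      (inv_ne_zero (zpow_ne_zero _ (by simpa using hϖ0))), Padic.valuation_inv,
      Padic.valuation_zpow] at h1
    omega
  have hc : (σ (ϖ : K)).valuation = 1 := by
    have h1 := key ((p : 𝓞 K) : K) (by simpa using hp.out.ne_zero)
    have h2 : σ ((p : 𝓞 K) : K) = (p : ℚ_[p]) := by simp
    rw [h2, Padic.valuation_p] at h1
    have h3 : 0 < ord v ((p : 𝓞 K) : K) := by
      rw [ord_pos_iff (by simpa using hp.out.ne_zero)]
      exact hpm
    exact Int.eq_one_of_mul_eq_one_left (by nlinarith) h1.symm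
  refine ⟨v, hpm, hmem, fun x hx ↦ ?_⟩
  rw [key x hx, hc, mul_one]

end Embedding

/-! ### Residues of trace forms outside an admissible set of primes -/

section Adm

variable (K : Type*) [Field K] [NumberField K]

/-- A finite set of rational primes containing `2`, the ramified primes, and generating the class
group. -/
structure Adm (S : Finset ℕ) : Prop where
  prime : ∀ p ∈ S, p.Prime
  two : 2 ∈ S
  disc : ∀ p : ℕ, p.Prime → (p : ℤ) ∣ discr K → p ∈ S
  unif : ∀ v : HeightOneSpectrum (𝓞 K), ∃ ϖ : K, ϖ ≠ 0 ∧
      (¬ Above S v → ord v ϖ = 1) ∧ ∀ w, w ≠ v → ¬ Above S w → ord w ϖ = 0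

lemma exists_adm : ∃ S₀ : Finset ℕ, (∀ p ∈ S₀, p.Prime) ∧
    ∀ S, S₀ ⊆ S → (∀ p ∈ S, p.Prime) → Adm K S := by
  obtain ⟨S₁, hS₁, h⟩ := exists_uniformizer_off K
  refine ⟨S₁ ∪ (insert 2 (discr K).natAbs.primeFactors), ?_, fun S hS hp ↦ ⟨hp, ?_, ?_, ?_⟩⟩
  · intro p hp
    simp only [Finset.mem_union, Finset.mem_insert] at hp
    rcases hp with hp | rfl | hp
    · exact hS₁ p hp
    · exact Nat.prime_two
    · exact Nat.prime_of_mem_primeFactors hp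
  · exact hS (by simp)
  · intro p hp hd
    apply hS
    simp only [Finset.mem_union, Finset.mem_insert, Nat.mem_primeFactors]
    exact Or.inr (Or.inr ⟨hp, Int.natCast_dvd.1 hd, by simpa using discr_ne_zero K⟩)
  · intro v
    obtain ⟨ϖ, h0, h1, h2⟩ := h v
    have hsub : S₁ ⊆ S := Finset.subset_union_left.trans hS
    exact ⟨ϖ, h0, fun hv ↦ h1 (mt (Above.mono hsub) hv),
      fun w hw hwS ↦ h2 w hw (mt (Above.mono hsub) hwS)⟩

variable {K} {S : Finset ℕ}

lemma Adm.resQ_tr_eq_zero (hS : Adm K S) {p : ℕ} [hp : Fact p.Prime] [NeZero (2 : ZMod p)]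
    (hpS : p ∉ S) {x : K} (hx : x ≠ 0)
    (h : ∀ v : HeightOneSpectrum (𝓞 K), (p : 𝓞 K) ∈ v.asIdeal → Even (ord v x)) :
    resQ p (tr K x) = 0 := by
  classical
  choose ϖ hϖ0 hϖ1 hϖ using hS.unif
  have hfin := finite_above (K := K) (S := {p}) (by simpa using hp.out)
  set F := hfin.toFinset
  set y : K := ∏ v ∈ F, ϖ v ^ (-(ord v x / 2))
  have hy0 : y ≠ 0 := Finset.prod_ne_zero_iff.2 fun v _ ↦ zpow_ne_zero _ (hϖ0 v)
  rw [← tr_mul_sq hx hy0]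
  refine resQ_tr_eq_zero_of_unit (fun hd ↦ hpS (hS.disc p hp.out hd))
    (mul_ne_zero hx (pow_ne_zero _ hy0)) fun v hv ↦ ?_
  have hvS : ¬ Above S v := by rwa [above_iff hS.prime hp.out hv]
  have hvF : v ∈ F := by
    simp only [F, Set.Finite.mem_toFinset]
    exact ⟨p, by simp, hv⟩
  have hy : ord v y = -(ord v x / 2) := by
    rw [ord_prod _ fun v _ ↦ zpow_ne_zero _ (hϖ0 v), Finset.sum_eq_single v]
    · rw [ord_zpow, hϖ1 v hvS, mul_one]
    · intro w _ hw
      rw [ord_zpow, hϖ w v hw.symm hvS, mul_zero]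
    · exact fun h ↦ absurd hvF h
  rw [ord_mul hx (pow_ne_zero _ hy0), ord_pow, hy]
  obtain ⟨k, hk⟩ := h v hv
  push_cast
  omega

/-- The place of `K` induced by an embedding into `ℚ_p`. -/
noncomputable def place {p : ℕ} [Fact p.Prime] (σ : K →+* ℚ_[p]) : HeightOneSpectrum (𝓞 K) :=
  (exists_place σ).choose

lemma natCast_mem_place {p : ℕ} [Fact p.Prime] (σ : K →+* ℚ_[p]) :
    (p : 𝓞 K) ∈ (place σ).asIdeal :=
  (exists_place σ).choose_spec.1

lemma mem_place_iff {p : ℕ} [Fact p.Prime] (σ : K →+* ℚ_[p]) (a : 𝓞 K) :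
    a ∈ (place σ).asIdeal ↔ ‖σ a‖ < 1 :=
  (exists_place σ).choose_spec.2.1 a

lemma valuation_embedding {p : ℕ} [Fact p.Prime] (σ : K →+* ℚ_[p]) {x : K} (hx : x ≠ 0) :
    (σ x).valuation = ord (place σ) x :=
  (exists_place σ).choose_spec.2.2 x hx

lemma place_injective {p : ℕ} [hp : Fact p.Prime] :
    Function.Injective (place : (K →+* ℚ_[p]) → HeightOneSpectrum (𝓞 K)) := by
  intro σ σ' h
  have hnorm : ∀ x, ‖σ x‖ = ‖σ' x‖ := by
    intro x
    rcases eq_or_ne x 0 with rfl | hx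
    · simp
    · rw [Padic.norm_eq_zpow_neg_valuation (by simpa using hx),
        Padic.norm_eq_zpow_neg_valuation (by simpa using hx), valuation_embedding σ hx,
        valuation_embedding σ' hx, h]
  ext x
  rw [← sub_eq_zero, ← norm_le_zero_iff]
  refine le_of_forall_pos_lt_add fun ε hε ↦ ?_
  obtain ⟨q, hq⟩ := Padic.rat_dense p (σ x) (half_pos hε)
  have h1 : σ x - q = σ (x - (q : K)) := by simp
  have h2 : σ' x - q = σ' (x - (q : K)) := by simp
  have h3 : ‖σ' x - q‖ < ε / 2 := by rwa [h2, ← hnorm, ← h1]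
  calc ‖σ x - σ' x‖ = ‖(σ x - q) - (σ' x - q)‖ := by ring_nf
    _ ≤ ‖σ x - q‖ + ‖σ' x - q‖ := norm_sub_le _ _
    _ < 0 + ε := by linarith

variable [IsGalois ℚ K]

lemma resQ_tr_of_embedding {p : ℕ} [hp : Fact p.Prime] [NeZero (2 : ZMod p)] (σ : K →+* ℚ_[p])
    {x : K} (hx : x ≠ 0) :
    resQ p (tr K x) = ∑ τ : K ≃ₐ[ℚ] K, res p (GW.of (σ (τ x))) := by
  classical
  have h1 := map_tr_eq_sum (F := ℚ_[p]) (σ := fun τ : K ≃ₐ[ℚ] K ↦ σ.comp (τ : K →+* K)) (by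
    intro τ τ' h
    ext x
    exact σ.injective (congrArg (fun f : K →+* ℚ_[p] ↦ f x) h))
    (by rw [← Nat.card_eq_fintype_card, IsGalois.card_aut_eq_finrank]) hx
  rw [resQ, AddMonoidHom.comp_apply, h1, map_sum]
  rfl

/-- The form whose residues compute the tame symbols of `u` and `b`. -/
noncomputable def symb (u b : K) : GW ℚ := tr K u - tr K (u * b) - tr K 1 + tr K b

open Classical in
lemma resQ_symb {p : ℕ} [hp : Fact p.Prime] [NeZero (2 : ZMod p)] (σ : K →+* ℚ_[p])
    {u b : K} (hu : u ≠ 0) (hb : b ≠ 0)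
    (hu' : ∀ v : HeightOneSpectrum (𝓞 K), (p : 𝓞 K) ∈ v.asIdeal → Even (ord v u))
    (hb' : ∀ v : HeightOneSpectrum (𝓞 K), (p : 𝓞 K) ∈ v.asIdeal → v ≠ place σ → Even (ord v b)) :
    resQ p (symb u b) = if Odd (ord (place σ) b) ∧ ¬ IsSquare (σ u) then eta p else 0 := by
  have hval : ∀ τ : K ≃ₐ[ℚ] K, ∀ x, x ≠ 0 → (σ (τ x)).valuation =
      ord (place (σ.comp (τ : K →+* K))) x := fun τ x hx ↦
    valuation_embedding (σ.comp (τ : K →+* K)) hx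
  have h0 : ∀ τ : K ≃ₐ[ℚ] K, ∀ x, x ≠ 0 → σ (τ x) ≠ 0 := by
    intro τ x hx
    simpa using hx
  rw [symb, map_add, map_sub, map_sub, resQ_tr_of_embedding σ hu,
    resQ_tr_of_embedding σ (mul_ne_zero hu hb), resQ_tr_of_embedding σ one_ne_zero,
    resQ_tr_of_embedding σ hb, ← Finset.sum_sub_distrib, ← Finset.sum_sub_distrib,
    ← Finset.sum_add_distrib]
  have hu1 : ∀ τ : K ≃ₐ[ℚ] K, Even (σ (τ u)).valuation := fun τ ↦ by
    rw [hval τ u hu]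
    exact hu' _ (natCast_mem_place _)
  have h1 : ∀ τ : K ≃ₐ[ℚ] K, res p (GW.of (σ (τ u))) = 0 := fun τ ↦
    res_of_even (h0 τ u hu) (hu1 τ)
  have h2 : ∀ τ : K ≃ₐ[ℚ] K, res p (GW.of (σ (τ (1 : K)))) = 0 := fun τ ↦ by
    rw [map_one, map_one]
    exact res_of_even one_ne_zero (by simp)
  rw [Finset.sum_eq_single (1 : K ≃ₐ[ℚ] K)]
  · rw [h1, h2]
    simp only [AlgEquiv.one_apply]
    have hσ : (σ b).valuation = ord (place σ) b := valuation_embedding σ hb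
    have hu1' := hu1 1
    have hu0 := h0 1 u hu
    have hb0 := h0 1 b hb
    simp only [AlgEquiv.one_apply] at hu1' hu0 hb0
    by_cases hodd : Odd (ord (place σ) b)
    · have := res_sub_res_mul hb0 hu0 (by rw [hσ]; exact hodd) hu1'
      rw [zero_sub, sub_zero, neg_add_eq_sub, mul_comm u, map_mul, this]
      by_cases hs : IsSquare (σ u) <;> simp [hs, hodd]
    · rw [Int.not_odd_iff_even] at hodd
      rw [map_mul, res_of_even (mul_ne_zero hu0 hb0), res_of_even hb0 (by rwa [hσ])]
      · rw [← Int.not_odd_iff_even] at hodd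
        simp [hodd]
      · rw [Padic.valuation_mul hu0 hb0, hσ]
        exact hu1'.add hodd
  · intro τ _ hτ
    have hb1 : Even (σ (τ b)).valuation := by
      rw [hval τ b hb]
      refine hb' _ (natCast_mem_place _) fun h ↦ hτ ?_
      have := place_injective h
      ext x
      exact σ.injective (congrArg (fun f : K →+* ℚ_[p] ↦ f x) this)
    rw [h1, h2, res_of_even (h0 τ b hb) hb1, map_mul, map_mul,
      res_of_even (mul_ne_zero (h0 τ u hu) (h0 τ b hb))]
    · simp
    · rw [Padic.valuation_mul (h0 τ u hu) (h0 τ b hb)]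
      exact (hu1 τ).add hb1
  · simp

/-- The class of the scaled hermitian trace form of `K(√δ)`. -/
noncomputable def trH (δ a : K) : GW ℚ := tr K (2 * a) + tr K (-2 * δ * a)

open Classical in
lemma resQ_trH {p : ℕ} [hp : Fact p.Prime] [NeZero (2 : ZMod p)] (σ : K →+* ℚ_[p])
    {δ a : K} (hδ : δ ≠ 0) (ha : a ≠ 0)
    (hδ' : ∀ v : HeightOneSpectrum (𝓞 K), (p : 𝓞 K) ∈ v.asIdeal → Even (ord v δ)) :
    resQ p (trH δ a) = ∑ τ : K ≃ₐ[ℚ] K,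
      if Odd (ord (place (σ.comp (τ : K →+* K))) a) ∧ ¬ IsSquare (σ (τ δ)) then eta p else 0 := by
  have h2 : (2 : K) ≠ 0 := two_ne_zero
  rw [trH, map_add, resQ_tr_of_embedding σ (mul_ne_zero h2 ha), resQ_tr_of_embedding σ
    (mul_ne_zero (mul_ne_zero (neg_ne_zero.2 h2) hδ) ha), ← Finset.sum_add_distrib]
  refine Finset.sum_congr rfl fun τ _ ↦ ?_
  have h0 : ∀ x, x ≠ 0 → σ (τ x) ≠ 0 := by
    intro x hx
    simpa using hx
  have hval : ∀ x, x ≠ 0 → (σ (τ x)).valuation = ord (place (σ.comp (τ : K →+* K))) x :=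
    fun x hx ↦ valuation_embedding (σ.comp (τ : K →+* K)) hx
  have hδ1 : Even (σ (τ δ)).valuation := by
    rw [hval δ hδ]
    exact hδ' _ (natCast_mem_place _)
  have hval2 : (2 : ℚ_[p]).valuation = 0 := by
    have := Padic.valuation_natCast (p := p) 2
    rw [Nat.cast_ofNat] at this
    rw [this]
    have h3 : ¬ p ∣ 2 := fun h ↦ ne_two_of_neZero ((Nat.prime_dvd_prime_iff_eq hp.out Nat.prime_two).1 h)
    simp [padicValNat.eq_zero_of_not_dvd h3]
  have e1 : σ (τ (2 * a)) = 2 * σ (τ a) := by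
    rw [map_mul, map_mul, map_ofNat, map_ofNat]
  have hv1 : (2 * σ (τ a)).valuation = ord (place (σ.comp (τ : K →+* K))) a := by
    rw [Padic.valuation_mul two_ne_zero (h0 a ha), hval2, zero_add, hval a ha]
  have e2 : σ (τ (-2 * δ * a)) = -(2 * σ (τ a) * σ (τ δ)) := by
    simp only [map_mul, map_neg, map_ofNat]
    ring
  have h20 : 2 * σ (τ a) ≠ 0 := mul_ne_zero two_ne_zero (h0 a ha)
  have e3 : res p (GW.of (-(2 * σ (τ a) * σ (τ δ)))) = -res p (GW.of (2 * σ (τ a) * σ (τ δ))) := by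
    have h4 := GW.of_add_of_neg (mul_ne_zero h20 (h0 δ hδ)) (one_ne_zero (α := ℚ_[p]))
    have h5 := congrArg (res p) h4
    rw [map_add, map_add, res_of_even one_ne_zero (by simp),
      res_of_even (a := (-1 : ℚ_[p])) (by simp) (by
        have := Padic.valuation_intCast (p := p) (-1)
        push_cast at this
        rw [this]
        simp [padicValInt]), add_zero] at h5
    exact (neg_eq_of_add_eq_zero_right h5).symm
  rw [e1, e2, e3, ← sub_eq_add_neg]
  by_cases hodd : Odd (ord (place (σ.comp (τ : K →+* K))) a)
  · rw [res_sub_res_mul h20 (h0 δ hδ) (by rwa [hv1]) hδ1]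
    by_cases hs : IsSquare (σ (τ δ)) <;> simp [hs, hodd]
  · have hev := Int.not_odd_iff_even.1 hodd
    rw [res_of_even h20 (by rwa [hv1]), res_of_even (mul_ne_zero h20 (h0 δ hδ)) (by
      rw [Padic.valuation_mul h20 (h0 δ hδ), hv1]
      exact hev.add hδ1)]
    simp [hodd]

end Adm

/-! ### Lifting residue homomorphisms to embeddings into `ℚ_p` -/

section Lift

variable (K : Type*) [Field K] [NumberField K]

lemma exists_integral_primitive : ∃ θ : 𝓞 K, IntermediateField.adjoin ℚ {(θ : K)} = ⊤ := by
  obtain ⟨α, hα⟩ := Field.exists_primitive_element ℚ K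
  obtain ⟨d, hd, hInt⟩ := ((IsFractionRing.isAlgebraic_iff ℤ ℚ K).2
    (Algebra.IsAlgebraic.isAlgebraic (R := ℚ) α)).exists_integral_multiple
  refine ⟨⟨d • α, hInt⟩, ?_⟩
  rw [eq_top_iff, ← hα, IntermediateField.adjoin_simple_le_iff]
  have h1 : (d • α) ∈ IntermediateField.adjoin ℚ {d • α} :=
    IntermediateField.mem_adjoin_simple_self ℚ _
  have h2 : (d : ℚ)⁻¹ • (d • α) = α := by
    rw [← Int.cast_smul_eq_zsmul ℚ, smul_smul, inv_mul_cancel₀ (by exact_mod_cast hd), one_smul]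
  have h3 := IntermediateField.smul_mem _ (x := (d : ℚ)⁻¹) h1
  rwa [h2] at h3

variable {K}

lemma exists_bezout {F : ℤ[X]} (hF : (F.map (algebraMap ℤ ℚ)).Separable) :
    ∃ (A B : ℤ[X]) (N : ℤ), N ≠ 0 ∧ A * F + B * derivative F = C N := by
  obtain ⟨a, b, h⟩ := hF
  obtain ⟨N₁, hN₁, h₁⟩ := IsLocalization.integerNormalization_spec (nonZeroDivisors ℤ) a
  obtain ⟨N₂, hN₂, h₂⟩ := IsLocalization.integerNormalization_spec (nonZeroDivisors ℤ) b
  refine ⟨C N₂ * IsLocalization.integerNormalization (nonZeroDivisors ℤ) a,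
    C N₁ * IsLocalization.integerNormalization (nonZeroDivisors ℤ) b, N₁ * N₂,
    mul_ne_zero (nonZeroDivisors.ne_zero hN₁) (nonZeroDivisors.ne_zero hN₂), ?_⟩
  apply Polynomial.map_injective _ (algebraMap ℤ ℚ).injective_int
  rw [derivative_map] at h
  simp only [Polynomial.map_add, Polynomial.map_mul, map_C, h₁, h₂, Algebra.smul_def,
    Polynomial.algebraMap_apply, map_mul]
  linear_combination C (algebraMap ℤ ℚ N₁) * C (algebraMap ℤ ℚ N₂) * h

/-- Apart from finitely many primes, a root modulo `p` of the minimal polynomial of a primitive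
integer lifts to an embedding into `ℚ_p`. -/
lemma exists_embedding_of_root {θ : 𝓞 K} (hθ : IntermediateField.adjoin ℚ {(θ : K)} = ⊤) :
    ∃ N : ℤ, N ≠ 0 ∧ ∀ (p : ℕ) [Fact p.Prime], ¬ (p : ℤ) ∣ N → ∀ r : ZMod p,
      aeval r (minpoly ℤ (θ : K)) = 0 → ∃ (σ : K →+* ℚ_[p]) (z : ℤ_[p]), σ θ = z ∧
        PadicInt.toZMod z = r := by
  have hInt : IsIntegral ℤ (θ : K) := RingOfIntegers.isIntegral_coe θ
  have hmin : (minpoly ℤ (θ : K)).map (algebraMap ℤ ℚ) = minpoly ℚ (θ : K) :=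
    (minpoly.isIntegrallyClosed_eq_field_fractions' ℚ hInt).symm
  obtain ⟨A, B, N, hN, hAB⟩ := exists_bezout (F := minpoly ℤ (θ : K)) (by
    rw [hmin]
    exact (minpoly.irreducible hInt.tower_top).separable)
  refine ⟨N, hN, fun p hp hpN r hr ↦ ?_⟩
  obtain ⟨a, rfl⟩ := ZMod.ringHom_surjective (PadicInt.toZMod (p := p)) r
  set F := minpoly ℤ (θ : K)
  have hcomm : ∀ G : ℤ[X], PadicInt.toZMod (aeval a G) = aeval (PadicInt.toZMod a) G := by
    intro G
    rw [aeval_def, aeval_def, hom_eval₂]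
    congr 1
    exact RingHom.ext_int _ _
  have hz : ∀ z : ℤ_[p], ‖z‖ < 1 ↔ PadicInt.toZMod z = 0 := by
    intro z
    rw [← PadicInt.mem_nonunits, ← IsLocalRing.mem_maximalIdeal, ← PadicInt.ker_toZMod, RingHom.mem_ker]
  have hd : ‖aeval a (derivative F)‖ = 1 := by
    refine le_antisymm (PadicInt.norm_le_one _) (not_lt.1 fun h ↦ hpN ?_)
    rw [hz, hcomm] at h
    have := congrArg (aeval (PadicInt.toZMod a)) hAB
    simp only [map_add, map_mul, hr, h, mul_zero, add_zero, aeval_C] at this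
    rw [← ZMod.intCast_zmod_eq_zero_iff_dvd]
    simpa using this.symm
  obtain ⟨z, hz1, hz2, -⟩ := hensels_lemma (p := p) (F := F) (a := a) (by
    rw [hd, one_pow, hz, hcomm, hr])
  rw [hd, hz, map_sub, sub_eq_zero] at hz2
  have hroot : aeval (z : ℚ_[p]) (minpoly ℚ (θ : K)) = 0 := by
    rw [← hmin, aeval_map_algebraMap, ← PadicInt.algebraMap_apply, aeval_algebraMap_apply, hz1,
      map_zero]
  let e : IntermediateField.adjoin ℚ {(θ : K)} →ₐ[ℚ] ℚ_[p] :=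
    (IntermediateField.algHomAdjoinIntegralEquiv ℚ hInt.tower_top).symm
      ⟨z, by
        rw [mem_aroots]
        exact ⟨minpoly.ne_zero hInt.tower_top, hroot⟩⟩
  refine ⟨(e.comp ((IntermediateField.equivOfEq hθ.symm).toAlgHom.comp
    IntermediateField.topEquiv.symm.toAlgHom)).toRingHom, z, ?_, hz2⟩
  have : e (IntermediateField.AdjoinSimple.gen ℚ (θ : K)) = z :=
    IntermediateField.algHomAdjoinIntegralEquiv_symm_apply_gen ℚ hInt.tower_top _
  exact this

/-- The restriction of an embedding into `ℚ_p` to the integers. -/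
noncomputable def integerHom {p : ℕ} [Fact p.Prime] (σ : K →+* ℚ_[p]) : 𝓞 K →+* ℤ_[p] where
  toFun a := ⟨σ a, norm_embedding_le_one σ a⟩
  map_one' := Subtype.ext (by simp)
  map_mul' a b := Subtype.ext (by simp; rfl)
  map_zero' := Subtype.ext (by simp)
  map_add' a b := Subtype.ext (by simp; rfl)

/-- The residue homomorphism of an embedding into `ℚ_p`. -/
noncomputable def residueHom {p : ℕ} [Fact p.Prime] (σ : K →+* ℚ_[p]) : 𝓞 K →+* ZMod p :=
  PadicInt.toZMod.comp (integerHom σ)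

lemma ker_residueHom {p : ℕ} [Fact p.Prime] (σ : K →+* ℚ_[p]) :
    RingHom.ker (residueHom σ) = (place σ).asIdeal := by
  ext a
  rw [mem_place_iff, RingHom.mem_ker, residueHom, RingHom.comp_apply, ← RingHom.mem_ker,
    PadicInt.ker_toZMod, IsLocalRing.mem_maximalIdeal, PadicInt.mem_nonunits]
  rfl

variable (K) in
/-- Apart from finitely many primes, residue homomorphisms onto `𝔽_p` come from embeddings. -/
lemma exists_embedding_of_residue : ∃ N : ℤ, N ≠ 0 ∧ ∀ (p : ℕ) [Fact p.Prime], ¬ (p : ℤ) ∣ N →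
    ∀ φ : 𝓞 K →+* ZMod p, ∃ σ : K →+* ℚ_[p], residueHom σ = φ := by
  obtain ⟨θ, hθ⟩ := exists_integral_primitive K
  obtain ⟨N, hN, h⟩ := exists_embedding_of_root hθ
  have hInt : IsIntegral ℤ (θ : K) := RingOfIntegers.isIntegral_coe θ
  have hG : ∀ x : K, ∃ (d : ℤ) (G : ℤ[X]), d ≠ 0 ∧ (d : K) * x = aeval (θ : K) G := by
    intro x
    have hx : x ∈ Algebra.adjoin ℚ {(θ : K)} := by
      rw [Algebra.adjoin_eq_top_of_primitive_element hInt.tower_top.isAlgebraic hθ]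
      trivial
    rw [Algebra.adjoin_singleton_eq_range_aeval] at hx
    obtain ⟨g, rfl⟩ := hx
    obtain ⟨d, hd, hg⟩ := IsLocalization.integerNormalization_spec (nonZeroDivisors ℤ) g
    refine ⟨d, IsLocalization.integerNormalization (nonZeroDivisors ℤ) g,
      nonZeroDivisors.ne_zero hd, ?_⟩
    rw [← aeval_map_algebraMap ℚ, hg, map_zsmul, zsmul_eq_mul]
    rfl
  choose d G hd hdG using fun i ↦ hG (RingOfIntegers.basis K i : 𝓞 K)
  refine ⟨N * ∏ i, d i, mul_ne_zero hN (Finset.prod_ne_zero_iff.2 fun i _ ↦ hd i),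
    fun p hp hpN φ ↦ ?_⟩
  obtain ⟨σ, z, hσ, hz⟩ := h p (fun hdvd ↦ hpN (hdvd.mul_right _)) (φ θ) (by
    have h1 : aeval (θ : 𝓞 K) (minpoly ℤ (θ : K)) = 0 := by
      apply RingOfIntegers.coe_injective
      rw [map_zero, ← aeval_algebraMap_apply]
      exact minpoly.aeval ℤ (θ : K)
    have h2 := congrArg φ.toIntAlgHom h1
    rwa [map_zero, ← aeval_algHom_apply] at h2)
  refine ⟨σ, ?_⟩
  have hθ' : residueHom σ θ = φ θ := by
    rw [← hz, residueHom, RingHom.comp_apply]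
    congr 1
    exact Subtype.ext hσ
  have hpoly : ∀ H : ℤ[X], residueHom σ (aeval θ H) = φ (aeval θ H) := by
    intro H
    have h1 := aeval_algHom_apply (residueHom σ).toIntAlgHom θ H
    have h2 := aeval_algHom_apply φ.toIntAlgHom θ H
    change _ = residueHom σ (aeval θ H) at h1
    change _ = φ (aeval θ H) at h2
    rw [← h1, ← h2]
    change aeval (residueHom σ θ) H = aeval (φ θ) H
    rw [hθ']
  have hbasis : ((residueHom σ : 𝓞 K →+ ZMod p).toIntLinearMap) = (φ : 𝓞 K →+ ZMod p).toIntLinearMap := by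
    refine (RingOfIntegers.basis K).ext fun i ↦ ?_
    change residueHom σ _ = φ _
    have hd0 : (d i : ZMod p) ≠ 0 := by
      rw [Ne, ZMod.intCast_zmod_eq_zero_iff_dvd]
      exact fun hdvd ↦ hpN ((hdvd.trans (Finset.dvd_prod_of_mem d (Finset.mem_univ i))).mul_left _)
    apply mul_left_cancel₀ hd0
    have h1 : (d i : 𝓞 K) * RingOfIntegers.basis K i = aeval θ (G i) := by
      apply RingOfIntegers.coe_injective
      rw [← aeval_algebraMap_apply, map_mul, map_intCast]
      exact hdG i
    have h2 := hpoly (G i)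
    rwa [← h1, map_mul, map_mul, map_intCast, map_intCast] at h2
  ext a
  exact congrArg (fun f ↦ f a) hbasis

end Lift

/-! ### Sums over free commutative monoids -/

section Euler

open ENNReal

variable {X Y : Type*}

/-- The sum over the free commutative monoid on `X` of the multiplicative extension of `w`. -/
noncomputable def eulerSum (w : X → ℝ≥0∞) : ℝ≥0∞ := ∑' f : X →₀ ℕ, f.prod fun x k ↦ w x ^ k

lemma eulerSum_le_of_injective {w : X → ℝ≥0∞} {w' : Y → ℝ≥0∞} {i : X → Y}
    (hi : Function.Injective i) (h : ∀ x, w x ≤ w' (i x)) : eulerSum w ≤ eulerSum w' := by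
  let e : X ↪ Y := ⟨i, hi⟩
  calc eulerSum w ≤ ∑' f : X →₀ ℕ, (f.embDomain e).prod fun x k ↦ w' x ^ k := by
        refine ENNReal.tsum_le_tsum fun f ↦ ?_
        rw [Finsupp.prod_embDomain]
        exact Finset.prod_le_prod' fun x _ ↦ pow_le_pow_left' (h x) _
    _ ≤ eulerSum w' := ENNReal.tsum_comp_le_tsum_of_injective (Finsupp.embDomain_injective e) _

lemma eulerSum_sum (w : X ⊕ Y → ℝ≥0∞) :
    eulerSum w = eulerSum (w ∘ Sum.inl) * eulerSum (w ∘ Sum.inr) := by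
  rw [eulerSum, ← Finsupp.sumFinsuppEquivProdFinsupp.symm.tsum_eq, eulerSum, eulerSum,
    ← ENNReal.tsum_mul_right]
  rw [ENNReal.tsum_prod']
  refine tsum_congr fun f ↦ ?_
  rw [← ENNReal.tsum_mul_left]
  refine tsum_congr fun g ↦ ?_
  change (Finsupp.sumElim f g).prod _ = _
  rw [Finsupp.prod_sumElim]
  rfl

lemma eulerSum_finite (X : Type*) [Finite X] :
    ∃ C : ℝ≥0∞, C ≠ ⊤ ∧ ∀ w : X → ℝ≥0∞, (∀ x, w x ≤ 2⁻¹) → eulerSum w ≤ C := by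
  induction X using Finite.induction_empty_option with
  | of_equiv e h =>
    obtain ⟨C, hC, h⟩ := h
    refine ⟨C, hC, fun w hw ↦ (eulerSum_le_of_injective (w' := w ∘ e) e.symm.injective ?_).trans
      (h _ fun x ↦ hw _)⟩
    simp
  | h_empty =>
    refine ⟨1, one_ne_top, fun w _ ↦ ?_⟩
    rw [eulerSum, tsum_eq_single 0 (fun f hf ↦ absurd (Subsingleton.elim f 0) hf)]
    simp
  | h_option h =>
    obtain ⟨C, hC, h⟩ := h
    refine ⟨C * 2, mul_ne_top hC (by simp), fun w hw ↦ ?_⟩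
    refine (eulerSum_le_of_injective (w' := w ∘ (Equiv.optionEquivSumPUnit.{0} _).symm)
      (Equiv.optionEquivSumPUnit.{0} _).injective (by simp)).trans ?_
    rw [eulerSum_sum]
    refine mul_le_mul' (h _ fun x ↦ hw _) ?_
    rw [eulerSum, ← Finsupp.uniqueEquiv PUnit.unit |>.symm.tsum_eq]
    calc _ ≤ ∑' k : ℕ, (2⁻¹ : ℝ≥0∞) ^ k := by
          refine ENNReal.tsum_le_tsum fun k ↦ ?_
          rw [Finsupp.prod_fintype _ _ (by simp), Fintype.prod_unique]
          have hk : (Finsupp.uniqueEquiv PUnit.unit).symm k (default : PUnit) = k :=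
            Finsupp.single_eq_same
          rw [hk]
          exact pow_le_pow_left' (hw _) k
      _ = 2 := by rw [ENNReal.tsum_geometric, ENNReal.one_sub_inv_two, inv_inv]

lemma eulerSum_prod_fin (w : X → ℝ≥0∞) (n : ℕ) :
    eulerSum (fun y : X × Fin n ↦ w y.1) ≤ eulerSum w ^ n := by
  induction n with
  | zero =>
    rw [eulerSum, tsum_eq_single 0 (fun f hf ↦ absurd (Subsingleton.elim f 0) hf)]
    simp
  | succ n ih =>
    rw [pow_succ]
    refine (eulerSum_le_of_injective (Y := (X × Fin n) ⊕ X)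
      (w' := Sum.elim (fun y ↦ w y.1) w)
      (i := fun y ↦ Fin.lastCases (motive := fun _ ↦ (X × Fin n) ⊕ X) (Sum.inr y.1)
        (fun j ↦ Sum.inl (y.1, j)) y.2) ?_ ?_).trans ?_
    · rintro ⟨x, j⟩ ⟨x', j'⟩ h
      induction j using Fin.lastCases <;> induction j' using Fin.lastCases <;> simp_all
    · rintro ⟨x, j⟩
      induction j using Fin.lastCases <;> simp
    · rw [eulerSum_sum]
      exact mul_le_mul' ih le_rfl

/-- The multiplicative function `n ↦ n ^ (-s)`. -/
noncomputable def npow (s : ℝ) : ℕ →* ℝ≥0∞ where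
  toFun n := ENNReal.ofReal ((n : ℝ) ^ (-s))
  map_one' := by simp
  map_mul' a b := by
    rw [Nat.cast_mul, Real.mul_rpow (by positivity) (by positivity),
      ENNReal.ofReal_mul (by positivity)]

lemma npow_apply (s : ℝ) (n : ℕ) : npow s n = ENNReal.ofReal ((n : ℝ) ^ (-s)) := rfl

lemma npow_le {s t : ℝ} {a b : ℕ} (ha : 2 ≤ a) (ht : 0 ≤ t) (hst : t ≤ s) (hab : a ≤ b) :
    npow s b ≤ npow t a := by
  refine ENNReal.ofReal_le_ofReal ?_
  have h1 : (1 : ℝ) ≤ b := by exact_mod_cast (by omega : 1 ≤ b)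
  calc (b : ℝ) ^ (-s) ≤ (b : ℝ) ^ (-t) := Real.rpow_le_rpow_of_exponent_le h1 (by linarith)
    _ ≤ (a : ℝ) ^ (-t) := Real.rpow_le_rpow_of_nonpos (by positivity) (by exact_mod_cast hab)
        (by linarith)

lemma eulerSum_primes_ne_top : eulerSum (fun p : Nat.Primes ↦ npow 2 p) ≠ ⊤ := by
  have h1 : ∑' n : ℕ, npow 2 n ≠ ⊤ := by
    simp only [npow_apply]
    rw [← ENNReal.ofReal_tsum_of_nonneg (fun n ↦ by positivity)
      (Real.summable_nat_rpow.2 (by norm_num))]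
    exact ofReal_ne_top
  refine ne_top_of_le_ne_top h1 ?_
  let e : Nat.Primes ↪ ℕ := ⟨fun p ↦ p, Nat.Primes.coe_nat_injective⟩
  have hinj : Function.Injective fun f : Nat.Primes →₀ ℕ ↦ f.prod fun p k ↦ (p : ℕ) ^ k := by
    have h2 : ∀ f : Nat.Primes →₀ ℕ,
        (f.prod fun p k ↦ (p : ℕ) ^ k).factorization = f.embDomain e := by
      intro f
      have h3 := Nat.prod_pow_factorization_eq_self (f := f.embDomain e) (by
        intro p hp
        rw [Finsupp.support_embDomain, Finset.mem_map] at hp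
        obtain ⟨q, -, rfl⟩ := hp
        exact q.2)
      rwa [Finsupp.prod_embDomain] at h3
    intro f g hfg
    apply Finsupp.embDomain_injective e
    rw [← h2, ← h2]
    exact congrArg _ hfg
  refine le_trans (le_of_eq (tsum_congr fun f ↦ ?_))
    (ENNReal.tsum_comp_le_tsum_of_injective hinj _)
  simp only [map_finsuppProd, map_pow]

end Euler

section Zeta

open ENNReal Filter Topology

variable (K : Type*) [Field K] [NumberField K]

/-- The Dedekind zeta function as a sum over ideals. -/
noncomputable def zetaSum (s : ℝ) : ℝ≥0∞ := ∑' I : Ideal (𝓞 K), npow s (Ideal.absNorm I)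

lemma zetaSum_eq {s : ℝ} (hs : 1 < s) (h : dedekindZeta K s ≠ 0) :
    zetaSum K s = ENNReal.ofReal ‖dedekindZeta K s‖ := by
  have hsum : LSeriesSummable (fun n ↦ Nat.card {I : Ideal (𝓞 K) // Ideal.absNorm I = n}) s := by
    by_contra hn
    exact h (tsum_eq_zero_of_not_summable hn)
  have hterm : ∀ n : ℕ, LSeries.term (fun n ↦ (Nat.card {I : Ideal (𝓞 K) // Ideal.absNorm I = n} : ℂ))
      s n = ((Nat.card {I : Ideal (𝓞 K) // Ideal.absNorm I = n} * (n : ℝ) ^ (-s) : ℝ) : ℂ) := by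
    intro n
    rcases eq_or_ne n 0 with rfl | hn
    · simp [Real.zero_rpow (by linarith : -s ≠ 0)]
    · rw [LSeries.term_of_ne_zero hn, Real.rpow_neg (by positivity)]
      push_cast
      rw [Complex.ofReal_cpow (by positivity), div_eq_mul_inv]
      simp
  have hsum' : Summable fun n : ℕ ↦ (Nat.card {I : Ideal (𝓞 K) // Ideal.absNorm I = n} * (n : ℝ) ^ (-s) : ℝ) := by
    rw [← Complex.summable_ofReal]
    exact hsum.congr fun n ↦ (hterm n)
  have h1 : dedekindZeta K s = ((∑' n : ℕ,
      (Nat.card {I : Ideal (𝓞 K) // Ideal.absNorm I = n} * (n : ℝ) ^ (-s) : ℝ) : ℝ) : ℂ) := by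
    rw [dedekindZeta, LSeries, Complex.ofReal_tsum]
    exact tsum_congr hterm
  have hnn : ∀ n : ℕ, 0 ≤ (Nat.card {I : Ideal (𝓞 K) // Ideal.absNorm I = n} * (n : ℝ) ^ (-s) : ℝ) :=
    fun n ↦ by positivity
  rw [h1, Complex.norm_real, Real.norm_of_nonneg (tsum_nonneg hnn),
    ENNReal.ofReal_tsum_of_nonneg hnn hsum', zetaSum,
    ← (Equiv.sigmaFiberEquiv (Ideal.absNorm (S := 𝓞 K))).tsum_eq, ENNReal.tsum_sigma']
  refine tsum_congr fun n ↦ ?_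
  have hfin : Finite {I : Ideal (𝓞 K) // Ideal.absNorm I = n} := Ideal.finite_setOfPred_absNorm_eq n
  calc _ = ∑' I : {I : Ideal (𝓞 K) // Ideal.absNorm I = n}, npow s n := by
        refine tsum_congr fun I ↦ ?_
        exact congrArg _ I.2
    _ = _ := by
        rw [ENNReal.tsum_const, ENNReal.ofReal_mul (by positivity), npow_apply,
          ENNReal.ofReal_natCast, ENat.card_eq_coe_natCard]
        rfl

/-- The weight of a prime ideal. -/
noncomputable def primeWeight (s : ℝ) (v : HeightOneSpectrum (𝓞 K)) : ℝ≥0∞ :=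
  npow s (Ideal.absNorm v.asIdeal)

/-- The ideal with a given factorization. -/
noncomputable def idealOf (f : HeightOneSpectrum (𝓞 K) →₀ ℕ) : Ideal (𝓞 K) :=
  f.prod fun v k ↦ v.asIdeal ^ k

lemma npow_idealOf (s : ℝ) (f : HeightOneSpectrum (𝓞 K) →₀ ℕ) :
    npow s (Ideal.absNorm (idealOf K f)) = f.prod fun v k ↦ primeWeight K s v ^ k := by
  simp only [idealOf, map_finsuppProd, map_pow, primeWeight]

lemma eulerSum_le_zetaSum (s : ℝ) : eulerSum (primeWeight K s) ≤ zetaSum K s := by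
  refine le_trans (le_of_eq (tsum_congr fun f ↦ (npow_idealOf K s f).symm))
    (ENNReal.tsum_comp_le_tsum_of_injective (f := idealOf K) ?_ _)
  have h : ∀ f v, FractionalIdeal.count K v (idealOf K f : FractionalIdeal (nonZeroDivisors (𝓞 K)) K) = f v := by
    intro f v
    have := FractionalIdeal.count_finsuppProd K v (f.mapRange (Nat.cast : ℕ → ℤ) rfl)
    rw [Finsupp.mapRange_apply] at this
    rw [← this, idealOf, Finsupp.prod_mapRange_index (by simp)]
    congr 1
    change FractionalIdeal.coeIdealHom _ K _ = _
    rw [map_finsuppProd]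
    simp only [map_pow, zpow_natCast]
    rfl
  intro f g hfg
  ext v
  have := h f v
  rw [hfg, h g v] at this
  exact_mod_cast this.symm

lemma zetaSum_le_eulerSum {s : ℝ} (hs : 1 < s) : zetaSum K s ≤ eulerSum (primeWeight K s) := by
  have hsurj : ∀ I : {I : Ideal (𝓞 K) // I ≠ 0}, ∃ f, idealOf K f = I := by
    rintro ⟨I, hI⟩
    induction I using UniqueFactorizationMonoid.induction_on_prime with
    | h₁ => exact absurd rfl hI
    | h₂ I hu =>
      refine ⟨0, ?_⟩
      change idealOf K 0 = I
      rw [Ideal.isUnit_iff.1 hu]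
      simp [idealOf]
    | h₃ I P hI0 hP ih =>
      obtain ⟨f, hf⟩ := ih hI0
      let v : HeightOneSpectrum (𝓞 K) := ⟨P, Ideal.isPrime_of_prime hP, hP.ne_zero⟩
      refine ⟨Finsupp.single v 1 + f, ?_⟩
      rw [idealOf, Finsupp.prod_add_index' (by simp) (fun _ _ _ ↦ pow_add _ _ _),
        Finsupp.prod_single_index (by simp)]
      change v.asIdeal ^ 1 * idealOf K f = _
      rw [hf, pow_one]
  choose f hf using hsurj
  have hinj : Function.Injective f := fun I J h ↦ Subtype.ext (by rw [← hf, ← hf, h])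
  calc zetaSum K s = ∑' I : {I : Ideal (𝓞 K) // I ≠ 0}, npow s (Ideal.absNorm (I : Ideal (𝓞 K))) := by
        rw [zetaSum]
        refine (tsum_subtype_eq_of_support_subset (s := {I : Ideal (𝓞 K) | I ≠ 0}) ?_).symm
        intro I hI h0
        apply hI
        simp only [h0, npow_apply]
        simp [Real.zero_rpow (by linarith : -s ≠ 0)]
    _ = ∑' I, (f I).prod fun v k ↦ primeWeight K s v ^ k :=
        tsum_congr fun I ↦ by rw [← npow_idealOf, hf]
    _ ≤ _ := ENNReal.tsum_comp_le_tsum_of_injective hinj _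

end Zeta

/-! ### Nonsquares at places of degree one -/

section Places

variable {K : Type*} [Field K] [NumberField K]

lemma absNorm_eq_pow {v : HeightOneSpectrum (𝓞 K)} {p : ℕ} (hp : p.Prime)
    (hv : (p : 𝓞 K) ∈ v.asIdeal) : ∃ k, k ≠ 0 ∧ Ideal.absNorm v.asIdeal = p ^ k := by
  have h1 : Ideal.absNorm v.asIdeal ∣ p ^ Module.finrank ℤ (𝓞 K) := by
    rw [← Ideal.absNorm_span_natCast]
    exact Ideal.absNorm_dvd_absNorm_of_le ((Ideal.span_singleton_le_iff_mem _).2 hv)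
  obtain ⟨k, -, hk⟩ := (Nat.dvd_prime_pow hp).1 h1
  refine ⟨k, ?_, hk⟩
  rintro rfl
  rw [pow_zero, Ideal.absNorm_eq_one_iff] at hk
  exact v.isPrime.ne_top hk

lemma two_le_absNorm (v : HeightOneSpectrum (𝓞 K)) : 2 ≤ Ideal.absNorm v.asIdeal := by
  obtain ⟨p, hp, hv⟩ := exists_prime_mem' v
  obtain ⟨k, hk, h⟩ := absNorm_eq_pow hp hv
  rw [h]
  exact hp.two_le.trans (Nat.le_self_pow hk p)

lemma card_places_le {p : ℕ} (hp : p.Prime) (F : Finset (HeightOneSpectrum (𝓞 K)))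
    (hF : ∀ v ∈ F, (p : 𝓞 K) ∈ v.asIdeal) : F.card ≤ Module.finrank ℤ (𝓞 K) := by
  classical
  have h1 : ∏ v ∈ F, v.asIdeal ∣ Ideal.span {(p : 𝓞 K)} := by
    have h2 := Finset.prod_primes_dvd (s := F.image HeightOneSpectrum.asIdeal)
      (Ideal.span {(p : 𝓞 K)}) (by
        intro I hI
        obtain ⟨v, -, rfl⟩ := Finset.mem_image.1 hI
        exact v.prime) (by
        intro I hI
        obtain ⟨v, hv, rfl⟩ := Finset.mem_image.1 hI
        exact Ideal.dvd_span_singleton.2 (hF v hv))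
    rwa [Finset.prod_image fun v _ w _ h ↦ HeightOneSpectrum.ext h] at h2
  have h3 : p ^ F.card ≤ p ^ Module.finrank ℤ (𝓞 K) := by
    calc p ^ F.card ≤ ∏ v ∈ F, Ideal.absNorm v.asIdeal := by
          rw [← Finset.prod_const]
          refine Finset.prod_le_prod' fun v hv ↦ ?_
          obtain ⟨k, hk, h⟩ := absNorm_eq_pow hp (hF v hv)
          rw [h]
          exact Nat.le_self_pow hk p
      _ ≤ _ := by
          rw [← map_prod]
          refine Nat.le_of_dvd (pow_pos hp.pos _) ?_
          rw [← Ideal.absNorm_span_natCast]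
          exact Ideal.absNorm_dvd_absNorm_of_le (Ideal.le_of_dvd h1)
  exact (Nat.pow_le_pow_iff_right hp.one_lt).1 h3

lemma absNorm_place {p : ℕ} [hp : Fact p.Prime] (σ : K →+* ℚ_[p]) :
    Ideal.absNorm (place σ).asIdeal = p := by
  rw [← ker_residueHom, Ideal.absNorm_apply, Submodule.cardQuot_apply]
  have h := Nat.card_congr (RingHom.quotientKerEquivOfSurjective
    (ZMod.ringHom_surjective (residueHom σ))).toEquiv
  rw [Nat.card_zmod] at h
  exact h

variable (K) in
lemma exists_embedding_of_absNorm : ∃ N : ℤ, N ≠ 0 ∧ ∀ (p : ℕ) [Fact p.Prime], ¬ (p : ℤ) ∣ N →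
    ∀ v : HeightOneSpectrum (𝓞 K), Ideal.absNorm v.asIdeal = p →
      ∃ σ : K →+* ℚ_[p], place σ = v := by
  obtain ⟨N, hN, h⟩ := exists_embedding_of_residue K
  refine ⟨N, hN, fun p hp hpN v hv ↦ ?_⟩
  rw [Ideal.absNorm_apply, Submodule.cardQuot_apply] at hv
  have hfin : Finite (𝓞 K ⧸ v.asIdeal) := Nat.finite_of_card_ne_zero (by
    rw [hv]
    exact hp.out.ne_zero)
  have := Fintype.ofFinite (𝓞 K ⧸ v.asIdeal)
  rw [Nat.card_eq_fintype_card] at hv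
  let e := ZMod.ringEquivOfPrime _ hp.out hv
  obtain ⟨σ, hσ⟩ := h p hpN ((e.symm : _ →+* ZMod p).comp (Ideal.Quotient.mk v.asIdeal))
  refine ⟨σ, HeightOneSpectrum.ext ?_⟩
  rw [← ker_residueHom, hσ]
  ext a
  simp [RingHom.mem_ker, Ideal.Quotient.eq_zero_iff_mem]

open ENNReal

variable (K) in
/-- The primes of degree at least two contribute a bounded factor. -/
lemma eulerSum_deg_two : ∃ C : ℝ≥0∞, C ≠ ⊤ ∧ ∀ s : ℝ, 1 < s →
    eulerSum (fun v : {v : HeightOneSpectrum (𝓞 K) // ¬ (Ideal.absNorm v.asIdeal).Prime} ↦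
      primeWeight K s v) ≤ C := by
  classical
  set n := Module.finrank ℤ (𝓞 K)
  refine ⟨_, pow_ne_top (n := n) eulerSum_primes_ne_top, fun s hs ↦ ?_⟩
  choose p hp hpv using fun v : HeightOneSpectrum (𝓞 K) ↦ exists_prime_mem' v
  have hidx : ∀ q : Nat.Primes, ∃ f : HeightOneSpectrum (𝓞 K) → Fin n,
      Set.InjOn f {v | (q : 𝓞 K) ∈ v.asIdeal} := by
    intro q
    have hfin : {v : HeightOneSpectrum (𝓞 K) | (q : 𝓞 K) ∈ v.asIdeal}.Finite := by
      refine (finite_above (K := K) (S := {(q : ℕ)}) (by simpa using q.2)).subset fun v hv ↦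
        ⟨q, by simp, hv⟩
    have hcard := card_places_le q.2 hfin.toFinset (by simp)
    have hne : Nonempty (Fin n) := ⟨⟨0, Module.finrank_pos⟩⟩
    let g : hfin.toFinset ↪ Fin n := hfin.toFinset.equivFin.toEmbedding.trans (Fin.castLEEmb hcard)
    refine ⟨fun v ↦ if h : v ∈ hfin.toFinset then g ⟨v, h⟩ else hne.some, fun v hv w hw h ↦ ?_⟩
    rw [← Set.Finite.mem_toFinset hfin] at hv hw
    simp only [hv, hw, dif_pos] at h
    exact congrArg Subtype.val (g.injective h)
  choose f hf using hidx
  refine le_trans ?_ (eulerSum_prod_fin _ n)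
  refine eulerSum_le_of_injective
    (i := fun v ↦ (⟨p v, hp v⟩, f ⟨p v, hp v⟩ v)) ?_ ?_
  · intro v w h
    replace h := Prod.mk.injEq _ _ _ _ ▸ h
    have h1 : p v = p w := congrArg Subtype.val h.1
    apply Subtype.ext
    refine hf ⟨p v, hp v⟩ (hpv v) ?_ (by rw [h.2, h.1])
    have h2 := hpv w
    rw [← h1] at h2
    exact h2
  · rintro ⟨v, hv⟩
    obtain ⟨k, hk, h⟩ := absNorm_eq_pow (hp v) (hpv v)
    have hk2 : 2 ≤ k := by
      by_contra hlt
      have : k = 1 := by omega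
      rw [h, this, pow_one] at hv
      exact hv (hp v)
    change npow s (Ideal.absNorm v.asIdeal) ≤ npow 2 (p v)
    calc npow s (Ideal.absNorm v.asIdeal) ≤ npow 1 (p v ^ 2) := by
          refine npow_le ?_ zero_le_one hs.le ?_
          · exact (hp v).two_le.trans (Nat.le_self_pow two_ne_zero _)
          · rw [h]
            exact Nat.pow_le_pow_right (hp v).pos hk2
      _ = npow 2 (p v) := by
          rw [npow_apply, npow_apply, Nat.cast_pow, ← Real.rpow_natCast, ← Real.rpow_mul (by positivity)]
          norm_num

lemma primeWeight_le {s : ℝ} (hs : 1 < s) (v : HeightOneSpectrum (𝓞 K)) :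
    primeWeight K s v ≤ 2⁻¹ := by
  refine (npow_le le_rfl zero_le_one hs.le (two_le_absNorm v)).trans ?_
  rw [npow_apply, Nat.cast_ofNat, Real.rpow_neg_one, ENNReal.ofReal_inv_of_pos two_pos]
  simp

/-- If every good place of degree one of `K` splits into two places of degree one of `M`, the pole
of the zeta function of `M` would have order two. -/
lemma false_of_splits (M : Type*) [Field M] [NumberField M] (G : Set (HeightOneSpectrum (𝓞 K)))
    (hG : {v : HeightOneSpectrum (𝓞 K) | (Ideal.absNorm v.asIdeal).Prime ∧ v ∉ G}.Finite)
    (i : G ⊕ G → HeightOneSpectrum (𝓞 M)) (hi : Function.Injective i)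
    (hl : ∀ v, Ideal.absNorm (i (Sum.inl v)).asIdeal = Ideal.absNorm v.1.asIdeal)
    (hr : ∀ v, Ideal.absNorm (i (Sum.inr v)).asIdeal = Ideal.absNorm v.1.asIdeal) : False := by
  classical
  have := hG.to_subtype
  obtain ⟨C₁, hC₁, h₁⟩ := eulerSum_finite
    {v : HeightOneSpectrum (𝓞 K) | (Ideal.absNorm v.asIdeal).Prime ∧ v ∉ G}
  obtain ⟨C₂, hC₂, h₂⟩ := eulerSum_deg_two K
  set C := C₁ * C₂
  have hC : C ≠ ⊤ := mul_ne_top hC₁ hC₂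
  have hkey : ∀ s : ℝ, 1 < s → zetaSum K s ^ 2 ≤ C ^ 2 * zetaSum M s := by
    intro s hs
    set E := eulerSum (fun v : G ↦ primeWeight K s v)
    have hle : zetaSum K s ≤ E * C := by
      refine (zetaSum_le_eulerSum K hs).trans ?_
      refine (eulerSum_le_of_injective (Y := G ⊕
          ({v : HeightOneSpectrum (𝓞 K) | (Ideal.absNorm v.asIdeal).Prime ∧ v ∉ G} ⊕
          {v : HeightOneSpectrum (𝓞 K) // ¬ (Ideal.absNorm v.asIdeal).Prime}))
        (w' := Sum.elim (fun v ↦ primeWeight K s v)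
          (Sum.elim (fun v ↦ primeWeight K s v) (fun v ↦ primeWeight K s v)))
        (i := fun v ↦ if h : v ∈ G then Sum.inl ⟨v, h⟩ else
          if h' : (Ideal.absNorm v.asIdeal).Prime then Sum.inr (Sum.inl ⟨v, h', h⟩) else
            Sum.inr (Sum.inr ⟨v, h'⟩)) ?_ ?_).trans ?_
      · intro v w h
        dsimp only at h
        split_ifs at h <;> simp_all
      · intro v
        split_ifs <;> simp
      · rw [eulerSum_sum, eulerSum_sum]
        exact mul_le_mul' le_rfl (mul_le_mul' (h₁ _ fun v ↦ primeWeight_le hs _) (h₂ s hs))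
    have hge : E * E ≤ zetaSum M s := by
      refine le_trans ?_ (eulerSum_le_zetaSum M s)
      refine le_trans (le_of_eq (eulerSum_sum
        (Sum.elim (fun v : G ↦ primeWeight K s v) (fun v : G ↦ primeWeight K s v))).symm) ?_
      refine eulerSum_le_of_injective hi ?_
      rintro (v | v)
      · exact le_of_eq (by simp [primeWeight, hl])
      · exact le_of_eq (by simp [primeWeight, hr])
    calc zetaSum K s ^ 2 ≤ (E * C) ^ 2 := pow_le_pow_left' hle 2
      _ = C ^ 2 * (E * E) := by ring
      _ ≤ _ := mul_le_mul' le_rfl hge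
  have hK := tendsto_sub_one_mul_dedekindZeta_nhdsGT K
  have hM := tendsto_sub_one_mul_dedekindZeta_nhdsGT M
  have hKne : ∀ᶠ s : ℝ in nhdsWithin 1 (Set.Ioi 1), dedekindZeta K s ≠ 0 := by
    refine (hK.eventually_ne
      (Complex.ofReal_ne_zero.2 (dedekindZeta_residue_ne_zero K))).mono fun s h h0 ↦ h ?_
    rw [h0, mul_zero]
  have hMne : ∀ᶠ s : ℝ in nhdsWithin 1 (Set.Ioi 1), dedekindZeta M s ≠ 0 := by
    refine (hM.eventually_ne
      (Complex.ofReal_ne_zero.2 (dedekindZeta_residue_ne_zero M))).mono fun s h h0 ↦ h ?_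
    rw [h0, mul_zero]
  have hev : ∀ᶠ s : ℝ in nhdsWithin 1 (Set.Ioi 1), ‖((s : ℂ) - 1) * dedekindZeta K s‖ ^ 2 ≤
      C.toReal ^ 2 * ((s - 1) * ‖((s : ℂ) - 1) * dedekindZeta M s‖) := by
    filter_upwards [hKne, hMne, self_mem_nhdsWithin] with s h1 h2 hs
    have hs : 1 < s := hs
    have h3 := hkey s hs
    rw [zetaSum_eq K hs h1, zetaSum_eq M hs h2, ← ENNReal.ofReal_toReal hC,
      ← ENNReal.ofReal_pow (norm_nonneg _), ← ENNReal.ofReal_pow toReal_nonneg,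
      ← ENNReal.ofReal_mul (by positivity), ENNReal.ofReal_le_ofReal_iff (by positivity)] at h3
    have h4 : ‖(s : ℂ) - 1‖ = s - 1 := by
      rw [← Complex.ofReal_one, ← Complex.ofReal_sub, Complex.norm_real,
        Real.norm_of_nonneg (by linarith)]
    rw [norm_mul, norm_mul, h4]
    have h5 : 0 ≤ (s - 1) ^ 2 := sq_nonneg _
    nlinarith [mul_le_mul_of_nonneg_left h3 h5]
  have hlim : Filter.Tendsto (fun s : ℝ ↦ C.toReal ^ 2 * ((s - 1) * ‖((s : ℂ) - 1) * dedekindZeta M s‖))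
      (nhdsWithin 1 (Set.Ioi 1)) (nhds (C.toReal ^ 2 * ((1 - 1) * ‖(dedekindZeta_residue M : ℂ)‖))) := by
    refine ((Filter.Tendsto.mul ?_ hM.norm)).const_mul _
    exact ((continuous_id.sub continuous_const).tendsto (1 : ℝ)).mono_left nhdsWithin_le_nhds
  have h6 := le_of_tendsto_of_tendsto (hK.norm.pow 2) hlim hev
  have h7 : 0 < ‖(dedekindZeta_residue K : ℂ)‖ := by
    rw [norm_pos_iff]
    exact_mod_cast dedekindZeta_residue_ne_zero K
  rw [sub_self, zero_mul, mul_zero] at h6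
  nlinarith

/-- A quadratic extension, described by its universal property. -/
lemma exists_adjoin_sqrt.{u} {K : Type u} [Field K] [NumberField K] {b : K} (hb : ¬ IsSquare b) :
    ∃ (M : Type u) (_ : Field M) (_ : NumberField M) (i : K →+* M) (w : M), w ^ 2 = i b ∧
      ∀ (F : Type) [Field F] (σ : K →+* F) (c : F), c ^ 2 = σ b →
        ∃ σ' : M →+* F, σ'.comp i = σ ∧ σ' w = c := by
  have hirr : Irreducible (X ^ 2 - C b : K[X]) := by
    refine X_pow_sub_C_irreducible_of_prime Nat.prime_two fun c hc ↦ hb ⟨c, ?_⟩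
    rw [← hc, sq]
  have := Fact.mk hirr
  have hmon : (X ^ 2 - C b : K[X]).Monic := monic_X_pow_sub_C b two_ne_zero
  have : Module.Finite K (AdjoinRoot (X ^ 2 - C b : K[X])) := hmon.finite_adjoinRoot
  have : CharZero (AdjoinRoot (X ^ 2 - C b : K[X])) :=
    charZero_of_injective_algebraMap (algebraMap K _).injective
  have hnf : NumberField (AdjoinRoot (X ^ 2 - C b : K[X])) :=
    { to_charZero := inferInstance, to_finiteDimensional := Module.Finite.trans K _ }
  refine ⟨AdjoinRoot (X ^ 2 - C b : K[X]), inferInstance, hnf, AdjoinRoot.of _, AdjoinRoot.root _,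
    ?_, fun F _ σ c hc ↦ ?_⟩
  · have := AdjoinRoot.eval₂_root (X ^ 2 - C b : K[X])
    simpa [sub_eq_zero] using this
  · refine ⟨AdjoinRoot.lift σ c (by simp [hc]), ?_, ?_⟩
    · ext x
      simp
    · simp

/-- A nonsquare of a number field stays a nonsquare at infinitely many places of degree one. -/
theorem exists_embedding_not_isSquare {b : K} (hb : ¬ IsSquare b) (S : Finset ℕ) :
    ∃ (p : ℕ) (_ : Fact p.Prime) (σ : K →+* ℚ_[p]), p ∉ S ∧ ¬ IsSquare (σ b) := by
  classical
  by_contra! hall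
  have hb0 : b ≠ 0 := by
    rintro rfl
    exact hb (IsSquare.zero)
  obtain ⟨M, _, _, i, w, hw, hext⟩ := exists_adjoin_sqrt hb
  obtain ⟨N, hN, hemb⟩ := exists_embedding_of_absNorm K
  let iO : 𝓞 K →+* 𝓞 M := RingOfIntegers.mapRingHom i
  let G : Set (HeightOneSpectrum (𝓞 K)) := {v | (Ideal.absNorm v.asIdeal).Prime ∧
    Ideal.absNorm v.asIdeal ∉ S ∧ ¬ ((Ideal.absNorm v.asIdeal : ℕ) : ℤ) ∣ N}
  have hG : {v : HeightOneSpectrum (𝓞 K) | (Ideal.absNorm v.asIdeal).Prime ∧ v ∉ G}.Finite := by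
    refine (finite_above (K := K) (S := S.filter Nat.Prime ∪ N.natAbs.primeFactors) ?_).subset ?_
    · intro p hp
      rcases Finset.mem_union.1 hp with hp | hp
      · exact (Finset.mem_filter.1 hp).2
      · exact Nat.prime_of_mem_primeFactors hp
    · rintro v ⟨hv, hvG⟩
      refine ⟨Ideal.absNorm v.asIdeal, ?_, Ideal.absNorm_mem _⟩
      simp only [Finset.mem_union, Finset.mem_filter, Nat.mem_primeFactors]
      by_cases hS : Ideal.absNorm v.asIdeal ∈ S
      · exact Or.inl ⟨hS, hv⟩
      · refine Or.inr ⟨hv, Int.natCast_dvd.1 ?_, by simpa using hN⟩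
        by_contra hdvd
        exact hvG ⟨hv, hS, hdvd⟩
  have hsplit : ∀ v : G, ∃ w₁ w₂ : HeightOneSpectrum (𝓞 M), w₁ ≠ w₂ ∧
      w₁.asIdeal.comap iO = v.1.asIdeal ∧ w₂.asIdeal.comap iO = v.1.asIdeal ∧
      Ideal.absNorm w₁.asIdeal = Ideal.absNorm v.1.asIdeal ∧
      Ideal.absNorm w₂.asIdeal = Ideal.absNorm v.1.asIdeal := by
    rintro ⟨v, hv, hvS, hvN⟩
    have := Fact.mk hv
    obtain ⟨σ, hσ⟩ := hemb _ hvN v rfl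
    obtain ⟨c, hc⟩ := hall _ this σ hvS
    obtain ⟨σ₁, h₁, h₁'⟩ := hext _ σ c (by rw [hc, sq])
    obtain ⟨σ₂, h₂, h₂'⟩ := hext _ σ (-c) (by rw [hc, neg_sq, sq])
    have hcomap : ∀ τ : M →+* ℚ_[Ideal.absNorm v.asIdeal], τ.comp i = σ →
        (place τ).asIdeal.comap iO = v.asIdeal := by
      rintro τ hτ
      refine Eq.trans ?_ (congrArg HeightOneSpectrum.asIdeal hσ)
      ext a
      rw [Ideal.mem_comap, mem_place_iff, mem_place_iff, ← hτ]
      rfl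
    refine ⟨place σ₁, place σ₂, fun h ↦ ?_, hcomap σ₁ h₁, hcomap σ₂ h₂, absNorm_place σ₁,
      absNorm_place σ₂⟩
    have hcc : c = -c := h₁'.symm.trans (by rw [place_injective h, h₂'])
    have hc0 : c = 0 := self_eq_neg.1 hcc
    rw [hc0, mul_zero, map_eq_zero] at hc
    exact hb0 hc
  choose w₁ w₂ hne h₁ h₂ hn₁ hn₂ using hsplit
  refine false_of_splits M G hG (Sum.elim w₁ w₂) ?_ hn₁ hn₂
  rintro (v | v) (v' | v') h <;> simp only [Sum.elim_inl, Sum.elim_inr] at h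
  · have : v = v' := Subtype.ext (HeightOneSpectrum.ext (by rw [← h₁, ← h₁, h]))
    rw [this]
  · have : v = v' := Subtype.ext (HeightOneSpectrum.ext (by rw [← h₁, ← h₂, h]))
    subst this
    exact absurd h (hne v)
  · have : v = v' := Subtype.ext (HeightOneSpectrum.ext (by rw [← h₂, ← h₁, h]))
    subst this
    exact absurd h.symm (hne v)
  · have : v = v' := Subtype.ext (HeightOneSpectrum.ext (by rw [← h₂, ← h₂, h]))
    rw [this]

end Places

section Approx

variable {K : Type*} [Field K] [NumberField K]

lemma one_sub_two_mul_ne_zero (a : 𝓞 K) : 1 - 2 * a ≠ 0 := by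
  intro h
  have h1 : (2 : 𝓞 K) * a = 1 := (sub_eq_zero.1 h).symm
  have h2 := congrArg (Algebra.norm ℤ) h1
  rw [map_mul, map_one] at h2
  have h3 : Algebra.norm ℤ (2 : 𝓞 K) = 2 ^ Module.finrank ℤ (𝓞 K) := by
    have := Algebra.norm_algebraMap_of_basis (RingOfIntegers.basis K) (2 : ℤ)
    rw [map_ofNat, ← Module.finrank_eq_card_basis (RingOfIntegers.basis K)] at this
    exact this
  rw [h3, RingOfIntegers.rank] at h2
  have h4 : IsUnit ((2 : ℤ) ^ Module.finrank ℚ K) := .of_mul_eq_one _ h2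
  rw [isUnit_pow_iff Module.finrank_pos.ne'] at h4
  exact absurd h4 (by decide)

/-- Newton iteration for the inverse square root. -/
lemma exists_one_add_mul_sq (P a : 𝓞 K) (N : ℕ) :
    ∃ y b : 𝓞 K, y ≠ 0 ∧ (1 + 4 * (P * a)) * y ^ 2 = 1 + 4 * (P ^ (N + 1) * b) := by
  induction N with
  | zero => exact ⟨1, a, one_ne_zero, by ring⟩
  | succ N ih =>
    obtain ⟨y, b, hy, h⟩ := ih
    refine ⟨y * (1 - 2 * (P ^ (N + 1) * b)), P ^ N * b ^ 2 * (-3 + 4 * (P ^ (N + 1) * b)),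
      mul_ne_zero hy (one_sub_two_mul_ne_zero _), ?_⟩
    rw [mul_pow, ← mul_assoc, h]
    ring

lemma exists_map_tr_eq {p P : ℕ} [Fact p.Prime] (hpP : p ∣ P) {l : K} (hl : l ≠ 0) :
    ∃ N : ℕ, ∀ b : 𝓞 K, (1 + 4 * ((P : 𝓞 K) ^ (N + 1) * b)) ≠ 0 →
      GW.map (algebraMap ℚ ℚ_[p]) (tr K (l * ((1 + 4 * ((P : 𝓞 K) ^ (N + 1) * b) : 𝓞 K) : K))) =
        GW.map (algebraMap ℚ ℚ_[p]) (tr K l) := by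
  classical
  by_contra! h
  choose b hb hne using h
  set e := integralBasis K
  let x : ℕ → K := fun N ↦ ((1 + 4 * ((P : 𝓞 K) ^ (N + 1) * b N) : 𝓞 K) : K)
  have hx : ∀ N, l * x N ≠ 0 := fun N ↦ mul_ne_zero hl (RingOfIntegers.coe_ne_zero_iff.2 (hb N))
  have hinj : Function.Injective (algebraMap ℚ ℚ_[p]) := (algebraMap ℚ ℚ_[p]).injective
  have hdet : IsUnit ((traceMat e l).map (algebraMap ℚ ℚ_[p])).det := by
    have := (algebraMap ℚ ℚ_[p]).map_det (traceMat e l)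
    rw [RingHom.mapMatrix_apply] at this
    rw [← this, isUnit_iff_ne_zero, _root_.map_ne_zero]
    exact det_traceMat_ne_zero e hl
  have hsymm : ∀ c : K, ((traceMat e c).map (algebraMap ℚ ℚ_[p])).IsSymm := fun c ↦
    (traceMat_isSymm e c).map _
  obtain ⟨d, hd, z, hz⟩ : ∃ d : ℤ, d ≠ 0 ∧ ∃ z : 𝓞 K, (d : K) * l = z := by
    obtain ⟨d, hd, hInt⟩ := ((IsFractionRing.isAlgebraic_iff ℤ ℚ K).2
      (Algebra.IsAlgebraic.isAlgebraic (R := ℚ) l)).exists_integral_multiple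
    exact ⟨d, hd, ⟨d • l, hInt⟩, (zsmul_eq_mul _ _).symm⟩
  have hfour : algebraMap (𝓞 K) K 4 = 4 := map_ofNat _ 4
  have hlim : Filter.Tendsto (fun N ↦ (traceMat e (l * x N)).map (algebraMap ℚ ℚ_[p])) Filter.atTop
      (nhds ((traceMat e l).map (algebraMap ℚ ℚ_[p]))) := by
    refine tendsto_pi_nhds.2 fun i ↦ tendsto_pi_nhds.2 fun j ↦ ?_
    rw [tendsto_iff_norm_sub_tendsto_zero]
    have hbound : ∀ N, ‖(traceMat e (l * x N)).map (algebraMap ℚ ℚ_[p]) i j -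
        (traceMat e l).map (algebraMap ℚ ℚ_[p]) i j‖ ≤ ‖(d : ℚ_[p])‖⁻¹ * (p : ℝ)⁻¹ ^ (N + 1) := by
      intro N
      obtain ⟨P', rfl⟩ := hpP
      set w : 𝓞 K := 4 * (P' : 𝓞 K) ^ (N + 1) * z * b N *
        (RingOfIntegers.basis K i * RingOfIntegers.basis K j)
      have h1 : (d : ℚ) * (traceMat e (l * x N) i j - traceMat e l i j) =
          (p : ℚ) ^ (N + 1) * (Algebra.trace ℤ (𝓞 K) w : ℤ) := by
        rw [traceMat_apply, traceMat_apply, ← map_sub, Algebra.coe_trace_int]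
        have h2 : (w : K) = 4 * (P' : K) ^ (N + 1) * ((d : K) * l) * (b N : K) * (e i * e j) := by
          rw [hz]
          simp [w, e, integralBasis_apply, hfour]
        rw [h2]
        have h3 : ∀ (q : ℚ) (y : K), q * Algebra.trace ℚ K y = Algebra.trace ℚ K ((q : K) * y) := by
          intro q y
          rw [← smul_eq_mul, ← map_smul, Algebra.smul_def]
          rfl
        rw [h3, ← Nat.cast_pow]
        have h4 := h3 ((p ^ (N + 1) : ℕ) : ℚ)
        rw [h4]
        congr 1
        simp only [x, map_add, map_one, map_mul, map_pow, map_natCast, hfour]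
        push_cast
        ring
      have h5 := congrArg (fun q : ℚ ↦ ‖algebraMap ℚ ℚ_[p] q‖) h1
      simp only [map_mul, map_sub, map_pow, map_intCast, map_natCast, norm_mul, norm_pow,
        Padic.norm_p] at h5
      have h6 : ‖((Algebra.trace ℤ (𝓞 K) w : ℤ) : ℚ_[p])‖ ≤ 1 := Padic.norm_int_le_one _
      have h7 : 0 < ‖(d : ℚ_[p])‖ := norm_pos_iff.2 (by exact_mod_cast hd)
      rw [le_inv_mul_iff₀ h7, Matrix.map_apply, Matrix.map_apply, h5]
      exact mul_le_of_le_one_right (by positivity) h6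
    refine squeeze_zero (fun _ ↦ norm_nonneg _) hbound ?_
    rw [← mul_zero ‖(d : ℚ_[p])‖⁻¹]
    refine Filter.Tendsto.const_mul _ ((tendsto_pow_atTop_nhds_zero_of_lt_one (by positivity)
      (inv_lt_one_of_one_lt₀ ?_)).comp (Filter.tendsto_add_atTop_nat 1))
    exact_mod_cast (Fact.out : p.Prime).one_lt
  obtain ⟨N, hN⟩ := (hlim.eventually (eventually_cong (hsymm l) hdet)).exists
  refine hne N ?_
  have := (hN (hsymm _)).gw_eq (hsymm l) hdet.ne_zero
  rw [gw_map _ (traceMat_isSymm e l) (det_traceMat_ne_zero e hl),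
    gw_map _ (traceMat_isSymm e _) (det_traceMat_ne_zero e (hx N)), gw_traceMat e hl,
    gw_traceMat e (hx N)] at this
  exact this.symm

end Approx

section Near

variable (K : Type*) [Field K] [NumberField K]

/-- The totally positive elements that cannot be distinguished from `1` by the trace forms at the
primes of `S`. -/
noncomputable def near (S : Finset ℕ) : Subgroup Kˣ where
  carrier := {x | (∀ τ : K →+* ℝ, 0 < τ x) ∧ ∀ p ∈ S, ∀ [Fact p.Prime], ∀ l : K, l ≠ 0 →
    GW.map (algebraMap ℚ ℚ_[p]) (tr K (l * x)) = GW.map (algebraMap ℚ ℚ_[p]) (tr K l)}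
  one_mem' := ⟨fun τ ↦ by simp, fun p _ _ l _ ↦ by simp⟩
  mul_mem' := by
    rintro x y ⟨hx, hx'⟩ ⟨hy, hy'⟩
    refine ⟨fun τ ↦ ?_, fun p hp _ l hl ↦ ?_⟩
    · rw [Units.val_mul, map_mul]
      exact mul_pos (hx τ) (hy τ)
    · rw [Units.val_mul, ← mul_assoc, hy' p hp _ (mul_ne_zero hl x.ne_zero), hx' p hp _ hl]
  inv_mem' := by
    rintro x ⟨hx, hx'⟩
    refine ⟨fun τ ↦ ?_, fun p hp _ l hl ↦ ?_⟩
    · rw [Units.val_inv_eq_inv_val, map_inv₀]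
      exact inv_pos.2 (hx τ)
    · rw [← hx' p hp (l * (x⁻¹ : Kˣ)) (mul_ne_zero hl (x⁻¹).ne_zero), mul_assoc, Units.inv_mul,
        mul_one]

variable {K} {S : Finset ℕ}

lemma pos_of_mem_near {x : Kˣ} (hx : x ∈ near K S) (τ : K →+* ℝ) : 0 < τ x := hx.1 τ

lemma map_tr_of_mem_near {x : Kˣ} (hx : x ∈ near K S) {p : ℕ} (hp : p ∈ S) [Fact p.Prime] {l : K}
    (hl : l ≠ 0) :
    GW.map (algebraMap ℚ ℚ_[p]) (tr K (l * x)) = GW.map (algebraMap ℚ ℚ_[p]) (tr K l) :=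
  hx.2 p hp l hl

lemma mem_near_of_one_add {x c : Kˣ} (hx : ∀ τ : K →+* ℝ, 0 < τ x) {a : 𝓞 K}
    (h : (x * c ^ 2 : K) = ((1 + 4 * (((∏ p ∈ S, p : ℕ) : 𝓞 K) * a) : 𝓞 K) : K)) :
    x ∈ near K S := by
  refine ⟨hx, fun p hp _ l hl ↦ ?_⟩
  obtain ⟨N, hN⟩ := exists_map_tr_eq (p := p) (Finset.dvd_prod_of_mem (fun q ↦ q) hp) hl
  obtain ⟨y, b, hy, hyb⟩ := exists_one_add_mul_sq ((∏ p ∈ S, p : ℕ) : 𝓞 K) a N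
  have hy' : (y : K) ≠ 0 := RingOfIntegers.coe_ne_zero_iff.2 hy
  have h1 : ((x : K) * (c * y) ^ 2) =
      ((1 + 4 * (((∏ p ∈ S, p : ℕ) : 𝓞 K) ^ (N + 1) * b) : 𝓞 K) : K) := by
    rw [← hyb, mul_pow, ← mul_assoc, h]
    rfl
  have h2 : (1 + 4 * (((∏ p ∈ S, p : ℕ) : 𝓞 K) ^ (N + 1) * b)) ≠ 0 := by
    refine RingOfIntegers.coe_ne_zero_iff.1 (h1.symm.trans_ne ?_)
    exact mul_ne_zero x.ne_zero (pow_ne_zero _ (mul_ne_zero c.ne_zero hy'))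
  rw [← hN b h2, ← h1, ← mul_assoc, tr_mul_sq (mul_ne_zero hl x.ne_zero)
    (mul_ne_zero c.ne_zero hy')]

lemma exists_denominator (F : Finset (HeightOneSpectrum (𝓞 K))) {x : K} (hx : x ≠ 0)
    (h : ∀ p : ℕ, p.Prime → ∀ v ∈ F, (p : 𝓞 K) ∈ v.asIdeal → ∀ w : HeightOneSpectrum (𝓞 K),
      (p : 𝓞 K) ∈ w.asIdeal → 0 ≤ ord w x) :
    ∃ d z : 𝓞 K, (d : K) * x = z ∧ ∀ v ∈ F, d ∉ v.asIdeal := by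
  let I : Ideal (𝓞 K) :=
    (1 : Submodule (𝓞 K) K).comap (LinearMap.toSpanSingleton (𝓞 K) K x)
  have hI : ∀ r, r ∈ I ↔ ∃ z : 𝓞 K, (r : K) * x = z := by
    intro r
    rw [Submodule.mem_comap, LinearMap.toSpanSingleton_apply, Submodule.mem_one,
      Algebra.smul_def]
    exact ⟨fun ⟨z, hz⟩ ↦ ⟨z, hz.symm⟩, fun ⟨z, hz⟩ ↦ ⟨z, hz.symm⟩⟩
  have h1 : ¬ ((I : Set (𝓞 K)) ⊆ ⋃ v ∈ (F : Set (HeightOneSpectrum (𝓞 K))), v.asIdeal) := by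
    classical
    rcases F.eq_empty_or_nonempty with rfl | ⟨v₀, hv₀⟩
    · intro hsub
      simpa using hsub I.zero_mem
    rw [Ideal.subset_union_prime v₀ v₀ fun v _ _ _ ↦ v.isPrime]
    rintro ⟨v, hv, hle⟩
    obtain ⟨p, hp, hpv⟩ := exists_prime_mem' v
    obtain ⟨N, hN, hz⟩ := exists_natCast_mul_mem hp hx (h p hp v hv hpv)
    have hNv : (N : 𝓞 K) ∈ v.asIdeal := hle ((hI _).2 (by simpa using hz))
    have hN0 : N ≠ 0 := by
      rintro rfl
      exact hp.ne_one (by simpa using hN)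
    obtain ⟨q, hq, hqv⟩ := exists_prime_mem v hN0 hNv
    have := eq_of_prime_mem hp (Nat.prime_of_mem_primeFactors hq) hpv hqv
    subst this
    exact hp.one_lt.ne' (Nat.Coprime.eq_one_of_dvd hN (Nat.dvd_of_mem_primeFactors hq))
  obtain ⟨d, hd, hdF⟩ := Set.not_subset.1 h1
  obtain ⟨z, hz⟩ := (hI d).1 hd
  refine ⟨d, z, hz, fun v hv hdv ↦ hdF ?_⟩
  exact Set.mem_biUnion (show v ∈ (F : Set _) from hv) hdv

variable (S) in
/-- The places above the primes of `S`. -/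
noncomputable def placesAbove (hS : ∀ p ∈ S, p.Prime) : Finset (HeightOneSpectrum (𝓞 K)) :=
  (finite_above hS).toFinset

lemma mem_placesAbove {hS : ∀ p ∈ S, p.Prime} {v : HeightOneSpectrum (𝓞 K)} :
    v ∈ placesAbove S hS ↔ Above S v := by
  simp [placesAbove]

lemma ord_finset_prod_uniformizer {F : Finset (HeightOneSpectrum (𝓞 K))}
    {ϖ : HeightOneSpectrum (𝓞 K) → Kˣ} (h1 : ∀ v ∈ F, ord v (ϖ v : K) = 1)
    (h0 : ∀ v ∈ F, ∀ w ∈ F, w ≠ v → ord w (ϖ v : K) = 0) (e : HeightOneSpectrum (𝓞 K) → ℤ)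
    {w : HeightOneSpectrum (𝓞 K)} (hw : w ∈ F) : ord w ((∏ v ∈ F, ϖ v ^ e v : Kˣ) : K) = e w := by
  classical
  have : ((∏ v ∈ F, ϖ v ^ e v : Kˣ) : K) = ∏ v ∈ F, (ϖ v : K) ^ e v := by
    push_cast
    rfl
  rw [this, ord_prod _ fun i _ ↦ zpow_ne_zero _ (ϖ i).ne_zero, Finset.sum_eq_single w]
  · rw [ord_zpow, h1 w hw, mul_one]
  · intro v hv hvw
    rw [ord_zpow, h0 v hv w hw hvw.symm, mul_zero]
  · exact fun h ↦ absurd hw h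

lemma exists_uniformizers (F : Finset (HeightOneSpectrum (𝓞 K))) :
    ∃ ϖ : HeightOneSpectrum (𝓞 K) → Kˣ, (∀ v ∈ F, ord v (ϖ v : K) = 1) ∧
      ∀ v ∈ F, ∀ w ∈ F, w ≠ v → ord w (ϖ v : K) = 0 := by
  choose ϖ h0 h1 h2 using exists_uniformizer_finset (K := K) F
  exact ⟨fun v ↦ Units.mk0 (ϖ v : K) (RingOfIntegers.coe_ne_zero_iff.2 (h0 v)),
    fun v _ ↦ h1 v, fun v _ ↦ h2 v⟩

lemma coe_ringOfIntegers_mul (a b : 𝓞 K) : ((a * b : 𝓞 K) : K) = a * b := rfl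

lemma coe_ringOfIntegers_zero : ((0 : 𝓞 K) : K) = 0 := rfl

lemma exists_integral_rep (hS : ∀ p ∈ S, p.Prime) {ϖ : HeightOneSpectrum (𝓞 K) → Kˣ}
    (h1 : ∀ v ∈ placesAbove S hS, ord v (ϖ v : K) = 1)
    (h0 : ∀ v ∈ placesAbove S hS, ∀ w ∈ placesAbove S hS, w ≠ v → ord w (ϖ v : K) = 0) (x : Kˣ) :
    ∃ (y : Kˣ) (z : 𝓞 K), (∀ v, Above S v → z ∉ v.asIdeal) ∧
      ((x * y ^ 2 * ∏ v ∈ placesAbove S hS, ϖ v ^ (-(ord v (x : K) % 2)) : Kˣ) : K) = z := by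
  classical
  set F := placesAbove (K := K) S hS
  set y₁ : Kˣ := ∏ v ∈ F, ϖ v ^ (-(ord v (x : K) / 2))
  set q : Kˣ := ∏ v ∈ F, ϖ v ^ (-(ord v (x : K) % 2))
  have hord : ∀ w, Above S w → ord w ((x * y₁ ^ 2 * q : Kˣ) : K) = 0 := by
    intro w hw
    have hwF : w ∈ F := mem_placesAbove.2 hw
    rw [Units.val_mul, Units.val_mul, Units.val_pow_eq_pow_val,
      ord_mul (mul_ne_zero x.ne_zero (pow_ne_zero _ y₁.ne_zero)) q.ne_zero,
      ord_mul x.ne_zero (pow_ne_zero _ y₁.ne_zero), ord_pow,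
      ord_finset_prod_uniformizer h1 h0 _ hwF, ord_finset_prod_uniformizer h1 h0 _ hwF]
    have := Int.emod_add_mul_ediv (ord w (x : K)) 2
    push_cast
    linarith
  obtain ⟨d, z, hz, hd⟩ := exists_denominator F (x * y₁ ^ 2 * q : Kˣ).ne_zero (by
    intro p hp v hv hpv w hpw
    refine (hord w ?_).ge
    rw [above_iff hS hp hpw, ← above_iff hS hp hpv]
    exact mem_placesAbove.1 hv)
  by_cases hF : d = 0
  · subst hF
    have hno : ∀ v, ¬ Above S v := fun v hv ↦ hd v (mem_placesAbove.2 hv) v.asIdeal.zero_mem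
    obtain ⟨a, b, hb, hab⟩ := IsFractionRing.div_surjective (A := 𝓞 K) (x * q : Kˣ).1
    have hb0 : (b : K) ≠ 0 := RingOfIntegers.coe_ne_zero_iff.2 (nonZeroDivisors.ne_zero hb)
    refine ⟨Units.mk0 (b : K) hb0, a * b, fun v hv ↦ absurd hv (hno v), ?_⟩
    have hab' : (x * q : K) = (a : K) / b := hab.symm
    have : ((x * Units.mk0 (b : K) hb0 ^ 2 * q : Kˣ) : K) = x * q * b ^ 2 := by
      push_cast
      rw [Units.val_mk0]
      ring
    rw [this, hab', coe_ringOfIntegers_mul]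
    field_simp
  · have hd0 : (d : K) ≠ 0 := RingOfIntegers.coe_ne_zero_iff.2 hF
    have hval : ((x * (y₁ * Units.mk0 (d : K) hd0) ^ 2 * q : Kˣ) : K) = ((d * z : 𝓞 K) : K) := by
      rw [coe_ringOfIntegers_mul, ← hz]
      push_cast
      rw [Units.val_mk0]
      ring
    refine ⟨y₁ * Units.mk0 (d : K) hd0, d * z, fun v hv hmem ↦ ?_, hval⟩
    have hdv := hd v (mem_placesAbove.2 hv)
    have hzv : z ∈ v.asIdeal := (v.isPrime.mem_or_mem hmem).resolve_left hdv
    have hz0 : z ≠ 0 := by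
      rintro rfl
      rw [coe_ringOfIntegers_zero] at hz
      exact mul_ne_zero hd0 (Units.ne_zero _) hz
    have := (ord_pos_iff hz0).2 hzv
    rw [← hz, ord_mul hd0 (Units.ne_zero _), hord v hv, ord_eq_zero_of_notMem hdv] at this
    exact lt_irrefl _ this

end Near

section Count

variable {K : Type*} [Field K] [NumberField K] {S : Finset ℕ}

lemma natCast_notMem_of_not_above {D : ℕ} (hD : D ≠ 0)
    (hDS : D.primeFactors ⊆ S) {v : HeightOneSpectrum (𝓞 K)} (hv : ¬ Above S v) :
    (D : 𝓞 K) ∉ v.asIdeal := by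
  intro h
  obtain ⟨p, hp, hpv⟩ := exists_prime_mem v hD h
  exact hv ⟨p, hDS hp, hpv⟩

lemma natCast_dvd_of_mem_pow {D : ℕ} (hD : D ≠ 0) (hDS : D.primeFactors ⊆ S) {a : 𝓞 K}
    (h : ∀ v : HeightOneSpectrum (𝓞 K), Above S v →
      a ∈ v.asIdeal ^ (ord v ((D : 𝓞 K) : K)).toNat) : (D : 𝓞 K) ∣ a := by
  by_cases ha : a = 0
  · rw [ha]
    exact dvd_zero _
  have hD0 : (D : 𝓞 K) ≠ 0 := Nat.cast_ne_zero.2 hD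
  have hDK : ((D : 𝓞 K) : K) ≠ 0 := RingOfIntegers.coe_ne_zero_iff.2 hD0
  have haK : (a : K) ≠ 0 := RingOfIntegers.coe_ne_zero_iff.2 ha
  obtain ⟨c, hc⟩ := HeightOneSpectrum.mem_integers_of_valuation_le_one (R := 𝓞 K) K
    ((a : K) / (D : 𝓞 K)) (by
      intro v
      rw [← ord_nonneg_iff (div_ne_zero haK hDK), ord_div haK hDK, sub_nonneg]
      by_cases hv : Above S v
      · have := (le_ord_iff (v := v) ha _).2 (h v hv)
        rwa [Int.toNat_of_nonneg (ord_coe_nonneg _)] at this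
      · rw [ord_eq_zero_of_notMem (natCast_notMem_of_not_above hD hDS hv)]
        exact ord_coe_nonneg _)
  refine ⟨c, RingOfIntegers.coe_injective ?_⟩
  rw [eq_div_iff hDK] at hc
  exact hc.symm.trans (mul_comm _ _)

lemma mem_pow_or_mem_pow {D : ℕ} (hD : D ≠ 0) {x c : 𝓞 K} (hx : x ^ 2 - 1 = 2 * D * c)
    (v : HeightOneSpectrum (𝓞 K)) :
    x - 1 ∈ v.asIdeal ^ (ord v ((D : 𝓞 K) : K)).toNat ∨
      x + 1 ∈ v.asIdeal ^ (ord v ((D : 𝓞 K) : K)).toNat := by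
  by_cases h1 : x - 1 = 0
  · left
    rw [h1]
    exact Ideal.zero_mem _
  by_cases h2 : x + 1 = 0
  · right
    rw [h2]
    exact Ideal.zero_mem _
  have hD0 : (D : 𝓞 K) ≠ 0 := Nat.cast_ne_zero.2 hD
  have hprod : (x - 1) * (x + 1) = 2 * D * c := by rw [← hx]; ring
  have hc : c ≠ 0 := by
    rintro rfl
    rw [mul_zero] at hprod
    exact mul_ne_zero h1 h2 hprod
  have h20 : (2 : 𝓞 K) ≠ 0 := two_ne_zero
  rw [← le_ord_iff h1, ← le_ord_iff h2, Int.toNat_of_nonneg (ord_coe_nonneg _)]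
  have hK := congrArg (fun a : 𝓞 K ↦ ord v (a : K)) hprod
  simp only [coe_ringOfIntegers_mul] at hK
  have ne := fun {a : 𝓞 K} (h : a ≠ 0) ↦ RingOfIntegers.coe_ne_zero_iff.2 h
  rw [ord_mul (ne h1) (ne h2), ord_mul (mul_ne_zero (ne h20) (ne hD0)) (ne hc),
    ord_mul (ne h20) (ne hD0)] at hK
  have hc0 := ord_coe_nonneg (v := v) c
  by_contra! hcon
  have h3 : ord v ((2 : 𝓞 K) : K) < ord v ((x - 1 : 𝓞 K) : K) := by linarith
  have h4 : ord v ((2 : 𝓞 K) : K) < ord v ((x + 1 : 𝓞 K) : K) := by linarith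
  set k := (ord v ((2 : 𝓞 K) : K)).toNat with hk
  have hk' : (k : ℤ) = ord v ((2 : 𝓞 K) : K) := Int.toNat_of_nonneg (ord_coe_nonneg _)
  have h5 := (le_ord_iff (v := v) h1 (k + 1)).1 (by
    rw [Nat.cast_add, Nat.cast_one, hk']
    exact Int.add_one_le_iff.2 h3)
  have h6 := (le_ord_iff (v := v) h2 (k + 1)).1 (by
    rw [Nat.cast_add, Nat.cast_one, hk']
    exact Int.add_one_le_iff.2 h4)
  have h7 : (2 : 𝓞 K) ∈ v.asIdeal ^ (k + 1) := by
    have := Ideal.sub_mem _ h6 h5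
    convert this using 1
    ring
  have h8 := (le_ord_iff (v := v) h20 (k + 1)).2 h7
  push_cast at h8
  linarith

lemma card_quotient_two : Nat.card (𝓞 K ⧸ Ideal.span {(2 : 𝓞 K)}) = 2 ^ Module.finrank ℚ K := by
  have h3 : Algebra.norm ℤ (2 : 𝓞 K) = 2 ^ Module.finrank ℤ (𝓞 K) := by
    have := Algebra.norm_algebraMap_of_basis (RingOfIntegers.basis K) (2 : ℤ)
    rw [map_ofNat, ← Module.finrank_eq_card_basis (RingOfIntegers.basis K)] at this
    exact this
  have := Ideal.absNorm_span_singleton (2 : 𝓞 K)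
  rw [Ideal.absNorm_apply, Submodule.cardQuot_apply, h3, RingOfIntegers.rank, Int.natAbs_pow] at this
  exact this

lemma finite_quotient_natCast {N : ℕ} (hN : N ≠ 0) :
    Finite (𝓞 K ⧸ Ideal.span {(N : 𝓞 K)}) := by
  refine Ideal.finiteQuotientOfFreeOfNeBot _ ?_
  rw [Ne, Ideal.span_singleton_eq_bot]
  exact Nat.cast_ne_zero.2 hN

variable (K) in
/-- Square roots of one modulo twice `D`. -/
lemma card_ker_sq_le (hS : ∀ p ∈ S, p.Prime) {D : ℕ} (hD : D ≠ 0) (hDS : D.primeFactors ⊆ S) :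
    Nat.card (powMonoidHom 2 : (𝓞 K ⧸ Ideal.span {((2 * D : ℕ) : 𝓞 K)})ˣ →*
      (𝓞 K ⧸ Ideal.span {((2 * D : ℕ) : 𝓞 K)})ˣ).ker ≤
      2 ^ (placesAbove (K := K) S hS).card * 2 ^ Module.finrank ℚ K := by
  classical
  set I := Ideal.span {((2 * D : ℕ) : 𝓞 K)}
  set H := (powMonoidHom 2 : (𝓞 K ⧸ I)ˣ →* (𝓞 K ⧸ I)ˣ).ker
  set F := placesAbove (K := K) S hS
  choose x hx using fun u : H ↦ Ideal.Quotient.mk_surjective (I := I) (u.1 : 𝓞 K ⧸ I)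
  have hx2 : ∀ u, ∃ c : 𝓞 K, x u ^ 2 - 1 = 2 * D * c := by
    intro u
    have h1 : ((u.1 ^ 2 : (𝓞 K ⧸ I)ˣ) : 𝓞 K ⧸ I) = 1 := by
      have := u.2
      rw [MonoidHom.mem_ker, powMonoidHom_apply] at this
      rw [this, Units.val_one]
    rw [Units.val_pow_eq_pow_val, ← hx, ← map_pow, ← map_one (Ideal.Quotient.mk I),
      Ideal.Quotient.eq, Ideal.mem_span_singleton] at h1
    obtain ⟨c, hc⟩ := h1
    exact ⟨c, by rw [hc]; push_cast; ring⟩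
  choose c hc using hx2
  let sg : H → F → Bool := fun u v ↦
    decide (x u - 1 ∈ v.1.asIdeal ^ (ord v.1 ((D : 𝓞 K) : K)).toNat)
  have hdvd : ∀ u u', sg u = sg u' → (D : 𝓞 K) ∣ x u - x u' := by
    intro u u' h
    refine natCast_dvd_of_mem_pow hD hDS fun v hv ↦ ?_
    have h1 := congrFun h ⟨v, mem_placesAbove.2 hv⟩
    simp only [sg, decide_eq_decide] at h1
    by_cases h2 : x u - 1 ∈ v.asIdeal ^ (ord v ((D : 𝓞 K) : K)).toNat
    · have := Ideal.sub_mem _ h2 (h1.1 h2)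
      convert this using 1
      ring
    · have := Ideal.sub_mem _ ((mem_pow_or_mem_pow hD (hc u) v).resolve_left h2)
        ((mem_pow_or_mem_pow hD (hc u') v).resolve_left (h1.not.1 h2))
      convert this using 1
      ring
  let base : (F → Bool) → 𝓞 K := fun s ↦ if h : ∃ u, sg u = s then x h.choose else 0
  have hbase : ∀ u, (D : 𝓞 K) ∣ x u - base (sg u) := by
    intro u
    have h : ∃ u', sg u' = sg u := ⟨u, rfl⟩
    simp only [base, dif_pos h]
    exact hdvd _ _ h.choose_spec.symm
  choose d hd using hbase
  have hfin : Finite (𝓞 K ⧸ Ideal.span {(2 : 𝓞 K)}) := finite_quotient_natCast two_ne_zero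
  refine (Nat.card_le_card_of_injective
    (fun u : H ↦ (sg u, Ideal.Quotient.mk (Ideal.span {(2 : 𝓞 K)}) (d u))) ?_).trans_eq ?_
  · intro u u' h
    rw [Prod.mk.injEq, Ideal.Quotient.eq, Ideal.mem_span_singleton] at h
    obtain ⟨h1, b, hb⟩ := h
    refine Subtype.ext (Units.ext ?_)
    rw [← hx, ← hx, Ideal.Quotient.eq, Ideal.mem_span_singleton]
    refine ⟨b, ?_⟩
    have h2 := hd u
    have h3 := hd u'
    rw [h1] at h2
    push_cast
    linear_combination h2 - h3 + (D : 𝓞 K) * hb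
  · rw [Nat.card_prod, card_quotient_two, Nat.card_fun, Nat.card_eq_fintype_card, Fintype.card_bool,
      Nat.card_eq_fintype_card, Fintype.card_coe]

lemma isUnit_mk_of_notMem {D : ℕ} (hD : D ≠ 0) (hDS : D.primeFactors ⊆ S) {z : 𝓞 K}
    (hz : ∀ v : HeightOneSpectrum (𝓞 K), Above S v → z ∉ v.asIdeal) :
    IsUnit (Ideal.Quotient.mk (Ideal.span {(D : 𝓞 K)}) z) := by
  by_contra h
  obtain ⟨M, hM, hzM⟩ := exists_max_ideal_of_mem_nonunits h
  have hprime : (M.comap (Ideal.Quotient.mk (Ideal.span {(D : 𝓞 K)}))).IsPrime :=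
    Ideal.comap_isPrime _ M
  have hDM : (D : 𝓞 K) ∈ M.comap (Ideal.Quotient.mk (Ideal.span {(D : 𝓞 K)})) := by
    rw [Ideal.mem_comap, Ideal.Quotient.eq_zero_iff_mem.2 (Ideal.mem_span_singleton_self _)]
    exact M.zero_mem
  let v : HeightOneSpectrum (𝓞 K) := ⟨M.comap (Ideal.Quotient.mk _), hprime, by
    intro hbot
    rw [hbot, Ideal.mem_bot] at hDM
    exact hD (by exact_mod_cast hDM)⟩
  have hv : Above S v := by
    by_contra hv
    exact natCast_notMem_of_not_above hD hDS hv hDM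
  exact hz v hv hzM

lemma card_real_embeddings_le : Nat.card (K →+* ℝ) ≤ Module.finrank ℚ K := by
  rw [← Embeddings.card K ℂ, ← Nat.card_eq_fintype_card]
  refine Nat.card_le_card_of_injective (fun τ ↦ (algebraMap ℝ ℂ).comp τ) fun τ τ' h ↦ ?_
  ext x
  exact (algebraMap ℝ ℂ).injective (congrArg (fun f : K →+* ℂ ↦ f x) h)

lemma finite_real_embeddings : Finite (K →+* ℝ) := by
  refine Finite.of_injective (fun τ : K →+* ℝ ↦ (algebraMap ℝ ℂ).comp τ) fun τ τ' h ↦ ?_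
  ext x
  exact (algebraMap ℝ ℂ).injective (congrArg (fun f : K →+* ℂ ↦ f x) h)

lemma index_le_of_code {G C : Type*} [Group G] [Finite C] (H : Subgroup G) (f : G → C)
    (hf : ∀ x y, f x = f y → x⁻¹ * y ∈ H) : H.index ≠ 0 ∧ H.index ≤ Nat.card C := by
  have hinj : Function.Injective (fun q : G ⧸ H ↦ f q.out) := by
    intro q q' h
    rw [← q.out_eq', ← q'.out_eq']
    exact QuotientGroup.eq.2 (hf _ _ h)
  have := Finite.of_injective _ hinj
  exact ⟨Nat.card_pos.ne', Nat.card_le_card_of_injective _ hinj⟩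

lemma mul_mul_sq_mul_inv_sq {G : Type*} [CommGroup G] (u w : G) :
    u * (u * w ^ 2) * ((u * w)⁻¹) ^ 2 = 1 := by
  rw [inv_pow, mul_pow, ← mul_assoc, ← pow_two, mul_inv_cancel]

variable (K) in
theorem near_index (hS : ∀ p ∈ S, p.Prime) (h2 : 2 ∈ S) : (near K S).index ≠ 0 ∧
    (near K S).index ≤ 4 ^ (Module.finrank ℚ K + (placesAbove (K := K) S hS).card) := by
  classical
  set P := ∏ p ∈ S, p with hP
  have hP0 : P ≠ 0 := Finset.prod_ne_zero_iff.2 fun p hp ↦ (hS p hp).ne_zero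
  set D := 2 * P with hDdef
  have hD : D ≠ 0 := mul_ne_zero two_ne_zero hP0
  have hPS : P.primeFactors ⊆ S := by
    intro q hq
    obtain ⟨p, hp, hqp⟩ := (Prime.dvd_finsetProd_iff
      (Nat.prime_of_mem_primeFactors hq).prime _).1 (Nat.dvd_of_mem_primeFactors hq)
    rwa [(Nat.prime_dvd_prime_iff_eq (Nat.prime_of_mem_primeFactors hq) (hS p hp)).1 hqp]
  have hmul : ∀ N : ℕ, N ≠ 0 → N.primeFactors ⊆ S → (2 * N).primeFactors ⊆ S := by
    intro N hN hNS
    rw [Nat.primeFactors_mul two_ne_zero hN, Nat.prime_two.primeFactors]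
    exact Finset.union_subset (by simpa using h2) hNS
  have hDS : D.primeFactors ⊆ S := hmul P hP0 hPS
  have h2D : 2 * D ≠ 0 := mul_ne_zero two_ne_zero hD
  set F := placesAbove (K := K) S hS
  set I := Ideal.span {((2 * D : ℕ) : 𝓞 K)}
  have hfinR : Finite (𝓞 K ⧸ I) := finite_quotient_natCast h2D
  set sq : (𝓞 K ⧸ I)ˣ →* (𝓞 K ⧸ I)ˣ := powMonoidHom 2
  obtain ⟨ϖ, hϖ1, hϖ0⟩ := exists_uniformizers F
  choose y z hz hyz using exists_integral_rep hS hϖ1 hϖ0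
  choose U hU using fun x ↦ isUnit_mk_of_notMem h2D (hmul D hD hDS) (hz x)
  have := finite_real_embeddings (K := K)
  have hfinF : Finite F := inferInstance
  obtain ⟨h, h'⟩ := index_le_of_code (near K S)
    (C := ((K →+* ℝ) → Bool) × (F → ZMod 2) × ((𝓞 K ⧸ I)ˣ ⧸ sq.range))
    (fun x ↦ (fun τ ↦ decide (0 < τ x), fun v ↦ (ord v.1 (x : K) : ZMod 2), (U x : _ ⧸ sq.range)))
    (by
      intro x x' hxx
      rw [Prod.mk.injEq, Prod.mk.injEq] at hxx
      obtain ⟨hsign, hord, hcls⟩ := hxx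
      obtain ⟨W, hW⟩ := QuotientGroup.eq.1 hcls
      obtain ⟨r, hr⟩ := Ideal.Quotient.mk_surjective (I := I) ((U x * W)⁻¹ : (𝓞 K ⧸ I)ˣ).1
      set q : Kˣ := ∏ v ∈ F, ϖ v ^ (-(ord v (x : K) % 2))
      have hq : ∏ v ∈ F, ϖ v ^ (-(ord v (x' : K) % 2)) = q := by
        refine Finset.prod_congr rfl fun v hv ↦ ?_
        have := congrFun hord ⟨v, hv⟩
        rw [ZMod.intCast_eq_intCast_iff] at this
        rw [show ord v (x' : K) % 2 = ord v (x : K) % 2 from this.symm]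
      have hz1 : ((x * y x ^ 2 * q : Kˣ) : K) = z x := hyz x
      have hz2 : ((x' * y x' ^ 2 * q : Kˣ) : K) = z x' := by
        rw [← hq]
        exact hyz x'
      have hW' : U x' = U x * W ^ 2 := by
        rw [show W ^ 2 = sq W from rfl, hW, mul_inv_cancel_left]
      have hone : Ideal.Quotient.mk I (z x * z x' * r ^ 2) = Ideal.Quotient.mk I 1 := by
        rw [map_mul, map_mul, map_pow, hr, ← hU, ← hU, map_one, hW', ← Units.val_pow_eq_pow_val,
          ← Units.val_mul, ← Units.val_mul, ← Units.val_one]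
        congr 1
        exact mul_mul_sq_mul_inv_sq _ _
      rw [Ideal.Quotient.eq, Ideal.mem_span_singleton] at hone
      obtain ⟨a, ha⟩ := hone
      have ha' : z x * z x' * r ^ 2 = 1 + 4 * ((P : 𝓞 K) * a) := by
        rw [sub_eq_iff_eq_add'] at ha
        rw [ha, hDdef]
        push_cast
        ring
      have hr0 : r ≠ 0 := by
        rintro rfl
        refine one_sub_two_mul_ne_zero (-2 * ((P : 𝓞 K) * a)) ?_
        linear_combination -ha'
      have hrK : (r : K) ≠ 0 := RingOfIntegers.coe_ne_zero_iff.2 hr0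
      have haK : (z x : K) * z x' * r ^ 2 = ((1 + 4 * ((P : 𝓞 K) * a) : 𝓞 K) : K) := by
        rw [← ha']
        rfl
      refine mem_near_of_one_add (c := y x' * (x * y x ^ 2 * q) * Units.mk0 (r : K) hrK * (y x)⁻¹)
        (a := a) (fun τ ↦ ?_) ?_
      · have h1 := congrFun hsign τ
        rw [decide_eq_decide] at h1
        have hx0 : τ x ≠ 0 := (map_ne_zero_iff _ τ.injective).2 x.ne_zero
        have hx0' : τ x' ≠ 0 := (map_ne_zero_iff _ τ.injective).2 x'.ne_zero
        rw [Units.val_mul, map_mul, Units.val_inv_eq_inv_val, map_inv₀]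
        rcases hx0.lt_or_gt with hlt | hgt
        · exact mul_pos_of_neg_of_neg (inv_neg''.2 hlt)
            (lt_of_le_of_ne (not_lt.1 (h1.not.1 hlt.le.not_gt)) hx0')
        · exact mul_pos (inv_pos.2 hgt) (h1.1 hgt)
      · rw [← haK, ← hz1, ← hz2]
        push_cast
        rw [Units.val_mk0]
        have := x.ne_zero
        have := (y x).ne_zero
        field_simp)
  refine ⟨h, h'.trans ?_⟩
  rw [Nat.card_prod, Nat.card_prod, Nat.card_fun, Nat.card_fun]
  have hcard : Nat.card ((𝓞 K ⧸ I)ˣ ⧸ sq.range) ≤ 2 ^ F.card * 2 ^ Module.finrank ℚ K := by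
    refine le_of_eq_of_le ?_ (card_ker_sq_le K hS hD hDS)
    exact Subgroup.index_range (f := sq)
  have hre : 2 ^ Nat.card (K →+* ℝ) ≤ 2 ^ Module.finrank ℚ K :=
    Nat.pow_le_pow_right two_pos card_real_embeddings_le
  have hb : Nat.card Bool = 2 := by simp
  have hZ : Nat.card (ZMod 2) = 2 := by simp
  rw [hb, hZ, Nat.card_eq_fintype_card (α := F), Fintype.card_coe]
  calc _ ≤ 2 ^ Module.finrank ℚ K * (2 ^ F.card * (2 ^ F.card * 2 ^ Module.finrank ℚ K)) := by
        gcongr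
    _ = _ := by
        rw [show 4 = 2 ^ 2 from rfl, ← pow_mul]
        ring

end Count

section TwoIndep

/-- A family in a commutative group that is linearly independent modulo squares. -/
def TwoIndep {ι G : Type*} [Fintype ι] [CommGroup G] (u : ι → G) : Prop :=
  ∀ ε : ι → ℤ, IsSquare (∏ i, u i ^ ε i) → ∀ i, Even (ε i)

lemma two_pow_le_relIndex {ι G : Type*} [Fintype ι] [CommGroup G] {Q H : Subgroup G} {u : ι → G}
    (hu : ∀ i, u i ∈ H) (hQ : ∀ x ∈ H, x ∈ Q → IsSquare x) (hind : TwoIndep u)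
    (hfin : Q.index ≠ 0) : 2 ^ Fintype.card ι ≤ Q.relIndex H := by
  classical
  have h0 : Q.relIndex H ≠ 0 := fun h ↦ hfin (Nat.eq_zero_of_zero_dvd
    (h ▸ Subgroup.relIndex_dvd_index_of_normal Q H))
  have : (Q.subgroupOf H).FiniteIndex := ⟨h0⟩
  have hfinite : Finite (H ⧸ Q.subgroupOf H) := inferInstance
  let f : (ι → Bool) → H := fun ε ↦ ∏ i, ⟨u i, hu i⟩ ^ (if ε i then (1 : ℤ) else 0)
  have hf : ∀ ε, (f ε : G) = ∏ i, u i ^ (if ε i then (1 : ℤ) else 0) := fun ε ↦ by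
    rw [Subgroup.val_finsetProd]
    rfl
  have hinj : Function.Injective fun ε ↦ (f ε : H ⧸ Q.subgroupOf H) := by
    intro ε ε' h
    have h1 := QuotientGroup.eq.1 h
    rw [Subgroup.mem_subgroupOf] at h1
    have h2 := hQ _ ((f ε)⁻¹ * f ε').2 h1
    have h3 : (((f ε)⁻¹ * f ε' : H) : G) =
        ∏ i, u i ^ (-(if ε i then (1 : ℤ) else 0) + if ε' i then (1 : ℤ) else 0) := by
      rw [Subgroup.coe_mul, Subgroup.coe_inv, hf, hf, ← Finset.prod_inv_distrib,
        ← Finset.prod_mul_distrib]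
      simp only [zpow_add, zpow_neg]
    rw [h3] at h2
    funext i
    have h4 := hind _ h2 i
    cases h5 : ε i <;> cases h6 : ε' i <;> simp_all
  have := Nat.card_le_card_of_injective _ hinj
  rw [Nat.card_fun, Nat.card_eq_fintype_card (α := Bool), Fintype.card_bool,
    Nat.card_eq_fintype_card (α := ι)] at this
  exact this

end TwoIndep

section SUnits

variable {K : Type*} [Field K] [NumberField K] {S : Finset ℕ}

variable (K) in
/-- The elements of even order at all places outside `S` and `V`. -/
noncomputable def evenOff (S : Finset ℕ) (V : Set (HeightOneSpectrum (𝓞 K))) : Subgroup Kˣ where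
  carrier := {x | ∀ v, ¬Above S v → v ∉ V → Even (ord v (x : K))}
  one_mem' := fun v _ _ ↦ by simp [ord_one]
  mul_mem' := fun {x y} hx hy v hv hv' ↦ by
    rw [Units.val_mul, ord_mul x.ne_zero y.ne_zero]
    exact (hx v hv hv').add (hy v hv hv')
  inv_mem' := fun {x} hx v hv hv' ↦ by
    rw [Units.val_inv_eq_inv_val, ord_inv]
    exact (hx v hv hv').neg

lemma exists_unit_of_ord_eq_zero {y : Kˣ} (h : ∀ v, ord v (y : K) = 0) :
    ∃ w : (𝓞 K)ˣ, ((w : 𝓞 K) : K) = y := by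
  have h1 : ∀ x : Kˣ, (∀ v, ord v (x : K) = 0) → ∃ a : 𝓞 K, (a : K) = x := fun x hx ↦
    HeightOneSpectrum.mem_integers_of_valuation_le_one (R := 𝓞 K) K (x : K) fun v ↦
      (ord_nonneg_iff x.ne_zero).1 (hx v).ge
  obtain ⟨a, ha⟩ := h1 y h
  obtain ⟨b, hb⟩ := h1 y⁻¹ fun v ↦ by rw [Units.val_inv_eq_inv_val, ord_inv, h v, neg_zero]
  have hab : a * b = 1 := by
    apply RingOfIntegers.ext
    rw [coe_ringOfIntegers_mul, ha, hb, Units.mul_inv]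
    rfl
  exact ⟨Units.mkOfMulEqOne a b hab, ha⟩

lemma ord_unit (w : (𝓞 K)ˣ) (v : HeightOneSpectrum (𝓞 K)) : ord v ((w : 𝓞 K) : K) = 0 :=
  ord_eq_zero_of_notMem fun h ↦ v.isPrime.ne_top (Ideal.eq_top_of_isUnit_mem _ h w.isUnit)

lemma neg_one_not_isSquare [IsTotallyReal K] : ¬IsSquare (-1 : Kˣ) := by
  rintro ⟨y, hy⟩
  let φ : K →+* ℂ := Classical.choice inferInstance
  have hφ := IsTotallyReal.complexEmbedding_isReal φ
  have h1 := congrArg (fun x : Kˣ ↦ hφ.embedding (x : K)) hy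
  simp only [Units.val_neg, Units.val_one, map_neg, map_one, Units.val_mul, map_mul] at h1
  nlinarith [mul_self_nonneg (hφ.embedding (y : K))]

/-- Units: `-1` and the fundamental units are independent modulo squares. -/
lemma even_of_units [IsTotallyReal K] {a : ℤ} {b : Fin (Units.rank K) → ℤ} {w : (𝓞 K)ˣ}
    (h : (-1) ^ a * ∏ i, Units.fundSystem K i ^ b i = w * w) : Even a ∧ ∀ i, Even (b i) := by
  obtain ⟨⟨ζ, d⟩, hw, -⟩ := Units.exist_unique_eq_mul_prod K w
  have htors : (-1 : (𝓞 K)ˣ) ^ a ∈ Units.torsion K := by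
    refine Subgroup.zpow_mem _ ?_ _
    rw [Units.torsion, CommGroup.mem_torsion]
    exact isOfFinOrder_iff_pow_eq_one.2 ⟨2, two_pos, by simp⟩
  have e3 := (Units.exist_unique_eq_mul_prod K (w * w)).unique (y₁ := (⟨_, htors⟩, b)) (y₂ := (ζ * ζ, d + d)) h.symm (by
    simp only [Pi.add_apply, zpow_add, Finset.prod_mul_distrib, Subgroup.coe_mul]
    conv_lhs => rw [hw]
    exact mul_mul_mul_comm _ _ _ _)
  rw [Prod.mk.injEq] at e3
  refine ⟨?_, fun i ↦ ⟨d i, congrFun e3.2 i⟩⟩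
  by_contra hodd
  rw [Int.not_even_iff_odd] at hodd
  have e4 := congrArg (Subtype.val) e3.1
  simp only [hodd.neg_one_zpow, Subgroup.coe_mul] at e4
  refine neg_one_not_isSquare (K := K) ⟨Units.map (algebraMap (𝓞 K) K).toMonoidHom ζ, ?_⟩
  have e5 := congrArg (Units.map (algebraMap (𝓞 K) K).toMonoidHom) e4
  rw [map_mul] at e5
  rw [← e5]
  ext
  simp

variable (K) in
/-- The order vector of an element at a finite set of places. -/
noncomputable def ordVec (F : Finset (HeightOneSpectrum (𝓞 K))) : Additive Kˣ →+ (F → ℤ) where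
  toFun x := fun v ↦ ord v.1 ((x.toMul : Kˣ) : K)
  map_zero' := by
    funext v
    exact ord_one
  map_add' x y := by
    funext v
    exact ord_mul x.toMul.ne_zero y.toMul.ne_zero

variable (K) in
/-- The `F`-units. -/
noncomputable def unitsOff (F : Finset (HeightOneSpectrum (𝓞 K))) : AddSubgroup (Additive Kˣ) where
  carrier := {x | ∀ v ∉ F, ord v ((x.toMul : Kˣ) : K) = 0}
  zero_mem' := fun v _ ↦ ord_one
  add_mem' := fun {x y} hx hy v hv ↦ by
    rw [toMul_add, Units.val_mul, ord_mul (Units.ne_zero _) (Units.ne_zero _), hx v hv, hy v hv,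
      add_zero]
  neg_mem' := fun {x} hx v hv ↦ by
    rw [toMul_neg, Units.val_inv_eq_inv_val, ord_inv, hx v hv, neg_zero]

variable (K) in
/-- The lattice of order vectors of `F`-units. -/
noncomputable def unitsLattice (F : Finset (HeightOneSpectrum (𝓞 K))) : Submodule ℤ (F → ℤ) :=
  AddSubgroup.toIntSubmodule ((unitsOff K F).map (ordVec K F))

lemma card_le_finrank_unitsLattice (F : Finset (HeightOneSpectrum (𝓞 K))) :
    F.card ≤ Module.finrank ℤ (unitsLattice K F) := by
  classical
  choose ϖ h hϖ h0 h1 h2 using exists_generator_pow (K := K)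
  let ϖ' : F → Additive Kˣ := fun v ↦ Additive.ofMul (Units.mk0 _ (hϖ v.1))
  have hmem : ∀ v, ϖ' v ∈ unitsOff K F := fun v w hw ↦ h2 v.1 w (fun e ↦ hw (e ▸ v.2))
  let b : F → unitsLattice K F := fun v ↦ ⟨ordVec K F (ϖ' v), ⟨_, hmem v, rfl⟩⟩
  have hb : LinearIndependent ℤ b := by
    rw [Fintype.linearIndependent_iff]
    intro g hg v
    have := congrFun (congrArg Subtype.val hg) v
    rw [Submodule.coe_sum, Finset.sum_apply] at this
    have this : ∑ w, g w * ord v.1 (ϖ w.1) = 0 := this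
    rw [Finset.sum_eq_single v] at this
    · have h3 : g v * (h v.1 : ℤ) = 0 := by
        rw [← h1 v.1]
        exact this
      exact (mul_eq_zero.1 h3).resolve_right (by exact_mod_cast (h0 v.1).ne')
    · intro w _ hw
      rw [h2 w.1 v.1 (fun e ↦ hw (Subtype.ext e.symm)), mul_zero]
    · simp
  simpa using hb.fintype_card_le_finrank

theorem exists_twoIndep [IsTotallyReal K] (F : Finset (HeightOneSpectrum (𝓞 K))) :
    ∃ (ι : Type) (_ : Fintype ι) (u : ι → Kˣ), TwoIndep u ∧
      (∀ i, ∀ v ∉ F, ord v (u i : K) = 0) ∧ Module.finrank ℚ K + F.card ≤ Fintype.card ι := by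
  classical
  let b := Module.finBasis ℤ (unitsLattice K F)
  choose η hη hηb using fun j ↦ (b j).2
  let ι₀ : (𝓞 K)ˣ →* Kˣ := Units.map (algebraMap (𝓞 K) K).toMonoidHom
  have hι₀ : Function.Injective ι₀ := Units.map_injective RingOfIntegers.coe_injective
  let u : Option (Fin (Units.rank K)) ⊕ Fin (Module.finrank ℤ (unitsLattice K F)) → Kˣ :=
    Sum.elim (fun i ↦ ι₀ (i.elim (-1) (Units.fundSystem K))) (fun j ↦ (η j).toMul)
  have hu : ∀ i, ∀ v ∉ F, ord v (u i : K) = 0 := by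
    rintro (i | j) v hv
    · exact ord_unit _ v
    · exact hη j v hv
  refine ⟨_, inferInstance, u, ?_, hu, ?_⟩
  · rintro ε ⟨y, hy⟩
    have hyF : Additive.ofMul y ∈ unitsOff K F := by
      intro v hv
      have := congrArg (fun x : Kˣ ↦ ord v (x : K)) hy
      simp only [Units.val_mul, Units.coe_prod, Units.val_zpow_eq_zpow_val] at this
      rw [ord_mul y.ne_zero y.ne_zero, ord_prod _ fun i _ ↦ zpow_ne_zero _ (u i).ne_zero,
        Finset.sum_eq_zero fun i _ ↦ by rw [ord_zpow, hu i v hv, mul_zero]] at this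
      change ord v (y : K) = 0
      omega
    have hsum : ∑ j, ε (Sum.inr j) • b j = (⟨ordVec K F (Additive.ofMul y), ⟨_, hyF, rfl⟩⟩ +
        ⟨ordVec K F (Additive.ofMul y), ⟨_, hyF, rfl⟩⟩ : unitsLattice K F) := by
      apply Subtype.ext
      funext v
      have := congrArg (fun x : Kˣ ↦ ord v.1 (x : K)) hy
      simp only [Units.val_mul, Units.coe_prod, Units.val_zpow_eq_zpow_val] at this
      rw [ord_mul y.ne_zero y.ne_zero, ord_prod _ fun i _ ↦ zpow_ne_zero _ (u i).ne_zero,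
        Fintype.sum_sum_type, Finset.sum_eq_zero fun i _ ↦ by
          rw [ord_zpow, show ord v.1 (u (Sum.inl i) : K) = 0 from ord_unit _ _, mul_zero],
        zero_add] at this
      refine Eq.trans ?_ this
      rw [Submodule.coe_sum, Finset.sum_apply]
      refine Finset.sum_congr rfl fun j _ ↦ ?_
      rw [ord_zpow, Submodule.coe_smul, ← hηb j]
      rfl
    have hc : ∀ j, Even (ε (Sum.inr j)) := fun j ↦ by
      have := congrArg (fun x ↦ b.repr x j) hsum
      simp only [b.repr_sum_self, map_add, Finsupp.add_apply] at this
      exact ⟨_, this⟩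
    choose c hc using hc
    have hprod : ι₀ ((-1) ^ ε (Sum.inl none) *
        ∏ i, Units.fundSystem K i ^ ε (Sum.inl (some i))) =
        (y * (∏ j, (η j).toMul ^ c j)⁻¹) * (y * (∏ j, (η j).toMul ^ c j)⁻¹) := by
      rw [mul_mul_mul_comm, ← hy, ← mul_inv, ← Finset.prod_mul_distrib, Fintype.prod_sum_type,
        Fintype.prod_option, map_mul, map_prod, map_zpow]
      simp only [map_zpow, ← zpow_add, ← hc]
      rw [show ∏ j, u (Sum.inr j) ^ ε (Sum.inr j) = ∏ j, (η j).toMul ^ ε (Sum.inr j) from rfl,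
        mul_inv_cancel_right]
      rfl
    obtain ⟨w, hw⟩ := exists_unit_of_ord_eq_zero (y := y * (∏ j, (η j).toMul ^ c j)⁻¹) fun v ↦ by
      have := congrArg (fun x : Kˣ ↦ ord v (x : K)) hprod
      simp only [Units.val_mul (y * _)] at this
      rw [ord_mul (Units.ne_zero _) (Units.ne_zero _)] at this
      have h0 : ord v ((ι₀ ((-1) ^ ε (Sum.inl none) *
        ∏ i, Units.fundSystem K i ^ ε (Sum.inl (some i))) : Kˣ) : K) = 0 := ord_unit _ v
      omega
    have hw' : ι₀ w = y * (∏ j, (η j).toMul ^ c j)⁻¹ := Units.ext hw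
    rw [← hw', ← map_mul] at hprod
    obtain ⟨h1, h2⟩ := even_of_units (hι₀ hprod)
    rintro ((_ | i) | j)
    · exact h1
    · exact h2 i
    · exact ⟨_, hc j⟩
  · have h1 := card_le_finrank_unitsLattice F
    have h2 : Module.finrank ℚ K = Units.rank K + 1 := by
      rw [IsTotallyReal.finrank, Units.rank, Nat.sub_add_cancel Fintype.card_pos,
        InfinitePlace.card_eq_nrRealPlaces_add_nrComplexPlaces,
        IsTotallyReal.nrComplexPlaces_eq_zero, add_zero]
    simp only [Fintype.card_sum, Fintype.card_option, Fintype.card_fin]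
    omega

end SUnits

section Reciprocity

lemma dim_gwMap {F E : Type*} [Field F] [Field E] (φ : F →+* E) (x : GW F) :
    (GW.map φ x).dim = x.dim := by
  have : GW.dim.comp (GW.map φ) = GW.dim := by
    refine GW.hom_ext fun a ↦ ?_
    rcases eq_or_ne a 0 with rfl | ha
    · simp
    · simp [GW.dim_of, ha]
  exact DFunLike.congr_fun this x

/-- The rational classes that vanish over `ℝ` and over `ℚ_p` for `p ∈ S`. -/
noncomputable def trivialAt (S : Finset ℕ) : AddSubgroup (GW ℚ) where
  carrier := {x | GW.map (algebraMap ℚ ℝ) x = 0 ∧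
    ∀ p ∈ S, ∀ [Fact p.Prime], GW.map (algebraMap ℚ ℚ_[p]) x = 0}
  zero_mem' := by simp
  add_mem' := fun hx hy ↦ ⟨by rw [map_add, hx.1, hy.1, add_zero], fun p hp _ ↦ by
    rw [map_add, hx.2 p hp, hy.2 p hp, add_zero]⟩
  neg_mem' := fun hx ↦ ⟨by rw [map_neg, hx.1, neg_zero], fun p hp _ ↦ by
    rw [map_neg, hx.2 p hp, neg_zero]⟩

variable {S : Finset ℕ}

lemma dim_of_mem_trivialAt {x : GW ℚ} (hx : x ∈ trivialAt S) : x.dim = 0 := by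
  rw [← dim_gwMap (algebraMap ℚ ℝ), hx.1, map_zero]

lemma sgnQ_of_mem_trivialAt {x : GW ℚ} (hx : x ∈ trivialAt S) : sgnQ x = 0 := by
  rw [sgnQ, AddMonoidHom.comp_apply, hx.1, map_zero]

lemma resQ_of_mem_trivialAt {x : GW ℚ} (hx : x ∈ trivialAt S) {p : ℕ} (hp : p ∈ S)
    [Fact p.Prime] [NeZero (2 : ZMod p)] : resQ p x = 0 := by
  rw [resQ, AddMonoidHom.comp_apply, hx.2 p hp, map_zero]

lemma even_card_of_mem_trivialAt (h2 : 2 ∈ S) {x : GW ℚ} (hx : x ∈ trivialAt S) {T : Finset ℕ}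
    (hT : ∀ p ∈ T, p.Prime ∧ p ∉ S)
    (hres : ∀ (p : ℕ) (_ : Fact p.Prime) (_ : NeZero (2 : ZMod p)), p ∉ S →
      resQ p x = if p ∈ T then eta p else 0) : Even T.card := by
  have := Fact.mk Nat.prime_two
  refine IsTest.even_card (dim_of_mem_trivialAt hx) (sgnQ_of_mem_trivialAt hx) (hx.2 2 h2)
    (fun p hp ↦ ⟨(hT p hp).1, fun h ↦ (hT p hp).2 (h ▸ h2)⟩) fun p _ _ ↦ ?_
  by_cases hp : p ∈ S
  · rw [resQ_of_mem_trivialAt hx hp, if_neg fun h ↦ (hT p h).2 hp]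
  · exact hres p _ _ hp

variable {K : Type*} [Field K] [NumberField K]

lemma card_real_embeddings [IsTotallyReal K] [Fintype (K →+* ℝ)] :
    Fintype.card (K →+* ℝ) = Module.finrank ℚ K := by
  rw [← Embeddings.card K ℂ]
  refine Fintype.card_of_bijective (f := fun τ : K →+* ℝ ↦ Complex.ofRealHom.comp τ) ⟨?_, ?_⟩
  · intro τ τ' h
    ext x
    exact Complex.ofReal_injective (DFunLike.congr_fun h x)
  · intro φ
    have hφ := IsTotallyReal.complexEmbedding_isReal φ
    refine ⟨hφ.embedding, ?_⟩
    ext x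
    simp

lemma tr_mul_sub_tr_mem [IsTotallyReal K] {q : Kˣ} (hq : q ∈ near K S) {l : K} (hl : l ≠ 0) :
    tr K (l * q) - tr K l ∈ trivialAt S := by
  classical
  have := finite_real_embeddings (K := K)
  have := Fintype.ofFinite (K →+* ℝ)
  refine ⟨?_, fun p hp _ ↦ ?_⟩
  · rw [map_sub, map_tr_eq_sum (σ := fun τ : K →+* ℝ ↦ τ) Function.injective_id
      card_real_embeddings (mul_ne_zero hl q.ne_zero),
      map_tr_eq_sum (σ := fun τ : K →+* ℝ ↦ τ) Function.injective_id card_real_embeddings hl,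
      sub_eq_zero]
    refine Finset.sum_congr rfl fun τ _ ↦ ?_
    have hpos := pos_of_mem_near hq τ
    refine GW.of_eq_of (c := √(τ q)) (Real.sqrt_pos.2 hpos).ne' ?_
    rw [map_mul, Real.sq_sqrt hpos.le]
  · rw [map_sub, map_tr_of_mem_near hq hp hl, sub_self]

lemma symb_mem_trivialAt [IsTotallyReal K] {q : Kˣ} (hq : q ∈ near K S) {l : K} (hl : l ≠ 0) :
    symb l (q : K) ∈ trivialAt S := by
  have h := (trivialAt S).sub_mem (tr_mul_sub_tr_mem hq one_ne_zero) (tr_mul_sub_tr_mem hq hl)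
  rw [one_mul] at h
  convert h using 1
  rw [symb]
  abel

lemma symb_comm (u b : K) : symb u b = symb b u := by
  rw [symb, symb, mul_comm]
  abel

lemma trH_sub_mem_trivialAt [IsTotallyReal K] {q : Kˣ} (hq : q ∈ near K S) {δ l : K} (hδ : δ ≠ 0)
    (hl : l ≠ 0) : trH δ (l * q) - trH δ l ∈ trivialAt S := by
  have h := (trivialAt S).add_mem (tr_mul_sub_tr_mem hq (mul_ne_zero two_ne_zero hl))
    (tr_mul_sub_tr_mem hq (mul_ne_zero (mul_ne_zero (neg_ne_zero.2 two_ne_zero) hδ) hl))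
  convert h using 1
  rw [trH, trH, ← mul_assoc, ← mul_assoc]
  abel

lemma Adm.resQ_symb_eq_zero (hS : Adm K S) {p : ℕ} [hp : Fact p.Prime] [NeZero (2 : ZMod p)]
    (hpS : p ∉ S) {u b : K} (hu : u ≠ 0) (hb : b ≠ 0)
    (hu' : ∀ v : HeightOneSpectrum (𝓞 K), (p : 𝓞 K) ∈ v.asIdeal → Even (ord v u))
    (hb' : ∀ v : HeightOneSpectrum (𝓞 K), (p : 𝓞 K) ∈ v.asIdeal → Even (ord v b)) :
    resQ p (symb u b) = 0 := by
  rw [symb, map_add, map_sub, map_sub, hS.resQ_tr_eq_zero hpS hu hu',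
    hS.resQ_tr_eq_zero hpS hb hb', hS.resQ_tr_eq_zero hpS one_ne_zero (by simp [ord_one]),
    hS.resQ_tr_eq_zero hpS (mul_ne_zero hu hb) fun v hv ↦ by
      rw [ord_mul hu hb]
      exact (hu' v hv).add (hb' v hv)]
  simp

/-- Elements of even order off `S` which are near `1` are squares. -/
lemma isSquare_of_mem_near [IsTotallyReal K] [IsGalois ℚ K] (hS : Adm K S) {b : Kˣ}
    (hb : b ∈ near K S) (hb' : b ∈ evenOff K S ∅) : IsSquare b := by
  classical
  suffices h : IsSquare (b : K) by
    obtain ⟨c, hc⟩ := h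
    have hc0 : c ≠ 0 := by
      rintro rfl
      exact b.ne_zero (by simp at hc)
    exact ⟨Units.mk0 c hc0, Units.ext hc⟩
  by_contra hns
  obtain ⟨p, hp, σ, hpS, hσ⟩ := exists_embedding_not_isSquare hns S
  have hab := above_iff (K := K) hS.prime hp.out (natCast_mem_place σ)
  obtain ⟨ϖ, hϖ0, hϖ1, hϖ2⟩ := hS.unif (place σ)
  have heven : ∀ q : ℕ, q.Prime → q ∉ S → ∀ v : HeightOneSpectrum (𝓞 K), (q : 𝓞 K) ∈ v.asIdeal →
      Even (ord v (b : K)) := fun q hq hqS v hv ↦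
    hb' v (fun h ↦ hqS ((above_iff hS.prime hq hv).1 h)) (Set.notMem_empty v)
  have hodd : Even ({p} : Finset ℕ).card := by
    refine even_card_of_mem_trivialAt hS.two (symb_comm ϖ (b : K) ▸ symb_mem_trivialAt hb hϖ0)
      (by simpa using ⟨hp.out, hpS⟩) fun q _ _ hqS ↦ ?_
    have hne : ∀ v : HeightOneSpectrum (𝓞 K), (q : 𝓞 K) ∈ v.asIdeal → v ≠ place σ →
        Even (ord v ϖ) := fun v hv hne ↦ by
      rw [hϖ2 v hne fun h ↦ hqS ((above_iff hS.prime (Fact.out : q.Prime) hv).1 h)]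
      exact Even.zero
    by_cases hqp : q = p
    · subst hqp
      rw [resQ_symb σ b.ne_zero hϖ0 (heven q hp.out hpS) hne,
        hϖ1 (fun h ↦ hpS (hab.1 h)), if_pos ⟨odd_one, hσ⟩, if_pos (Finset.mem_singleton_self _)]
    · rw [if_neg (by simpa using hqp), hS.resQ_symb_eq_zero hqS b.ne_zero hϖ0
        (heven q Fact.out hqS) fun v hv ↦ hne v hv ?_]
      rintro rfl
      exact hqp (eq_of_prime_mem Fact.out hp.out hv (natCast_mem_place σ))
  simp at hodd

end Reciprocity

section LocalSquares

lemma isSquare_mul_of_not {p : ℕ} [hp : Fact p.Prime] (h2 : p ≠ 2) {y z : ℚ_[p]}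
    (hy : Even y.valuation) (hz : Even z.valuation) (hy' : ¬IsSquare y) (hz' : ¬IsSquare z) :
    IsSquare (y * z) := by
  have hp0 : (p : ℚ_[p]) ≠ 0 := by exact_mod_cast hp.out.ne_zero
  have key : ∀ {y : ℚ_[p]}, Even y.valuation → ¬IsSquare y → ∃ (c : ℚ_[p]) (u : ℤ_[p]),
      PadicInt.toZMod u ≠ 0 ∧ ¬IsSquare (PadicInt.toZMod u) ∧ y = c ^ 2 * u := by
    rintro y ⟨k, hk⟩ hns
    have hy0 : y ≠ 0 := by
      rintro rfl
      exact hns (IsSquare.zero)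
    obtain ⟨u, hu, hyu⟩ := exists_padic_rep' hy0
    have hyu' : y = ((p : ℚ_[p]) ^ k) ^ 2 * u := by
      rw [pow_two, ← zpow_add₀ hp0, ← hk]
      exact hyu
    refine ⟨(p : ℚ_[p]) ^ k, u, hu, fun h ↦ hns ?_, hyu'⟩
    obtain ⟨c, hc⟩ := isSquare_of_toZMod h2 hu h
    exact ⟨(p : ℚ_[p]) ^ k * c, by rw [hyu', hc]; push_cast; ring⟩
  obtain ⟨c, u, hu, hu', rfl⟩ := key hy hy'
  obtain ⟨d, w, hw, hw', rfl⟩ := key hz hz'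
  have : IsSquare (PadicInt.toZMod (u * w)) := by
    have h3 : PadicInt.toZMod (u * w) ≠ 0 := by
      rw [map_mul]
      exact mul_ne_zero hu hw
    rw [← quadraticChar_one_iff_isSquare h3, map_mul, map_mul,
      quadraticChar_neg_one_iff_not_isSquare.2 hu', quadraticChar_neg_one_iff_not_isSquare.2 hw']
    norm_num
  obtain ⟨e, he⟩ := isSquare_of_toZMod h2 (by rw [map_mul]; exact mul_ne_zero hu hw) this
  refine ⟨c * d * e, ?_⟩
  have hcast := congrArg (fun x : ℤ_[p] ↦ (x : ℚ_[p])) he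
  push_cast at hcast
  linear_combination c ^ 2 * d ^ 2 * hcast

/-- A nonsquare of `K` which stays a nonsquare in `K(√δ)` is a nonsquare at a place of degree one
where `δ` is a square. -/
lemma exists_embedding_isSquare_not_isSquare {K : Type*} [Field K] [NumberField K] {δ b : K}
    (hδ : ¬IsSquare δ) (hb : ¬IsSquare b) (hbδ : ¬IsSquare (b * δ)) (S : Finset ℕ) :
    ∃ (p : ℕ) (_ : Fact p.Prime) (σ : K →+* ℚ_[p]), p ∉ S ∧ IsSquare (σ δ) ∧ ¬IsSquare (σ b) := by
  have hirr : Irreducible (X ^ 2 - C δ : K[X]) := by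
    refine X_pow_sub_C_irreducible_of_prime Nat.prime_two fun c hc ↦ hδ ⟨c, ?_⟩
    rw [← hc, sq]
  have := Fact.mk hirr
  have hmon : (X ^ 2 - C δ : K[X]).Monic := monic_X_pow_sub_C δ two_ne_zero
  have : Module.Finite K (AdjoinRoot (X ^ 2 - C δ : K[X])) := hmon.finite_adjoinRoot
  have : CharZero (AdjoinRoot (X ^ 2 - C δ : K[X])) :=
    charZero_of_injective_algebraMap (algebraMap K _).injective
  have hnf : NumberField (AdjoinRoot (X ^ 2 - C δ : K[X])) :=
    { to_charZero := inferInstance, to_finiteDimensional := Module.Finite.trans K _ }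
  set i := AdjoinRoot.of (X ^ 2 - C δ : K[X])
  set w := AdjoinRoot.root (X ^ 2 - C δ : K[X])
  have hw : w ^ 2 = i δ := by
    have := AdjoinRoot.eval₂_root (X ^ 2 - C δ : K[X])
    simpa [sub_eq_zero] using this
  have hns : ¬IsSquare (i b) := by
    rintro ⟨c, hc⟩
    obtain ⟨f, rfl⟩ := AdjoinRoot.mk_surjective c
    have hdeg : (f %ₘ (X ^ 2 - C δ)).degree ≤ 1 := by
      have h1 := degree_modByMonic_lt f hmon
      rw [degree_X_pow_sub_C two_pos] at h1
      exact Order.lt_succ_iff.1 h1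
    obtain ⟨s, t, hst⟩ : ∃ s t : K, f %ₘ (X ^ 2 - C δ) = C s * X + C t :=
      ⟨_, _, eq_X_add_C_of_degree_le_one hdeg⟩
    have hmk : AdjoinRoot.mk (X ^ 2 - C δ) f = i s * w + i t := by
      conv_lhs => rw [← modByMonic_add_div f (X ^ 2 - C δ), hst]
      simp [i, w]
    rw [hmk] at hc
    have h1 : i (b - (s ^ 2 * δ + t ^ 2)) = i (2 * s * t) * w := by
      simp only [map_sub, map_add, map_mul, map_pow, map_ofNat]
      linear_combination hc + (i s) ^ 2 * hw
    by_cases h0 : 2 * s * t = 0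
    · rw [h0, map_zero, zero_mul, map_eq_zero] at h1
      rcases mul_eq_zero.1 h0 with h0 | rfl
      · obtain rfl : s = 0 := by simpa using h0
        exact hb ⟨t, by linear_combination h1⟩
      · exact hbδ ⟨s * δ, by linear_combination δ * h1⟩
    · refine hδ ⟨(b - (s ^ 2 * δ + t ^ 2)) / (2 * s * t), i.injective ?_⟩
      have h0' : i (2 * s * t) ≠ 0 := by simpa using h0
      rw [map_mul, map_div₀, h1, mul_div_cancel_left₀ _ h0', ← sq, hw]
  obtain ⟨p, hp, σ, hpS, hσ⟩ := exists_embedding_not_isSquare hns S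
  refine ⟨p, hp, σ.comp i, hpS, ⟨σ w, ?_⟩, hσ⟩
  rw [RingHom.comp_apply, ← hw, map_pow, sq]

end LocalSquares

section SplitPlaces

variable {K : Type*} [Field K] [NumberField K]

/-- An embedding of `K` into a `p`-adic field for which `δ` becomes a square. -/
structure SplitPlace (δ : K) where
  p : ℕ
  fact : Fact p.Prime
  σ : K →+* ℚ_[p]
  sq : IsSquare (σ δ)

attribute [instance] SplitPlace.fact

open Classical in
/-- The quadratic symbol of an element at a split place. -/
noncomputable def SplitPlace.chi {δ : K} (V : SplitPlace δ) (u : Kˣ) : ZMod 2 :=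
  if IsSquare (V.σ u) then 0 else 1

lemma SplitPlace.chi_eq_zero_iff {δ : K} (V : SplitPlace δ) {u : Kˣ} :
    V.chi u = 0 ↔ IsSquare (V.σ u) := by
  simp [chi]

lemma SplitPlace.chi_mul {δ : K} (V : SplitPlace δ) (h2 : V.p ≠ 2) {u w : Kˣ}
    (hu : Even (ord (place V.σ) (u : K))) (hw : Even (ord (place V.σ) (w : K))) :
    V.chi (u * w) = V.chi u + V.chi w := by
  have hu0 : V.σ u ≠ 0 := (map_ne_zero_iff _ V.σ.injective).2 u.ne_zero
  have hw0 : V.σ w ≠ 0 := (map_ne_zero_iff _ V.σ.injective).2 w.ne_zero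
  unfold chi
  rw [Units.val_mul, map_mul]
  by_cases h1 : IsSquare (V.σ u) <;> by_cases h3 : IsSquare (V.σ w)
  · rw [if_pos h1, if_pos h3, if_pos (h1.mul h3), add_zero]
  · rw [if_pos h1, if_neg h3, if_neg, zero_add]
    intro h
    apply h3
    have := h.mul h1.inv
    rwa [mul_right_comm, mul_inv_cancel₀ hu0, one_mul] at this
  · rw [if_neg h1, if_pos h3, if_neg, add_zero]
    intro h
    apply h1
    have := h.mul h3.inv
    rwa [mul_inv_cancel_right₀ hw0] at this
  · rw [if_neg h1, if_neg h3, if_pos]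
    · rfl
    · exact isSquare_mul_of_not h2 (by rwa [valuation_embedding _ u.ne_zero])
        (by rwa [valuation_embedding _ w.ne_zero]) h1 h3

lemma SplitPlace.chi_prod {δ : K} (V : SplitPlace δ) (h2 : V.p ≠ 2) {ι : Type*} (s : Finset ι)
    {u : ι → Kˣ} (hu : ∀ i, ord (place V.σ) (u i : K) = 0) (ε : ι → ZMod 2) :
    V.chi (∏ i ∈ s, u i ^ (ε i).val) = ∑ i ∈ s, ε i * V.chi (u i) := by
  classical
  have hpow : ∀ i, ord (place V.σ) ((u i ^ (ε i).val : Kˣ) : K) = 0 := fun i ↦ by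
    rw [Units.val_pow_eq_pow_val, ord_pow, hu, mul_zero]
  induction s using Finset.induction_on with
  | empty => simp [chi]
  | insert i s hi ih =>
    have hprod : ord (place V.σ) ((∏ i ∈ s, u i ^ (ε i).val : Kˣ) : K) = 0 := by
      rw [Units.coe_prod, ord_prod _ fun i _ ↦ Units.ne_zero _,
        Finset.sum_eq_zero fun i _ ↦ hpow i]
    rw [Finset.prod_insert hi, Finset.sum_insert hi, V.chi_mul h2 (by rw [hpow]; exact Even.zero)
      (by rw [hprod]; exact Even.zero), ih]
    congr 1
    have : ε i = 0 ∨ ε i = 1 := by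
      generalize ε i = e
      revert e
      decide
    rcases this with h | h
    · rw [h]
      simp [chi]
    · rw [h, ZMod.val_one]
      simp

/-- Split places with linearly independent symbols on a family independent modulo squares. -/
lemma exists_splitPlaces {δ : K} (hδ : ¬IsSquare δ) {ι : Type} [Fintype ι] {u : ι → Kˣ}
    (hu : TwoIndep u) {S : Finset ℕ} (hS : ∀ p ∈ S, p.Prime) (h2 : 2 ∈ S)
    (huS : ∀ i v, ¬Above S v → ord v (u i : K) = 0) {S' : Finset ℕ} (hS' : S ⊆ S') (k : ℕ)
    (hk : k + 1 ≤ Fintype.card ι) : ∃ V : Fin k → SplitPlace δ,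
      (Function.Injective fun j ↦ (V j).p) ∧ (∀ j, (V j).p ∉ S') ∧
      LinearIndependent (ZMod 2) fun j i ↦ (V j).chi (u i) := by
  classical
  have hnot : ∀ V : SplitPlace δ, V.p ∉ S' → V.p ≠ 2 ∧
      ∀ i, ord (place V.σ) (u i : K) = 0 := fun V hV ↦
    ⟨fun h ↦ hV (hS' (h ▸ h2)), fun i ↦ huS i _ fun h ↦ hV (hS' ((above_iff hS V.fact.out
      (natCast_mem_place V.σ)).1 h))⟩
  induction k with
  | zero => exact ⟨Fin.elim0, fun j ↦ j.elim0, fun j ↦ j.elim0, linearIndependent_empty_type⟩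
  | succ k ih =>
    obtain ⟨V, hinj, hV, hind⟩ := ih (by omega)
    let M : Matrix (Fin k) ι (ZMod 2) := fun j i ↦ (V j).chi (u i)
    let φ : (ι → ZMod 2) →ₗ[ZMod 2] (Fin k → ZMod 2) := M.mulVecLin
    let w : (ι → ZMod 2) → Kˣ := fun ε ↦ ∏ i, u i ^ (ε i).val
    have hwind : ∀ ε ε', IsSquare (w ε * w ε') → ε = ε' := by
      intro ε ε' h
      have h1 := hu (fun i ↦ (ε i).val + (ε' i).val) (by
        simp only [zpow_add, zpow_natCast, Finset.prod_mul_distrib]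
        exact h)
      funext i
      have h4 := h1 i
      rw [← Nat.cast_add, Int.even_coe_nat] at h4
      generalize ε i = e at h4 ⊢
      generalize ε' i = e' at h4 ⊢
      revert e e'
      decide
    obtain ⟨ε, hε, hns, hns'⟩ : ∃ ε, φ ε = 0 ∧ ¬IsSquare (w ε) ∧
        ¬∃ y : Kˣ, (w ε : K) * δ = y * y := by
      by_contra! hall
      have hcard : Nat.card (LinearMap.ker φ) ≤ Nat.card Bool := by
        refine Nat.card_le_card_of_injective (fun ε ↦ decide (IsSquare (w ε.1))) fun ε ε' h ↦ ?_
        rw [decide_eq_decide] at h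
        apply Subtype.ext
        apply hwind
        by_cases h1 : IsSquare (w ε.1)
        · exact h1.mul (h.1 h1)
        · obtain ⟨y, hy⟩ := hall ε.1 ε.2 h1
          obtain ⟨y', hy'⟩ := hall ε'.1 ε'.2 (h.not.1 h1)
          have hδ0 : δ ≠ 0 := by
            rintro rfl
            exact hδ IsSquare.zero
          refine ⟨y * y' * (Units.mk0 δ hδ0)⁻¹, Units.ext ?_⟩
          push_cast
          rw [Units.val_mk0]
          field_simp
          linear_combination (w ε'.1 : K) * δ * hy + (y : K) ^ 2 * hy'
      have hrn := φ.finrank_range_add_finrank_ker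
      have hle : Module.finrank (ZMod 2) (LinearMap.range φ) ≤ k := by
        simpa using Submodule.finrank_le (LinearMap.range φ)
      rw [Module.finrank_fintype_fun_eq_card] at hrn
      have hker : 2 ≤ Module.finrank (ZMod 2) (LinearMap.ker φ) := by omega
      have := Module.natCard_eq_pow_finrank (K := ZMod 2) (V := LinearMap.ker φ)
      rw [this, Nat.card_zmod, Nat.card_eq_fintype_card, Fintype.card_bool] at hcard
      have := Nat.pow_le_pow_right two_pos hker
      omega
    have hns1 : ¬IsSquare (w ε : K) := by
      rintro ⟨y, hy⟩
      have hy0 : y ≠ 0 := by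
        rintro rfl
        exact (w ε).ne_zero (by rw [hy, mul_zero])
      exact hns ⟨Units.mk0 y hy0, Units.ext hy⟩
    have hns2 : ¬IsSquare ((w ε : K) * δ) := by
      rintro ⟨y, hy⟩
      have hy0 : y ≠ 0 := by
        rintro rfl
        rw [mul_zero] at hy
        refine hδ ?_
        rw [(mul_eq_zero.1 hy).resolve_left (w ε).ne_zero]
        exact IsSquare.zero
      exact hns' ⟨Units.mk0 y hy0, hy⟩
    obtain ⟨p, hp, σ, hpS, hsq, hσ⟩ := exists_embedding_isSquare_not_isSquare hδ hns1 hns2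
      (S' ∪ Finset.univ.image fun j ↦ (V j).p)
    rw [Finset.notMem_union] at hpS
    let V₀ : SplitPlace δ := ⟨p, hp, σ, hsq⟩
    refine ⟨Fin.cons V₀ V, ?_, ?_, ?_⟩
    · have : (fun j ↦ ((Fin.cons V₀ V : Fin (k + 1) → SplitPlace δ) j).p) =
          Fin.cons p fun j ↦ (V j).p := by
        funext j
        refine Fin.cases ?_ (fun j ↦ ?_) j <;> simp [V₀]
      rw [this, Fin.cons_injective_iff]
      refine ⟨?_, hinj⟩
      rintro ⟨j, hj⟩
      exact hpS.2 (Finset.mem_image.2 ⟨j, Finset.mem_univ _, hj⟩)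
    · intro j
      refine Fin.cases ?_ (fun j ↦ ?_) j
      · exact hpS.1
      · exact hV j
    · have : (fun j i ↦ ((Fin.cons V₀ V : Fin (k + 1) → SplitPlace δ) j).chi (u i)) =
          Fin.cons (fun i ↦ V₀.chi (u i)) fun j i ↦ (V j).chi (u i) := by
        funext j
        refine Fin.cases ?_ (fun j ↦ ?_) j <;> simp
      rw [this, linearIndependent_finCons]
      refine ⟨hind, fun hmem ↦ ?_⟩
      let ℓ : (ι → ZMod 2) →ₗ[ZMod 2] ZMod 2 := dotProductBilin (ZMod 2) (ZMod 2) ε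
      have hℓ : Submodule.span (ZMod 2) (Set.range fun j i ↦ (V j).chi (u i)) ≤
          LinearMap.ker ℓ := by
        rw [Submodule.span_le]
        rintro _ ⟨j, rfl⟩
        have := congrFun hε j
        change ε ⬝ᵥ (fun i ↦ (V j).chi (u i)) = 0
        rw [dotProduct_comm]
        exact this
      have h3 : ε ⬝ᵥ (fun i ↦ V₀.chi (u i)) = 0 := hℓ hmem
      refine hσ (V₀.chi_eq_zero_iff.1 ?_)
      obtain ⟨h4, h5⟩ := hnot V₀ hpS.1
      rw [V₀.chi_prod h4 _ h5]
      exact h3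

end SplitPlaces

section Hermitian

variable {K : Type*} [Field K] [NumberField K] {S : Finset ℕ} {δ : K}

lemma ord_two_of_not_above (h2 : 2 ∈ S) {v : HeightOneSpectrum (𝓞 K)} (hv : ¬Above S v) :
    ord v (2 : K) = 0 := by
  have : ((2 : 𝓞 K) : K) = 2 := rfl
  rw [← this]
  exact ord_eq_zero_of_notMem fun h ↦ hv ⟨2, h2, by exact_mod_cast h⟩

lemma Adm.resQ_trH_of_even (hS : Adm K S) (hδ : δ ≠ 0) (hδS : ∀ v, ¬Above S v → Even (ord v δ))
    {p : ℕ} [hp : Fact p.Prime] [NeZero (2 : ZMod p)] (hpS : p ∉ S) {x : K} (hx : x ≠ 0)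
    (h : ∀ v : HeightOneSpectrum (𝓞 K), (p : 𝓞 K) ∈ v.asIdeal → Even (ord v x)) :
    resQ p (trH δ x) = 0 := by
  have hab : ∀ v : HeightOneSpectrum (𝓞 K), (p : 𝓞 K) ∈ v.asIdeal → ¬Above S v := fun v hv h ↦
    hpS ((above_iff hS.prime hp.out hv).1 h)
  have h2 : (2 : K) ≠ 0 := two_ne_zero
  rw [trH, map_add, hS.resQ_tr_eq_zero hpS (mul_ne_zero h2 hx) fun v hv ↦ by
      rw [ord_mul h2 hx, ord_two_of_not_above hS.two (hab v hv), zero_add]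
      exact h v hv,
    hS.resQ_tr_eq_zero hpS (mul_ne_zero (mul_ne_zero (neg_ne_zero.2 h2) hδ) hx) fun v hv ↦ by
      rw [ord_mul (mul_ne_zero (neg_ne_zero.2 h2) hδ) hx, ord_mul (neg_ne_zero.2 h2) hδ, ord_neg,
        ord_two_of_not_above hS.two (hab v hv), zero_add]
      exact (hδS v (hab v hv)).add (h v hv), add_zero]

variable [IsGalois ℚ K]

lemma isSquare_embedding_iff (hδ : δ ≠ 0) (hgal : ∀ τ : K ≃ₐ[ℚ] K, IsSquare (τ δ * δ)) {F : Type*}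
    [Field F] (σ : K →+* F) (τ : K ≃ₐ[ℚ] K) : IsSquare (σ (τ δ)) ↔ IsSquare (σ δ) := by
  have h1 : IsSquare (σ (τ δ) * σ δ) := by
    rw [← map_mul]
    exact (hgal τ).map σ
  have h2 : σ δ ≠ 0 := (map_ne_zero_iff _ σ.injective).2 hδ
  have h3 : σ (τ δ) ≠ 0 := (map_ne_zero_iff _ σ.injective).2 ((map_ne_zero_iff _ τ.injective).2 hδ)
  constructor <;> intro h
  · have := h1.mul h.inv
    rwa [mul_right_comm, mul_inv_cancel₀ h3, one_mul] at this
  · have := h1.mul h.inv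
    rwa [mul_inv_cancel_right₀ h2] at this

lemma resQ_trH_of_isSquare (hδ : δ ≠ 0) (hgal : ∀ τ : K ≃ₐ[ℚ] K, IsSquare (τ δ * δ))
    {p : ℕ} [hp : Fact p.Prime] [NeZero (2 : ZMod p)]
    (hδ' : ∀ v : HeightOneSpectrum (𝓞 K), (p : 𝓞 K) ∈ v.asIdeal → Even (ord v δ))
    {σ : K →+* ℚ_[p]} (hσ : IsSquare (σ δ)) {x : K} (hx : x ≠ 0) : resQ p (trH δ x) = 0 := by
  rw [resQ_trH σ hδ hx hδ']
  refine Finset.sum_eq_zero fun τ _ ↦ if_neg fun h ↦ h.2 ?_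
  rwa [isSquare_embedding_iff hδ hgal]

lemma resQ_trH_of_not_isSquare (hδ : δ ≠ 0)
    {p : ℕ} [hp : Fact p.Prime] [NeZero (2 : ZMod p)]
    (hδ' : ∀ v : HeightOneSpectrum (𝓞 K), (p : 𝓞 K) ∈ v.asIdeal → Even (ord v δ))
    {σ : K →+* ℚ_[p]} (hσ : ¬IsSquare (σ δ)) {x : K} (hx : x ≠ 0)
    (h : ∀ v : HeightOneSpectrum (𝓞 K), (p : 𝓞 K) ∈ v.asIdeal → v ≠ place σ → Even (ord v x)) :
    resQ p (trH δ x) = if Odd (ord (place σ) x) then eta p else 0 := by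
  classical
  rw [resQ_trH σ hδ hx hδ', Finset.sum_eq_single 1]
  · have h1 : σ.comp ((1 : K ≃ₐ[ℚ] K) : K →+* K) = σ := rfl
    rw [h1]
    refine if_congr ⟨And.left, fun h ↦ ⟨h, hσ⟩⟩ rfl rfl
  · intro τ _ hτ
    refine if_neg fun h' ↦ Int.not_even_iff_odd.2 h'.1 (h _ (natCast_mem_place _) fun e ↦ hτ ?_)
    ext y
    exact σ.injective (DFunLike.congr_fun (place_injective e) y)
  · simp

variable [IsTotallyReal K]

/-- The elements near `1` and those of even order off `S` and off suitable split places generate a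
subgroup of index at most two. -/
lemma exists_splitPlaces_index_le (hS : Adm K S) (hδ : ¬IsSquare δ) {S' : Finset ℕ} (hS' : S ⊆ S') :
    ∃ (k : ℕ) (V : Fin k → SplitPlace δ), (∀ j, (V j).p ∉ S') ∧
      (evenOff K S (Set.range fun j ↦ place (V j).σ) ⊔ near K S).index ≤ 2 := by
  classical
  obtain ⟨ι, _, u, hu, huF, hcard⟩ := exists_twoIndep (placesAbove (K := K) S hS.prime)
  have huS : ∀ i v, ¬Above S v → ord v (u i : K) = 0 := fun i v hv ↦
    huF i v fun h ↦ hv (mem_placesAbove.1 h)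
  have hpos : 0 < Module.finrank ℚ K := Module.finrank_pos
  obtain ⟨V, hinj, hV, hind⟩ := exists_splitPlaces hδ hu hS.prime hS.two huS hS'
    (Fintype.card ι - 1) (by omega)
  have hVS : ∀ j, (V j).p ∉ S := fun j h ↦ hV j (hS' h)
  have hVab : ∀ j, ¬Above S (place (V j).σ) := fun j h ↦
    hVS j ((above_iff hS.prime (V j).fact.out (natCast_mem_place _)).1 h)
  have hVinj : ∀ j j', place (V j).σ = place (V j').σ → j = j' := fun j j' h ↦
    hinj (eq_of_prime_mem (V j).fact.out (V j').fact.out (natCast_mem_place (V j).σ)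
      (by rw [h]; exact natCast_mem_place (V j').σ))
  refine ⟨_, V, hV, ?_⟩
  set H := evenOff K S (Set.range fun j ↦ place (V j).σ)
  have hker : ∀ b ∈ H, b ∈ near K S → IsSquare b := by
    intro b hbH hb
    refine isSquare_of_mem_near hS hb fun v hv _ ↦ ?_
    by_cases hvV : v ∈ Set.range fun j ↦ place (V j).σ
    swap
    · exact hbH v hv hvV
    obtain ⟨j₀, rfl⟩ := hvV
    have hsum : ∑ j, (ord (place (V j).σ) (b : K) : ZMod 2) • (fun i ↦ (V j).chi (u i)) = 0 := by
      funext i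
      set W := Finset.univ.filter fun j ↦
        Odd (ord (place (V j).σ) (b : K)) ∧ ¬IsSquare ((V j).σ (u i))
      have hWcard : Even (W.image fun j ↦ (V j).p).card := by
        refine even_card_of_mem_trivialAt hS.two (symb_mem_trivialAt hb (u i).ne_zero) ?_ ?_
        · intro p hp
          obtain ⟨j, -, rfl⟩ := Finset.mem_image.1 hp
          exact ⟨(V j).fact.out, hVS j⟩
        · intro p _ _ hpS
          have hab : ∀ v : HeightOneSpectrum (𝓞 K), (p : 𝓞 K) ∈ v.asIdeal → ¬Above S v :=
            fun v hv h ↦ hpS ((above_iff hS.prime (Fact.out : p.Prime) hv).1 h)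
          have hue : ∀ v : HeightOneSpectrum (𝓞 K), (p : 𝓞 K) ∈ v.asIdeal →
              Even (ord v (u i : K)) := fun v hv ↦ by
            rw [huS i v (hab v hv)]
            exact Even.zero
          by_cases hpV : ∃ j, (V j).p = p
          · obtain ⟨j, rfl⟩ := hpV
            rw [resQ_symb (V j).σ (u i).ne_zero b.ne_zero hue fun v hv hne ↦ hbH v (hab v hv) ?_]
            · refine if_congr ?_ rfl rfl
              rw [Finset.mem_image]
              constructor
              · exact fun h ↦ ⟨j, Finset.mem_filter.2 ⟨Finset.mem_univ _, h⟩, rfl⟩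
              · rintro ⟨j', hj', e⟩
                rw [← hinj e]
                exact (Finset.mem_filter.1 hj').2
            · rintro ⟨j', rfl⟩
              refine hne ?_
              rw [hinj (eq_of_prime_mem (V j).fact.out (V j').fact.out hv (natCast_mem_place _))]
          · rw [hS.resQ_symb_eq_zero hpS (u i).ne_zero b.ne_zero hue fun v hv ↦
              hbH v (hab v hv) ?_, if_neg]
            · intro h
              obtain ⟨j, -, hj⟩ := Finset.mem_image.1 h
              exact hpV ⟨j, hj⟩
            · rintro ⟨j', rfl⟩
              exact hpV ⟨j', eq_of_prime_mem (V j').fact.out Fact.out (natCast_mem_place _) hv⟩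
      rw [Finset.card_image_of_injective _ hinj] at hWcard
      rw [Finset.sum_apply, Pi.zero_apply, ← (ZMod.natCast_eq_zero_iff_even).2 hWcard,
        Finset.card_filter, Nat.cast_sum]
      refine Finset.sum_congr rfl fun j _ ↦ ?_
      rw [Pi.smul_apply, smul_eq_mul, SplitPlace.chi]
      by_cases h1 : Odd (ord (place (V j).σ) (b : K)) <;>
        by_cases h3 : IsSquare ((V j).σ (u i))
      · simp [h3]
      · simp [h1, h3, ZMod.intCast_eq_one_iff_odd.2 h1]
      · simp [h3]
      · simp [h1, h3, ZMod.intCast_eq_zero_iff_even.2 (Int.not_odd_iff_even.1 h1)]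
    have := (Fintype.linearIndependent_iff.1 hind _ hsum) j₀
    exact ZMod.intCast_eq_zero_iff_even.1 this
  choose ϖ hϖ0 hϖ1 hϖ2 using fun j ↦ hS.unif (place (V j).σ)
  let t : ι ⊕ Fin (Fintype.card ι - 1) → Kˣ := Sum.elim u fun j ↦ Units.mk0 (ϖ j) (hϖ0 j)
  have htH : ∀ i, t i ∈ H := by
    rintro (i | j) v hv hv'
    · change Even (ord v (u i : K))
      rw [huS i v hv]
      exact Even.zero
    · change Even (ord v (ϖ j))
      rw [hϖ2 j v (fun e ↦ hv' ⟨j, e.symm⟩) hv]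
      exact Even.zero
  have htind : TwoIndep t := by
    rintro ε ⟨y, hy⟩
    have hc : ∀ j, Even (ε (Sum.inr j)) := by
      intro j
      have h1 := congrArg (fun x : Kˣ ↦ ord (place (V j).σ) (x : K)) hy
      simp only [Units.val_mul, Units.coe_prod, Units.val_zpow_eq_zpow_val] at h1
      rw [ord_mul y.ne_zero y.ne_zero, ord_prod _ fun i _ ↦ zpow_ne_zero _ (t i).ne_zero,
        Fintype.sum_sum_type, Finset.sum_eq_zero fun i _ ↦ by
          rw [ord_zpow, show ord (place (V j).σ) (t (Sum.inl i) : K) = 0 from huS i _ (hVab j),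
            mul_zero],
        zero_add, Finset.sum_eq_single j] at h1
      · rw [ord_zpow, show ord (place (V j).σ) (t (Sum.inr j) : K) = 1 from hϖ1 j (hVab j),
          mul_one] at h1
        exact ⟨_, h1⟩
      · intro j' _ hne
        rw [ord_zpow, show ord (place (V j).σ) (t (Sum.inr j') : K) = 0 from
          hϖ2 j' _ (fun e ↦ hne (hVinj _ _ e).symm) (hVab j), mul_zero]
      · simp
    choose c hc using hc
    have hu' := hu (fun i ↦ ε (Sum.inl i)) ⟨y * (∏ j, t (Sum.inr j) ^ c j)⁻¹, by
      rw [mul_mul_mul_comm, ← hy, ← mul_inv, ← Finset.prod_mul_distrib, Fintype.prod_sum_type]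
      simp only [← zpow_add, ← hc]
      rw [mul_inv_cancel_right]
      rfl⟩
    rintro (i | j)
    · exact hu' i
    · exact ⟨_, hc j⟩
  obtain ⟨hfin, hle⟩ := near_index K hS.prime hS.two
  have h1 := two_pow_le_relIndex htH hker htind hfin
  rw [Fintype.card_sum, Fintype.card_fin] at h1
  have h3 := Subgroup.relIndex_mul_index (le_sup_right : near K S ≤ H ⊔ near K S)
  rw [Subgroup.relIndex_sup_right] at h3
  have h4 : (near K S).index ≤ 4 ^ Fintype.card ι :=
    hle.trans (Nat.pow_le_pow_right (by norm_num) hcard)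
  by_contra! h5
  have h6 : 2 ^ (Fintype.card ι + (Fintype.card ι - 1)) * 3 ≤ 4 ^ Fintype.card ι :=
    (Nat.mul_le_mul h1 h5).trans (h3.le.trans h4)
  obtain ⟨m, hm⟩ : ∃ m, Fintype.card ι = m + 1 := ⟨Fintype.card ι - 1, by omega⟩
  rw [hm, show m + 1 + (m + 1 - 1) = 2 * m + 1 by omega, pow_succ, pow_succ, pow_mul] at h6
  have : 0 < 4 ^ m := by positivity
  norm_num at h6
  omega

/-- A one-dimensional hermitian trace form can be modified, without changing it at `S` and at the
real places, so as to be unramified off `S` and a given inert prime. -/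
theorem exists_near_resQ_trH (hS : Adm K S) (hδ : ¬IsSquare δ)
    (hgal : ∀ τ : K ≃ₐ[ℚ] K, IsSquare (τ δ * δ)) (hδS : ∀ v, ¬Above S v → Even (ord v δ))
    {p₀ : ℕ} [hp₀ : Fact p₀.Prime] (hp₀S : p₀ ∉ S) {σ₀ : K →+* ℚ_[p₀]} (hσ₀ : ¬IsSquare (σ₀ δ))
    (l : Kˣ) : ∃ q ∈ near K S, ∃ e : Bool,
      ∀ (p : ℕ) (_ : Fact p.Prime) (_ : NeZero (2 : ZMod p)), p ∉ S →
        resQ p (trH δ ((l * q : Kˣ) : K)) = if p = p₀ ∧ e then eta p else 0 := by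
  classical
  have hδ0 : δ ≠ 0 := by
    rintro rfl
    exact hδ IsSquare.zero
  obtain ⟨k, V, hV, hidx⟩ := exists_splitPlaces_index_le hS hδ (Finset.subset_insert p₀ S)
  set T := Set.range fun j ↦ place (V j).σ
  have hVS : ∀ j, (V j).p ∉ S ∧ (V j).p ≠ p₀ := fun j ↦ by
    have := hV j
    rw [Finset.mem_insert, not_or] at this
    exact ⟨this.2, this.1⟩
  have habove : ∀ p : ℕ, p.Prime → p ∉ S → ∀ v : HeightOneSpectrum (𝓞 K), (p : 𝓞 K) ∈ v.asIdeal →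
      ¬Above S v := fun p hp hpS v hv h ↦ hpS ((above_iff hS.prime hp hv).1 h)
  have hres : ∀ x ∈ evenOff K S (T ∪ {place σ₀}),
      ∀ (p : ℕ) (_ : Fact p.Prime) (_ : NeZero (2 : ZMod p)), p ∉ S →
        resQ p (trH δ (x : K)) = if p = p₀ ∧ Odd (ord (place σ₀) (x : K)) then eta p else 0 := by
    intro x hx p hp _ hpS
    have hab := habove p hp.out hpS
    have hδ' : ∀ v : HeightOneSpectrum (𝓞 K), (p : 𝓞 K) ∈ v.asIdeal → Even (ord v δ) :=
      fun v hv ↦ hδS v (hab v hv)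
    by_cases hp0 : p = p₀
    · subst hp0
      rw [resQ_trH_of_not_isSquare hδ0 hδ' hσ₀ x.ne_zero fun v hv hne ↦ hx v (hab v hv) ?_]
      · exact if_congr ⟨fun h ↦ ⟨rfl, h⟩, And.right⟩ rfl rfl
      · rintro (⟨j, rfl⟩ | h)
        · exact (hVS j).2 (eq_of_prime_mem (V j).fact.out hp.out (natCast_mem_place _) hv)
        · exact hne h
    · rw [if_neg fun h ↦ hp0 h.1]
      by_cases hpV : ∃ j, (V j).p = p
      · obtain ⟨j, rfl⟩ := hpV
        exact resQ_trH_of_isSquare hδ0 hgal hδ' (V j).sq x.ne_zero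
      · refine hS.resQ_trH_of_even hδ0 hδS hpS x.ne_zero fun v hv ↦ hx v (hab v hv) ?_
        rintro (⟨j, rfl⟩ | rfl)
        · exact hpV ⟨j, eq_of_prime_mem (V j).fact.out hp.out (natCast_mem_place _) hv⟩
        · exact hp0 (eq_of_prime_mem hp.out hp₀.out hv (natCast_mem_place _))
  obtain ⟨ϖ, hϖ0, hϖ1, hϖ2⟩ := hS.unif (place σ₀)
  have hv₀ : ¬Above S (place σ₀) := habove p₀ hp₀.out hp₀S _ (natCast_mem_place _)
  have hv₀T : place σ₀ ∉ T := by
    rintro ⟨j, hj⟩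
    refine (hVS j).2 (eq_of_prime_mem (V j).fact.out hp₀.out (natCast_mem_place (V j).σ) ?_)
    rw [show place (V j).σ = place σ₀ from hj]
    exact natCast_mem_place _
  set ϖ' : Kˣ := Units.mk0 ϖ hϖ0
  have hϖmem : ϖ' ∈ evenOff K S (T ∪ {place σ₀}) := fun v hv hv' ↦ by
    change Even (ord v ϖ)
    rw [hϖ2 v (fun e ↦ hv' (Or.inr e)) hv]
    exact Even.zero
  have hmono : evenOff K S T ≤ evenOff K S (T ∪ {place σ₀}) := fun x hx v hv hv' ↦
    hx v hv fun h ↦ hv' (Or.inl h)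
  have hnot : ϖ' ∉ evenOff K S T ⊔ near K S := by
    intro hmem
    obtain ⟨h, hh, q, hq, hhq⟩ := Subgroup.mem_sup.1 hmem
    have hq' : q = h⁻¹ * ϖ' := by rw [← hhq, inv_mul_cancel_left]
    have hqmem : q ∈ evenOff K S (T ∪ {place σ₀}) := by
      rw [hq']
      exact mul_mem (inv_mem (hmono hh)) hϖmem
    have hqodd : Odd (ord (place σ₀) (q : K)) := by
      rw [hq', Units.val_mul, ord_mul (Units.ne_zero _) (Units.ne_zero _),
        Units.val_inv_eq_inv_val, ord_inv, show ord (place σ₀) (ϖ' : K) = 1 from hϖ1 hv₀]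
      exact (hh _ hv₀ hv₀T).neg.add_one
    have h1 : Even ({p₀} : Finset ℕ).card := by
      refine even_card_of_mem_trivialAt hS.two (trH_sub_mem_trivialAt hq hδ0 one_ne_zero)
        (by simpa using ⟨hp₀.out, hp₀S⟩) fun p _ _ hpS ↦ ?_
      rw [one_mul, map_sub, hres q hqmem p _ _ hpS, hS.resQ_trH_of_even hδ0 hδS hpS one_ne_zero
        (by simp [ord_one]), sub_zero]
      exact if_congr (by simp [hqodd]) rfl rfl
    simp at h1
  have hcase : ∃ e : Bool, l * ϖ' ^ (if e then (-1 : ℤ) else 0) ∈ evenOff K S T ⊔ near K S := by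
    have hne : (evenOff K S T ⊔ near K S).index ≠ 0 := fun h ↦
      (near_index K hS.prime hS.two).1 (Nat.eq_zero_of_zero_dvd
        (h ▸ Subgroup.index_dvd_of_le le_sup_right))
    have hne1 : (evenOff K S T ⊔ near K S).index ≠ 1 := fun h ↦
      hnot (Subgroup.index_eq_one.1 h ▸ Subgroup.mem_top _)
    have hi2 : (evenOff K S T ⊔ near K S).index = 2 := by omega
    by_cases hl : l ∈ evenOff K S T ⊔ near K S
    · exact ⟨false, by simpa using hl⟩
    · refine ⟨true, ?_⟩
      rw [if_pos rfl, Subgroup.mul_mem_iff_of_index_two hi2]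
      refine iff_of_false hl ?_
      rwa [zpow_neg_one, inv_mem_iff]
  obtain ⟨e, he⟩ := hcase
  obtain ⟨h, hh, q, hq, hhq⟩ := Subgroup.mem_sup.1 he
  refine ⟨q⁻¹, inv_mem hq, e, fun p _ _ hpS ↦ ?_⟩
  have hl : l * q⁻¹ = h * ϖ' ^ (if e then (1 : ℤ) else 0) := by
    rw [mul_inv_eq_iff_eq_mul, mul_right_comm, hhq]
    cases e <;> simp
  rw [hl, hres _ (mul_mem (hmono hh) (zpow_mem hϖmem _)) p _ _ hpS]
  refine if_congr (and_congr_right fun _ ↦ ?_) rfl rfl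
  rw [Units.val_mul, ord_mul (Units.ne_zero _) (Units.ne_zero _), Units.val_zpow_eq_zpow_val,
    ord_zpow, show ord (place σ₀) (ϖ' : K) = 1 from hϖ1 hv₀]
  have := hh _ hv₀ hv₀T
  cases e
  · simpa using this
  · simpa using this.add_one

end Hermitian

section Gram

variable {F V ι κ : Type*} [Field F] [AddCommGroup V] [Module F V] [Fintype ι] [DecidableEq ι]
  [Fintype κ] [DecidableEq κ] (B : LinearMap.BilinForm F V)

/-- The Gram matrix of a family of vectors. -/
def gram (v : κ → V) : Matrix κ κ F := Matrix.of fun i j ↦ B (v i) (v j)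

lemma gram_apply (v : κ → V) (i j : κ) : gram B v i j = B (v i) (v j) := rfl

lemma toMatrix_eq_gram (b : Module.Basis ι F V) : LinearMap.BilinForm.toMatrix b B = gram B b := by
  ext i j
  rw [LinearMap.BilinForm.toMatrix_apply, gram_apply]

variable {B} in
lemma linearIndependent_of_gram {v : κ → V} (h : (gram B v).det ≠ 0) : LinearIndependent F v := by
  rw [Fintype.linearIndependent_iff]
  intro g hg
  have h2 : (gram B v).mulVec g = 0 := by
    ext i
    have := congrArg (B (v i)) hg
    simp only [map_sum, map_smul, smul_eq_mul, map_zero] at this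
    simp only [Matrix.mulVec, dotProduct, gram_apply, Pi.zero_apply]
    rw [← this]
    exact Finset.sum_congr rfl fun j _ ↦ mul_comm _ _
  exact congrFun (Matrix.eq_zero_of_mulVec_eq_zero h h2)

variable {B} in
lemma cong_gram (b : Module.Basis ι F V) {v : κ → V} (hcard : Fintype.card κ = Module.finrank F V)
    (h : (gram B v).det ≠ 0) : Cong (gram B b) (gram B v) := by
  have : FiniteDimensional F V := b.finiteDimensional_of_finite
  cases isEmpty_or_nonempty κ with
  | inl hκ =>
    have : Fintype.card κ = Fintype.card ι := hcard.trans (Module.finrank_eq_card_basis b)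
    have : IsEmpty ι := by rwa [← Fintype.card_eq_zero_iff, ← this, Fintype.card_eq_zero_iff]
    refine ⟨0, 0, ?_, ?_, ?_⟩ <;> ext i <;> exact isEmptyElim i
  | inr hκ =>
    let c := basisOfLinearIndependentOfCardEqFinrank (linearIndependent_of_gram h) hcard
    have hc : ⇑c = v := coe_basisOfLinearIndependentOfCardEqFinrank _ _
    refine ⟨b.toMatrix c, c.toMatrix b, b.toMatrix_mul_toMatrix_flip c,
      c.toMatrix_mul_toMatrix_flip b, ?_⟩
    rw [← toMatrix_eq_gram, LinearMap.BilinForm.toMatrix_mul_basis_toMatrix, toMatrix_eq_gram, hc]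

end Gram

section CM

variable {L : Type*} [Field L] [NumberField L] [IsCMField L]

open IsCMField

local notation "K" => maximalRealSubfield L

/-- The square of an element of a CM field negated by complex conjugation. -/
noncomputable def antiSq (w : L) (hw : complexConj L w = -w) : K :=
  ⟨w ^ 2, (complexConj_eq_self_iff L _).1 (by rw [map_pow, hw, neg_sq])⟩

variable {w : L} (hw : complexConj L w = -w)

lemma coe_antiSq : (antiSq w hw : L) = w ^ 2 := rfl

lemma not_isSquare_antiSq (hw0 : w ≠ 0) : ¬IsSquare (antiSq w hw) := by
  rintro ⟨k, hk⟩
  have h : w ^ 2 = (k : L) ^ 2 := by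
    rw [← coe_antiSq hw, hk, sq]
    rfl
  have hwk : complexConj L w = w := by
    rcases sq_eq_sq_iff_eq_or_eq_neg.1 h with h | h
    · rw [h, complexConj_apply_eq_self]
    · rw [h, map_neg, complexConj_apply_eq_self]
  rw [hw] at hwk
  exact hw0 (self_eq_neg.1 hwk.symm)

lemma isGalois_maximalRealSubfield [IsAbelianGalois ℚ L] : IsGalois ℚ K :=
  (IsAbelianGalois.tower_bot ℚ K L).toIsGalois

lemma isSquare_apply_antiSq_mul [IsAbelianGalois ℚ L] (τ : K ≃ₐ[ℚ] K) :
    IsSquare (τ (antiSq w hw) * antiSq w hw) := by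
  let T := τ.liftNormal L
  have hT : ∀ x : K, T x = (τ x : L) := fun x ↦ τ.liftNormal_commutes L x
  have hc : complexConj L (T w) = -T w := by
    have h := congrArg (fun f : L ≃ₐ[ℚ] L ↦ f w)
      (mul_comm' T ((complexConj L).restrictScalars ℚ))
    change T (complexConj L w) = complexConj L (T w) at h
    rw [← h, hw, map_neg]
  refine ⟨⟨T w * w, (complexConj_eq_self_iff L _).1 (by rw [map_mul, hc, hw, neg_mul_neg])⟩, ?_⟩
  apply Subtype.ext
  change ((τ (antiSq w hw) : K) : L) * (antiSq w hw : L) = _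
  rw [← hT, coe_antiSq, map_pow]
  change _ = (T w * w) * (T w * w)
  ring

variable {ι κ : Type*} [Fintype ι] [DecidableEq ι] [Fintype κ] [DecidableEq κ]

/-- The hermitian trace form `(x, y) ↦ Tr (a * conj x * y)`. -/
noncomputable def hermForm (a : K) : LinearMap.BilinForm ℚ L :=
  LinearMap.mk₂ ℚ (fun x y ↦ Algebra.trace ℚ L ((a : L) * (complexConj L x * y)))
    (fun x y z ↦ by rw [map_add, add_mul, mul_add, map_add])
    (fun r x y ↦ by rw [map_rat_smul, smul_mul_assoc, mul_smul_comm, map_smul])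
    (fun x y z ↦ by rw [mul_add, mul_add, map_add])
    (fun r x y ↦ by rw [mul_smul_comm, mul_smul_comm, map_smul])

lemma hermForm_apply (a : K) (x y : L) :
    hermForm a x y = Algebra.trace ℚ L ((a : L) * (complexConj L x * y)) := rfl

lemma trace_complexConj (x : L) : Algebra.trace ℚ L (complexConj L x) = Algebra.trace ℚ L x :=
  Algebra.trace_eq_of_algEquiv ((complexConj L).restrictScalars ℚ) x

lemma hermForm_comm (a : K) (x y : L) : hermForm a x y = hermForm a y x := by
  rw [hermForm_apply, ← trace_complexConj, hermForm_apply]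
  simp only [map_mul, complexConj_apply_apply, complexConj_apply_eq_self]
  rw [mul_comm x]

lemma trace_coe (x : K) : Algebra.trace ℚ L (x : L) = 2 * Algebra.trace ℚ K x := by
  have h := Algebra.trace_trace (R := ℚ) (S := K) (x : L)
  rw [← h]
  have h2 : Algebra.trace K L (x : L) = 2 • x := by
    rw [← Algebra.IsQuadraticExtension.finrank_eq_two K L]
    exact Algebra.trace_algebraMap x
  rw [h2, map_nsmul, nsmul_eq_mul]
  rfl

lemma trace_mul_anti (hw : complexConj L w = -w) (x : K) : Algebra.trace ℚ L ((x : L) * w) = 0 := by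
  have h := trace_complexConj ((x : L) * w)
  rw [map_mul, complexConj_apply_eq_self, hw, mul_neg, map_neg] at h
  exact self_eq_neg.1 h.symm

lemma gram_hermForm_sumElim (e : Module.Basis ι ℚ K) (a : K) :
    gram (hermForm a) (Sum.elim (fun i ↦ (e i : L)) (fun i ↦ (e i : L) * w)) =
      Matrix.fromBlocks (traceMat e (2 * a)) 0 0 (traceMat e (-2 * antiSq w hw * a)) := by
  have hq : ∀ x : K, 2 * Algebra.trace ℚ K x = Algebra.trace ℚ K (2 * x) := fun x ↦ by
    rw [two_mul, two_mul, map_add]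
  ext (i | i) (j | j) <;>
    simp only [gram_apply, Sum.elim_inl, Sum.elim_inr, hermForm_apply, map_mul,
      complexConj_apply_eq_self, hw, Matrix.fromBlocks_apply₁₁, Matrix.fromBlocks_apply₁₂,
      Matrix.fromBlocks_apply₂₁, Matrix.fromBlocks_apply₂₂, Matrix.zero_apply, traceMat_apply]
  · rw [mul_assoc, ← hq, ← trace_coe]
    rfl
  · rw [← trace_mul_anti hw (a * (e i * e j))]
    congr 1
    push_cast
    ring
  · rw [← trace_mul_anti hw (-(a * (e i * e j)))]
    congr 1
    push_cast
    ring
  · have : -2 * antiSq w hw * a * (e i * e j) = 2 * (-antiSq w hw * a * (e i * e j)) := by ring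
    rw [this, ← hq, ← trace_coe]
    congr 1
    push_cast [coe_antiSq]
    ring

lemma gram_hermForm_isSymm (a : K) (v : ι → L) : (gram (hermForm a) v).IsSymm := by
  ext i j
  exact hermForm_comm a _ _

lemma gw_hermForm {a : K} (hw0 : w ≠ 0) (b : Module.Basis ι ℚ L) (ha : a ≠ 0) :
    (gram (hermForm a) b).det ≠ 0 ∧ gw (gram (hermForm a) b) = trH (antiSq w hw) a := by
  classical
  let e := Module.finBasis ℚ K
  have hδ : antiSq w hw ≠ 0 := fun h ↦ not_isSquare_antiSq hw hw0 (h ▸ IsSquare.zero)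
  have h2 : (2 : K) * a ≠ 0 := mul_ne_zero two_ne_zero ha
  have h3 : -2 * antiSq w hw * a ≠ 0 := mul_ne_zero (mul_ne_zero (by norm_num) hδ) ha
  have hdet : (gram (hermForm a) (Sum.elim (fun i ↦ (e i : L)) (fun i ↦ (e i : L) * w))).det ≠ 0 := by
    rw [gram_hermForm_sumElim hw, Matrix.det_fromBlocks_zero₁₂]
    exact mul_ne_zero (det_traceMat_ne_zero e h2) (det_traceMat_ne_zero e h3)
  have hcong := cong_gram b (by
    rw [Fintype.card_sum, Fintype.card_fin, ← two_mul,
      ← Algebra.IsQuadraticExtension.finrank_eq_two K L, mul_comm, Module.finrank_mul_finrank]) hdet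
  have hdet' := hcong.symm.det_ne_zero hdet
  refine ⟨hdet', ?_⟩
  rw [hcong.gw_eq (gram_hermForm_isSymm a b) hdet', gram_hermForm_sumElim hw,
    gw_fromBlocks (traceMat_isSymm _ _) (det_traceMat_ne_zero e h2) (traceMat_isSymm _ _)
      (det_traceMat_ne_zero e h3), gw_traceMat e h2, gw_traceMat e h3]
  rfl

end CM

section Cyclotomic

variable {L : Type*} [Field L] [NumberField L] [IsCMField L] {m : ℕ} {ζ : L}

open IsCMField

local notation "K" => maximalRealSubfield L

lemma complexConj_of_pow_eq_one [NeZero m] (hζ : ζ ^ m = 1) : complexConj L ζ = ζ⁻¹ := by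
  obtain ⟨φ⟩ : Nonempty (L →+* ℂ) := inferInstance
  apply φ.injective
  rw [complexEmbedding_complexConj, map_inv₀, Complex.inv_def, Complex.normSq_eq_norm_sq,
    Complex.norm_eq_one_of_pow_eq_one (n := m) (by rw [← map_pow, hζ, map_one]) (NeZero.ne m)]
  simp

lemma complexConj_sub_inv [NeZero m] (hζ : ζ ^ m = 1) :
    complexConj L (ζ - ζ⁻¹) = -(ζ - ζ⁻¹) := by
  rw [map_sub, map_inv₀, complexConj_of_pow_eq_one hζ, inv_inv, neg_sub]

lemma sub_inv_ne_zero (hζ : IsPrimitiveRoot ζ m) (hm : 3 ≤ m) : ζ - ζ⁻¹ ≠ 0 := by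
  intro h
  have h0 : ζ ≠ 0 := hζ.ne_zero (by lia)
  have h1 : ζ ^ 2 = 1 := by
    rw [sub_eq_zero] at h
    nth_rw 1 [sq, h, inv_mul_cancel₀ h0]
  have := Nat.le_of_dvd two_pos (hζ.dvd_of_pow_eq_one 2 h1)
  lia

/-- The `p`-power map is complex conjugation modulo `p` when `p ≡ -1` modulo `m`. -/
lemma exists_pow_sub_conj [NeZero m] [IsCyclotomicExtension {m} ℚ L] (hζ : IsPrimitiveRoot ζ m) {p : ℕ}
    (hp : p.Prime) (hpm : m ∣ p + 1) (x : 𝓞 L) :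
    ∃ y : 𝓞 L, x ^ p - ringOfIntegersComplexConj L x = p * y := by
  have hx : x ∈ Algebra.adjoin ℤ {hζ.toInteger} := by
    rw [IsCyclotomicExtension.adjoin_primitive_root_eq_top hζ.toInteger_isPrimitiveRoot]
    trivial
  change (p : 𝓞 L) ∣ _
  induction hx using Algebra.adjoin_induction with
  | mem x hx =>
    rw [Set.mem_singleton_iff.1 hx]
    have : hζ.toInteger ^ p - ringOfIntegersComplexConj L hζ.toInteger = 0 := by
      apply RingOfIntegers.coe_injective
      have h1 : algebraMap (𝓞 L) L (ringOfIntegersComplexConj L hζ.toInteger) = ζ⁻¹ :=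
        complexConj_of_pow_eq_one hζ.pow_eq_one
      rw [map_sub, h1, map_pow, map_zero]
      change ζ ^ p - ζ⁻¹ = 0
      rw [sub_eq_zero]
      apply eq_inv_of_mul_eq_one_left
      rw [← pow_succ]
      exact (hζ.pow_eq_one_iff_dvd _).2 hpm
    rw [this]
    exact dvd_zero _
  | algebraMap r =>
    have h1 : (p : ℤ) ∣ r ^ p - r := by
      have : Fact p.Prime := ⟨hp⟩
      rw [← ZMod.intCast_zmod_eq_zero_iff_dvd]
      simp
    have h2 := map_dvd (algebraMap ℤ (𝓞 L)) h1
    simpa using h2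
  | add x y _ _ hx hy =>
    obtain ⟨c, hc⟩ := exists_add_pow_prime_eq hp x y
    rw [hc, map_add]
    have h : x ^ p + y ^ p + p * x * y * c - (ringOfIntegersComplexConj L x + ringOfIntegersComplexConj L y) =
      (x ^ p - ringOfIntegersComplexConj L x) + (y ^ p - ringOfIntegersComplexConj L y) + p * (x * y * c) := by
        ring
    rw [h]
    exact dvd_add (dvd_add hx hy) (dvd_mul_right _ _)
  | mul x y _ _ hx hy =>
    rw [map_mul, mul_pow]
    have h : x ^ p * y ^ p - ringOfIntegersComplexConj L x * ringOfIntegersComplexConj L y =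
      (x ^ p - ringOfIntegersComplexConj L x) * y ^ p +
        ringOfIntegersComplexConj L x * (y ^ p - ringOfIntegersComplexConj L y) := by
        ring
    rw [h]
    exact dvd_add (hx.mul_right _) (hy.mul_left _)

lemma exists_zmod_root [NeZero m] [IsCyclotomicExtension {m} ℚ L] (hζ : IsPrimitiveRoot ζ m)
    {p : ℕ} [hp : Fact p.Prime] (hpm : m ∣ p + 1) (θ : 𝓞 K) :
    ∃ r : ZMod p, aeval r (minpoly ℤ (θ : K)) = 0 := by
  have hmax : (Ideal.span {(p : ℤ)}).IsMaximal :=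
    PrincipalIdealRing.isMaximal_of_irreducible (Nat.prime_iff_prime_int.1 hp.out).irreducible
  obtain ⟨P, hPmax, hP⟩ := Ideal.exists_maximal_ideal_liesOver_of_isIntegral
    (S := 𝓞 L) (Ideal.span {(p : ℤ)})
  let _ : Field (𝓞 L ⧸ P) := Ideal.Quotient.field P
  have hpP : (p : 𝓞 L) ∈ P := by
    have h : (p : ℤ) ∈ P.under ℤ := by
      rw [← hP.over]
      exact Ideal.mem_span_singleton_self _
    simpa [Ideal.mem_comap] using h
  have hchar : CharP (𝓞 L ⧸ P) p := by
    refine (CharP.charP_iff_prime_eq_zero hp.out).2 ?_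
    rw [← map_natCast (Ideal.Quotient.mk P), Ideal.Quotient.eq_zero_iff_mem]
    exact hpP
  let _ : Algebra (ZMod p) (𝓞 L ⧸ P) := ZMod.algebra _ p
  let φ : 𝓞 K →+* 𝓞 L ⧸ P := (Ideal.Quotient.mk P).comp (algebraMap (𝓞 K) (𝓞 L))
  have hfix : φ θ ^ p = φ θ := by
    obtain ⟨y, hy⟩ := exists_pow_sub_conj hζ hp.out hpm (algebraMap (𝓞 K) (𝓞 L) θ)
    rw [AlgEquiv.commutes] at hy
    have := congrArg (Ideal.Quotient.mk P) hy
    rw [map_sub, map_mul, Ideal.Quotient.eq_zero_iff_mem.2 hpP, zero_mul, map_pow, sub_eq_zero] at this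
    exact this
  obtain ⟨r, hr⟩ : ∃ r : ZMod p, algebraMap (ZMod p) (𝓞 L ⧸ P) r = φ θ := by
    have := (Subfield.mem_bot_iff_pow_eq_self (F := 𝓞 L ⧸ P) p).2 hfix
    exact (bot_le : (⊥ : Subfield (𝓞 L ⧸ P)) ≤ (algebraMap (ZMod p) (𝓞 L ⧸ P)).fieldRange) this
  refine ⟨r, ?_⟩
  apply (algebraMap (ZMod p) (𝓞 L ⧸ P)).injective
  have h1 : aeval θ (minpoly ℤ (θ : K)) = 0 := by
    apply RingOfIntegers.coe_injective
    rw [map_zero, ← aeval_algebraMap_apply]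
    exact minpoly.aeval ℤ (θ : K)
  have h2 := congrArg φ.toIntAlgHom h1
  rw [map_zero, ← aeval_algHom_apply] at h2
  rw [map_zero, ← aeval_algebraMap_apply, hr]
  exact h2

lemma isRoot_cyclotomic_of_sq_sub [NeZero m] (hζ : IsPrimitiveRoot ζ m) (hm : 3 ≤ m)
    {F : Type*} [Field F] [CharZero F] (σ : K →+* F) {s : F}
    (hs : σ (antiSq (ζ - ζ⁻¹) (complexConj_sub_inv hζ.pow_eq_one)) = s * s) :
    ∃ z : F, (cyclotomic m F).IsRoot z := by
  have hζ0 : ζ ≠ 0 := hζ.ne_zero (NeZero.ne m)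
  let θ : K := ⟨ζ + ζ⁻¹, (complexConj_eq_self_iff L _).1 (by
    rw [map_add, map_inv₀, complexConj_of_pow_eq_one hζ.pow_eq_one, inv_inv, add_comm])⟩
  have hδ : antiSq (ζ - ζ⁻¹) (complexConj_sub_inv hζ.pow_eq_one) = θ ^ 2 - 4 := by
    apply Subtype.ext
    change (ζ - ζ⁻¹) ^ 2 = (ζ + ζ⁻¹) ^ 2 - 4
    field_simp
    ring
  have hInt : IsIntegral K ζ := Algebra.IsIntegral.isIntegral ζ
  have h2 : 2 ≤ (minpoly K ζ).natDegree := by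
    rw [minpoly.two_le_natDegree_iff hInt]
    rintro ⟨k, hk⟩
    have h1 := complexConj_apply_eq_self L k
    change complexConj L (algebraMap K L k) = algebraMap K L k at h1
    rw [hk, complexConj_of_pow_eq_one hζ.pow_eq_one] at h1
    exact sub_inv_ne_zero hζ hm (by rw [h1, sub_self])
  have hq : minpoly K ζ ∣ X ^ 2 - C θ * X + 1 := by
    apply minpoly.dvd
    simp only [map_add, map_sub, map_pow, map_mul, map_one, aeval_X, aeval_C]
    change ζ ^ 2 - (ζ + ζ⁻¹) * ζ + 1 = 0
    field_simp
    ring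
  have hdeg : (X ^ 2 - C θ * X + 1 : (K)[X]).natDegree = 2 := by compute_degree!
  have hmonic : (X ^ 2 - C θ * X + 1 : (K)[X]).Monic := by monicity!
  have heq : X ^ 2 - C θ * X + 1 = minpoly K ζ :=
    (eq_of_monic_of_dvd_of_natDegree_le (minpoly.monic hInt) hmonic hq (by rw [hdeg]; exact h2))
  have hdvd : minpoly K ζ ∣ cyclotomic m K := by
    apply minpoly.dvd
    rw [aeval_def, eval₂_eq_eval_map, map_cyclotomic]
    exact hζ.isRoot_cyclotomic (NeZero.pos m)
  refine ⟨(σ θ + s) / 2, ?_⟩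
  rw [← map_cyclotomic m σ]
  refine IsRoot.dvd ?_ (Polynomial.map_dvd σ hdvd)
  rw [← heq, IsRoot.def]
  rw [hδ, map_sub, map_pow, map_ofNat] at hs
  simp only [Polynomial.map_add, Polynomial.map_sub, Polynomial.map_pow, Polynomial.map_mul,
    map_X, map_C, Polynomial.map_one, eval_add, eval_sub, eval_pow, eval_mul, eval_X, eval_C, eval_one]
  linear_combination (-1 / 4) * hs

lemma false_of_isRoot_cyclotomic [NeZero m] (hm : 3 ≤ m) {p : ℕ} [hp : Fact p.Prime]
    (hpm : m ∣ p + 1) {z : ℚ_[p]} (hz : (cyclotomic m ℚ_[p]).IsRoot z) : False := by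
  have hpz : z ^ m = 1 := ((isRoot_cyclotomic_iff).1 hz).pow_eq_one
  have hnorm : ‖z‖ = 1 := by
    have := congrArg norm hpz
    rw [norm_pow, norm_one] at this
    exact (pow_eq_one_iff_of_nonneg (norm_nonneg z) (NeZero.ne m)).1 this
  let y : ℤ_[p] := ⟨z, hnorm.le⟩
  have hy : (cyclotomic m ℤ_[p]).IsRoot y := by
    rw [← map_cyclotomic m (algebraMap ℤ_[p] ℚ_[p])] at hz
    exact IsRoot.of_map (f := algebraMap ℤ_[p] ℚ_[p]) (x := y) hz
      (FaithfulSMul.algebraMap_injective ℤ_[p] ℚ_[p])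
  have hr : (cyclotomic m (ZMod p)).IsRoot (PadicInt.toZMod y) := by
    rw [← map_cyclotomic m (PadicInt.toZMod (p := p))]
    exact hy.map
  have hmp : NeZero (m : ZMod p) := ⟨by
    rw [Ne, ZMod.natCast_eq_zero_iff]
    intro h
    have := (Nat.dvd_add_right (dvd_refl p)).1 (h.trans hpm)
    exact hp.out.one_lt.ne' (Nat.dvd_one.1 this)⟩
  have hprim := (isRoot_cyclotomic_iff).1 hr
  have h1 : m ∣ p - 1 := hprim.dvd_of_pow_eq_one _
    (ZMod.pow_card_sub_one_eq_one (hprim.ne_zero (NeZero.ne m)))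
  have h2 : m ∣ (p + 1) - (p - 1) := Nat.dvd_sub hpm h1
  have h3 : (p + 1) - (p - 1) = 2 := by
    have := hp.out.one_lt
    lia
  rw [h3] at h2
  have := Nat.le_of_dvd two_pos h2
  lia

lemma exists_embedding_antiSq_not_isSquare [NeZero m] [IsCyclotomicExtension {m} ℚ L]
    (hζ : IsPrimitiveRoot ζ m) (hm : 3 ≤ m) : ∃ N : ℤ, N ≠ 0 ∧
      ∀ (p : ℕ) [Fact p.Prime], ¬ (p : ℤ) ∣ N → m ∣ p + 1 → ∃ σ : K →+* ℚ_[p],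
        ¬IsSquare (σ (antiSq (ζ - ζ⁻¹) (complexConj_sub_inv hζ.pow_eq_one))) := by
  obtain ⟨θ, hθ⟩ := exists_integral_primitive K
  obtain ⟨N, hN, h⟩ := exists_embedding_of_root hθ
  refine ⟨N, hN, fun p hp hpN hpm ↦ ?_⟩
  obtain ⟨r, hr⟩ := exists_zmod_root hζ hpm θ
  obtain ⟨σ, -⟩ := h p hpN r hr
  refine ⟨σ, fun ⟨s, hs⟩ ↦ ?_⟩
  obtain ⟨z, hz⟩ := isRoot_cyclotomic_of_sq_sub hζ hm σ hs
  exact false_of_isRoot_cyclotomic hm hpm hz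

end Cyclotomic

lemma exists_even_ord_off {K : Type*} [Field K] [NumberField K] {x : K} (hx : x ≠ 0) :
    ∃ S₀ : Finset ℕ, (∀ p ∈ S₀, p.Prime) ∧
      ∀ S, S₀ ⊆ S → ∀ v : HeightOneSpectrum (𝓞 K), ¬Above S v → Even (ord v x) := by
  classical
  choose q hq hqv using fun v : HeightOneSpectrum (𝓞 K) ↦ exists_prime_mem' v
  refine ⟨(finite_ord_ne_zero hx).toFinset.image q, ?_, fun S hS v hv ↦ ?_⟩
  · intro p hp
    obtain ⟨v, -, rfl⟩ := Finset.mem_image.1 hp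
    exact hq v
  · by_contra h
    refine hv ⟨q v, hS (Finset.mem_image_of_mem q ?_), hqv v⟩
    rw [Set.Finite.mem_toFinset]
    intro h0
    rw [h0] at h
    exact h Even.zero

section Cyclotomic

variable {L : Type*} [Field L] [NumberField L] [IsCMField L] {m : ℕ} {ζ : L}
  {ι : Type*} [Fintype ι] [DecidableEq ι]

local notation "K" => maximalRealSubfield L

/-- A hermitian form over a cyclotomic field may be rescaled, without changing it at a given large
finite set of places, so that it becomes unimodular outside of one auxiliary place. -/
theorem exists_hermForm_resQ [NeZero m] [IsCyclotomicExtension {m} ℚ L] (hζ : IsPrimitiveRoot ζ m)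
    (hm : 3 ≤ m) (b : Module.Basis ι ℚ L) : ∃ S₀ : Finset ℕ, (∀ p ∈ S₀, p.Prime) ∧
      ∀ S, S₀ ⊆ S → (∀ p ∈ S, p.Prime) → ∀ (p₀ : ℕ) (_ : Fact p₀.Prime), p₀ ∉ S → m ∣ p₀ + 1 →
        ∀ a : K, a ≠ 0 → ∃ a' : K, a' ≠ 0 ∧
          gw (gram (hermForm a') b) - gw (gram (hermForm a) b) ∈ trivialAt S ∧
          ∃ e : Bool, ∀ (p : ℕ) (_ : Fact p.Prime) (_ : NeZero (2 : ZMod p)), p ∉ S →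
            resQ p (gw (gram (hermForm a') b)) = if p = p₀ ∧ e then eta p else 0 := by
  classical
  have hab := IsCyclotomicExtension.isAbelianGalois {m} ℚ L
  have hgal : IsGalois ℚ K := isGalois_maximalRealSubfield
  have hw := complexConj_sub_inv (L := L) hζ.pow_eq_one
  have hw0 := sub_inv_ne_zero hζ hm
  have hδ := not_isSquare_antiSq hw hw0
  have hδ0 : antiSq _ hw ≠ 0 := fun h ↦ hδ (h ▸ IsSquare.zero)
  obtain ⟨S₁, hS₁, hadm⟩ := exists_adm K
  obtain ⟨S₂, hS₂, heven⟩ := exists_even_ord_off hδ0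
  obtain ⟨N, hN, hemb⟩ := exists_embedding_antiSq_not_isSquare hζ hm
  refine ⟨S₁ ∪ S₂ ∪ N.natAbs.primeFactors, ?_, fun S hS hprime p₀ hp₀ hp₀S hmp a ha ↦ ?_⟩
  · intro p hp
    rcases Finset.mem_union.1 hp with hp | hp
    · rcases Finset.mem_union.1 hp with hp | hp
      exacts [hS₁ p hp, hS₂ p hp]
    · exact Nat.prime_of_mem_primeFactors hp
  · have hA := hadm S (Finset.subset_union_left.trans (Finset.subset_union_left.trans hS)) hprime
    obtain ⟨σ, hσ⟩ := hemb p₀ (fun h ↦ hp₀S (hS (Finset.mem_union_right _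
      (Nat.mem_primeFactors.2 ⟨hp₀.out, Int.natCast_dvd.1 h, Int.natAbs_ne_zero.2 hN⟩)))) hmp
    obtain ⟨q, hq, e, he⟩ := exists_near_resQ_trH hA hδ (isSquare_apply_antiSq_mul hw)
      (heven S (Finset.subset_union_right.trans (Finset.subset_union_left.trans hS))) hp₀S hσ
      (Units.mk0 a ha)
    have ha' : ((Units.mk0 a ha * q : (K)ˣ) : K) ≠ 0 := Units.ne_zero _
    refine ⟨_, ha', ?_, e, ?_⟩
    · rw [(gw_hermForm hw hw0 b ha').2, (gw_hermForm hw hw0 b ha).2]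
      exact trH_sub_mem_trivialAt hq hδ0 ha
    · rw [(gw_hermForm hw hw0 b ha').2]
      exact he

end Cyclotomic

end

section Isometry

variable {F V : Type*} [Field F] [AddCommGroup V] [Module F V]

/-- The cyclic submodule generated by a vector. -/
noncomputable def cyc (t : Module.End F V) (x : V) : Submodule F V :=
  LinearMap.range ((LinearMap.applyₗ x).comp (aeval t : F[X] →ₐ[F] Module.End F V).toLinearMap)

lemma mem_cyc {t : Module.End F V} {x u : V} : u ∈ cyc t x ↔ ∃ p : F[X], aeval t p x = u := Iff.rfl

lemma aeval_mem_cyc (t : Module.End F V) (p : F[X]) (x : V) : aeval t p x ∈ cyc t x := ⟨p, rfl⟩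

lemma self_mem_cyc (t : Module.End F V) (x : V) : x ∈ cyc t x :=
  ⟨1, by rw [LinearMap.comp_apply]; simp⟩

lemma aeval_mul_apply (t : Module.End F V) (p q : F[X]) (x : V) :
    aeval t (p * q) x = aeval t p (aeval t q x) := by
  rw [map_mul, Module.End.mul_apply]

lemma aeval_comm_apply (t : Module.End F V) (p q : F[X]) (x : V) :
    aeval t p (aeval t q x) = aeval t q (aeval t p x) := by
  rw [← aeval_mul_apply, mul_comm, aeval_mul_apply]

lemma cyc_le_of_mem {t : Module.End F V} {x y : V} (h : y ∈ cyc t x) : cyc t y ≤ cyc t x := by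
  obtain ⟨q, rfl⟩ := mem_cyc.1 h
  rintro _ ⟨p, rfl⟩
  exact ⟨p * q, aeval_mul_apply t p q x⟩

lemma aeval_mem_of_invariant {t : Module.End F V} {Q : Submodule F V} (hQ : ∀ x ∈ Q, t x ∈ Q)
    (p : F[X]) {x : V} (hx : x ∈ Q) : aeval t p x ∈ Q := by
  induction p using Polynomial.induction_on' with
  | add p q hp hq =>
    rw [map_add, LinearMap.add_apply]
    exact Q.add_mem hp hq
  | monomial n a =>
    rw [aeval_monomial, Module.End.mul_apply, Module.algebraMap_end_apply]
    apply Q.smul_mem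
    induction n with
    | zero => simpa using hx
    | succ n ih =>
      rw [pow_succ', Module.End.mul_apply]
      exact hQ _ ih

lemma apply_mem_cyc {t : Module.End F V} {x u : V} (h : u ∈ cyc t x) : t u ∈ cyc t x := by
  obtain ⟨q, rfl⟩ := mem_cyc.1 h
  exact ⟨X * q, by rw [LinearMap.comp_apply]; simp⟩

/-- The restriction of the form to the cyclic submodule generated by `x` is nondegenerate. -/
def Good (B : LinearMap.BilinForm F V) (t : Module.End F V) (x : V) : Prop :=
  ∀ u ∈ cyc t x, (∀ v ∈ cyc t x, B u v = 0) → u = 0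

/-- A periodic isometry of a nondegenerate symmetric form. -/
structure IsPeriodicIsometry (B : LinearMap.BilinForm F V) (t : Module.End F V) (M : ℕ) : Prop where
  pos : 0 < M
  comm : ∀ x y, B x y = B y x
  nondeg : ∀ x, (∀ y, B x y = 0) → x = 0
  isom : ∀ x y, B (t x) (t y) = B x y
  pow : t ^ M = 1

namespace IsPeriodicIsometry

variable {B : LinearMap.BilinForm F V} {t : Module.End F V} {M : ℕ}

lemma adjoint (h : IsPeriodicIsometry B t M)
    (p : F[X]) (x y : V) : B (aeval t p x) y = B x (aeval (t ^ (M - 1)) p y) := by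
  have h1 : ∀ x y, B (t x) y = B x ((t ^ (M - 1)) y) := fun x y ↦ by
    rw [← h.isom x, ← Module.End.mul_apply, ← pow_succ', Nat.sub_add_cancel h.pos, h.pow,
      Module.End.one_apply]
  induction p using Polynomial.induction_on' generalizing x y with
  | add p q hp hq =>
    rw [map_add, map_add, LinearMap.add_apply, LinearMap.add_apply, map_add, map_add,
      LinearMap.add_apply, hp, hq]
  | monomial n a =>
    simp only [aeval_monomial, Module.End.mul_apply, Module.algebraMap_end_apply, map_smul,
      LinearMap.smul_apply]
    congr 1
    induction n generalizing x y with
    | zero => simp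
    | succ n ih => rw [pow_succ', Module.End.mul_apply, h1, ih, ← Module.End.mul_apply, ← pow_succ]

lemma exists_adjoint (h : IsPeriodicIsometry B t M) (p : F[X]) :
    ∃ q : F[X], ∀ x y, B (aeval t p x) y = B x (aeval t q y) :=
  ⟨p.comp (X ^ (M - 1)), fun x y ↦ by rw [h.adjoint, aeval_comp]; simp⟩

lemma isSemisimple [CharZero F] [FiniteDimensional F V] (h : IsPeriodicIsometry B t M) :
    t.IsSemisimple := by
  refine Module.End.isSemisimple_of_squarefree_aeval_eq_zero (p := X ^ M - 1) ?_ ?_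
  · exact (separable_X_pow_sub_C (1 : F) (by exact_mod_cast h.pos.ne') one_ne_zero).squarefree
  · simp [h.pow]

/-- Self-adjoint idempotents complementary to a nondegenerate cyclic submodule. -/
lemma exists_idempotent [CharZero F] [FiniteDimensional F V] (h : IsPeriodicIsometry B t M)
    {x : V} (hx : Good B t x) :
    ∃ e : F[X], aeval t e x = 0 ∧ (∀ s : F[X], aeval t s x = 0 → aeval t (s * e) = aeval t s) ∧
      ∀ u v, B (aeval t e u) v = B u (aeval t e v) := by
  let I : Ideal F[X] :=
    { carrier := {p | aeval t p x = 0}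
      add_mem' := fun {p q} hp hq ↦ by
        change aeval t (p + q) x = 0
        rw [map_add, LinearMap.add_apply, show aeval t p x = 0 from hp,
          show aeval t q x = 0 from hq, add_zero]
      zero_mem' := by
        change aeval t (0 : F[X]) x = 0
        rw [map_zero, LinearMap.zero_apply]
      smul_mem' := fun c p hp ↦ by
        change aeval t (c * p) x = 0
        rw [aeval_mul_apply, show aeval t p x = 0 from hp, map_zero] }
  have hI : ∀ p, p ∈ I ↔ aeval t p x = 0 := fun p ↦ Iff.rfl
  let a := Submodule.IsPrincipal.generator I
  have ha : ∀ p, aeval t p x = 0 ↔ a ∣ p := fun p ↦ by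
    rw [← hI, Submodule.IsPrincipal.mem_iff_generator_dvd]
  have hμ : aeval t (minpoly F t) = 0 := minpoly.aeval F t
  obtain ⟨c, hc⟩ := (ha (minpoly F t)).1 (by rw [hμ, LinearMap.zero_apply])
  have hsq : Squarefree (minpoly F t) := h.isSemisimple.minpoly_squarefree
  rw [hc, squarefree_mul_iff] at hsq
  obtain ⟨u, v, huv⟩ := hsq.1.isCoprime
  have hmul : ∀ s, aeval t s x = 0 → aeval t (s * (u * a)) = aeval t s := by
    intro s hs
    obtain ⟨s', rfl⟩ := (ha s).1 hs
    have : a * s' * (u * a) = a * s' - v * s' * minpoly F t := by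
      rw [hc]
      linear_combination (a * s') * huv
    rw [this, map_sub, map_mul _ (v * s'), hμ, mul_zero, sub_zero]
  have hex : aeval t (u * a) x = 0 := (ha _).2 (dvd_mul_left _ _)
  refine ⟨u * a, hex, hmul, ?_⟩
  obtain ⟨e', he'⟩ := h.exists_adjoint (u * a)
  have he'x : aeval t e' x = 0 := by
    refine hx _ (aeval_mem_cyc _ _ _) fun w hw ↦ ?_
    obtain ⟨p, rfl⟩ := mem_cyc.1 hw
    rw [h.comm, ← he', aeval_comm_apply, hex, map_zero, map_zero, LinearMap.zero_apply]
  have he'e := hmul e' he'x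
  have hEE : ∀ y z, B (aeval t (u * a) y) z = B (aeval t (u * a) y) (aeval t (u * a) z) :=
    fun y z ↦ by rw [he', he', ← aeval_mul_apply, he'e]
  intro y z
  rw [hEE y z, h.comm y, hEE z y, h.comm]

lemma exists_good_in_range [CharZero F] [FiniteDimensional F V]
    (h : IsPeriodicIsometry B t M) {e : F[X]} (he : aeval t e ≠ 0)
    (hee : aeval t (e * e) = aeval t e) (hadj : ∀ u v, B (aeval t e u) v = B u (aeval t e v)) :
    ∃ y, y ≠ 0 ∧ aeval t e y = y ∧ Good B t y := by
  have hee' : ∀ u, aeval t e (aeval t e u) = aeval t e u := fun u ↦ by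
    rw [← aeval_mul_apply, hee]
  have hex : ∃ y, aeval t e y = y ∧ B y y ≠ 0 := by
    by_contra! hcon
    apply he
    ext u
    refine h.nondeg _ fun v ↦ ?_
    have h1 := hcon _ (hee' (u + v))
    rw [map_add] at h1
    simp only [map_add, LinearMap.add_apply, hcon _ (hee' u), hcon _ (hee' v)] at h1
    rw [h.comm (aeval t e v), zero_add, add_zero, ← two_mul] at h1
    rw [← hee' u, hadj]
    exact (mul_eq_zero.1 h1).resolve_left two_ne_zero
  obtain ⟨y, ⟨hy, hyB⟩, hmin⟩ := (InvImage.wf (fun y ↦ Module.finrank F (cyc t y))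
    wellFounded_lt).has_min {y | aeval t e y = y ∧ B y y ≠ 0} hex
  refine ⟨y, ?_, hy, ?_⟩
  · rintro rfl
    simp at hyB
  intro u hu hur
  let R : Submodule F V := cyc t y ⊓ LinearMap.ker (B.domRestrict₁₂ ⊤ (cyc t y) ∘ₗ (Submodule.topEquiv.symm : V ≃ₗ[F] (⊤ : Submodule F V)).toLinearMap)
  have hR : ∀ z, z ∈ R ↔ z ∈ cyc t y ∧ ∀ v ∈ cyc t y, B z v = 0 := by
    intro z
    simp only [R, Submodule.mem_inf, LinearMap.mem_ker, LinearMap.ext_iff]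
    refine and_congr_right fun _ ↦ ⟨fun h v hv ↦ h ⟨v, hv⟩, fun h v ↦ h v v.2⟩
  have hRinv : R ∈ t.invtSubmodule := by
    intro z hz
    change t z ∈ R
    have hz' := (hR z).1 hz
    refine (hR _).2 ⟨apply_mem_cyc hz'.1, fun v hv ↦ ?_⟩
    have h2 := h.adjoint X z v
    rw [aeval_X, aeval_X] at h2
    rw [h2]
    have h3 := aeval_mem_of_invariant (fun w hw ↦ apply_mem_cyc hw) (X ^ (M - 1)) hv
    rw [map_pow, aeval_X] at h3
    exact hz'.2 _ h3
  obtain ⟨Q, hQ, hRQ⟩ := Module.End.isSemisimple_iff.1 h.isSemisimple R hRinv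
  obtain ⟨r, hr, c, hc, hrc⟩ := Submodule.mem_sup.1 (hRQ.sup_eq_top.symm ▸ Submodule.mem_top : y ∈ R ⊔ Q)
  have hr' := (hR r).1 hr
  have hcy : c ∈ cyc t y := by
    have : c = y - r := by rw [← hrc, add_sub_cancel_left]
    rw [this]
    exact Submodule.sub_mem _ (self_mem_cyc t y) hr'.1
  have hce : aeval t e c = c := by
    obtain ⟨p, rfl⟩ := mem_cyc.1 hcy
    rw [aeval_comm_apply, hy]
  have hcB : B c c = B y y := by
    rw [← hrc]
    simp only [map_add, LinearMap.add_apply, hr'.2 c hcy, h.comm c r, hr'.2 r hr'.1, zero_add]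
  have hle := cyc_le_of_mem hcy
  have hnot := hmin c ⟨hce, hcB ▸ hyB⟩
  have heq : cyc t c = cyc t y := by
    refine Submodule.eq_of_le_of_finrank_le hle (not_lt.1 hnot)
  have hcQ : cyc t c ≤ Q := by
    have hQ' : ∀ w ∈ Q, t w ∈ Q := fun w hw ↦ hQ hw
    rintro _ ⟨p, rfl⟩
    exact aeval_mem_of_invariant hQ' p hc
  exact (Submodule.disjoint_def.1 hRQ.disjoint) u ((hR u).2 ⟨hu, hur⟩) (hcQ (heq ▸ hu))

/-- There is a vector with full annihilator generating a nondegenerate cyclic submodule. -/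
theorem exists_good [CharZero F] [FiniteDimensional F V] (h : IsPeriodicIsometry B t M) :
    ∃ x, Good B t x ∧ ∀ s : F[X], aeval t s x = 0 → aeval t s = 0 := by
  obtain ⟨x, hx, hmin⟩ := (InvImage.wf (fun y ↦ Module.finrank F V - Module.finrank F (cyc t y))
    wellFounded_lt).has_min {y | Good B t y} ⟨0, fun u hu _ ↦ by
      obtain ⟨p, rfl⟩ := mem_cyc.1 hu
      rw [map_zero]⟩
  refine ⟨x, hx, ?_⟩
  obtain ⟨e, hex, hs, hadj⟩ := h.exists_idempotent hx
  by_cases he : aeval t e = 0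
  · intro s hsx
    rw [← hs s hsx, map_mul, he, mul_zero]
  exfalso
  obtain ⟨y, hy0, hey, hy⟩ := h.exists_good_in_range he (hs e hex) hadj
  have hep : ∀ p : F[X], aeval t e (aeval t p x) = 0 := fun p ↦ by
    rw [aeval_comm_apply, hex, map_zero]
  have hep' : ∀ p : F[X], aeval t e (aeval t p y) = aeval t p y := fun p ↦ by
    rw [aeval_comm_apply, hey]
  have horth : ∀ p q : F[X], B (aeval t p x) (aeval t q y) = 0 := fun p q ↦ by
    rw [← hep' q, ← hadj, hep, map_zero, LinearMap.zero_apply]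
  have hymem : y ∈ cyc t (x + y) := ⟨e, by
    change aeval t e (x + y) = y
    rw [map_add, hex, hey, zero_add]⟩
  have hxmem : x ∈ cyc t (x + y) := by
    have := Submodule.sub_mem _ (self_mem_cyc t (x + y)) hymem
    rwa [add_sub_cancel_right] at this
  have hlt : cyc t x < cyc t (x + y) := by
    refine lt_of_le_of_ne (cyc_le_of_mem hxmem) fun heq ↦ hy0 ?_
    rw [← heq] at hymem
    obtain ⟨p, hp⟩ := mem_cyc.1 hymem
    rw [← hey, ← hp, hep]
  refine hmin (x + y) ?_ ?_
  · intro u hu hur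
    obtain ⟨p, rfl⟩ := mem_cyc.1 hu
    have h1 : ∀ v ∈ cyc t y, B (aeval t p y) v = 0 := by
      rintro _ ⟨q, rfl⟩
      have := hur _ (cyc_le_of_mem hymem (aeval_mem_cyc t q y))
      rwa [map_add, map_add, LinearMap.add_apply, horth, zero_add] at this
    have h2 : ∀ v ∈ cyc t x, B (aeval t p x) v = 0 := by
      rintro _ ⟨q, rfl⟩
      have := hur _ (cyc_le_of_mem hxmem (aeval_mem_cyc t q x))
      rwa [map_add, map_add, LinearMap.add_apply, h.comm (aeval t p y), horth, add_zero] at this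
    rw [map_add, hx _ (aeval_mem_cyc t p x) h2, hy _ (aeval_mem_cyc t p y) h1, add_zero]
  · have h1 := Submodule.finrank_lt_finrank_of_lt hlt
    have h2 := Submodule.finrank_le (cyc t (x + y))
    change Module.finrank F V - Module.finrank F (cyc t (x + y)) <
      Module.finrank F V - Module.finrank F (cyc t x)
    lia

end IsPeriodicIsometry

end Isometry

section Charpoly

variable {F ι : Type*} [Field F] [Fintype ι] [DecidableEq ι]

lemma exists_charmatrix_mul (M : Matrix ι ι F) (p : F[X]) :
    ∃ N, Matrix.scalar ι p - (C : F →+* F[X]).mapMatrix (aeval M p) = M.charmatrix * N := by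
  induction p using Polynomial.induction_on' with
  | add p q hp hq =>
    obtain ⟨N, hN⟩ := hp
    obtain ⟨N', hN'⟩ := hq
    exact ⟨N + N', by rw [mul_add, ← hN, ← hN', map_add, map_add, map_add]; abel⟩
  | monomial n a =>
    have hcomm : Commute (Matrix.scalar ι (X : F[X])) ((C : F →+* F[X]).mapMatrix M) :=
      Matrix.scalar_commute _ (fun r' ↦ Commute.all _ r') _
    have h := hcomm.mul_geom_sum₂ n
    refine ⟨(∑ i ∈ Finset.range n, Matrix.scalar ι (X : F[X]) ^ i *
      (C : F →+* F[X]).mapMatrix M ^ (n - 1 - i)) * Matrix.scalar ι (C a), ?_⟩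
    rw [Matrix.charmatrix, ← mul_assoc, h, sub_mul, aeval_monomial, map_mul, map_pow,
      ← C_mul_X_pow_eq_monomial, mul_comm (C a), map_mul, map_pow]
    congr 1
    rw [← map_pow, ← map_mul, Algebra.commutes a, map_mul]
    congr 1
    ext i j
    simp [Matrix.algebraMap_matrix_apply, Matrix.diagonal_apply, apply_ite]

lemma _root_.Matrix.charpoly_dvd_pow (M : Matrix ι ι F) {p : F[X]} (hp : aeval M p = 0) :
    M.charpoly ∣ p ^ Fintype.card ι := by
  obtain ⟨N, hN⟩ := exists_charmatrix_mul M p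
  rw [hp, map_zero, sub_zero] at hN
  have h := congrArg Matrix.det hN
  rw [Matrix.det_mul, Matrix.scalar_apply, Matrix.det_diagonal, Finset.prod_const,
    Finset.card_univ] at h
  exact ⟨_, h⟩

variable {V : Type*} [AddCommGroup V] [Module F V] [FiniteDimensional F V]

lemma _root_.LinearMap.dvd_minpoly_of_dvd_charpoly (t : Module.End F V) {p : F[X]}
    (hp : Squarefree p) (h : p ∣ t.charpoly) : p ∣ minpoly F t := by
  let b := Module.finBasis F V
  have h1 : aeval (LinearMap.toMatrixAlgEquiv b t) (minpoly F t) = 0 := by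
    rw [aeval_algHom_apply, minpoly.aeval, map_zero]
  have h2 := Matrix.charpoly_dvd_pow _ h1
  have h3 : (LinearMap.toMatrixAlgEquiv b t).charpoly = t.charpoly := LinearMap.charpoly_toMatrix t b
  rw [h3] at h2
  refine (hp.dvd_pow_iff_dvd (Nat.succ_ne_zero _)).1
    ((h.trans h2).trans (pow_dvd_pow _ (Nat.le_succ _)))

lemma _root_.LinearMap.charpoly_eq_mul_of_isCompl (t : Module.End F V) {U W : Submodule F V}
    (hUW : IsCompl U W) (hU : ∀ x ∈ U, t x ∈ U) (hW : ∀ x ∈ W, t x ∈ W) :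
    t.charpoly = (t.restrict hU).charpoly * (t.restrict hW).charpoly := by
  rw [← LinearMap.charpoly_prodMap,
    ← (Submodule.prodEquivOfIsCompl U W hUW).charpoly_conj]
  congr 1
  ext x
  rw [LinearEquiv.conj_apply_apply]
  obtain ⟨⟨u, w⟩, rfl⟩ := (Submodule.prodEquivOfIsCompl U W hUW).surjective x
  rw [LinearEquiv.symm_apply_apply]
  simp

end Charpoly

namespace IsPeriodicIsometry

variable {F V : Type*} [Field F] [AddCommGroup V] [Module F V] [CharZero F] [FiniteDimensional F V]
  {B : LinearMap.BilinForm F V} {t : Module.End F V} {M : ℕ}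

lemma exists_good_of_dvd (h : IsPeriodicIsometry B t M) {f : F[X]} (hf : Squarefree f)
    (hft : f ∣ t.charpoly) (hfM : f ∣ f.comp (X ^ (M - 1))) :
    ∃ x, Good B t x ∧ ∀ q : F[X], aeval t q x = 0 ↔ f ∣ q := by
  obtain ⟨x₀, hx₀, hann⟩ := h.exists_good
  have hann' : ∀ q : F[X], aeval t q x₀ = 0 ↔ minpoly F t ∣ q := fun q ↦ by
    rw [minpoly.dvd_iff]
    exact ⟨hann q, fun hq ↦ by rw [hq, LinearMap.zero_apply]⟩
  obtain ⟨c, hc⟩ := t.dvd_minpoly_of_dvd_charpoly hf hft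
  have hsq : Squarefree (minpoly F t) := h.isSemisimple.minpoly_squarefree
  have hc0 : c ≠ 0 := by
    rintro rfl
    exact hsq.ne_zero (by rw [hc, mul_zero])
  have hsq' := hsq
  rw [hc, squarefree_mul_iff] at hsq'
  obtain ⟨u, v, huv⟩ := hsq'.1.isCoprime
  have hvf : IsCoprime f v := ⟨u, c, by linear_combination huv⟩
  have hfvc : aeval t (f * (v * c)) = 0 := by
    rw [← minpoly.dvd_iff, hc]
    exact ⟨v, by ring⟩
  have hE : ∀ w, aeval t f w = 0 → aeval t (v * c) w = w := fun w hw ↦ by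
    rw [show v * c = 1 - u * f by rw [← huv]; ring, map_sub, map_one,
      LinearMap.sub_apply, aeval_mul_apply, hw, map_zero, sub_zero, Module.End.one_apply]
  refine ⟨aeval t (v * c) x₀, ?_, fun q ↦ ?_⟩
  · intro y hy hy0
    refine hx₀ y (cyc_le_of_mem (aeval_mem_cyc _ _ _) hy) fun w hw ↦ ?_
    obtain ⟨r, rfl⟩ := mem_cyc.1 hw
    have hyy : aeval t (v * c) y = y := by
      obtain ⟨p, rfl⟩ := mem_cyc.1 hy
      apply hE
      rw [aeval_comm_apply, ← aeval_mul_apply t f, hfvc, LinearMap.zero_apply, map_zero]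
    rw [← hyy, h.adjoint]
    apply hy0
    have hcomp : ∀ p : F[X], aeval (t ^ (M - 1)) p = aeval t (p.comp (X ^ (M - 1))) := fun p ↦ by
      rw [aeval_comp, map_pow, aeval_X]
    have hf0 : aeval t f (aeval (t ^ (M - 1)) (v * c) (aeval t r x₀)) = 0 := by
      refine h.nondeg _ fun z ↦ ?_
      obtain ⟨d, hd⟩ := hfM
      rw [h.adjoint, h.comm, ← h.adjoint, hcomp, ← aeval_mul_apply, hd, 
        show v * c * (f * d) = d * (f * (v * c)) by ring, map_mul, hfvc, mul_zero,
        LinearMap.zero_apply, map_zero, LinearMap.zero_apply]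
    rw [← hE _ hf0, hcomp, aeval_comm_apply, aeval_comm_apply t (v * c) r, ← aeval_mul_apply]
    exact aeval_mem_cyc _ _ _
  · rw [← aeval_mul_apply, hann', hc, ← mul_assoc, mul_dvd_mul_iff_right hc0]
    exact ⟨hvf.dvd_of_dvd_mul_right, fun h ↦ h.mul_right _⟩

end IsPeriodicIsometry

section Cyclic

variable {F V : Type*} [Field F] [AddCommGroup V] [Module F V]
  {B : LinearMap.BilinForm F V} {t : Module.End F V} {x : V} {f : F[X]}

lemma span_pow_eq_cyc (hf : f.Monic) (hf1 : f ≠ 1) (hx : ∀ q, aeval t q x = 0 ↔ f ∣ q) {d : ℕ}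
    (hd : d = f.natDegree) : Submodule.span F (Set.range fun a : Fin d ↦ (t ^ (a : ℕ)) x) = cyc t x := by
  apply le_antisymm
  · rw [Submodule.span_le]
    rintro _ ⟨a, rfl⟩
    exact ⟨X ^ (a : ℕ), by rw [LinearMap.comp_apply]; simp⟩
  · rintro _ ⟨q, rfl⟩
    change aeval t q x ∈ _
    have h : aeval t q x = aeval t (q %ₘ f) x := by
      conv_lhs => rw [← modByMonic_add_div q f, map_add, LinearMap.add_apply,
        (hx (f * (q /ₘ f))).2 (dvd_mul_right _ _), add_zero]
    rw [h, aeval_eq_sum_range' (hd ▸ natDegree_modByMonic_lt q hf hf1 : _ < d), LinearMap.sum_apply]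
    refine Submodule.sum_mem _ fun a ha ↦ Submodule.smul_mem _ _ (Submodule.subset_span ?_)
    exact ⟨⟨a, Finset.mem_range.1 ha⟩, rfl⟩

lemma linearIndependent_pow (hf : f.Monic) (hx : ∀ q, aeval t q x = 0 ↔ f ∣ q) {d : ℕ}
    (hd : d = f.natDegree) : LinearIndependent F (fun a : Fin d ↦ (t ^ (a : ℕ)) x) := by
  rw [Fintype.linearIndependent_iff]
  intro g hg
  let q : F[X] := ∑ a : Fin d, C (g a) * X ^ (a : ℕ)
  have hq : q.degree < d := degree_sum_fin_lt g
  have hqx : aeval t q x = 0 := by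
    rw [← hg]
    simp [q, LinearMap.sum_apply, Module.algebraMap_end_apply]
  have hq0 : q = 0 := by
    refine eq_zero_of_dvd_of_degree_lt ((hx q).1 hqx) (hq.trans_le ?_)
    rw [degree_eq_natDegree hf.ne_zero, hd]
  intro a
  have h2 := congrArg (fun r : F[X] ↦ r.coeff a) hq0
  simpa [q, finsetSum_coeff, coeff_X_pow, Fin.val_inj] using h2

lemma det_gram_pow_ne_zero (hgood : Good B t x) (hf : f.Monic) (hf1 : f ≠ 1)
    (hx : ∀ q, aeval t q x = 0 ↔ f ∣ q) {d : ℕ} (hd : d = f.natDegree) :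
    (gram B fun a : Fin d ↦ (t ^ (a : ℕ)) x).det ≠ 0 := by
  intro h0
  obtain ⟨g, hg0, hg⟩ := Matrix.exists_vecMul_eq_zero_iff.2 h0
  apply hg0
  have hspan := span_pow_eq_cyc hf hf1 hx hd
  have h1 : ∑ a : Fin d, g a • (t ^ (a : ℕ)) x = 0 := by
    apply hgood
    · rw [← hspan]
      exact Submodule.sum_mem _ fun a _ ↦ Submodule.smul_mem _ _ (Submodule.subset_span ⟨a, rfl⟩)
    · intro v hv
      rw [← hspan] at hv
      induction hv using Submodule.span_induction with
      | mem v hv =>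
        obtain ⟨b, rfl⟩ := hv
        have h2 := congrFun hg b
        simp only [Matrix.vecMul, dotProduct, gram_apply, Pi.zero_apply] at h2
        rw [← h2]
        simp [LinearMap.sum_apply]
      | zero => simp
      | add v w _ _ hv hw => rw [map_add, hv, hw, add_zero]
      | smul c v _ hv => rw [map_smul, hv, smul_zero]
  exact funext (Fintype.linearIndependent_iff.1 (linearIndependent_pow hf hx hd) g h1)

lemma coe_aeval_restrict {W : Submodule F V} (hW : ∀ x ∈ W, t x ∈ W) (q : F[X]) (w : W) :
    (aeval (t.restrict hW) q w : V) = aeval t q w := by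
  induction q using Polynomial.induction_on' generalizing w with
  | add p q hp hq => simp only [map_add, LinearMap.add_apply, Submodule.coe_add, hp, hq]
  | monomial n a =>
    simp only [aeval_monomial, Module.End.mul_apply, Module.algebraMap_end_apply,
      Submodule.coe_smul]
    congr 1
    induction n generalizing w with
    | zero => rfl
    | succ n ih => rw [pow_succ, pow_succ, Module.End.mul_apply, Module.End.mul_apply, ih]; rfl

lemma coe_mem_cyc_iff {W : Submodule F V} (hW : ∀ x ∈ W, t x ∈ W) (x : W) {v : V} :
    v ∈ cyc t x ↔ ∃ w ∈ cyc (t.restrict hW) x, (w : V) = v := by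
  constructor
  · rintro ⟨q, rfl⟩
    exact ⟨_, aeval_mem_cyc _ q x, coe_aeval_restrict hW q x⟩
  · rintro ⟨_, ⟨q, rfl⟩, rfl⟩
    exact ⟨q, (coe_aeval_restrict hW q x).symm⟩

lemma charpoly_restrict_cyc [FiniteDimensional F V] (hf : f.Monic) (hf1 : f ≠ 1)
    (hx : ∀ q, aeval t q x = 0 ↔ f ∣ q) :
    (t.restrict (p := cyc t x) (q := cyc t x) fun _ ↦ apply_mem_cyc).charpoly = f := by
  refine eq_of_monic_of_dvd_of_natDegree_le hf (LinearMap.charpoly_monic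
    (t.restrict (p := cyc t x) (q := cyc t x) fun _ ↦ apply_mem_cyc)) ?_ ?_
  · rw [← hx]
    have := LinearMap.aeval_self_charpoly
      (t.restrict (p := cyc t x) (q := cyc t x) fun _ ↦ apply_mem_cyc)
    have h2 := congrArg (fun s ↦ ((s ⟨x, self_mem_cyc t x⟩ : cyc t x) : V)) this
    rw [coe_aeval_restrict] at h2
    exact h2
  · rw [LinearMap.charpoly_natDegree, ← span_pow_eq_cyc hf hf1 hx rfl]
    exact (finrank_range_le_card _).trans (Fintype.card_fin _).le

end Cyclic

theorem IsPeriodicIsometry.exists_family {F J : Type*} [Field F] [CharZero F] [DecidableEq J]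
    {M : ℕ} {f : J → F[X]} (hf : ∀ j, (f j).Monic) (hf1 : ∀ j, f j ≠ 1)
    (hsq : ∀ j, Squarefree (f j)) (hfM : ∀ j, f j ∣ (f j).comp (X ^ (M - 1))) (s : Finset J)
    {V : Type*} [AddCommGroup V] [Module F V] [FiniteDimensional F V]
    {B : LinearMap.BilinForm F V} {t : Module.End F V} (h : IsPeriodicIsometry B t M)
    (ht : t.charpoly = ∏ j ∈ s, f j) :
    ∃ x : J → V, (∀ j ∈ s, Good B t (x j) ∧ ∀ q, aeval t q (x j) = 0 ↔ f j ∣ q) ∧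
      ∀ i ∈ s, ∀ j ∈ s, i ≠ j → ∀ u ∈ cyc t (x i), ∀ v ∈ cyc t (x j), B u v = 0 := by
  induction s using Finset.induction_on generalizing V with
  | empty => exact ⟨0, by simp, by simp⟩
  | insert j s hj ih =>
    rw [Finset.prod_insert hj] at ht
    obtain ⟨x₀, hgood, hann⟩ := h.exists_good_of_dvd (hsq j) ⟨_, ht⟩ (hfM j)
    let W := B.orthogonal (cyc t x₀)
    have hWmem : ∀ w, w ∈ W ↔ ∀ u ∈ cyc t x₀, B u w = 0 := fun w ↦ Iff.rfl
    have hdisj : Disjoint (cyc t x₀) W := by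
      rw [Submodule.disjoint_def]
      exact fun u hu hu' ↦ hgood u hu fun v hv ↦ by rw [h.comm]; exact hu' v hv
    have hcompl : IsCompl (cyc t x₀) W :=
      (LinearMap.BilinForm.isCompl_orthogonal_iff_disjoint
        (fun a b hab ↦ by rw [h.comm]; exact hab)).2 hdisj
    have hW : ∀ w ∈ W, t w ∈ W := fun w hw ↦ by
      rw [hWmem]
      intro u hu
      have h2 := h.adjoint X w u
      rw [aeval_X, aeval_X] at h2
      rw [h.comm, h2, h.comm]
      have h3 := aeval_mem_of_invariant (fun w hw ↦ apply_mem_cyc hw) (X ^ (M - 1)) hu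
      rw [map_pow, aeval_X] at h3
      exact hw _ h3
    have hchar := t.charpoly_eq_mul_of_isCompl hcompl (fun _ ↦ apply_mem_cyc) hW
    rw [charpoly_restrict_cyc (hf j) (hf1 j) hann, ht] at hchar
    have hper : IsPeriodicIsometry (B.restrict W) (t.restrict hW) M :=
      { pos := h.pos
        comm := fun x y ↦ h.comm x y
        nondeg := fun x hx ↦ by
          apply Subtype.ext
          refine h.nondeg _ fun y ↦ ?_
          obtain ⟨u, hu, w, hw, rfl⟩ :=
            Submodule.mem_sup.1 (hcompl.sup_eq_top.symm ▸ Submodule.mem_top : y ∈ cyc t x₀ ⊔ W)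
          rw [map_add, h.comm, x.2 u hu, zero_add]
          exact hx ⟨w, hw⟩
        isom := fun x y ↦ h.isom x y
        pow := by
          ext w
          have h2 := coe_aeval_restrict hW (X ^ M) w
          rw [map_pow, map_pow, aeval_X, aeval_X, h.pow] at h2
          exact h2 }
    obtain ⟨x', hx', hort⟩ := ih hper (mul_left_cancel₀ (hf j).ne_zero hchar.symm)
    have hne : ∀ i ∈ s, i ≠ j := fun i hi hij ↦ hj (hij ▸ hi)
    have hxi : ∀ i ∈ s, Function.update (fun i ↦ (x' i : V)) j x₀ i = x' i := fun i hi ↦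
      Function.update_of_ne (hne i hi) _ _
    have hxj : Function.update (fun i ↦ (x' i : V)) j x₀ j = x₀ := Function.update_self _ _ _
    refine ⟨Function.update (fun i ↦ (x' i : V)) j x₀, ?_, ?_⟩
    · intro i hi
      rcases Finset.mem_insert.1 hi with rfl | hi
      · rw [hxj]
        exact ⟨hgood, hann⟩
      · rw [hxi i hi]
        refine ⟨fun u hu hu0 ↦ ?_, fun q ↦ ?_⟩
        · obtain ⟨w, hw, rfl⟩ := (coe_mem_cyc_iff hW _).1 hu
          exact congrArg Subtype.val ((hx' i hi).1 w hw fun v hv ↦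
            hu0 v ((coe_mem_cyc_iff hW _).2 ⟨v, hv, rfl⟩))
        · rw [← (hx' i hi).2 q, ← coe_aeval_restrict hW, Submodule.coe_eq_zero]
    · have hcross : ∀ i ∈ s, ∀ u ∈ cyc t x₀, ∀ v ∈ cyc t (x' i : V), B u v = 0 := by
        intro i hi u hu v hv
        obtain ⟨w, hw, rfl⟩ := (coe_mem_cyc_iff hW _).1 hv
        exact w.2 u hu
      intro i hi k hk hik u hu v hv
      rcases Finset.mem_insert.1 hi with rfl | hi'
      · rw [hxj] at hu
        rcases Finset.mem_insert.1 hk with rfl | hk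
        · exact (hik rfl).elim
        · rw [hxi k hk] at hv
          exact hcross k hk u hu v hv
      · rw [hxi i hi'] at hu
        rcases Finset.mem_insert.1 hk with rfl | hk
        · rw [hxj] at hv
          rw [h.comm]
          exact hcross i hi' v hv u hu
        · rw [hxi k hk] at hv
          obtain ⟨u', hu', rfl⟩ := (coe_mem_cyc_iff hW _).1 hu
          obtain ⟨v', hv', rfl⟩ := (coe_mem_cyc_iff hW _).1 hv
          exact hort i hi' k hk hik u' hu' v' hv'

section WeakApproximation

lemma not_isEquiv_padic {p q : ℕ} [Fact p.Prime] [Fact q.Prime] (h : p ≠ q) :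
    ¬(Rat.AbsoluteValue.padic p).IsEquiv (Rat.AbsoluteValue.padic q) := by
  intro hpq
  have h1 : Rat.AbsoluteValue.padic p (p : ℚ) < 1 := by
    rw [Rat.AbsoluteValue.padic_eq_padicNorm]
    exact_mod_cast padicNorm.padicNorm_p_lt_one_of_prime
  have h2 := hpq.lt_one_iff.1 h1
  rw [Rat.AbsoluteValue.padic_eq_padicNorm, padicNorm.padicNorm_of_prime_of_ne h.symm] at h2
  norm_num at h2

lemma exists_rat_near (S : Finset {p : ℕ // p.Prime}) (r : ℝ) (f : ∀ p : {p : ℕ // p.Prime},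
    have := Fact.mk p.2; ℚ_[p]) {ε : ℝ} (hε : 0 < ε) :
    ∃ q : ℚ, |(q : ℝ) - r| < ε ∧ ∀ p ∈ S, haveI := Fact.mk p.2; ‖(q : ℚ_[p]) - f p‖ < ε := by
  have hε2 := half_pos hε
  obtain ⟨c, hc⟩ := _root_.exists_rat_near r hε2
  have : ∀ p : {p : ℕ // p.Prime}, haveI := Fact.mk p.2; ∃ d : ℚ, ‖f p - (d : ℚ_[p])‖ < ε / 2 :=
    fun p ↦ haveI := Fact.mk p.2; Padic.rat_dense p (f p) hε2
  choose d hd using this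
  let v : Option S → AbsoluteValue ℚ ℝ := fun o ↦ o.elim Rat.AbsoluteValue.real
    fun p ↦ haveI := Fact.mk p.1.2; Rat.AbsoluteValue.padic p.1
  have hdense := AbsoluteValue.denseRange_algebraMap_pi (v := v) (by
    rintro (_ | p)
    · refine ⟨2, two_ne_zero, ?_⟩
      simp [v]
    · have := Fact.mk p.1.2
      refine ⟨p.1.1, by exact_mod_cast p.1.2.ne_zero, ?_⟩
      have : ((padicNorm p.1.1 (p.1.1 : ℚ) : ℚ) : ℝ) < 1 := by
        exact_mod_cast padicNorm.padicNorm_p_lt_one_of_prime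
      exact this.ne) (by
    rintro (_ | p) (_ | q) hpq
    · exact (hpq rfl).elim
    · have := Fact.mk q.1.2
      exact Rat.AbsoluteValue.not_real_isEquiv_padic q.1
    · have := Fact.mk p.1.2
      exact fun h ↦ Rat.AbsoluteValue.not_real_isEquiv_padic p.1 h.symm
    · have := Fact.mk p.1.2
      have := Fact.mk q.1.2
      refine not_isEquiv_padic fun h ↦ hpq ?_
      rw [Subtype.ext (Subtype.ext h)])
  obtain ⟨q, hq⟩ := hdense.exists_dist_lt (fun o ↦ WithAbs.toAbs (v o)
    (o.elim c fun p ↦ d p.1)) hε2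
  rw [dist_pi_lt_iff hε2] at hq
  have hq' : ∀ o, v o (o.elim c (fun p ↦ d p.1) - q) < ε / 2 := fun o ↦ by
    have := hq o
    rwa [dist_eq_norm, WithAbs.norm_eq_apply_ofAbs] at this
  refine ⟨q, ?_, fun p hp ↦ ?_⟩
  · have h1 := hq' none
    simp only [v, Option.elim_none, Rat.AbsoluteValue.real_eq_abs] at h1
    push_cast at h1
    rw [abs_sub_comm] at h1 hc
    calc |(q : ℝ) - r| = |((q : ℝ) - c) + (c - r)| := by ring_nf
      _ ≤ _ := abs_add_le _ _
      _ < ε := by linarith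
  · have := Fact.mk p.2
    have h1 := hq' (some ⟨p, hp⟩)
    simp only [v, Option.elim_some, Rat.AbsoluteValue.padic_eq_padicNorm] at h1
    rw [← Padic.eq_padicNorm] at h1
    have h2 := hd p
    push_cast at h1
    rw [norm_sub_rev] at h1 h2
    calc ‖(q : ℚ_[p]) - f p‖ = ‖((q : ℚ_[p]) - d p) + (d p - f p)‖ := by ring_nf
      _ ≤ _ := norm_add_le _ _
      _ < ε := by linarith

open Filter Topology in
/-- Weak approximation for finite families of rational numbers. -/
theorem exists_rat_of_eventually {T : Type*} [Finite T] (S : Finset {p : ℕ // p.Prime})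
    (r : T → ℝ) (f : ∀ p : {p : ℕ // p.Prime}, haveI := Fact.mk p.2; T → ℚ_[p])
    {P : (T → ℝ) → Prop} {Q : ∀ p : {p : ℕ // p.Prime}, haveI := Fact.mk p.2; (T → ℚ_[p]) → Prop}
    (hP : ∀ᶠ g in 𝓝 r, P g)
    (hQ : ∀ p ∈ S, haveI := Fact.mk p.2; ∀ᶠ g in 𝓝 (f p), Q p g) :
    ∃ q : T → ℚ, (P fun i ↦ (q i : ℝ)) ∧ ∀ p ∈ S, haveI := Fact.mk p.2; Q p fun i ↦ (q i : ℚ_[p]) := by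
  cases nonempty_fintype T
  obtain ⟨ε, hε, hε'⟩ := Metric.eventually_nhds_iff.1 hP
  have : ∀ p : {p : ℕ // p.Prime}, haveI := Fact.mk p.2;
      ∃ δ > 0, p ∈ S → ∀ g, dist g (f p) < δ → Q p g := fun p ↦ by
    have := Fact.mk p.2
    by_cases hp : p ∈ S
    · obtain ⟨δ, hδ, hδ'⟩ := Metric.eventually_nhds_iff.1 (hQ p hp)
      exact ⟨δ, hδ, fun _ g hg ↦ hδ' hg⟩
    · exact ⟨1, one_pos, fun h ↦ (hp h).elim⟩
  choose δ hδ hδ' using this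
  obtain ⟨η, hη, hηε, hηδ⟩ : ∃ η > 0, η ≤ ε ∧ ∀ p ∈ S, η ≤ δ p := by
    have : ∀ᶠ η in 𝓝[>] (0 : ℝ), η ≤ ε ∧ ∀ p ∈ S, η ≤ δ p := by
      rw [eventually_and]
      refine ⟨mem_nhdsWithin_of_mem_nhds (Iic_mem_nhds hε), ?_⟩
      rw [eventually_all_finset]
      exact fun p _ ↦ mem_nhdsWithin_of_mem_nhds (Iic_mem_nhds (hδ p))
    obtain ⟨η, h, hη⟩ := (this.and self_mem_nhdsWithin).exists
    exact ⟨η, hη, h⟩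
  choose q hq hq' using fun i ↦ exists_rat_near S (r i) (fun p ↦ f p i) hη
  refine ⟨q, hε' ?_, fun p hp ↦ ?_⟩
  · rw [dist_pi_lt_iff hε]
    exact fun i ↦ (hq i).trans_le hηε
  · have := Fact.mk p.2
    apply hδ' p hp
    rw [dist_pi_lt_iff (hδ p)]
    intro i
    rw [dist_eq_norm]
    exact (hq' i p hp).trans_le (hηδ p hp)

end WeakApproximation

section

open NumberField

section Functional

variable {L : Type*} [Field L] [NumberField L] [IsCMField L]

open IsCMField

local notation "K" => maximalRealSubfield L

variable {ι : Type*} [Fintype ι] [DecidableEq ι]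

/-- The symmetrized trace-dual basis. -/
noncomputable def symmDual (b : Module.Basis ι ℚ L) (j : ι) : K :=
  ⟨(1 / 2 : ℚ) • (b.traceDual j + complexConj L (b.traceDual j)),
    (complexConj_eq_self_iff L _).1 (by
      rw [map_rat_smul, map_add, complexConj_apply_apply, add_comm])⟩

variable {F V : Type*} [Field F] [CharZero F] [Algebra ℚ F] [AddCommGroup V] [Module F V]

lemma functional_eq_sum (b : Module.Basis ι ℚ L) (l : L →ₗ[ℚ] F)
    (hl : ∀ y, l (complexConj L y) = l y) (y : L) :
    l y = ∑ j, l (b j) * algebraMap ℚ F (Algebra.trace ℚ L (symmDual b j * y)) := by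
  have h : ∀ y, l y = ∑ j, l (b j) * algebraMap ℚ F (Algebra.trace ℚ L (b.traceDual j * y)) := by
    intro y
    conv_lhs => rw [← b.sum_repr y, map_sum]
    refine Finset.sum_congr rfl fun j _ ↦ ?_
    have h2 := b.traceDual.traceDual_repr_apply y j
    rw [b.traceDual_traceDual, Algebra.traceForm_apply] at h2
    rw [map_smul, h2, mul_comm y, Algebra.smul_def, mul_comm]
  have h2 : l y = algebraMap ℚ F (1 / 2) * (l y + l (complexConj L y)) := by
    rw [hl, ← two_mul, ← mul_assoc, map_div₀, map_one, map_ofNat, one_div,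
      inv_mul_cancel₀ two_ne_zero, one_mul]
  rw [h2, h, h (complexConj L y), ← Finset.sum_add_distrib, Finset.mul_sum]
  refine Finset.sum_congr rfl fun j _ ↦ ?_
  have h3 : Algebra.trace ℚ L (symmDual b j * y) = (1 / 2) * (Algebra.trace ℚ L (b.traceDual j * y) +
      Algebra.trace ℚ L (b.traceDual j * complexConj L y)) := by
    change Algebra.trace ℚ L (((1 / 2 : ℚ) • (b.traceDual j + complexConj L (b.traceDual j))) * y) = _
    rw [smul_mul_assoc, map_smul, add_mul, map_add, ← trace_complexConj (complexConj L _ * y),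
      map_mul (complexConj L), complexConj_apply_apply, smul_eq_mul]
  rw [h3, map_mul (algebraMap ℚ F), map_add]
  ring

lemma exists_functional {B : LinearMap.BilinForm F V} {t : Module.End F V} {x : V} {z : L}
    (hz : Function.Surjective (aeval z : ℚ[X] →ₐ[ℚ] L))
    (hx : aeval t ((minpoly ℚ z).map (algebraMap ℚ F)) x = 0) :
    ∃ l : L →ₗ[ℚ] F, ∀ q : ℚ[X], l (aeval z q) = B x (aeval t (q.map (algebraMap ℚ F)) x) := by
  let ψ : ℚ[X] →ₗ[ℚ] F :=
    { toFun := fun q ↦ B x (aeval t (q.map (algebraMap ℚ F)) x)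
      map_add' := fun p q ↦ by
        rw [Polynomial.map_add, map_add, LinearMap.add_apply, map_add]
      map_smul' := fun c q ↦ by
        rw [Polynomial.smul_eq_C_mul, Polynomial.map_mul, map_C, aeval_mul_apply, aeval_C,
          Module.algebraMap_end_apply, map_smul, smul_eq_mul, RingHom.id_apply, Algebra.smul_def] }
  obtain ⟨s, hs⟩ := (aeval z : ℚ[X] →ₐ[ℚ] L).toLinearMap.exists_rightInverse_of_surjective
    (LinearMap.range_eq_top.2 hz)
  refine ⟨ψ ∘ₗ s, fun q ↦ ?_⟩
  change ψ (s (aeval z q)) = ψ q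
  rw [← sub_eq_zero, ← map_sub]
  have h1 : aeval z (s (aeval z q) - q) = 0 := by
    rw [map_sub, sub_eq_zero]
    exact LinearMap.congr_fun hs (aeval z q)
  obtain ⟨c, hc⟩ := minpoly.dvd ℚ z h1
  change B x (aeval t ((s (aeval z q) - q).map (algebraMap ℚ F)) x) = 0
  rw [hc, mul_comm, Polynomial.map_mul, aeval_mul_apply, hx, map_zero, map_zero]

/-- The Gram matrix of a cyclic subspace is a combination of hermitian trace forms. -/
theorem IsPeriodicIsometry.exists_coeff {B : LinearMap.BilinForm F V} {t : Module.End F V} {M : ℕ}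
    (h : IsPeriodicIsometry B t M) (b : Module.Basis ι ℚ L) {x : V} {z : L}
    (hz : Function.Surjective (aeval z : ℚ[X] →ₐ[ℚ] L)) (hzM : z ^ M = 1)
    (hx : aeval t ((minpoly ℚ z).map (algebraMap ℚ F)) x = 0) :
    ∃ f : ι → F, ∀ i j : ℕ, B ((t ^ i) x) ((t ^ j) x) =
      ∑ k, f k * algebraMap ℚ F (hermForm (symmDual b k) (z ^ i) (z ^ j)) := by
  have : NeZero M := ⟨h.pos.ne'⟩
  have hconj : complexConj L z = z ^ (M - 1) := by
    rw [complexConj_of_pow_eq_one hzM]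
    refine inv_eq_of_mul_eq_one_right ?_
    rw [← pow_succ', Nat.sub_add_cancel h.pos, hzM]
  have hcq : ∀ q : ℚ[X], complexConj L (aeval z q) = aeval z (q.comp (X ^ (M - 1))) := fun q ↦ by
    rw [aeval_comp, map_pow, aeval_X, ← hconj]
    exact (aeval_algHom_apply ((complexConj L).restrictScalars ℚ) z q).symm
  obtain ⟨l, hl⟩ := exists_functional (B := B) hz hx
  have hadj : ∀ q r : ℚ[X], B (aeval t (q.map (algebraMap ℚ F)) x)
      (aeval t (r.map (algebraMap ℚ F)) x) = l (complexConj L (aeval z q) * aeval z r) := by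
    intro q r
    rw [hcq, ← map_mul, hl, h.adjoint, Polynomial.map_mul, aeval_mul_apply, Polynomial.map_comp,
      Polynomial.map_pow, map_X, aeval_comp, map_pow, aeval_X]
  have hlc : ∀ y, l (complexConj L y) = l y := by
    intro y
    obtain ⟨q, rfl⟩ := hz y
    have h1 := hadj q 1
    have h2 := hadj 1 q
    rw [map_one, mul_one] at h1
    rw [map_one, map_one, one_mul] at h2
    rw [← h1, ← h2, h.comm]
  refine ⟨fun k ↦ l (b k), fun i j ↦ ?_⟩
  have h1 := hadj (X ^ i) (X ^ j)
  simp only [Polynomial.map_pow, map_X, map_pow, aeval_X] at h1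
  rw [h1, functional_eq_sum b l hlc]
  simp only [hermForm_apply, map_pow]

end Functional

section LocalForm

open IsCMField

lemma minpoly_dvd_comp {L : Type*} [Field L] [NumberField L] [IsCMField L] {z : L} {M : ℕ}
    (hM : 0 < M) (hzM : z ^ M = 1) : minpoly ℚ z ∣ (minpoly ℚ z).comp (X ^ (M - 1)) := by
  have : NeZero M := ⟨hM.ne'⟩
  have hconj : complexConj L z = z ^ (M - 1) := by
    rw [complexConj_of_pow_eq_one hzM]
    refine inv_eq_of_mul_eq_one_right ?_
    rw [← pow_succ', Nat.sub_add_cancel hM, hzM]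
  refine minpoly.dvd ℚ z ?_
  rw [aeval_comp, map_pow, aeval_X, ← hconj]
  have h := aeval_algHom_apply ((complexConj L).restrictScalars ℚ) z (minpoly ℚ z)
  rw [minpoly.aeval, map_zero] at h
  exact h

variable {J : Type*} [Fintype J] [DecidableEq J] {L : J → Type*} [∀ j, Field (L j)]
  [∀ j, NumberField (L j)] [∀ j, IsCMField (L j)] {d : J → ℕ}

/-- The orthogonal sum of rational hermitian trace forms with prescribed coordinates. -/
noncomputable def hermSum {F : Type*} [Field F] [Algebra ℚ F]
    (b : ∀ j, Module.Basis (Fin (d j)) ℚ (L j)) (c : (Σ j, Fin (d j)) → F) :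
    Matrix (Σ j, Fin (d j)) (Σ j, Fin (d j)) F :=
  Matrix.blockDiagonal' fun j ↦ ∑ k, c ⟨j, k⟩ •
    (gram (hermForm (symmDual (b j) k)) (b j)).map (algebraMap ℚ F)

lemma hermSum_isSymm {F : Type*} [Field F] [Algebra ℚ F]
    (b : ∀ j, Module.Basis (Fin (d j)) ℚ (L j)) (c : (Σ j, Fin (d j)) → F) :
    (hermSum b c).IsSymm := by
  rw [Matrix.IsSymm, hermSum, Matrix.blockDiagonal'_transpose]
  congr 1
  ext1 j
  rw [Matrix.transpose_sum]
  refine Finset.sum_congr rfl fun k _ ↦ ?_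
  rw [Matrix.transpose_smul, ← Matrix.transpose_map, (gram_hermForm_isSymm _ _).eq]

lemma continuous_hermSum {F : Type*} [NontriviallyNormedField F] [Algebra ℚ F]
    (b : ∀ j, Module.Basis (Fin (d j)) ℚ (L j)) : Continuous (hermSum (F := F) b) := by
  refine Continuous.matrix_blockDiagonal' (continuous_pi fun j ↦ ?_)
  exact continuous_finsetSum _ fun k _ ↦ (continuous_apply _).smul continuous_const

lemma det_blockDiagonal'_ne_zero {F : Type*} [Field F]
    {A : ∀ j, Matrix (Fin (d j)) (Fin (d j)) F} (hA : ∀ j, (A j).det ≠ 0) :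
    (Matrix.blockDiagonal' A).det ≠ 0 := by
  refine Matrix.det_ne_zero_of_left_inverse (B := Matrix.blockDiagonal' fun j ↦ (A j)⁻¹) ?_
  rw [← Matrix.blockDiagonal'_mul]
  simp_rw [fun j ↦ Matrix.nonsing_inv_mul (A j) (hA j).isUnit]
  exact Matrix.blockDiagonal'_one

theorem exists_eventually_cong_hermSum {F : Type*} [NontriviallyNormedField F] [CompleteSpace F]
    [CharZero F] [Algebra ℚ F] {W κ : Type*} [AddCommGroup W] [Module F W]
    [FiniteDimensional F W] [Fintype κ] [DecidableEq κ] (bW : Module.Basis κ F W)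
    {B : LinearMap.BilinForm F W} {t : Module.End F W} {M : ℕ} (h : IsPeriodicIsometry B t M)
    {z : ∀ j, L j} (hzM : ∀ j, z j ^ M = 1)
    (hz : ∀ j, Function.Surjective (aeval (z j) : ℚ[X] →ₐ[ℚ] L j))
    (b : ∀ j, Module.Basis (Fin (d j)) ℚ (L j)) (hb : ∀ j a, b j a = z j ^ (a : ℕ))
    (hd : ∀ j, d j = (minpoly ℚ (z j)).natDegree)
    (ht : t.charpoly = ∏ j, (minpoly ℚ (z j)).map (algebraMap ℚ F)) :
    ∃ c : (Σ j, Fin (d j)) → F, ∀ᶠ c' in nhds c, Cong (gram B bW) (hermSum b c') := by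
  have hInt : ∀ j, IsIntegral ℚ (z j) := fun j ↦ Algebra.IsIntegral.isIntegral _
  have hmon : ∀ j, ((minpoly ℚ (z j)).map (algebraMap ℚ F)).Monic := fun j ↦
    (minpoly.monic (hInt j)).map _
  have hdF : ∀ j, d j = ((minpoly ℚ (z j)).map (algebraMap ℚ F)).natDegree := fun j ↦ by
    rw [natDegree_map, hd]
  have hne : ∀ j, (minpoly ℚ (z j)).map (algebraMap ℚ F) ≠ 1 := fun j h1 ↦ by
    have h2 := minpoly.natDegree_pos (hInt j)
    rw [← hd, hdF, h1, natDegree_one] at h2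
    exact h2.false
  obtain ⟨x, hx, horth⟩ := h.exists_family hmon hne
    (fun j ↦ ((minpoly.irreducible (hInt j)).separable.map).squarefree)
    (fun j ↦ by
      have h1 := Polynomial.map_dvd (algebraMap ℚ F) (minpoly_dvd_comp h.pos (hzM j))
      rwa [Polynomial.map_comp, Polynomial.map_pow, map_X] at h1) Finset.univ ht
  choose c hc using fun j ↦ h.exists_coeff (b j) (hz j) (hzM j)
    (((hx j (Finset.mem_univ _)).2 _).2 dvd_rfl)
  let v : (Σ j, Fin (d j)) → W := fun a ↦ (t ^ (a.2 : ℕ)) (x a.1)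
  have hmem : ∀ j (a : ℕ), (t ^ a) (x j) ∈ cyc t (x j) := fun j a ↦ by
    simpa using aeval_mem_cyc (t := t) (x := x j) (X ^ a)
  have hblock : gram B v = Matrix.blockDiagonal' fun j ↦
      gram B fun a : Fin (d j) ↦ (t ^ (a : ℕ)) (x j) := by
    ext ⟨i, a⟩ ⟨j, a'⟩
    by_cases hij : i = j
    · subst hij
      rw [Matrix.blockDiagonal'_apply_eq, gram_apply, gram_apply]
    · rw [Matrix.blockDiagonal'_apply_ne _ _ _ hij, gram_apply]
      exact horth i (Finset.mem_univ _) j (Finset.mem_univ _) hij _ (hmem _ _) _ (hmem _ _)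
  have hdet : (gram B v).det ≠ 0 := by
    rw [hblock]
    exact det_blockDiagonal'_ne_zero fun j ↦ det_gram_pow_ne_zero (hx j (Finset.mem_univ _)).1 (hmon j) (hne j)
      (hx j (Finset.mem_univ _)).2 (hdF j)
  have hcard : Fintype.card (Σ j, Fin (d j)) = Module.finrank F W := by
    rw [← LinearMap.charpoly_natDegree t, ht, natDegree_prod_of_monic _ _ fun j _ ↦ hmon j,
      Fintype.card_sigma]
    exact Finset.sum_congr rfl fun j _ ↦ by rw [Fintype.card_fin, hdF]
  have hsum : gram B v = hermSum b fun a ↦ c a.1 a.2 := by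
    rw [hblock, hermSum]
    congr 1
    ext j a a'
    rw [gram_apply, hc, Matrix.sum_apply]
    refine Finset.sum_congr rfl fun k _ ↦ ?_
    rw [Matrix.smul_apply, Matrix.map_apply, gram_apply, hb, hb, smul_eq_mul]
  refine ⟨fun a ↦ c a.1 a.2, ?_⟩
  have hcong := cong_gram bW hcard hdet
  rw [hsum] at hcong hdet
  have h1 := eventually_cong (hermSum_isSymm b _) hdet.isUnit
  filter_upwards [(continuous_hermSum b).continuousAt.eventually h1] with c' hc'
  exact hcong.trans (hc' (hermSum_isSymm b c'))

end LocalForm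

section BaseChange

variable {V κ : Type*} [AddCommGroup V] [Module ℚ V] [Fintype κ] [DecidableEq κ]
  {F : Type*} [Field F] [Algebra ℚ F]

lemma gram_baseChange (B : LinearMap.BilinForm ℚ V) (b : Module.Basis κ ℚ V) :
    gram (LinearMap.BilinForm.baseChange F B) (Algebra.TensorProduct.basis F b) =
      (gram B b).map (algebraMap ℚ F) := by
  ext i j
  rw [gram_apply, Algebra.TensorProduct.basis_apply, Algebra.TensorProduct.basis_apply,
    LinearMap.BilinForm.baseChange_tmul, mul_one, Matrix.map_apply, gram_apply,
    Algebra.algebraMap_eq_smul_one]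

lemma prod_cyclotomic_dvd {r : ℕ} {m : Fin r → ℕ} (hdist : Function.Injective m) :
    ∏ i, cyclotomic (m i) ℚ ∣ X ^ (∏ i, m i) - 1 := by
  refine Finset.prod_dvd_of_coprime (fun i _ j _ hij ↦ cyclotomic.isCoprime_rat (hdist.ne hij))
    fun i _ ↦ (cyclotomic.dvd_X_pow_sub_one (m i) ℚ).trans ?_
  obtain ⟨k, hk⟩ := Finset.dvd_prod_of_mem m (Finset.mem_univ i)
  rw [hk, pow_mul]
  exact sub_one_dvd_pow_sub_one _ _

lemma isPeriodicIsometry_baseChange {r : ℕ} {m : Fin r → ℕ} (hm : ∀ i, 3 ≤ m i)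
    (hdist : Function.Injective m) {B : LinearMap.BilinForm ℚ V} (hB : B.Nondegenerate)
    (hBs : B.IsSymm) (b : Module.Basis κ ℚ V) {t : Module.End F (F ⊗[ℚ] V)}
    (hiso : ∀ x y, LinearMap.BilinForm.baseChange F B (t x) (t y) =
      LinearMap.BilinForm.baseChange F B x y)
    (ht : minpoly F t = (∏ i, cyclotomic (m i) ℚ).map (algebraMap ℚ F)) :
    IsPeriodicIsometry (LinearMap.BilinForm.baseChange F B) t (∏ i, m i) where
  pos := Finset.prod_pos fun i _ ↦ by have := hm i; omega
  comm := (LinearMap.BilinForm.IsSymm.baseChange F ⟨hBs.eq⟩).eq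
  nondeg := by
    have h : (LinearMap.BilinForm.baseChange F B).Nondegenerate := by
      rw [LinearMap.BilinForm.nondegenerate_iff_det_ne_zero (Algebra.TensorProduct.basis F b),
        toMatrix_eq_gram, gram_baseChange, ← RingHom.mapMatrix_apply, ← RingHom.map_det, _root_.map_ne_zero,
        ← toMatrix_eq_gram]
      exact (LinearMap.BilinForm.nondegenerate_iff_det_ne_zero b).1 hB
    exact h.1
  isom := hiso
  pow := by
    obtain ⟨q, hq⟩ := prod_cyclotomic_dvd hdist
    have h := congrArg (fun f ↦ aeval t (f.map (algebraMap ℚ F))) hq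
    simp only [Polynomial.map_sub, Polynomial.map_pow, map_X, Polynomial.map_one] at h
    rw [Polynomial.map_mul, ← ht, map_mul, minpoly.aeval F t, zero_mul, map_sub, map_pow, aeval_X,
      map_one] at h
    exact sub_eq_zero.1 h

end BaseChange

section LocalGlobal

open IsCMField

lemma exists_resQ_eq_zero_off (x : GW ℚ) : ∃ S : Finset ℕ, (∀ p ∈ S, p.Prime) ∧
    ∀ (p : ℕ) (_ : Fact p.Prime) (_ : NeZero (2 : ZMod p)), p ∉ S → resQ p x = 0 := by
  induction x using GW.induction with
  | zero => exact ⟨∅, by simp, fun p _ _ _ ↦ map_zero _⟩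
  | of' a ha =>
    refine ⟨(a.num * a.den).natAbs.primeFactors, fun p hp ↦ Nat.prime_of_mem_primeFactors hp,
      fun p hp _ hpS ↦ ?_⟩
    have hd : (a.den : ℚ) ≠ 0 := by exact_mod_cast a.den_nz
    have h : GW.of a = GW.of ((a.num * a.den : ℤ) : ℚ) := by
      rw [← GW.of_mul_sq a hd]
      congr 1
      rw [Int.cast_mul, Int.cast_natCast, sq, ← mul_assoc, Rat.mul_den_eq_num]
    rw [h]
    refine resQ_of fun h0 ↦ hpS (Nat.mem_primeFactors.2 ⟨hp.out, ?_, ?_⟩)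
    · exact Int.natCast_dvd.1 ((ZMod.intCast_zmod_eq_zero_iff_dvd _ p).1 h0)
    · exact Int.natAbs_ne_zero.2 (mul_ne_zero (Rat.num_ne_zero.2 ha) (by exact_mod_cast a.den_nz))
  | neg x hx =>
    obtain ⟨S, hS, h⟩ := hx
    exact ⟨S, hS, fun p _ _ hp ↦ by rw [map_neg, h p _ _ hp, neg_zero]⟩
  | add x y hx hy =>
    obtain ⟨S, hS, h⟩ := hx
    obtain ⟨S', hS', h'⟩ := hy
    refine ⟨S ∪ S', fun p hp ↦ (Finset.mem_union.1 hp).elim (hS p) (hS' p), fun p _ _ hp ↦ ?_⟩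
    rw [Finset.mem_union, not_or] at hp
    rw [map_add, h p _ _ hp.1, h' p _ _ hp.2, add_zero]

lemma sum_ite_eta {J : Type*} (s : Finset J) (e : J → Bool) (p : ℕ) [Fact p.Prime] :
    ∃ e' : Bool, (∑ j ∈ s, if e j then eta p else 0) = if e' then eta p else 0 := by
  classical
  induction s using Finset.induction_on with
  | empty => exact ⟨false, by simp⟩
  | insert j s hj ih =>
    obtain ⟨e', he'⟩ := ih
    rw [Finset.sum_insert hj, he']
    refine ⟨xor (e j) e', ?_⟩
    cases e j <;> cases e' <;> simp [two_smul_eta]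

/-- A rational class that is trivial at the places of `S` and unramified off `S`, except for a
multiple of `eta` at a single prime, vanishes. -/
lemma eq_zero_of_mem_trivialAt {S : Finset ℕ} (h2 : 2 ∈ S) {x : GW ℚ} (hx : x ∈ trivialAt S)
    {p₀ : ℕ} (hp₀ : p₀.Prime) (hp₀S : p₀ ∉ S) (e : Bool)
    (hres : ∀ (p : ℕ) (_ : Fact p.Prime) (_ : NeZero (2 : ZMod p)), p ∉ S →
      resQ p x = if p = p₀ ∧ e then eta p else 0) : x = 0 := by
  have he : e = false := by
    by_contra he
    rw [Bool.not_eq_false] at he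
    subst he
    have h := even_card_of_mem_trivialAt (T := {p₀}) h2 hx (by simpa using ⟨hp₀, hp₀S⟩)
      fun p _ _ hp ↦ by simpa using hres p _ _ hp
    simp at h
  subst he
  have := Fact.mk Nat.prime_two
  refine GW.eq_zero_of_resQ (dim_of_mem_trivialAt hx) (sgnQ_of_mem_trivialAt hx) ?_
    fun p _ _ ↦ ?_
  · rw [parityQ, AddMonoidHom.comp_apply, hx.2 2 h2, map_zero]
  · by_cases hp : p ∈ S
    · exact resQ_of_mem_trivialAt hx hp
    · simpa using hres p _ _ hp

lemma gw_sub_gw_mem_trivialAt {S : Finset ℕ} {ι κ : Type*} [Fintype ι] [DecidableEq ι] [Fintype κ]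
    [DecidableEq κ] {A : Matrix ι ι ℚ} {N : Matrix κ κ ℚ} (hA : A.IsSymm) (hA0 : A.det ≠ 0)
    (hN : N.IsSymm) (hN0 : N.det ≠ 0)
    (hreal : Cong (N.map (algebraMap ℚ ℝ)) (A.map (algebraMap ℚ ℝ)))
    (hfin : ∀ p ∈ S, ∀ [Fact p.Prime],
      Cong (N.map (algebraMap ℚ ℚ_[p])) (A.map (algebraMap ℚ ℚ_[p]))) :
    gw A - gw N ∈ trivialAt S := by
  have key : ∀ {F : Type} [Field F] [CharZero F] (φ : ℚ →+* F), Cong (N.map φ) (A.map φ) →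
      GW.map φ (gw A - gw N) = 0 := fun {F} _ _ φ h ↦ by
    rw [map_sub, ← gw_map φ hA hA0, ← gw_map φ hN hN0, sub_eq_zero]
    refine (h.gw_eq (hN.map φ) ?_).symm
    rw [← RingHom.mapMatrix_apply, ← RingHom.map_det]
    exact (_root_.map_ne_zero φ).2 hN0
  exact ⟨key _ hreal, fun p hp _ ↦ key _ (hfin p hp)⟩

end LocalGlobal

section LocalGlobal

open IsCMField

variable {J : Type*} [Fintype J] [DecidableEq J] {L : J → Type*} [∀ j, Field (L j)]
  [∀ j, NumberField (L j)] [∀ j, IsCMField (L j)] {d : J → ℕ}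

/-- The orthogonal sum of the hermitian trace forms with given coefficients. -/
noncomputable def hermDiag (b : ∀ j, Module.Basis (Fin (d j)) ℚ (L j))
    (a : ∀ j, maximalRealSubfield (L j)) : Matrix (Σ j, Fin (d j)) (Σ j, Fin (d j)) ℚ :=
  Matrix.blockDiagonal' fun j ↦ gram (hermForm (a j)) (b j)

lemma hermDiag_isSymm (b : ∀ j, Module.Basis (Fin (d j)) ℚ (L j))
    (a : ∀ j, maximalRealSubfield (L j)) : (hermDiag b a).IsSymm := by
  rw [Matrix.IsSymm, hermDiag, Matrix.blockDiagonal'_transpose]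
  simp_rw [fun j ↦ (gram_hermForm_isSymm (a j) (b j)).eq]

lemma hermSum_ratCast {F : Type*} [Field F] [Algebra ℚ F]
    (b : ∀ j, Module.Basis (Fin (d j)) ℚ (L j)) (q : (Σ j, Fin (d j)) → ℚ) :
    hermSum b (fun i ↦ (q i : F)) =
      (hermDiag b fun j ↦ ∑ k, q ⟨j, k⟩ • symmDual (b j) k).map (algebraMap ℚ F) := by
  rw [hermSum, hermDiag, Matrix.blockDiagonal'_map _ _ (map_zero _)]
  congr 1
  ext j x y
  rw [Matrix.sum_apply, Matrix.map_apply, gram_apply, hermForm_apply,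
    AddSubmonoidClass.coe_finsetSum, Finset.sum_mul, map_sum, map_sum]
  refine Finset.sum_congr rfl fun k _ ↦ ?_
  have h : ((q ⟨j, k⟩ • symmDual (b j) k : maximalRealSubfield (L j)) : L j) =
      q ⟨j, k⟩ • (symmDual (b j) k : L j) := by
    rw [Rat.smul_def, Rat.smul_def]
    simp
  rw [Matrix.smul_apply, Matrix.map_apply, gram_apply, hermForm_apply, h, smul_mul_assoc, map_smul,
    smul_eq_mul, smul_eq_mul, map_mul (algebraMap ℚ F), eq_ratCast, eq_ratCast]

variable {m : J → ℕ} [∀ j, NeZero (m j)] [∀ j, IsCyclotomicExtension {m j} ℚ (L j)] {ζ : ∀ j, L j}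

/-- A rational symmetric matrix which is locally everywhere an orthogonal sum of hermitian trace
forms over cyclotomic fields is globally such a sum. -/
theorem exists_cong_hermDiag (hζ : ∀ j, IsPrimitiveRoot (ζ j) (m j)) (hm : ∀ j, 3 ≤ m j)
    (b : ∀ j, Module.Basis (Fin (d j)) ℚ (L j)) {κ : Type*} [Fintype κ] [DecidableEq κ]
    {N : Matrix κ κ ℚ} (hN : N.IsSymm) (hN0 : N.det ≠ 0)
    (hreal : ∃ c : (Σ j, Fin (d j)) → ℝ, ∀ᶠ c' in nhds c,
      Cong (N.map (algebraMap ℚ ℝ)) (hermSum b c'))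
    (hfin : ∀ p : ℕ, ∀ _ : Fact p.Prime, ∃ c : (Σ j, Fin (d j)) → ℚ_[p], ∀ᶠ c' in nhds c,
      Cong (N.map (algebraMap ℚ ℚ_[p])) (hermSum b c')) :
    ∃ a : ∀ j, maximalRealSubfield (L j), Cong N (hermDiag b a) := by
  have hherm : ∀ j (a : maximalRealSubfield (L j)), a ≠ 0 → (gram (hermForm a) (b j)).det ≠ 0 :=
    fun j a ha ↦ (gw_hermForm (complexConj_sub_inv (L := L j) (hζ j).pow_eq_one)
      (sub_inv_ne_zero (hζ j) (hm j)) (b j) ha).1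
  choose S₀ hS₀ hmove using fun j ↦ exists_hermForm_resQ (hζ j) (hm j) (b j)
  obtain ⟨S₁, hS₁, hoff⟩ := exists_resQ_eq_zero_off (gw N)
  obtain ⟨S, hSdef⟩ : ∃ S, S = insert 2 (S₁ ∪ Finset.univ.biUnion S₀) := ⟨_, rfl⟩
  have hSprime : ∀ p ∈ S, p.Prime := by
    intro p hp
    simp only [hSdef, Finset.mem_insert, Finset.mem_union, Finset.mem_biUnion] at hp
    rcases hp with rfl | hp | ⟨j, -, hp⟩
    exacts [Nat.prime_two, hS₁ p hp, hS₀ j p hp]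
  have hS₁S : S₁ ⊆ S := hSdef ▸ Finset.subset_union_left.trans (Finset.subset_insert _ _)
  have hS₀S : ∀ j, S₀ j ⊆ S := fun j ↦ hSdef ▸ (Finset.subset_biUnion_of_mem S₀
    (Finset.mem_univ j)).trans (Finset.subset_union_right.trans (Finset.subset_insert _ _))
  have h2S : 2 ∈ S := hSdef ▸ Finset.mem_insert_self _ _
  obtain ⟨p₀, hp₀S, hp₀, hp₀m⟩ : ∃ p₀, p₀ ∉ S ∧ p₀.Prime ∧ ∀ j, m j ∣ p₀ + 1 := by
    obtain ⟨p₀, hgt, hp, hmod⟩ := Nat.forall_exists_prime_gt_and_zmodEq (S.sup id)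
      (q := ∏ j, m j) (a := -1) (Finset.prod_ne_zero_iff.2 fun j _ ↦ NeZero.ne _)
      (isCoprime_one_left.neg_left)
    refine ⟨p₀, fun h ↦ absurd (Finset.le_sup (f := id) h) (not_le.2 hgt), hp, fun j ↦ ?_⟩
    refine (Finset.dvd_prod_of_mem m (Finset.mem_univ j)).trans ?_
    have h := hmod.symm.dvd
    rw [sub_neg_eq_add] at h
    exact_mod_cast h
  obtain ⟨r, hr⟩ := hreal
  choose f hf using fun p : {p : ℕ // p.Prime} ↦ hfin p ⟨p.2⟩
  obtain ⟨q, hqr, hqf⟩ := exists_rat_of_eventually (S.subtype Nat.Prime) r f hr fun p _ ↦ hf p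
  set a : ∀ j, maximalRealSubfield (L j) := fun j ↦ ∑ k, q ⟨j, k⟩ • symmDual (b j) k with ha
  rw [hermSum_ratCast] at hqr
  have hNreal : (N.map (algebraMap ℚ ℝ)).det ≠ 0 := by
    rw [← RingHom.mapMatrix_apply, ← RingHom.map_det]
    exact (_root_.map_ne_zero _).2 hN0
  have ha0 : ∀ j, a j ≠ 0 := by
    intro j hj
    have hd : 0 < d j := by
      have := Module.finrank_pos (R := ℚ) (M := L j)
      rwa [Module.finrank_eq_card_basis (b j), Fintype.card_fin] at this
    refine hqr.det_ne_zero hNreal (Matrix.det_eq_zero_of_row_eq_zero ⟨j, ⟨0, hd⟩⟩ ?_)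
    rintro ⟨i, k⟩
    rw [Matrix.map_apply, hermDiag]
    by_cases hij : j = i
    · subst hij
      rw [Matrix.blockDiagonal'_apply_eq, gram_apply, hermForm_apply]
      change algebraMap ℚ ℝ (Algebra.trace ℚ (L j) ((a j : L j) * _)) = 0
      rw [hj]
      simp
    · rw [Matrix.blockDiagonal'_apply_ne _ _ _ hij, map_zero]
  choose a' ha'0 ha' e he using fun j ↦
    hmove j S (hS₀S j) hSprime p₀ ⟨hp₀⟩ hp₀S (hp₀m j) (a j) (ha0 j)
  have hdiag : ∀ c : ∀ j, maximalRealSubfield (L j), (∀ j, c j ≠ 0) →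
      gw (hermDiag b c) = ∑ j, gw (gram (hermForm (c j)) (b j)) := fun c hc ↦
    gw_blockDiagonal' (fun j ↦ gram_hermForm_isSymm _ _) fun j ↦ hherm j _ (hc j)
  have hx : gw (hermDiag b a') - gw N ∈ trivialAt S := by
    have h1 : gw (hermDiag b a) - gw N ∈ trivialAt S := by
      refine gw_sub_gw_mem_trivialAt (hermDiag_isSymm b a)
        (det_blockDiagonal'_ne_zero fun j ↦ hherm j _ (ha0 j)) hN hN0 hqr fun p hp _ ↦ ?_
      have h := hqf ⟨p, Fact.out⟩ (by simpa using hp)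
      rwa [hermSum_ratCast] at h
    have h2 := (trivialAt S).add_mem ((trivialAt S).sum_mem fun j (_ : j ∈ Finset.univ) ↦ ha' j) h1
    rwa [Finset.sum_sub_distrib, ← hdiag a' ha'0, ← hdiag a ha0, sub_add_sub_cancel] at h2
  have := Fact.mk hp₀
  obtain ⟨e', he'⟩ := sum_ite_eta Finset.univ e p₀
  have hzero := eq_zero_of_mem_trivialAt h2S hx hp₀ hp₀S e' fun p _ _ hp ↦ by
    rw [map_sub, hoff p _ _ fun h ↦ hp (hS₁S h), sub_zero, hdiag a' ha'0, map_sum,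
      Finset.sum_congr rfl fun j _ ↦ he j p _ _ hp]
    by_cases hpp : p = p₀
    · subst hpp
      simpa using he'
    · simp [hpp]
  exact ⟨a', cong_of_gw_eq hN hN0 (hermDiag_isSymm b a')
    (det_blockDiagonal'_ne_zero fun j ↦ hherm j _ (ha'0 j)) (sub_eq_zero.1 hzero).symm⟩

end LocalGlobal

section Transport

open IsCMField

lemma Cong.exists_basis {F V κ σ : Type*} [Field F] [AddCommGroup V] [Module F V] [Fintype κ]
    [DecidableEq κ] [Fintype σ] [DecidableEq σ] {B : LinearMap.BilinForm F V}
    {b : Module.Basis κ F V} {H : Matrix σ σ F} (h : Cong (gram B b) H) :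
    ∃ c : Module.Basis σ F V, gram B c = H := by
  obtain ⟨P, Q, hPQ, hQP, hH⟩ := h
  let c : Module.Basis σ F V :=
    Module.Basis.ofEquivFun (b.equivFun.trans (Matrix.toLin'OfInv hPQ hQP))
  have hc : b.toMatrix c = P := by
    ext i s
    simp [c, Module.Basis.toMatrix_apply, Matrix.toLin'OfInv, Finsupp.single_apply]
  refine ⟨c, ?_⟩
  rw [← hH, ← toMatrix_eq_gram, ← toMatrix_eq_gram,
    ← LinearMap.BilinForm.toMatrix_mul_basis_toMatrix b c, hc]

/-- A matrix preserving a Gram matrix gives an isometry. -/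
lemma hasIsometryWith_of_matrix {F V σ : Type*} [Field F] [AddCommGroup V] [Module F V]
    [Module.Finite F V] [Fintype σ] [DecidableEq σ] {B : LinearMap.BilinForm F V}
    (hB : B.Nondegenerate) (c : Module.Basis σ F V) {C : Matrix σ σ F}
    (hC : C.transpose * gram B c * C = gram B c) :
    HasIsometryWith F V B C.charpoly (minpoly F C) := by
  have hiso : B.comp (Matrix.toLin c c C) (Matrix.toLin c c C) = B := by
    apply (LinearMap.BilinForm.toMatrix c).injective
    rw [LinearMap.BilinForm.toMatrix_comp c, LinearMap.toMatrix_toLin, toMatrix_eq_gram, hC]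
  have hiso' : ∀ x y, B (Matrix.toLin c c C x) (Matrix.toLin c c C y) = B x y := fun x y ↦
    LinearMap.congr_fun₂ hiso x y
  have hinj : Function.Injective (Matrix.toLin c c C) := by
    rw [injective_iff_map_eq_zero]
    intro x hx
    refine hB.1 x fun y ↦ ?_
    rw [← hiso', hx, map_zero, LinearMap.zero_apply]
  have hcoe : (LinearEquiv.ofInjectiveEndo _ hinj : V →ₗ[F] V) = Matrix.toLin c c C := by
    ext x
    rfl
  refine ⟨LinearEquiv.ofInjectiveEndo _ hinj, hiso', ?_, ?_⟩
  · rw [hcoe, ← LinearMap.charpoly_toMatrix _ c, LinearMap.toMatrix_toLin]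
  · rw [hcoe, Matrix.minpoly_toLin]

lemma charpoly_blockDiagonal' {J R : Type*} [Fintype J] [DecidableEq J] [CommRing R] {d : J → ℕ}
    (A : ∀ j, Matrix (Fin (d j)) (Fin (d j)) R) :
    (Matrix.blockDiagonal' A).charpoly = ∏ j, (A j).charpoly := by
  let : LinearOrder J := LinearOrder.lift' (Fintype.equivFin J) (Fintype.equivFin J).injective
  have hblock : ∀ j, ((Matrix.blockDiagonal' A).toSquareBlock Sigma.fst j).charpoly =
      (A j).charpoly := fun j ↦ by
    refine Eq.trans ?_ (Matrix.charpoly_reindex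
      (Equiv.sigmaSubtype (β := fun j ↦ Fin (d j)) j).symm (A j))
    congr 1
    ext ⟨⟨i, x⟩, rfl⟩ ⟨⟨j, y⟩, h⟩
    dsimp only at h
    subst h
    simp [Matrix.toSquareBlock_def, Equiv.sigmaSubtype]
  rw [Matrix.BlockTriangular.charpoly _ (b := Sigma.fst) fun ⟨i, x⟩ ⟨j, y⟩ h ↦
    Matrix.blockDiagonal'_apply_ne _ _ _ (ne_of_gt h)]
  rw [Finset.prod_congr rfl fun j _ ↦ by convert hblock j]
  refine Finset.prod_subset (Finset.subset_univ _) fun j _ hj ↦ ?_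
  have : IsEmpty (Fin (d j)) := ⟨fun x ↦ hj (by
    convert Finset.mem_image_of_mem Sigma.fst (Finset.mem_univ (⟨j, x⟩ : Σ j, Fin (d j))))⟩
  rw [Matrix.charpoly, Matrix.det_isEmpty]

lemma leftMulMatrix_mul_gram_hermForm {L : Type*} [Field L] [NumberField L] [IsCMField L] {m : ℕ}
    [NeZero m] {ζ : L} (hζ : ζ ^ m = 1) (a : maximalRealSubfield L) {ι : Type*} [Fintype ι]
    [DecidableEq ι] (b : Module.Basis ι ℚ L) :
    (Algebra.leftMulMatrix b ζ).transpose * gram (hermForm a) b * Algebra.leftMulMatrix b ζ =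
      gram (hermForm a) b := by
  have hζ0 : ζ ≠ 0 := fun h ↦ by simp [h, NeZero.ne m] at hζ
  rw [← toMatrix_eq_gram, Algebra.leftMulMatrix_apply, ← LinearMap.BilinForm.toMatrix_comp]
  congr 1
  ext x y
  change hermForm a (ζ * x) (ζ * y) = hermForm a x y
  rw [hermForm_apply, hermForm_apply, map_mul (complexConj L), complexConj_of_pow_eq_one hζ]
  congr 2
  field_simp

variable {J : Type*} [Fintype J] [DecidableEq J] {L : J → Type*} [∀ j, Field (L j)]
  [∀ j, NumberField (L j)] {d : J → ℕ}

lemma minpoly_blockDiagonal' (b : ∀ j, Module.Basis (Fin (d j)) ℚ (L j)) (z : ∀ j, L j) :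
    minpoly ℚ (Matrix.blockDiagonal' fun j ↦ Algebra.leftMulMatrix (b j) (z j)) = minpoly ℚ z := by
  let φ : (∀ j, L j) →+* Matrix (Σ j, Fin (d j)) (Σ j, Fin (d j)) ℚ :=
    (Matrix.blockDiagonal'RingHom (fun j ↦ Fin (d j)) ℚ).comp
      (RingHom.pi fun j ↦ (Algebra.leftMulMatrix (b j)).toRingHom.comp (Pi.evalRingHom L j))
  refine minpoly.algHom_eq φ.toRatAlgHom (fun x y hxy ↦ funext fun j ↦ ?_) z
  exact Algebra.leftMulMatrix_injective (b j) (congrFun (Matrix.blockDiagonal'_injective hxy) j)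

lemma minpoly_pi_eq {r : ℕ} {m : Fin r → ℕ} (hdist : Function.Injective m) (k : J → Fin r)
    (hk : Function.Surjective k) {z : ∀ j, L j}
    (hz : ∀ j, minpoly ℚ (z j) = cyclotomic (m (k j)) ℚ) :
    minpoly ℚ z = ∏ i, cyclotomic (m i) ℚ := by
  have heval : ∀ (q : ℚ[X]) j, aeval z q j = aeval (z j) q := fun q j ↦
    (aeval_algHom_apply (Pi.evalAlgHom ℚ L j) z q).symm
  have h1 : minpoly ℚ z ∣ ∏ i, cyclotomic (m i) ℚ := minpoly.dvd ℚ z (funext fun j ↦ by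
    rw [heval, Pi.zero_apply, ← minpoly.dvd_iff, hz]
    exact Finset.dvd_prod_of_mem _ (Finset.mem_univ _))
  have h2 : ∏ i, cyclotomic (m i) ℚ ∣ minpoly ℚ z := by
    refine Finset.prod_dvd_of_coprime (fun i _ j _ hij ↦ cyclotomic.isCoprime_rat (hdist.ne hij))
      fun i _ ↦ ?_
    obtain ⟨j, rfl⟩ := hk i
    rw [← hz, minpoly.dvd_iff, ← heval, minpoly.aeval, Pi.zero_apply]
  exact eq_of_monic_of_associated (minpoly.monic (Algebra.IsIntegral.isIntegral z))
    (monic_prod_of_monic _ _ fun i _ ↦ cyclotomic.monic _ _) (associated_of_dvd_dvd h1 h2)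

end Transport

end

end CycIso

open CycIso in
theorem stmt_6 {r : ℕ} (m : Fin r → ℕ) (n : Fin r → ℕ)
    (hm : ∀ i, 3 ≤ m i) (hdist : Function.Injective m)
    (hn : ∀ i, 1 ≤ n i)
    {V : Type*} [AddCommGroup V] [Module ℚ V] [FiniteDimensional ℚ V]
    (hdim : Module.finrank ℚ V = (∏ i, (cyclotomic (m i) ℚ) ^ n i).natDegree)
    (B : LinearMap.BilinForm ℚ V) (hBnd : B.Nondegenerate) (hBsymm : B.IsSymm)
    (hfin : ∀ p : ℕ, ∀ _ : Fact p.Prime,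
      HasIsometryWith ℚ_[p] (ℚ_[p] ⊗[ℚ] V) (LinearMap.BilinForm.baseChange ℚ_[p] B)
        ((∏ i, (cyclotomic (m i) ℚ) ^ n i).map (algebraMap ℚ ℚ_[p]))
        ((∏ i, cyclotomic (m i) ℚ).map (algebraMap ℚ ℚ_[p])))
    (hreal : HasIsometryWith ℝ (ℝ ⊗[ℚ] V) (LinearMap.BilinForm.baseChange ℝ B)
        ((∏ i, (cyclotomic (m i) ℚ) ^ n i).map (algebraMap ℚ ℝ))
        ((∏ i, cyclotomic (m i) ℚ).map (algebraMap ℚ ℝ))) :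
    HasIsometryWith ℚ V B (∏ i, (cyclotomic (m i) ℚ) ^ n i) (∏ i, cyclotomic (m i) ℚ) := by
  have hne : ∀ j : Σ i, Fin (n i), NeZero (m j.1) := fun j ↦ ⟨by have := hm j.1; omega⟩
  have hneQ : ∀ j : Σ i, Fin (n i), NeZero (m j.1 : ℚ) := fun j ↦ ⟨Nat.cast_ne_zero.2 (NeZero.ne _)⟩
  let L : (Σ i, Fin (n i)) → Type := fun j ↦ CyclotomicField (m j.1) ℚ
  have hcyc : ∀ j, IsCyclotomicExtension {m j.1} ℚ (L j) := fun j ↦ by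
    convert CyclotomicField.isCyclotomicExtension (m j.1) ℚ
    exacts [rfl, Subsingleton.elim _ _]
  have hCM : ∀ j, NumberField.IsCMField (L j) := fun j ↦
    IsCyclotomicExtension.Rat.isCMField (L j) (S := {m j.1}) ⟨m j.1, rfl, hm j.1⟩
  let pb : ∀ j, PowerBasis ℚ (L j) := fun j ↦
    (IsCyclotomicExtension.zeta_spec (m j.1) ℚ (L j)).powerBasis ℚ
  have hζ : ∀ j, IsPrimitiveRoot (pb j).gen (m j.1) := fun j ↦ by
    have h := IsCyclotomicExtension.zeta_spec (m j.1) ℚ (L j)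
    rwa [← h.powerBasis_gen ℚ] at h
  have hmin : ∀ j, minpoly ℚ (pb j).gen = cyclotomic (m j.1) ℚ := fun j ↦
    (cyclotomic_eq_minpoly_rat (hζ j) (NeZero.pos _)).symm
  have hprod : ∏ j, minpoly ℚ (pb j).gen = ∏ i, (cyclotomic (m i) ℚ) ^ n i := by
    simp_rw [hmin, Fintype.prod_sigma, Finset.prod_const, Finset.card_univ, Fintype.card_fin]
  let bV := Module.finBasis ℚ V
  have hlocal : ∀ {F : Type} [NontriviallyNormedField F] [CompleteSpace F] [CharZero F]
      [Algebra ℚ F], HasIsometryWith F (F ⊗[ℚ] V) (LinearMap.BilinForm.baseChange F B)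
        ((∏ i, (cyclotomic (m i) ℚ) ^ n i).map (algebraMap ℚ F))
        ((∏ i, cyclotomic (m i) ℚ).map (algebraMap ℚ F)) →
      ∃ c : (Σ j, Fin (pb j).dim) → F, ∀ᶠ c' in nhds c,
        Cong ((gram B bV).map (algebraMap ℚ F)) (hermSum (fun j ↦ (pb j).basis) c') := by
    intro F _ _ _ _ ⟨t, hiso, hchar, ht⟩
    rw [← gram_baseChange]
    refine exists_eventually_cong_hermSum _
      (isPeriodicIsometry_baseChange hm hdist hBnd hBsymm bV hiso ht) (z := fun j ↦ (pb j).gen)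
      (fun j ↦ ?_) (fun j y ↦ ?_) _ (fun j a ↦ (pb j).basis_eq_pow a)
      (fun j ↦ (pb j).natDegree_minpoly.symm) ?_
    · obtain ⟨k, hk⟩ := Finset.dvd_prod_of_mem m (Finset.mem_univ j.1)
      rw [hk, pow_mul, (hζ j).pow_eq_one, one_pow]
    · obtain ⟨q, hq⟩ := (pb j).exists_eq_aeval' y
      exact ⟨q, hq.symm⟩
    · rw [hchar, ← hprod, Polynomial.map_prod]
  have hdet : (gram B bV).det ≠ 0 := by
    rw [← toMatrix_eq_gram]
    exact (LinearMap.BilinForm.nondegenerate_iff_det_ne_zero bV).1 hBnd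
  obtain ⟨a, ha⟩ := exists_cong_hermDiag hζ (fun j ↦ hm j.1) (fun j ↦ (pb j).basis)
    (Matrix.IsSymm.ext fun i j ↦ hBsymm.eq _ _) hdet (hlocal hreal) fun p _ ↦ hlocal (hfin p _)
  obtain ⟨c, hc⟩ := ha.exists_basis
  have h := hasIsometryWith_of_matrix hBnd c
    (C := Matrix.blockDiagonal' fun j ↦ Algebra.leftMulMatrix (pb j).basis (pb j).gen) (by
      rw [hc, hermDiag, Matrix.blockDiagonal'_transpose, ← Matrix.blockDiagonal'_mul,
        ← Matrix.blockDiagonal'_mul]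
      congr 1
      exact funext fun j ↦ leftMulMatrix_mul_gram_hermForm (hζ j).pow_eq_one (a j) (pb j).basis)
  rwa [charpoly_blockDiagonal', minpoly_blockDiagonal', minpoly_pi_eq hdist Sigma.fst
    (fun i ↦ ⟨⟨i, ⟨0, hn i⟩⟩, rfl⟩) hmin, Finset.prod_congr rfl fun j _ ↦
      charpoly_leftMulMatrix (pb j), hprod] at h
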